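/- Let 𝔸 and 𝔹 be generalized algebraic theories. Given context morphisms f : X → X' and f' : X' → X'' in 𝔸 and g : Y → Y' and g' : Y' → Y'' in 𝔹, the morphism equalities (f'⊗Y) ∘ (f⊗Y) ≡ (f'∘f) ⊗ Y : X⊗Y → X''⊗Y and (X⊗g') ∘ (X⊗g) ≡ X ⊗ (g'∘g) : X⊗Y → X⊗Y'' are derivable in 𝔸⊗𝔹. -/

import Mathlib

set_option linter.unusedVariables false

/-! # Syntax of generalized algebraic theories (following Cartmell / the paper's appendix) -/

namespace GATPaper

/-- A sort-and-term alphabet: a countably infinite set of variables, a set of sort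
symbols and a set of term symbols. -/
structure Alphabet : Type 1 where
  Var : Type
  SortSym : Type
  TermSym : Type
  var_infinite : Infinite Var
  var_countable : Countable Var

attribute [instance] Alphabet.var_infinite Alphabet.var_countable

variable {A B : Alphabet}

/-- Term expressions over an alphabet. -/
inductive Expr (A : Alphabet) : Type where
  | var : A.Var → Expr A
  | app : A.TermSym → List (Expr A) → Expr A

/-- Sort expressions: a sort symbol applied to a list of term expressions. -/
structure SortE (A : Alphabet) : Type where
  head : A.SortSym
  args : List (Expr A)

/-- Occurrence of a variable in a term expression. -/
inductive Occurs (x : A.Var) : Expr A → Prop where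
  | var : Occurs x (Expr.var x)
  | app {t : A.TermSym} {es : List (Expr A)} {e : Expr A} :
      e ∈ es → Occurs x e → Occurs x (Expr.app t es)

/-- Occurrence of a variable in a sort expression. -/
def SOccurs (x : A.Var) (U : SortE A) : Prop := ∃ e ∈ U.args, Occurs x e

/-- Simultaneous substitution along a function on variables. -/
def Expr.subst (σ : A.Var → Expr A) : Expr A → Expr A
  | .var x => σ x
  | .app t es => .app t (es.attach.map fun e => Expr.subst σ e.1)
termination_by e => sizeOf e
decreasing_by
  have := List.sizeOf_lt_of_mem e.2
  simp only [Expr.app.sizeOf_spec]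
  omega

def SortE.subst (σ : A.Var → Expr A) (U : SortE A) : SortE A :=
  ⟨U.head, U.args.map (Expr.subst σ)⟩

open Classical in
/-- The function on variables determined by a finite list of substitution pairs
`(zᵢ, uᵢ)` (substituting `uᵢ` for `zᵢ`, first matching pair winning, all other
variables unchanged). -/
noncomputable def lookupV : List (A.Var × Expr A) → A.Var → Expr A
  | [], x => .var x
  | p :: ps, x => if p.1 = x then p.2 else lookupV ps x

/-- The simultaneous substitution `e[u₁ | z₁, …, u_k | z_k]` where
`ps = [(z₁,u₁),…,(z_k,u_k)]`. -/
noncomputable def Expr.substL (e : Expr A) (ps : List (A.Var × Expr A)) : Expr A :=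
  e.subst (lookupV ps)

noncomputable def SortE.substL (U : SortE A) (ps : List (A.Var × Expr A)) : SortE A :=
  U.subst (lookupV ps)

/-- A (pre)context is a finite list of (variable, sort expression) pairs. -/
abbrev PreCtx (A : Alphabet) := List (A.Var × SortE A)

/-- The list of variables of a precontext, as term expressions. -/
def ctxVars (X : PreCtx A) : List (Expr A) := X.map fun p => Expr.var p.1

/-- The scoping condition of a precontext: the `i`-th sort expression only contains
variables among the first `i` variables. -/
def IsPreCtx (X : PreCtx A) : Prop :=
  ∀ i (hi : i < X.length) (v : A.Var),
    SOccurs v (X[i]'hi).2 → v ∈ (X.take i).map Prod.fst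

/-- Substitution pairs sending the variables of `X` to the entries of `f`. -/
def mkSub (X : PreCtx A) (f : List (Expr A)) : List (A.Var × Expr A) :=
  (X.map Prod.fst).zip f

/-- `Xᵢ[f₁ | x₁, …, f_{i-1} | x_{i-1}]` (0-based: the `i`-th sort of `X`
substituted along the first `i` entries of `f`). -/
noncomputable def subPre (X : PreCtx A) (f : List (Expr A)) (i : ℕ) (hi : i < X.length) :
    SortE A :=
  ((X[i]'hi).2).substL (mkSub (X.take i) (f.take i))

/-- Judgments: context judgments and the four kinds of standard judgments. -/
inductive Judg (A : Alphabet) : Type where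
  | ctx (X : PreCtx A)
  | sort (X : PreCtx A) (U : SortE A)
  | term (X : PreCtx A) (u : Expr A) (U : SortE A)
  | sortEq (X : PreCtx A) (U V : SortE A)
  | termEq (X : PreCtx A) (u v : Expr A) (U : SortE A)

/-- The context of a judgment. -/
def Judg.ctxOf : Judg A → PreCtx A
  | .ctx X => X
  | .sort X _ => X
  | .term X _ _ => X
  | .sortEq X _ _ => X
  | .termEq X _ _ _ => X

/-- The judgment introducing a sort symbol over the context `X`. -/
def introSort (X : PreCtx A) (S : A.SortSym) : Judg A := .sort X ⟨S, ctxVars X⟩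

/-- The judgment introducing a term symbol over the context `X`, with sort `U`. -/
def introTerm (X : PreCtx A) (t : A.TermSym) (U : SortE A) : Judg A :=
  .term X (.app t (ctxVars X)) U

/-- A set of axioms is a pretheory if: no axiom is a context judgment, every
axiom's context is a precontext, every sort symbol has a unique introducing sort
axiom and there are no other sort axioms, and likewise for term symbols. -/
structure IsPretheory (Ax : Set (Judg A)) : Prop where
  no_ctx : ∀ X : PreCtx A, Judg.ctx X ∉ Ax
  wf_ctx : ∀ J ∈ Ax, IsPreCtx J.ctxOf
  sort_intro : ∀ S : A.SortSym, ∃! X : PreCtx A, introSort X S ∈ Ax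
  sort_shape : ∀ (X : PreCtx A) (U : SortE A), Judg.sort X U ∈ Ax → U.args = ctxVars X
  term_intro : ∀ t : A.TermSym, ∃! p : PreCtx A × SortE A, introTerm p.1 t p.2 ∈ Ax
  term_shape : ∀ (X : PreCtx A) (u : Expr A) (U : SortE A), Judg.term X u U ∈ Ax →
      ∃ t : A.TermSym, u = Expr.app t (ctxVars X)

/-- One inference step of the paper's system: `Step Ax D J` holds when `J` is the
conclusion of an instance of one of the sixteen rules all of whose premises
satisfy `D`. -/
inductive Step (Ax : Set (Judg A)) (D : Judg A → Prop) : Judg A → Prop where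
  | ctx_nil : Step Ax D (.ctx [])
  | ctx_cons {X : PreCtx A} {U : SortE A} {x : A.Var}
      (hs : D (.sort X U)) (hfresh : ∀ p ∈ X, p.1 ≠ x)
      (hpre : IsPreCtx (X ++ [(x, U)])) :
      Step Ax D (.ctx (X ++ [(x, U)]))
  | s1 {X : PreCtx A} {U : SortE A} (h : D (.sort X U)) : Step Ax D (.sortEq X U U)
  | s2 {X : PreCtx A} {U V : SortE A} (h : D (.sortEq X U V)) : Step Ax D (.sortEq X V U)
  | s3 {X : PreCtx A} {U V W : SortE A}
      (h1 : D (.sortEq X U V)) (h2 : D (.sortEq X V W)) : Step Ax D (.sortEq X U W)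
  | t1 {X : PreCtx A} {u : Expr A} {U : SortE A}
      (h : D (.term X u U)) : Step Ax D (.termEq X u u U)
  | t2 {X : PreCtx A} {u v : Expr A} {U : SortE A}
      (h : D (.termEq X u v U)) : Step Ax D (.termEq X v u U)
  | t3 {X : PreCtx A} {u v w : Expr A} {U : SortE A}
      (h1 : D (.termEq X u v U)) (h2 : D (.termEq X v w U)) : Step Ax D (.termEq X u w U)
  | seqt {X : PreCtx A} {U U' : SortE A} {u : Expr A}
      (h1 : D (.sortEq X U U')) (h2 : D (.term X u U)) : Step Ax D (.term X u U')
  | seqteq {X : PreCtx A} {U U' : SortE A} {u u' : Expr A}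
      (h1 : D (.sortEq X U U')) (h2 : D (.termEq X u u' U))
      (h3 : D (.term X u U')) (h4 : D (.term X u' U')) : Step Ax D (.termEq X u u' U')
  | var {X : PreCtx A} {i : ℕ} (hi : i < X.length)
      (h : D (.sort X (X[i]'hi).2)) :
      Step Ax D (.term X (.var (X[i]'hi).1) (X[i]'hi).2)
  | sA {X : PreCtx A} {U : SortE A} (hax : Judg.sort X U ∈ Ax) (h : D (.ctx X))
      (hv : ∀ i (hi : i < X.length), D (.term X (.var (X[i]'hi).1) (X[i]'hi).2)) :
      Step Ax D (.sort X U)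
  | tA {X : PreCtx A} {u : Expr A} {U : SortE A} (hax : Judg.term X u U ∈ Ax)
      (h : D (.sort X U))
      (hv : ∀ i (hi : i < X.length), D (.term X (.var (X[i]'hi).1) (X[i]'hi).2)) :
      Step Ax D (.term X u U)
  | seqA {X : PreCtx A} {U U' : SortE A} (hax : Judg.sortEq X U U' ∈ Ax)
      (h1 : D (.sort X U)) (h2 : D (.sort X U')) : Step Ax D (.sortEq X U U')
  | teqA {X : PreCtx A} {u u' : Expr A} {U : SortE A} (hax : Judg.termEq X u u' U ∈ Ax)
      (h1 : D (.term X u U)) (h2 : D (.term X u' U)) : Step Ax D (.termEq X u u' U)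
  | sSub {X : PreCtx A} {S : A.SortSym} (hax : introSort X S ∈ Ax)
      {Y : PreCtx A} (hY : IsPreCtx Y) {f : List (Expr A)} (hlen : f.length = X.length)
      (hJ : D (introSort X S)) (hYc : D (.ctx Y))
      (hargs : ∀ i (hi : i < X.length) (hif : i < f.length),
        D (.term Y (f[i]'hif) (subPre X f i hi))) :
      Step Ax D (.sort Y ⟨S, f⟩)
  | tSub {X : PreCtx A} {t : A.TermSym} {U : SortE A} (hax : introTerm X t U ∈ Ax)
      {Y : PreCtx A} (hY : IsPreCtx Y) {f : List (Expr A)} (hlen : f.length = X.length)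
      (hJ : D (introTerm X t U))
      (hU : D (.sort Y (U.substL (mkSub X f))))
      (hargs : ∀ i (hi : i < X.length) (hif : i < f.length),
        D (.term Y (f[i]'hif) (subPre X f i hi))) :
      Step Ax D (.term Y (.app t f) (U.substL (mkSub X f)))
  | seqSub1 {X : PreCtx A} {U U' : SortE A} (hax : Judg.sortEq X U U' ∈ Ax)
      {Y : PreCtx A} (hY : IsPreCtx Y) {f : List (Expr A)} (hlen : f.length = X.length)
      (hJ : D (.sortEq X U U'))
      (h1 : D (.sort Y (U.substL (mkSub X f)))) (h2 : D (.sort Y (U'.substL (mkSub X f))))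
      (hargs : ∀ i (hi : i < X.length) (hif : i < f.length),
        D (.term Y (f[i]'hif) (subPre X f i hi))) :
      Step Ax D (.sortEq Y (U.substL (mkSub X f)) (U'.substL (mkSub X f)))
  | seqSub2 {X : PreCtx A} {S : A.SortSym} (hax : introSort X S ∈ Ax)
      {Y : PreCtx A} (hY : IsPreCtx Y) {f g : List (Expr A)}
      (hlf : f.length = X.length) (hlg : g.length = X.length)
      (hJ : D (introSort X S))
      (h1 : D (.sort Y ⟨S, f⟩)) (h2 : D (.sort Y ⟨S, g⟩))
      (hargs : ∀ i (hi : i < X.length) (hif : i < f.length) (hig : i < g.length),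
        D (.termEq Y (f[i]'hif) (g[i]'hig) (subPre X f i hi))) :
      Step Ax D (.sortEq Y ⟨S, f⟩ ⟨S, g⟩)
  | teqSub1 {X : PreCtx A} {u u' : Expr A} {U : SortE A}
      (hax : Judg.termEq X u u' U ∈ Ax)
      {Y : PreCtx A} (hY : IsPreCtx Y) {f : List (Expr A)} (hlen : f.length = X.length)
      (hJ : D (.termEq X u u' U))
      (h1 : D (.term Y (u.substL (mkSub X f)) (U.substL (mkSub X f))))
      (h2 : D (.term Y (u'.substL (mkSub X f)) (U.substL (mkSub X f))))
      (hargs : ∀ i (hi : i < X.length) (hif : i < f.length),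
        D (.term Y (f[i]'hif) (subPre X f i hi))) :
      Step Ax D (.termEq Y (u.substL (mkSub X f)) (u'.substL (mkSub X f))
        (U.substL (mkSub X f)))
  | teqSub2 {X : PreCtx A} {t : A.TermSym} {U : SortE A} (hax : introTerm X t U ∈ Ax)
      {Y : PreCtx A} (hY : IsPreCtx Y) {f g : List (Expr A)}
      (hlf : f.length = X.length) (hlg : g.length = X.length)
      (hJ : D (introTerm X t U))
      (h1 : D (.term Y (.app t f) (U.substL (mkSub X f))))
      (h2 : D (.term Y (.app t g) (U.substL (mkSub X f))))
      (hargs : ∀ i (hi : i < X.length) (hif : i < f.length) (hig : i < g.length),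
        D (.termEq Y (f[i]'hif) (g[i]'hig) (subPre X f i hi))) :
      Step Ax D (.termEq Y (.app t f) (.app t g) (U.substL (mkSub X f)))

/-- `DerAt Ax n J`: `J` is the conclusion of an inference step in the `n`-th stage
`𝒟ₙ` of the recursive construction of the derivable judgments. -/
def DerAt (Ax : Set (Judg A)) : ℕ → Judg A → Prop
  | 0, _ => False
  | n + 1, J => DerAt Ax n J ∨ Step Ax (DerAt Ax n) J

/-- A judgment is derivable if it is the conclusion of a step of some stage. -/
def Derivable (Ax : Set (Judg A)) (J : Judg A) : Prop := ∃ n, DerAt Ax n J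

/-- The height of a (derivable) judgment: the least stage at which it appears. -/
noncomputable def ht (Ax : Set (Judg A)) (J : Judg A) : ℕ := sInf {n | DerAt Ax n J}

/-- The height of a context: `0` for the empty context, and the height of
`∂X ⊢ Xₙ sort` otherwise. -/
noncomputable def htCtx (Ax : Set (Judg A)) (X : PreCtx A) : ℕ :=
  match X with
  | [] => 0
  | p :: X' =>
      ht Ax (.sort ((p :: X').dropLast) (((p :: X').getLast (List.cons_ne_nil p X')).2))

/-- A generalized algebraic theory: a pretheory all of whose axioms are derivable. -/
def IsGAT (Ax : Set (Judg A)) : Prop := IsPretheory Ax ∧ ∀ J ∈ Ax, Derivable Ax J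

/-- The partial term judgment `X ⊢ u term` is derivable. -/
def DerTerm (Ax : Set (Judg A)) (X : PreCtx A) (u : Expr A) : Prop :=
  ∃ U, Derivable Ax (.term X u U)

/-- The partial term equality judgment `X ⊢ u ≡ v term` is derivable. -/
def DerTermEq (Ax : Set (Judg A)) (X : PreCtx A) (u v : Expr A) : Prop :=
  ∃ U, Derivable Ax (.termEq X u v U)

/-- Height of a derivable partial term judgment: the minimum of the heights of
`X ⊢ u : U` over all `U`. -/
noncomputable def htTerm (Ax : Set (Judg A)) (X : PreCtx A) (u : Expr A) : ℕ :=
  sInf {n | ∃ U, DerAt Ax n (.term X u U)}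

/-- `f` is a context morphism from `X` to `Y`. -/
def IsMor (Ax : Set (Judg A)) (X Y : PreCtx A) (f : List (Expr A)) : Prop :=
  Derivable Ax (.ctx X) ∧ Derivable Ax (.ctx Y) ∧ f.length = Y.length ∧
  ∀ i (hi : i < Y.length) (hif : i < f.length),
    Derivable Ax (.term X (f[i]'hif) (subPre Y f i hi))

/-- The morphism equality `f ≡ g : X → Y` is derivable. -/
def MorEq (Ax : Set (Judg A)) (X Y : PreCtx A) (f g : List (Expr A)) : Prop :=
  IsMor Ax X Y f ∧ IsMor Ax X Y g ∧
  ∀ i (hi : i < Y.length) (hif : i < f.length) (hig : i < g.length),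
    Derivable Ax (.termEq X (f[i]'hif) (g[i]'hig) (subPre Y f i hi))

/-- The context equality `X ≡ Y ctx` is derivable. -/
def CtxEq (Ax : Set (Judg A)) (X Y : PreCtx A) : Prop :=
  X.length = Y.length ∧ Derivable Ax (.ctx X) ∧ Derivable Ax (.ctx Y) ∧
  ∀ i (hX : i < X.length) (hY : i < Y.length),
    Derivable Ax (.sortEq (X.take i) (X[i]'hX).2
      (((Y[i]'hY).2).substL (mkSub (Y.take i) (ctxVars (X.take i)))))

/-- Height of a context morphism. -/
noncomputable def htMor (Ax : Set (Judg A)) (X Y : PreCtx A) (f : List (Expr A)) : ℕ :=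
  max (htCtx Ax X) (max (htCtx Ax Y)
    ((Finset.range Y.length).sup fun i =>
      if h : i < Y.length ∧ i < f.length then
        ht Ax (.term X (f[i]'h.2) (subPre Y f i h.1))
      else 0))

/-- Height of a morphism equality. -/
noncomputable def htMorEq (Ax : Set (Judg A)) (X Y : PreCtx A) (f g : List (Expr A)) : ℕ :=
  max (htMor Ax X Y f) (max (htMor Ax X Y g)
    ((Finset.range Y.length).sup fun i =>
      if h : i < Y.length ∧ i < f.length ∧ i < g.length then
        ht Ax (.termEq X (f[i]'h.2.1) (g[i]'h.2.2) (subPre Y f i h.1))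
      else 0))

/-- The composite `g ∘ f` of tuples of term expressions, where `f : X → Y` and
`g : Y → Z`: the `i`-th entry is `gᵢ[f]`. -/
noncomputable def compMor (Y : PreCtx A) (f g : List (Expr A)) : List (Expr A) :=
  g.map fun e => e.substL (mkSub Y f)

/-- The canonical sort `𝒮(u)` of a term in a context (as a relation). -/
inductive CanonSort (Ax : Set (Judg A)) (X : PreCtx A) : Expr A → SortE A → Prop where
  | var {i : ℕ} (hi : i < X.length) : CanonSort Ax X (.var (X[i]'hi).1) (X[i]'hi).2
  | app {t : A.TermSym} {f : List (Expr A)} {Xa : PreCtx A} {V : SortE A}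
      (hax : introTerm Xa t V ∈ Ax) :
      CanonSort Ax X (.app t f) (V.substL (mkSub Xa f))


/-! ## The tensor product of generalized algebraic theories (§2 of the paper) -/

/-- The tensor product of two sort-and-term alphabets. -/
abbrev Alphabet.tensor (A B : Alphabet) : Alphabet :=
  { Var := A.Var × B.Var
    SortSym := A.SortSym × B.SortSym
    TermSym := (A.SortSym × B.TermSym) ⊕ (A.TermSym × B.SortSym)
    var_infinite := inferInstance
    var_countable := inferInstance }

/-- An input for the tensor term operations `⊗_t`, `●_t`: a derivable term judgment
`X ⊢ u : U` (notation `u^U`), or an augmented derivable sort judgment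
`(X ⊢ U sort, x)` (notation `x^U`), represented with `tm = var x`. -/
structure TArg (A : Alphabet) : Type where
  ctx : PreCtx A
  tm : Expr A
  srt : SortE A

/-- `L` is the lexicographically ordered `m × n` grid whose `(i,j)` entry is `M i j`. -/
def IsGrid {γ : Type} (m n : ℕ) (M : ℕ → ℕ → γ) (L : List γ) : Prop :=
  L.length = m * n ∧
  ∀ i j (hi : i < m) (hj : j < n) (h : i * n + j < L.length), L[i * n + j]'h = M i j

/-- Substitution pairs `[g 1 | x y₁, …, g n | x yₙ]` where the `yⱼ` are the
variables of `Y`. -/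
def pairsR (x : A.Var) (Y : PreCtx B) (g : ℕ → Expr (A.tensor B)) :
    List ((A.tensor B).Var × Expr (A.tensor B)) :=
  (List.finRange Y.length).map fun j => ((x, (Y.get j).1), g j.1)

/-- Substitution pairs `[g 1 | x₁ y, …, g m | x_m y]` where the `xᵢ` are the
variables of `X`. -/
def pairsL (X : PreCtx A) (y : B.Var) (g : ℕ → Expr (A.tensor B)) :
    List ((A.tensor B).Var × Expr (A.tensor B)) :=
  (List.finRange X.length).map fun i => (((X.get i).1, y), g i.1)

variable {A B : Alphabet}

/-- The graph of the tensor term operation on pairs of (augmented sort / term)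
judgments: `TTg TA TB false a b e` means `e = a ⊗_t b` and
`TTg TA TB true a b e` means `e = a ⊗*_t b` (the variant of §8 in which the two
defining substitution formulas for non-variable terms are interchanged). -/
inductive TTg (TA : Set (Judg A)) (TB : Set (Judg B)) :
    Bool → TArg A → TArg B → Expr (A.tensor B) → Prop where
  | varvar {b : Bool} {X : PreCtx A} {U : SortE A} {x : A.Var}
      {Y : PreCtx B} {V : SortE B} {y : B.Var} :
      TTg TA TB b ⟨X, .var x, U⟩ ⟨Y, .var y, V⟩ (.var (x, y))
  | varapp {b : Bool} {X : PreCtx A} {x : A.Var} {S : A.SortSym} {ss : List (Expr A)}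
      {Y : PreCtx B} {t : B.TermSym} {ts : List (Expr B)} {V : SortE B}
      (SS : ℕ → SortE A) (TSf : ℕ → SortE B)
      (hSS : ∀ i (hi : i < ss.length), CanonSort TA X (ss[i]'hi) (SS i))
      (hTS : ∀ j (hj : j < ts.length), CanonSort TB Y (ts[j]'hj) (TSf j))
      (M : ℕ → ℕ → Expr (A.tensor B)) (out : List (Expr (A.tensor B)))
      (hM : ∀ i (hi : i < ss.length), ∀ j (hj : j < ts.length),
          TTg TA TB b ⟨X, ss[i]'hi, SS i⟩ ⟨Y, ts[j]'hj, TSf j⟩ (M i j))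
      (hMx : ∀ j (hj : j < ts.length),
          TTg TA TB b ⟨X, .var x, ⟨S, ss⟩⟩ ⟨Y, ts[j]'hj, TSf j⟩ (M ss.length j))
      (hout : IsGrid (ss.length + 1) ts.length M out) :
      TTg TA TB b ⟨X, .var x, ⟨S, ss⟩⟩ ⟨Y, .app t ts, V⟩ (.app (Sum.inl (S, t)) out)
  | appvar {b : Bool} {X : PreCtx A} {s : A.TermSym} {ss : List (Expr A)} {U : SortE A}
      {Y : PreCtx B} {y : B.Var} {T : B.SortSym} {ts : List (Expr B)}
      (SS : ℕ → SortE A) (TSf : ℕ → SortE B)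
      (hSS : ∀ i (hi : i < ss.length), CanonSort TA X (ss[i]'hi) (SS i))
      (hTS : ∀ j (hj : j < ts.length), CanonSort TB Y (ts[j]'hj) (TSf j))
      (M : ℕ → ℕ → Expr (A.tensor B)) (out : List (Expr (A.tensor B)))
      (hM : ∀ i (hi : i < ss.length), ∀ j (hj : j < ts.length),
          TTg TA TB b ⟨X, ss[i]'hi, SS i⟩ ⟨Y, ts[j]'hj, TSf j⟩ (M i j))
      (hMy : ∀ i (hi : i < ss.length),
          TTg TA TB b ⟨X, ss[i]'hi, SS i⟩ ⟨Y, .var y, ⟨T, ts⟩⟩ (M i ts.length))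
      (hout : IsGrid ss.length (ts.length + 1) M out) :
      TTg TA TB b ⟨X, .app s ss, U⟩ ⟨Y, .var y, ⟨T, ts⟩⟩ (.app (Sum.inr (s, T)) out)
  | appapp_base {X : PreCtx A} {s : A.TermSym} {ss : List (Expr A)} {U : SortE A}
      {Y : PreCtx B} {t : B.TermSym} {ts : List (Expr B)} {V : SortE B} {x : A.Var}
      (hx : ∀ p ∈ X, p.1 ≠ x)
      (e0 : Expr (A.tensor B))
      (h0 : TTg TA TB false ⟨X, .var x, U⟩ ⟨Y, .app t ts, V⟩ e0)
      (g : ℕ → Expr (A.tensor B))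
      (hg : ∀ j (hj : j < Y.length),
          TTg TA TB false ⟨X, .app s ss, U⟩
            ⟨Y.take j, .var (Y[j]'hj).1, (Y[j]'hj).2⟩ (g j)) :
      TTg TA TB false ⟨X, .app s ss, U⟩ ⟨Y, .app t ts, V⟩ (e0.substL (pairsR x Y g))
  | appapp_star {X : PreCtx A} {s : A.TermSym} {ss : List (Expr A)} {U : SortE A}
      {Y : PreCtx B} {t : B.TermSym} {ts : List (Expr B)} {V : SortE B} {y : B.Var}
      (hy : ∀ p ∈ Y, p.1 ≠ y)
      (e0 : Expr (A.tensor B))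
      (h0 : TTg TA TB true ⟨X, .app s ss, U⟩ ⟨Y, .var y, V⟩ e0)
      (g : ℕ → Expr (A.tensor B))
      (hg : ∀ i (hi : i < X.length),
          TTg TA TB true ⟨X.take i, .var (X[i]'hi).1, (X[i]'hi).2⟩
            ⟨Y, .app t ts, V⟩ (g i)) :
      TTg TA TB true ⟨X, .app s ss, U⟩ ⟨Y, .app t ts, V⟩ (e0.substL (pairsL X y g))

/-- The graph of the operation `●_t` (flag `false`), resp. of `●*_t` (flag `true`). -/
inductive TTd (TA : Set (Judg A)) (TB : Set (Judg B)) :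
    Bool → TArg A → TArg B → Expr (A.tensor B) → Prop where
  | varL {b : Bool} {X : PreCtx A} {x : A.Var} {U : SortE A} {bArg : TArg B}
      {e : Expr (A.tensor B)}
      (h : TTg TA TB b ⟨X, .var x, U⟩ bArg e) : TTd TA TB b ⟨X, .var x, U⟩ bArg e
  | varR {b : Bool} {aArg : TArg A} {Y : PreCtx B} {y : B.Var} {V : SortE B}
      {e : Expr (A.tensor B)}
      (h : TTg TA TB b aArg ⟨Y, .var y, V⟩ e) : TTd TA TB b aArg ⟨Y, .var y, V⟩ e
  | appapp_base {X : PreCtx A} {s : A.TermSym} {ss : List (Expr A)} {U : SortE A}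
      {Y : PreCtx B} {t : B.TermSym} {ts : List (Expr B)} {V : SortE B} {y : B.Var}
      (hy : ∀ p ∈ Y, p.1 ≠ y)
      (e0 : Expr (A.tensor B))
      (h0 : TTg TA TB false ⟨X, .app s ss, U⟩ ⟨Y, .var y, V⟩ e0)
      (g : ℕ → Expr (A.tensor B))
      (hg : ∀ i (hi : i < X.length),
          TTg TA TB false ⟨X.take i, .var (X[i]'hi).1, (X[i]'hi).2⟩
            ⟨Y, .app t ts, V⟩ (g i)) :
      TTd TA TB false ⟨X, .app s ss, U⟩ ⟨Y, .app t ts, V⟩ (e0.substL (pairsL X y g))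
  | appapp_star {X : PreCtx A} {s : A.TermSym} {ss : List (Expr A)} {U : SortE A}
      {Y : PreCtx B} {t : B.TermSym} {ts : List (Expr B)} {V : SortE B} {x : A.Var}
      (hx : ∀ p ∈ X, p.1 ≠ x)
      (e0 : Expr (A.tensor B))
      (h0 : TTg TA TB true ⟨X, .var x, U⟩ ⟨Y, .app t ts, V⟩ e0)
      (g : ℕ → Expr (A.tensor B))
      (hg : ∀ j (hj : j < Y.length),
          TTg TA TB true ⟨X, .app s ss, U⟩
            ⟨Y.take j, .var (Y[j]'hj).1, (Y[j]'hj).2⟩ (g j)) :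
      TTd TA TB true ⟨X, .app s ss, U⟩ ⟨Y, .app t ts, V⟩ (e0.substL (pairsR x Y g))

/-- The graph of the tensor sort operation `⊗_s` (resp. `⊗*_s` for flag `true`):
`TSo TA TB b X x U Y y V W` means `W = U^x ⊗ V^y`. -/
inductive TSo (TA : Set (Judg A)) (TB : Set (Judg B)) :
    Bool → PreCtx A → A.Var → SortE A → PreCtx B → B.Var → SortE B →
    SortE (A.tensor B) → Prop where
  | mk {b : Bool} {X : PreCtx A} {x : A.Var} {S : A.SortSym} {ss : List (Expr A)}
      {Y : PreCtx B} {y : B.Var} {T : B.SortSym} {ts : List (Expr B)}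
      (hx : ∀ p ∈ X, p.1 ≠ x) (hy : ∀ p ∈ Y, p.1 ≠ y)
      (SS : ℕ → SortE A) (TSf : ℕ → SortE B)
      (hSS : ∀ i (hi : i < ss.length), CanonSort TA X (ss[i]'hi) (SS i))
      (hTS : ∀ j (hj : j < ts.length), CanonSort TB Y (ts[j]'hj) (TSf j))
      (M : ℕ → ℕ → Expr (A.tensor B)) (out : List (Expr (A.tensor B)))
      (hM : ∀ i (hi : i < ss.length), ∀ j (hj : j < ts.length),
          TTg TA TB b ⟨X, ss[i]'hi, SS i⟩ ⟨Y, ts[j]'hj, TSf j⟩ (M i j))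
      (hMx : ∀ j (hj : j < ts.length),
          TTg TA TB b ⟨X, .var x, ⟨S, ss⟩⟩ ⟨Y, ts[j]'hj, TSf j⟩ (M ss.length j))
      (hMy : ∀ i (hi : i < ss.length),
          TTg TA TB b ⟨X, ss[i]'hi, SS i⟩ ⟨Y, .var y, ⟨T, ts⟩⟩ (M i ts.length))
      (hout : IsGrid (ss.length + 1) (ts.length + 1) M out) :
      TSo TA TB b X x ⟨S, ss⟩ Y y ⟨T, ts⟩ ⟨(S, T), out.dropLast⟩

/-- The tensor precontext `Z = X ⊗ Y`, with entries `xᵢyⱼ : Xᵢ ⊗ Yⱼ` ordered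
lexicographically. -/
def TCtx (TA : Set (Judg A)) (TB : Set (Judg B)) (b : Bool)
    (X : PreCtx A) (Y : PreCtx B) (Z : PreCtx (A.tensor B)) : Prop :=
  Z.length = X.length * Y.length ∧
  ∀ i j (hi : i < X.length) (hj : j < Y.length) (h : i * Y.length + j < Z.length),
    (Z[i * Y.length + j]'h).1 = ((X[i]'hi).1, (Y[j]'hj).1) ∧
    TSo TA TB b (X.take i) (X[i]'hi).1 (X[i]'hi).2
      (Y.take j) (Y[j]'hj).1 (Y[j]'hj).2 (Z[i * Y.length + j]'h).2

/-- The graph of the tensor operation `⊙` on pairs of judgments of the admissible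
kinds of Table 1 (flag `false`), resp. of the interchanged operation `⊙*` of §8
(flag `true`).  `chA` and `chB` are the functions choosing, for each context, a
variable not occurring in it. -/
inductive TJudg (TA : Set (Judg A)) (TB : Set (Judg B))
    (chA : PreCtx A → A.Var) (chB : PreCtx B → B.Var) :
    Bool → Judg A → Judg B → Judg (A.tensor B) → Prop where
  /- sort ⊙ sort -/
  | ss {b : Bool} {X : PreCtx A} {U : SortE A} {Y : PreCtx B} {V : SortE B}
      {Z : PreCtx (A.tensor B)} {W : SortE (A.tensor B)}
      (hZ : TCtx TA TB b (X ++ [(chA X, U)]) (Y ++ [(chB Y, V)]) Z)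
      (hW : TSo TA TB b X (chA X) U Y (chB Y) V W) :
      TJudg TA TB chA chB b (.sort X U) (.sort Y V) (.sort Z.dropLast W)
  /- sort ⊙ term -/
  | st {b : Bool} {X : PreCtx A} {U : SortE A} {Y : PreCtx B} {v : Expr B} {V : SortE B}
      {Z : PreCtx (A.tensor B)} {e : Expr (A.tensor B)} {W : SortE (A.tensor B)}
      {g : ℕ → Expr (A.tensor B)}
      (hZ : TCtx TA TB b (X ++ [(chA X, U)]) Y Z)
      (he : TTg TA TB b ⟨X, .var (chA X), U⟩ ⟨Y, v, V⟩ e)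
      (hW : TSo TA TB b X (chA X) U Y (chB Y) V W)
      (hg : ∀ i (hi : i < X.length),
          TTg TA TB b ⟨X.take i, .var (X[i]'hi).1, (X[i]'hi).2⟩ ⟨Y, v, V⟩ (g i)) :
      TJudg TA TB chA chB b (.sort X U) (.term Y v V)
        (.term Z e (W.substL (pairsL X (chB Y) g)))
  /- term ⊙ sort -/
  | ts {b : Bool} {X : PreCtx A} {u : Expr A} {U : SortE A} {Y : PreCtx B} {V : SortE B}
      {Z : PreCtx (A.tensor B)} {e : Expr (A.tensor B)} {W : SortE (A.tensor B)}
      {g : ℕ → Expr (A.tensor B)}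
      (hZ : TCtx TA TB b X (Y ++ [(chB Y, V)]) Z)
      (he : TTg TA TB b ⟨X, u, U⟩ ⟨Y, .var (chB Y), V⟩ e)
      (hW : TSo TA TB b X (chA X) U Y (chB Y) V W)
      (hg : ∀ j (hj : j < Y.length),
          TTg TA TB b ⟨X, u, U⟩ ⟨Y.take j, .var (Y[j]'hj).1, (Y[j]'hj).2⟩ (g j)) :
      TJudg TA TB chA chB b (.term X u U) (.sort Y V)
        (.term Z e (W.substL (pairsR (chA X) Y g)))
  /- term ⊙ term -/
  | tt {b : Bool} {X : PreCtx A} {u : Expr A} {U : SortE A}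
      {Y : PreCtx B} {v : Expr B} {V : SortE B}
      {Z : PreCtx (A.tensor B)} {e1 e2 : Expr (A.tensor B)} {W : SortE (A.tensor B)}
      {gx gy : ℕ → Expr (A.tensor B)}
      (hZ : TCtx TA TB b X Y Z)
      (he1 : TTg TA TB b ⟨X, u, U⟩ ⟨Y, v, V⟩ e1)
      (he2 : TTd TA TB b ⟨X, u, U⟩ ⟨Y, v, V⟩ e2)
      (hW : TSo TA TB b X (chA X) U Y (chB Y) V W)
      (hgx : ∀ i (hi : i < X.length),
          TTg TA TB b ⟨X.take i, .var (X[i]'hi).1, (X[i]'hi).2⟩ ⟨Y, v, V⟩ (gx i))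
      (hgy : ∀ j (hj : j < Y.length),
          TTg TA TB b ⟨X, u, U⟩ ⟨Y.take j, .var (Y[j]'hj).1, (Y[j]'hj).2⟩ (gy j)) :
      TJudg TA TB chA chB b (.term X u U) (.term Y v V)
        (.termEq Z e1 e2 (W.substL (pairsL X (chB Y) gx ++ pairsR (chA X) Y gy)))
  /- sort ⊙ sort equality -/
  | sseq {b : Bool} {X : PreCtx A} {U : SortE A} {Y : PreCtx B} {V V' : SortE B}
      {Z : PreCtx (A.tensor B)} {W W' : SortE (A.tensor B)}
      (hZ : TCtx TA TB b (X ++ [(chA X, U)]) (Y ++ [(chB Y, V)]) Z)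
      (hW : TSo TA TB b X (chA X) U Y (chB Y) V W)
      (hW' : TSo TA TB b X (chA X) U Y (chB Y) V' W') :
      TJudg TA TB chA chB b (.sort X U) (.sortEq Y V V') (.sortEq Z.dropLast W W')
  /- sort equality ⊙ sort -/
  | seqs {b : Bool} {X : PreCtx A} {U U' : SortE A} {Y : PreCtx B} {V : SortE B}
      {Z : PreCtx (A.tensor B)} {W W' : SortE (A.tensor B)}
      (hZ : TCtx TA TB b (X ++ [(chA X, U)]) (Y ++ [(chB Y, V)]) Z)
      (hW : TSo TA TB b X (chA X) U Y (chB Y) V W)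
      (hW' : TSo TA TB b X (chA X) U' Y (chB Y) V W') :
      TJudg TA TB chA chB b (.sortEq X U U') (.sort Y V) (.sortEq Z.dropLast W W')
  /- sort ⊙ term equality -/
  | steq {b : Bool} {X : PreCtx A} {U : SortE A} {Y : PreCtx B} {v v' : Expr B}
      {V : SortE B} {Z : PreCtx (A.tensor B)} {e e' : Expr (A.tensor B)}
      {W : SortE (A.tensor B)} {g : ℕ → Expr (A.tensor B)}
      (hZ : TCtx TA TB b (X ++ [(chA X, U)]) Y Z)
      (he : TTg TA TB b ⟨X, .var (chA X), U⟩ ⟨Y, v, V⟩ e)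
      (he' : TTg TA TB b ⟨X, .var (chA X), U⟩ ⟨Y, v', V⟩ e')
      (hW : TSo TA TB b X (chA X) U Y (chB Y) V W)
      (hg : ∀ i (hi : i < X.length),
          TTg TA TB b ⟨X.take i, .var (X[i]'hi).1, (X[i]'hi).2⟩ ⟨Y, v, V⟩ (g i)) :
      TJudg TA TB chA chB b (.sort X U) (.termEq Y v v' V)
        (.termEq Z e e' (W.substL (pairsL X (chB Y) g)))
  /- term equality ⊙ sort -/
  | teqs {b : Bool} {X : PreCtx A} {u u' : Expr A} {U : SortE A} {Y : PreCtx B}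
      {V : SortE B} {Z : PreCtx (A.tensor B)} {e e' : Expr (A.tensor B)}
      {W : SortE (A.tensor B)} {g : ℕ → Expr (A.tensor B)}
      (hZ : TCtx TA TB b X (Y ++ [(chB Y, V)]) Z)
      (he : TTg TA TB b ⟨X, u, U⟩ ⟨Y, .var (chB Y), V⟩ e)
      (he' : TTg TA TB b ⟨X, u', U⟩ ⟨Y, .var (chB Y), V⟩ e')
      (hW : TSo TA TB b X (chA X) U Y (chB Y) V W)
      (hg : ∀ j (hj : j < Y.length),
          TTg TA TB b ⟨X, u, U⟩ ⟨Y.take j, .var (Y[j]'hj).1, (Y[j]'hj).2⟩ (g j)) :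
      TJudg TA TB chA chB b (.termEq X u u' U) (.sort Y V)
        (.termEq Z e e' (W.substL (pairsR (chA X) Y g)))
  /- sort equality ⊙ term -/
  | seqt {b : Bool} {X : PreCtx A} {U U' : SortE A} {Y : PreCtx B} {v : Expr B}
      {V : SortE B} {Z : PreCtx (A.tensor B)} {e e' : Expr (A.tensor B)}
      {W : SortE (A.tensor B)} {g : ℕ → Expr (A.tensor B)}
      (hZ : TCtx TA TB b (X ++ [(chA X, U)]) Y Z)
      (he : TTg TA TB b ⟨X, .var (chA X), U⟩ ⟨Y, v, V⟩ e)
      (he' : TTg TA TB b ⟨X, .var (chA X), U'⟩ ⟨Y, v, V⟩ e')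
      (hW : TSo TA TB b X (chA X) U Y (chB Y) V W)
      (hg : ∀ i (hi : i < X.length),
          TTg TA TB b ⟨X.take i, .var (X[i]'hi).1, (X[i]'hi).2⟩ ⟨Y, v, V⟩ (g i)) :
      TJudg TA TB chA chB b (.sortEq X U U') (.term Y v V)
        (.termEq Z e e' (W.substL (pairsL X (chB Y) g)))
  /- term ⊙ sort equality -/
  | tseq {b : Bool} {X : PreCtx A} {u : Expr A} {U : SortE A} {Y : PreCtx B}
      {V V' : SortE B} {Z : PreCtx (A.tensor B)} {e e' : Expr (A.tensor B)}
      {W : SortE (A.tensor B)} {g : ℕ → Expr (A.tensor B)}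
      (hZ : TCtx TA TB b X (Y ++ [(chB Y, V)]) Z)
      (he : TTg TA TB b ⟨X, u, U⟩ ⟨Y, .var (chB Y), V⟩ e)
      (he' : TTg TA TB b ⟨X, u, U⟩ ⟨Y, .var (chB Y), V'⟩ e')
      (hW : TSo TA TB b X (chA X) U Y (chB Y) V W)
      (hg : ∀ j (hj : j < Y.length),
          TTg TA TB b ⟨X, u, U⟩ ⟨Y.take j, .var (Y[j]'hj).1, (Y[j]'hj).2⟩ (g j)) :
      TJudg TA TB chA chB b (.term X u U) (.sortEq Y V V')
        (.termEq Z e e' (W.substL (pairsR (chA X) Y g)))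

/-- A choice, for every precontext, of a variable not contained in it. -/
def FreshCh {A : Alphabet} (ch : PreCtx A → A.Var) : Prop :=
  ∀ X : PreCtx A, ∀ p ∈ X, p.1 ≠ ch X

/-- The set of axioms of the pretheory `𝔸 ⊗ 𝔹`: the judgments `J ⊙ J'` for `J` an
axiom of `𝔸` and `J'` an axiom of `𝔹`. -/
def tensorAx (TA : Set (Judg A)) (TB : Set (Judg B))
    (chA : PreCtx A → A.Var) (chB : PreCtx B → B.Var) : Set (Judg (A.tensor B)) :=
  {K | ∃ J J', J ∈ TA ∧ J' ∈ TB ∧ TJudg TA TB chA chB false J J' K}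

/-- The pair `(𝔸, 𝔹)` is `h`-derivable: `J ⊙ J'` is derivable in the pretheory
`𝔸 ⊗ 𝔹` whenever `J`, `J'` are derivable judgments of `𝔸`, `𝔹` (of admissible
kinds) with `ht J * ht J' ≤ h`. -/
def hDerivable (TA : Set (Judg A)) (TB : Set (Judg B))
    (chA : PreCtx A → A.Var) (chB : PreCtx B → B.Var) (h : ℕ) : Prop :=
  ∀ (J : Judg A) (J' : Judg B) (K : Judg (A.tensor B)),
    Derivable TA J → Derivable TB J' → ht TA J * ht TB J' ≤ h →
    TJudg TA TB chA chB false J J' K → Derivable (tensorAx TA TB chA chB) K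

/-- The tensor `out = f ⊗ g` of two tuples of derivable terms, each entry being
the tensor of terms taken at their canonical sorts, ordered lexicographically. -/
def TMor (TA : Set (Judg A)) (TB : Set (Judg B)) (b : Bool)
    (X : PreCtx A) (f : List (Expr A)) (Y : PreCtx B) (g : List (Expr B))
    (out : List (Expr (A.tensor B))) : Prop :=
  out.length = f.length * g.length ∧
  ∀ i j (hi : i < f.length) (hj : j < g.length) (h : i * g.length + j < out.length),
    ∃ U V, CanonSort TA X (f[i]'hi) U ∧ CanonSort TB Y (g[j]'hj) V ∧
      TTg TA TB b ⟨X, f[i]'hi, U⟩ ⟨Y, g[j]'hj, V⟩ (out[i * g.length + j]'h)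

/-- The tensor `out = f ⊗ Y` of a tuple of derivable terms of `𝔸` with a context
of `𝔹`: entries `fᵢ^{𝒮(fᵢ)} ⊗ yⱼ^{Yⱼ}`. -/
def TMorCtx (TA : Set (Judg A)) (TB : Set (Judg B)) (b : Bool)
    (X : PreCtx A) (f : List (Expr A)) (Y : PreCtx B)
    (out : List (Expr (A.tensor B))) : Prop :=
  out.length = f.length * Y.length ∧
  ∀ i j (hi : i < f.length) (hj : j < Y.length) (h : i * Y.length + j < out.length),
    ∃ U, CanonSort TA X (f[i]'hi) U ∧
      TTg TA TB b ⟨X, f[i]'hi, U⟩ ⟨Y.take j, .var (Y[j]'hj).1, (Y[j]'hj).2⟩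
        (out[i * Y.length + j]'h)

/-- The tensor `out = X ⊗ g` of a context of `𝔸` with a tuple of derivable terms
of `𝔹`: entries `xᵢ^{Xᵢ} ⊗ gⱼ^{𝒮(gⱼ)}`. -/
def TCtxMor (TA : Set (Judg A)) (TB : Set (Judg B)) (b : Bool)
    (X : PreCtx A) (Y : PreCtx B) (g : List (Expr B))
    (out : List (Expr (A.tensor B))) : Prop :=
  out.length = X.length * g.length ∧
  ∀ i j (hi : i < X.length) (hj : j < g.length) (h : i * g.length + j < out.length),
    ∃ V, CanonSort TB Y (g[j]'hj) V ∧
      TTg TA TB b ⟨X.take i, .var (X[i]'hi).1, (X[i]'hi).2⟩ ⟨Y, g[j]'hj, V⟩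
        (out[i * g.length + j]'h)

/-- The tensor `out = (x₁,…,x_m,u^U) ⊗ Y` of the section determined by a term
`X ⊢ u : U` with a context of `𝔹`. -/
def TSecL (TA : Set (Judg A)) (TB : Set (Judg B)) (b : Bool)
    (X : PreCtx A) (u : Expr A) (U : SortE A) (Y : PreCtx B)
    (out : List (Expr (A.tensor B))) : Prop :=
  out.length = (X.length + 1) * Y.length ∧
  (∀ i j (hi : i < X.length) (hj : j < Y.length) (h : i * Y.length + j < out.length),
      TTg TA TB b ⟨X.take i, .var (X[i]'hi).1, (X[i]'hi).2⟩
        ⟨Y.take j, .var (Y[j]'hj).1, (Y[j]'hj).2⟩ (out[i * Y.length + j]'h)) ∧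
  (∀ j (hj : j < Y.length) (h : X.length * Y.length + j < out.length),
      TTg TA TB b ⟨X, u, U⟩ ⟨Y.take j, .var (Y[j]'hj).1, (Y[j]'hj).2⟩
        (out[X.length * Y.length + j]'h))

/-- The tensor `out = X ⊗ (y₁,…,yₙ,v^V)` of a context of `𝔸` with the section
determined by a term `Y ⊢ v : V` of `𝔹`. -/
def TSecR (TA : Set (Judg A)) (TB : Set (Judg B)) (b : Bool)
    (X : PreCtx A) (Y : PreCtx B) (v : Expr B) (V : SortE B)
    (out : List (Expr (A.tensor B))) : Prop :=
  out.length = X.length * (Y.length + 1) ∧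
  (∀ i j (hi : i < X.length) (hj : j < Y.length)
      (h : i * (Y.length + 1) + j < out.length),
      TTg TA TB b ⟨X.take i, .var (X[i]'hi).1, (X[i]'hi).2⟩
        ⟨Y.take j, .var (Y[j]'hj).1, (Y[j]'hj).2⟩ (out[i * (Y.length + 1) + j]'h)) ∧
  (∀ i (hi : i < X.length) (h : i * (Y.length + 1) + Y.length < out.length),
      TTg TA TB b ⟨X.take i, .var (X[i]'hi).1, (X[i]'hi).2⟩ ⟨Y, v, V⟩
        (out[i * (Y.length + 1) + Y.length]'h))

section

variable {A B : Alphabet}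

/-! ### Substitution -/

theorem subst_var (σ : A.Var → Expr A) (x : A.Var) : (Expr.var x).subst σ = σ x := by
  rw [Expr.subst]

theorem subst_app (σ : A.Var → Expr A) (t : A.TermSym) (es : List (Expr A)) :
    (Expr.app t es).subst σ = .app t (es.map (Expr.subst σ)) := by
  rw [Expr.subst]; simp

/-- Induction principle for expressions with a membership induction hypothesis. -/
theorem Expr.rec_mem {P : Expr A → Prop} (hv : ∀ x, P (.var x))
    (ha : ∀ t es, (∀ e ∈ es, P e) → P (.app t es)) : ∀ e, P e
  | .var x => hv x
  | .app t es => ha t es fun e he => Expr.rec_mem hv ha e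
termination_by e => sizeOf e
decreasing_by
  have := List.sizeOf_lt_of_mem he
  simp only [Expr.app.sizeOf_spec]
  omega

theorem occurs_var {x y : A.Var} : Occurs x (Expr.var y) ↔ x = y :=
  ⟨fun h => by cases h; rfl, fun h => h ▸ .var⟩

theorem occurs_app {x : A.Var} {t : A.TermSym} {es : List (Expr A)} :
    Occurs x (Expr.app t es) ↔ ∃ e ∈ es, Occurs x e :=
  ⟨fun h => by cases h with | app h1 h2 => exact ⟨_, h1, h2⟩,
    fun ⟨e, h1, h2⟩ => .app h1 h2⟩

theorem subst_congr {σ τ : A.Var → Expr A} (e : Expr A) (h : ∀ x, Occurs x e → σ x = τ x) :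
    e.subst σ = e.subst τ := by
  induction e using Expr.rec_mem with
  | hv x => simpa [subst_var] using h x .var
  | ha t es ih =>
    rw [subst_app, subst_app, List.map_congr_left]
    exact fun e he => ih e he fun x hx => h x (.app he hx)

theorem ssubst_congr {σ τ : A.Var → Expr A} (U : SortE A)
    (h : ∀ x, SOccurs x U → σ x = τ x) : U.subst σ = U.subst τ := by
  simp only [SortE.subst, SortE.mk.injEq, true_and]
  exact List.map_congr_left fun e he => subst_congr e fun x hx => h x ⟨e, he, hx⟩

theorem subst_subst (σ τ : A.Var → Expr A) (e : Expr A) :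
    (e.subst σ).subst τ = e.subst fun x => (σ x).subst τ := by
  induction e using Expr.rec_mem with
  | hv x => simp [subst_var]
  | ha t es ih => simpa [subst_app] using ih

theorem ssubst_ssubst (σ τ : A.Var → Expr A) (U : SortE A) :
    (U.subst σ).subst τ = U.subst fun x => (σ x).subst τ := by
  simp [SortE.subst, subst_subst]

theorem subst_id (e : Expr A) : e.subst Expr.var = e := by
  induction e using Expr.rec_mem with
  | hv x => simp [subst_var]
  | ha t es ih =>
    rw [subst_app]; congr 1
    exact (List.map_congr_left ih).trans (by simp)

theorem ssubst_id (U : SortE A) : U.subst Expr.var = U := by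
  cases U with
  | mk S l =>
    simp only [SortE.subst, SortE.mk.injEq, true_and]
    exact (List.map_congr_left fun e _ => subst_id e).trans (by simp)

/-- The tuple of values of `φ` at the variables of `X`. -/
def vals (φ : A.Var → Expr A) (X : PreCtx A) : List (Expr A) := X.map fun p => φ p.1

theorem vals_subst (φ σ : A.Var → Expr A) (X : PreCtx A) :
    (vals φ X).map (Expr.subst σ) = vals (fun x => (φ x).subst σ) X := by
  simp [vals]

theorem vals_var (X : PreCtx A) : vals Expr.var X = ctxVars X := rfl

theorem lookupV_zip (X : PreCtx A) (hnd : (X.map Prod.fst).Nodup) (f : List (Expr A))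
    (hl : f.length = X.length) : vals (lookupV (mkSub X f)) X = f := by
  induction X generalizing f with
  | nil => simp_all [vals]
  | cons p X ih =>
    cases f with
    | nil => simp at hl
    | cons a f =>
      simp only [List.map_cons, List.nodup_cons] at hnd
      have := ih hnd.2 f (by simpa using hl)
      simp only [vals, mkSub, List.map_cons, List.zip_cons_cons, lookupV, if_true] at this ⊢
      congr 1
      refine Eq.trans (List.map_congr_left fun q hq => ?_) this
      rw [if_neg]
      rintro h
      exact hnd.1 (List.mem_map.2 ⟨q, hq, h.symm⟩)

theorem lookupV_of_vals (φ : A.Var → Expr A) (X : PreCtx A) (x : A.Var)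
    (hx : x ∈ X.map Prod.fst) : lookupV (mkSub X (vals φ X)) x = φ x := by
  induction X with
  | nil => simp at hx
  | cons p X ih =>
    simp only [vals, mkSub, List.map_cons, List.zip_cons_cons, lookupV]
    by_cases h : p.1 = x
    · simp [h]
    · rw [if_neg h]
      refine ih ?_
      simp only [List.map_cons, List.mem_cons] at hx
      exact hx.resolve_left fun e => h e.symm

end

section

variable {A B : Alphabet}

/-! ### A graded presentation of the derivable judgments -/

/-- A graded system without context judgments, equivalent to the sixteen rules over
derivable contexts. Substitutions are functions on variables. -/
inductive R (Ax : Set (Judg A)) : ℕ → Judg A → Prop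
  | mono {n J} (h : R Ax n J) : R Ax (n + 1) J
  | srefl {n X U} (h : R Ax n (.sort X U)) : R Ax n (.sortEq X U U)
  | ssymm {n X U V} (h : R Ax n (.sortEq X U V)) : R Ax n (.sortEq X V U)
  | strans {n X U V W} (h1 : R Ax n (.sortEq X U V)) (h2 : R Ax n (.sortEq X V W)) :
      R Ax n (.sortEq X U W)
  | trefl {n X u U} (h : R Ax n (.term X u U)) : R Ax n (.termEq X u u U)
  | tsymm {n X u v U} (h : R Ax n (.termEq X u v U)) : R Ax n (.termEq X v u U)
  | ttrans {n X u v w U} (h1 : R Ax n (.termEq X u v U)) (h2 : R Ax n (.termEq X v w U)) :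
      R Ax n (.termEq X u w U)
  | conv {n X u U V} (h1 : R Ax n (.sortEq X U V)) (h2 : R Ax n (.term X u U)) :
      R Ax (n + 1) (.term X u V)
  | conveq {n X u v U V} (h1 : R Ax n (.sortEq X U V)) (h2 : R Ax n (.termEq X u v U))
      (h3 : R Ax n (.term X u U)) (h4 : R Ax n (.term X v U)) :
      R Ax (n + 1) (.termEq X u v V)
  | var {n X x U} (hx : (x, U) ∈ X) (h : R Ax n (.sort X U)) : R Ax n (.term X (.var x) U)
  | sSub {n Xa S Y φ} (hax : introSort Xa S ∈ Ax) (hnd : (Xa.map Prod.fst).Nodup)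
      (hctx : ∀ pre z post, Xa = pre ++ z :: post → R Ax n (.sort pre z.2))
      (hargs : ∀ p ∈ Xa, R Ax n (.term Y (φ p.1) (p.2.subst φ))) :
      R Ax (n + 1) (.sort Y ⟨S, vals φ Xa⟩)
  | tSub {n Xa t U Y φ} (hax : introTerm Xa t U ∈ Ax) (hnd : (Xa.map Prod.fst).Nodup)
      (hctx : ∀ pre z post, Xa = pre ++ z :: post → R Ax n (.sort pre z.2))
      (hU : R Ax n (.sort Xa U)) (hUφ : R Ax n (.sort Y (U.subst φ)))
      (hargs : ∀ p ∈ Xa, R Ax n (.term Y (φ p.1) (p.2.subst φ))) :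
      R Ax (n + 1) (.term Y (.app t (vals φ Xa)) (U.subst φ))
  | seqSub {n Xa U U' Y φ} (hax : Judg.sortEq Xa U U' ∈ Ax) (hnd : (Xa.map Prod.fst).Nodup)
      (hctx : ∀ pre z post, Xa = pre ++ z :: post → R Ax n (.sort pre z.2))
      (hU : R Ax n (.sort Xa U)) (hU' : R Ax n (.sort Xa U'))
      (h1 : R Ax n (.sort Y (U.subst φ))) (h2 : R Ax n (.sort Y (U'.subst φ)))
      (hargs : ∀ p ∈ Xa, R Ax n (.term Y (φ p.1) (p.2.subst φ))) :
      R Ax (n + 1) (.sortEq Y (U.subst φ) (U'.subst φ))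
  | seqCong {n Xa S Y φ ψ} (hax : introSort Xa S ∈ Ax) (hnd : (Xa.map Prod.fst).Nodup)
      (hctx : ∀ pre z post, Xa = pre ++ z :: post → R Ax n (.sort pre z.2))
      (h1 : R Ax n (.sort Y ⟨S, vals φ Xa⟩)) (h2 : R Ax n (.sort Y ⟨S, vals ψ Xa⟩))
      (hargs : ∀ p ∈ Xa, R Ax n (.termEq Y (φ p.1) (ψ p.1) (p.2.subst φ))) :
      R Ax (n + 1) (.sortEq Y ⟨S, vals φ Xa⟩ ⟨S, vals ψ Xa⟩)
  | teqSub {n Xa u u' U Y φ} (hax : Judg.termEq Xa u u' U ∈ Ax)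
      (hnd : (Xa.map Prod.fst).Nodup)
      (hctx : ∀ pre z post, Xa = pre ++ z :: post → R Ax n (.sort pre z.2))
      (hu : R Ax n (.term Xa u U)) (hu' : R Ax n (.term Xa u' U))
      (h1 : R Ax n (.term Y (u.subst φ) (U.subst φ)))
      (h2 : R Ax n (.term Y (u'.subst φ) (U.subst φ)))
      (hargs : ∀ p ∈ Xa, R Ax n (.term Y (φ p.1) (p.2.subst φ))) :
      R Ax (n + 1) (.termEq Y (u.subst φ) (u'.subst φ) (U.subst φ))
  | teqCong {n Xa t U Y φ ψ} (hax : introTerm Xa t U ∈ Ax) (hnd : (Xa.map Prod.fst).Nodup)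
      (hctx : ∀ pre z post, Xa = pre ++ z :: post → R Ax n (.sort pre z.2))
      (hU : R Ax n (.sort Xa U))
      (h1 : R Ax n (.term Y (.app t (vals φ Xa)) (U.subst φ)))
      (h2 : R Ax n (.term Y (.app t (vals ψ Xa)) (U.subst φ)))
      (hargs : ∀ p ∈ Xa, R Ax n (.termEq Y (φ p.1) (ψ p.1) (p.2.subst φ))) :
      R Ax (n + 1) (.termEq Y (.app t (vals φ Xa)) (.app t (vals ψ Xa)) (U.subst φ))

/-- Validity of a context at a given stage of the graded system. -/
def CtxR (Ax : Set (Judg A)) (n : ℕ) (X : PreCtx A) : Prop :=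
  (X.map Prod.fst).Nodup ∧ ∀ pre z post, X = pre ++ z :: post → R Ax n (.sort pre z.2)

variable {Ax : Set (Judg A)}

theorem R.le {n m : ℕ} (hnm : n ≤ m) {J : Judg A} (h : R Ax n J) : R Ax m J := by
  induction hnm with
  | refl => exact h
  | step _ ih => exact ih.mono

theorem not_R_zero_aux {n : ℕ} {J : Judg A} (h : R Ax n J) : n ≠ 0 := by
  induction h <;> omega

theorem not_R_zero {J : Judg A} (h : R Ax 0 J) : False := not_R_zero_aux h rfl

theorem CtxR.le {n m : ℕ} (hnm : n ≤ m) {X : PreCtx A} (h : CtxR Ax n X) : CtxR Ax m X :=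
  ⟨h.1, fun pre z post e => (h.2 pre z post e).le hnm⟩

/-- Replace the context of a judgment. -/
def Judg.reCtx (Y : PreCtx A) : Judg A → Judg A
  | .ctx X => .ctx X
  | .sort _ U => .sort Y U
  | .term _ u U => .term Y u U
  | .sortEq _ U V => .sortEq Y U V
  | .termEq _ u v U => .termEq Y u v U

theorem R.weaken {n : ℕ} {J : Judg A} (h : R Ax n J) {Y : PreCtx A}
    (hs : J.ctxOf ⊆ Y) : R Ax n (J.reCtx Y) := by
  induction h with
  | mono h ih => exact (ih hs).mono
  | srefl h ih => exact .srefl (ih hs)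
  | ssymm h ih => exact .ssymm (ih hs)
  | strans h1 h2 ih1 ih2 => exact .strans (ih1 hs) (ih2 hs)
  | trefl h ih => exact .trefl (ih hs)
  | tsymm h ih => exact .tsymm (ih hs)
  | ttrans h1 h2 ih1 ih2 => exact .ttrans (ih1 hs) (ih2 hs)
  | conv h1 h2 ih1 ih2 => exact .conv (ih1 hs) (ih2 hs)
  | conveq h1 h2 h3 h4 i1 i2 i3 i4 => exact .conveq (i1 hs) (i2 hs) (i3 hs) (i4 hs)
  | var hx h ih => exact .var (hs hx) (ih hs)
  | sSub hax hnd hctx hargs _ ih => exact .sSub hax hnd hctx fun p hp => ih p hp hs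
  | tSub hax hnd hctx hU hUφ hargs _ _ ih1 ih2 =>
    exact .tSub hax hnd hctx hU (ih1 hs) fun p hp => ih2 p hp hs
  | seqSub hax hnd hctx hU hU' h1 h2 hargs _ _ _ i1 i2 i3 =>
    exact .seqSub hax hnd hctx hU hU' (i1 hs) (i2 hs) fun p hp => i3 p hp hs
  | seqCong hax hnd hctx h1 h2 hargs _ i1 i2 i3 =>
    exact .seqCong hax hnd hctx (i1 hs) (i2 hs) fun p hp => i3 p hp hs
  | teqSub hax hnd hctx hu hu' h1 h2 hargs _ _ _ i1 i2 i3 =>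
    exact .teqSub hax hnd hctx hu hu' (i1 hs) (i2 hs) fun p hp => i3 p hp hs
  | teqCong hax hnd hctx hU h1 h2 hargs _ _ i1 i2 i3 =>
    exact .teqCong hax hnd hctx hU (i1 hs) (i2 hs) fun p hp => i3 p hp hs

theorem R.weaken_sort {n : ℕ} {X Y : PreCtx A} {U : SortE A} (h : R Ax n (.sort X U))
    (hs : X ⊆ Y) : R Ax n (.sort Y U) := h.weaken hs

/-- The judgments presupposed by a judgment. -/
def Judg.Presup (P : Judg A → Prop) : Judg A → Prop
  | .ctx _ => True
  | .sort _ _ => True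
  | .term X _ U => P (.sort X U)
  | .sortEq X U V => P (.sort X U) ∧ P (.sort X V)
  | .termEq X u v U => P (.term X u U) ∧ P (.term X v U) ∧ P (.sort X U)

theorem R.presup {n : ℕ} {J : Judg A} (h : R Ax n J) : J.Presup (R Ax n) := by
  induction h with
  | @mono n J h ih =>
    cases J with
    | ctx => trivial
    | sort => trivial
    | term => exact ih.mono
    | sortEq => exact ⟨ih.1.mono, ih.2.mono⟩
    | termEq => exact ⟨ih.1.mono, ih.2.1.mono, ih.2.2.mono⟩
  | srefl h ih => exact ⟨h, h⟩
  | ssymm h ih => exact ⟨ih.2, ih.1⟩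
  | strans h1 h2 ih1 ih2 => exact ⟨ih1.1, ih2.2⟩
  | trefl h ih => exact ⟨h, h, ih⟩
  | tsymm h ih => exact ⟨ih.2.1, ih.1, ih.2.2⟩
  | ttrans h1 h2 ih1 ih2 => exact ⟨ih1.1, ih2.2.1, ih1.2.2⟩
  | conv h1 h2 ih1 ih2 => exact ih1.2.mono
  | conveq h1 h2 h3 h4 ih1 => exact ⟨.conv h1 h3, .conv h1 h4, ih1.2.mono⟩
  | var hx h ih => exact h
  | sSub => trivial
  | tSub hax hnd hctx hU hUφ => exact hUφ.mono
  | seqSub hax hnd hctx hU hU' h1 h2 => exact ⟨h1.mono, h2.mono⟩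
  | seqCong hax hnd hctx h1 h2 => exact ⟨h1.mono, h2.mono⟩
  | teqSub hax hnd hctx hu hu' h1 h2 _ _ _ _ i1 => exact ⟨h1.mono, h2.mono, i1.mono⟩
  | teqCong hax hnd hctx hU h1 h2 _ _ _ i1 => exact ⟨h1.mono, h2.mono, i1.mono⟩

theorem R.sort_of_term {n : ℕ} {X : PreCtx A} {u : Expr A} {U : SortE A}
    (h : R Ax n (.term X u U)) : R Ax n (.sort X U) := h.presup
theorem R.left_sort {n : ℕ} {X : PreCtx A} {U V : SortE A}
    (h : R Ax n (.sortEq X U V)) : R Ax n (.sort X U) := h.presup.1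
theorem R.right_sort {n : ℕ} {X : PreCtx A} {U V : SortE A}
    (h : R Ax n (.sortEq X U V)) : R Ax n (.sort X V) := h.presup.2
theorem R.left_term {n : ℕ} {X : PreCtx A} {u v : Expr A} {U : SortE A}
    (h : R Ax n (.termEq X u v U)) : R Ax n (.term X u U) := h.presup.1
theorem R.right_term {n : ℕ} {X : PreCtx A} {u v : Expr A} {U : SortE A}
    (h : R Ax n (.termEq X u v U)) : R Ax n (.term X v U) := h.presup.2.1

/-! ### Inversion -/

/-- Inversion of well-formed sorts. -/
theorem R.sort_inv_aux {n : ℕ} {J : Judg A} (h : R Ax n J) :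
    ∀ Y U, J = .sort Y U → ∃ k Xa φ, n = k + 1 ∧ introSort Xa U.head ∈ Ax ∧ CtxR Ax k Xa ∧
      U = ⟨U.head, vals φ Xa⟩ ∧ ∀ p ∈ Xa, R Ax k (.term Y (φ p.1) (p.2.subst φ)) := by
  induction h with
  | mono h ih =>
    rintro Y U rfl
    obtain ⟨k, Xa, φ, rfl, h1, h2, h3, h4⟩ := ih Y U rfl
    exact ⟨k + 1, Xa, φ, rfl, h1, h2.le (by omega), h3, fun p hp => (h4 p hp).mono⟩
  | @sSub k Xa S Y φ hax hnd hctx hargs =>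
    intro Y U e
    cases e
    exact ⟨k, Xa, φ, rfl, hax, ⟨hnd, hctx⟩, rfl, hargs⟩
  | _ => intro Y U e; cases e

theorem R.sort_inv {n : ℕ} {Y : PreCtx A} {U : SortE A} (h : R Ax n (.sort Y U)) :
    ∃ k Xa φ, n = k + 1 ∧ introSort Xa U.head ∈ Ax ∧ CtxR Ax k Xa ∧
      U = ⟨U.head, vals φ Xa⟩ ∧ ∀ p ∈ Xa, R Ax k (.term Y (φ p.1) (p.2.subst φ)) :=
  h.sort_inv_aux Y U rfl

theorem R.sort_args {n : ℕ} {Y : PreCtx A} {U : SortE A} (h : R Ax n (.sort Y U))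
    {e : Expr A} (he : e ∈ U.args) : ∃ k W, n = k + 1 ∧ R Ax k (.term Y e W) := by
  obtain ⟨k, Xa, φ, rfl, h1, h2, h3, h4⟩ := h.sort_inv
  rw [h3] at he
  obtain ⟨p, hp, rfl⟩ := List.mem_map.1 he
  exact ⟨k, _, rfl, h4 p hp⟩

/-- Inversion of typing derivations, one step. -/
theorem R.term_inv_aux {n : ℕ} {J : Judg A} (h : R Ax n J) :
    ∀ Y u U, J = .term Y u U →
      (∃ x, u = .var x ∧ (x, U) ∈ Y ∧ R Ax n (.sort Y U)) ∨
      (∃ k Xa t V φ, n = k + 1 ∧ u = .app t (vals φ Xa) ∧ U = V.subst φ ∧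
        introTerm Xa t V ∈ Ax ∧ CtxR Ax k Xa ∧ R Ax k (.sort Xa V) ∧
        R Ax k (.sort Y (V.subst φ)) ∧ ∀ p ∈ Xa, R Ax k (.term Y (φ p.1) (p.2.subst φ))) ∨
      (∃ k V, n = k + 1 ∧ R Ax k (.sortEq Y V U) ∧ R Ax k (.term Y u V)) := by
  induction h with
  | mono h ih =>
    rintro Y u U rfl
    obtain ⟨x, rfl, h1, h2⟩ | ⟨k, Xa, t, V, φ, rfl, h1, h2, h3, h4, h5, h6, h7⟩ |
      ⟨k, V, rfl, h1, h2⟩ := ih Y u U rfl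
    · exact .inl ⟨x, rfl, h1, h2.mono⟩
    · exact .inr (.inl ⟨k + 1, Xa, t, V, φ, rfl, h1, h2, h3, h4.le (by omega), h5.mono,
        h6.mono, fun p hp => (h7 p hp).mono⟩)
    · exact .inr (.inr ⟨k + 1, V, rfl, h1.mono, h2.mono⟩)
  | var hx h =>
    intro Y u U e; cases e
    exact .inl ⟨_, rfl, hx, h⟩
  | tSub hax hnd hctx hU hUφ hargs =>
    intro Y u U e; cases e
    exact .inr (.inl ⟨_, _, _, _, _, rfl, rfl, rfl, hax, ⟨hnd, hctx⟩, hU, hUφ, hargs⟩)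
  | conv h1 h2 =>
    intro Y u U e; cases e
    exact .inr (.inr ⟨_, _, rfl, h1, h2⟩)
  | _ => intro Y u U e; cases e

theorem R.term_inv {n : ℕ} {Y : PreCtx A} {u : Expr A} {U : SortE A}
    (h : R Ax n (.term Y u U)) :
      (∃ x, u = .var x ∧ (x, U) ∈ Y ∧ R Ax n (.sort Y U)) ∨
      (∃ k Xa t V φ, n = k + 1 ∧ u = .app t (vals φ Xa) ∧ U = V.subst φ ∧
        introTerm Xa t V ∈ Ax ∧ CtxR Ax k Xa ∧ R Ax k (.sort Xa V) ∧
        R Ax k (.sort Y (V.subst φ)) ∧ ∀ p ∈ Xa, R Ax k (.term Y (φ p.1) (p.2.subst φ))) ∨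
      (∃ k V, n = k + 1 ∧ R Ax k (.sortEq Y V U) ∧ R Ax k (.term Y u V)) :=
  h.term_inv_aux Y u U rfl

/-- Inversion of typing for variables. -/
theorem R.var_inv {Y : PreCtx A} {x : A.Var} : ∀ {n : ℕ} {U : SortE A},
    R Ax n (.term Y (.var x) U) →
    ∃ V, (x, V) ∈ Y ∧ R Ax n (.sort Y V) ∧ R Ax n (.sortEq Y V U) := by
  intro n
  induction n with
  | zero => intro U h; exact (not_R_zero h).elim
  | succ n ih =>
    intro U h
    obtain ⟨y, e, h1, h2⟩ | ⟨k, Xa, t, V, φ, e, h1, -⟩ | ⟨k, V, e, h1, h2⟩ := h.term_inv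
    · cases e; exact ⟨U, h1, h2, .srefl h2⟩
    · cases h1
    · cases e
      obtain ⟨W, w1, w2, w3⟩ := ih h2
      exact ⟨W, w1, w2.mono, (R.strans w3 h1).mono⟩

/-- Inversion of typing for function applications. -/
theorem R.app_inv {Y : PreCtx A} {t : A.TermSym} {l : List (Expr A)} :
    ∀ {n : ℕ} {U : SortE A}, R Ax n (.term Y (.app t l) U) →
    ∃ k Xa V φ, n = k + 1 ∧ l = vals φ Xa ∧ introTerm Xa t V ∈ Ax ∧ CtxR Ax k Xa ∧
      R Ax k (.sort Xa V) ∧ R Ax k (.sort Y (V.subst φ)) ∧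
      (∀ p ∈ Xa, R Ax k (.term Y (φ p.1) (p.2.subst φ))) ∧
      R Ax n (.sortEq Y (V.subst φ) U) := by
  intro n
  induction n with
  | zero => intro U h; exact (not_R_zero h).elim
  | succ n ih =>
    intro U h
    obtain ⟨y, e, -⟩ | ⟨k, Xa, t, V, φ, e, h1, rfl, h3, h4, h5, h6, h7⟩ | ⟨k, V, e, h1, h2⟩ :=
      h.term_inv
    · cases e
    · cases e; cases h1
      exact ⟨n, Xa, V, φ, rfl, rfl, h3, h4, h5, h6, h7, .mono (.srefl h6)⟩
    · cases e
      obtain ⟨k, Xa, V, φ, rfl, rfl, h3, h4, h5, h6, h7, h8⟩ := ih h2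
      exact ⟨k + 1, Xa, V, φ, rfl, rfl, h3, h4.le (by omega), h5.mono, h6.mono,
        fun p hp => (h7 p hp).mono, (R.strans h8 h1).mono⟩

theorem R.app_args {n : ℕ} {Y : PreCtx A} {t : A.TermSym} {l : List (Expr A)} {U : SortE A}
    (h : R Ax n (.term Y (.app t l) U)) {e : Expr A} (he : e ∈ l) :
    ∃ k W, n = k + 1 ∧ R Ax k (.term Y e W) := by
  obtain ⟨k, Xa, V, φ, rfl, rfl, h3, h4, h5, h6, h7, h8⟩ := h.app_inv
  obtain ⟨p, hp, rfl⟩ := List.mem_map.1 he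
  exact ⟨k, _, rfl, h7 p hp⟩

/-! ### Scoping -/

theorem R.scope {Y : PreCtx A} : ∀ n : ℕ,
    (∀ U, R Ax n (.sort Y U) → ∀ x, SOccurs x U → x ∈ Y.map Prod.fst) ∧
    (∀ u U, R Ax n (.term Y u U) → ∀ x, Occurs x u → x ∈ Y.map Prod.fst) := by
  intro n
  induction n with
  | zero => exact ⟨fun U h => (not_R_zero h).elim, fun u U h => (not_R_zero h).elim⟩
  | succ n ih =>
    constructor
    · rintro U h x ⟨e, he, hx⟩
      obtain ⟨k, W, e, hk⟩ := h.sort_args he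
      cases e
      exact ih.2 _ _ hk x hx
    · rintro u U h x hx
      cases u with
      | var y =>
        rw [occurs_var] at hx
        subst hx
        obtain ⟨V, hV, -⟩ := h.var_inv
        exact List.mem_map.2 ⟨_, hV, rfl⟩
      | app t l =>
        rw [occurs_app] at hx
        obtain ⟨e, he, hx⟩ := hx
        obtain ⟨k, W, e, hk⟩ := h.app_args he
        cases e
        exact ih.2 _ _ hk x hx

theorem R.scope_sort {n : ℕ} {Y : PreCtx A} {U : SortE A} (h : R Ax n (.sort Y U))
    {x : A.Var} (hx : SOccurs x U) : x ∈ Y.map Prod.fst := (R.scope n).1 U h x hx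

theorem R.scope_term {n : ℕ} {Y : PreCtx A} {u : Expr A} {U : SortE A}
    (h : R Ax n (.term Y u U)) {x : A.Var} (hx : Occurs x u) : x ∈ Y.map Prod.fst :=
  (R.scope n).2 u U h x hx

theorem R.subst_sort_congr {n : ℕ} {Y : PreCtx A} {U : SortE A} (h : R Ax n (.sort Y U))
    {σ τ : A.Var → Expr A} (hst : ∀ x ∈ Y.map Prod.fst, σ x = τ x) :
    U.subst σ = U.subst τ :=
  ssubst_congr U fun x hx => hst x (h.scope_sort hx)

theorem CtxR.sort_mem {n : ℕ} {X : PreCtx A} (h : CtxR Ax n X) {p : A.Var × SortE A}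
    (hp : p ∈ X) : R Ax n (.sort X p.2) := by
  obtain ⟨pre, post, rfl⟩ := List.append_of_mem hp
  exact (h.2 pre p post rfl).weaken_sort (by simp)

theorem CtxR.var_mem {n : ℕ} {X : PreCtx A} (h : CtxR Ax n X) {p : A.Var × SortE A}
    (hp : p ∈ X) : R Ax n (.term X (.var p.1) p.2) := .var hp (h.sort_mem hp)

theorem CtxR.initial {n : ℕ} {X X' : PreCtx A} (h : CtxR Ax n (X ++ X')) : CtxR Ax n X :=
  ⟨(by have := h.1; rw [List.map_append] at this; exact this.of_append_left),
    fun pre z post e => h.2 pre z (post ++ X') (by simp [e])⟩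

theorem CtxR.snoc {n : ℕ} {X : PreCtx A} (h : CtxR Ax n X) {x : A.Var} {U : SortE A}
    (hx : ∀ p ∈ X, p.1 ≠ x) (hU : R Ax n (.sort X U)) : CtxR Ax n (X ++ [(x, U)]) := by
  refine ⟨?_, ?_⟩
  · rw [List.map_append, List.nodup_append]
    refine ⟨h.1, by simp, ?_⟩
    rintro a ha b hb rfl
    obtain ⟨p, hp, rfl⟩ := List.mem_map.1 ha
    simp at hb
    exact hx p hp hb
  · intro pre z post e
    rcases List.eq_nil_or_concat post with rfl | ⟨post', w, rfl⟩
    · have := List.append_inj' e rfl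
      obtain ⟨rfl, h2⟩ := this
      cases h2
      exact hU
    · rw [List.concat_eq_append, ← List.cons_append, ← List.append_assoc] at e
      have := List.append_inj' e rfl
      exact h.2 pre z post' this.1

end

section

variable {A B : Alphabet} {Ax : Set (Judg A)}

/-! ### Comparison with the sixteen rules -/

theorem CtxR.isPreCtx {n : ℕ} {X : PreCtx A} (h : CtxR Ax n X) : IsPreCtx X := by
  intro i hi v hv
  have := h.2 (X.take i) (X[i]) (X.drop (i + 1)) (by simp)
  exact this.scope_sort hv

theorem mem_take_fst_of_split {X : PreCtx A} {i : ℕ} (hi : i < X.length) :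
    X = X.take i ++ X[i] :: X.drop (i + 1) := by simp

/-- With distinct variables and scoped entries, the sorts `subPre` are full substitutions. -/
theorem subPre_vals {X : PreCtx A} (hX : IsPreCtx X) (φ : A.Var → Expr A) (i : ℕ)
    (hi : i < X.length) : subPre X (vals φ X) i hi = (X[i]).2.subst φ := by
  unfold subPre SortE.substL
  refine ssubst_congr _ fun x hx => ?_
  have hx' := hX i hi x hx
  have : (vals φ X).take i = vals φ (X.take i) := by simp [vals, List.map_take]
  rw [this, lookupV_of_vals _ _ _ hx']

theorem substL_vals {X : PreCtx A} (φ : A.Var → Expr A) {U : SortE A}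
    (hU : ∀ x, SOccurs x U → x ∈ X.map Prod.fst) :
    U.substL (mkSub X (vals φ X)) = U.subst φ :=
  ssubst_congr _ fun x hx => lookupV_of_vals _ _ _ (hU x hx)

theorem esubstL_vals {X : PreCtx A} (φ : A.Var → Expr A) {u : Expr A}
    (hU : ∀ x, Occurs x u → x ∈ X.map Prod.fst) :
    u.substL (mkSub X (vals φ X)) = u.subst φ :=
  subst_congr _ fun x hx => lookupV_of_vals _ _ _ (hU x hx)

/-- The content of a judgment in the graded system. -/
def Judg.RGood (Ax : Set (Judg A)) (n : ℕ) : Judg A → Prop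
  | .ctx X => CtxR Ax n X
  | J => CtxR Ax n J.ctxOf ∧ R Ax n J

theorem RGood.mono {n : ℕ} {J : Judg A} (h : J.RGood Ax n) : J.RGood Ax (n + 1) := by
  cases J with
  | ctx => exact CtxR.le (by omega) h
  | _ => exact ⟨CtxR.le (by omega) h.1, h.2.mono⟩

theorem args_of_list {D : Judg A → Prop} {X Y : PreCtx A}
    (hX : IsPreCtx X) (hnd : (X.map Prod.fst).Nodup)
    {f : List (Expr A)} (hlen : f.length = X.length)
    (hargs : ∀ i (hi : i < X.length) (hif : i < f.length),
        D (.term Y (f[i]'hif) (subPre X f i hi))) :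
    ∃ φ, f = vals φ X ∧ ∀ p ∈ X, D (.term Y (φ p.1) (p.2.subst φ)) := by
  refine ⟨lookupV (mkSub X f), (lookupV_zip X hnd f hlen).symm, ?_⟩
  intro p hp
  obtain ⟨i, hi, rfl⟩ := List.getElem_of_mem hp
  have := hargs i hi (by omega)
  generalize hφ : lookupV (mkSub X f) = φ
  have hf : f = vals φ X := by rw [← hφ, lookupV_zip X hnd f hlen]
  subst hf
  rw [subPre_vals hX] at this
  simpa [vals] using this

theorem argsEq_of_list {D : Judg A → Prop} {X Y : PreCtx A}
    (hX : IsPreCtx X) (hnd : (X.map Prod.fst).Nodup)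
    {f g : List (Expr A)} (hlf : f.length = X.length) (hlg : g.length = X.length)
    (hargs : ∀ i (hi : i < X.length) (hif : i < f.length) (hig : i < g.length),
        D (.termEq Y (f[i]'hif) (g[i]'hig) (subPre X f i hi))) :
    ∃ φ ψ, f = vals φ X ∧ g = vals ψ X ∧
      ∀ p ∈ X, D (.termEq Y (φ p.1) (ψ p.1) (p.2.subst φ)) := by
  refine ⟨lookupV (mkSub X f), lookupV (mkSub X g), (lookupV_zip X hnd f hlf).symm,
    (lookupV_zip X hnd g hlg).symm, ?_⟩
  intro p hp
  obtain ⟨i, hi, rfl⟩ := List.getElem_of_mem hp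
  have := hargs i hi (by omega) (by omega)
  generalize hφ : lookupV (mkSub X f) = φ
  have hf : f = vals φ X := by rw [← hφ, lookupV_zip X hnd f hlf]
  generalize hψ : lookupV (mkSub X g) = ψ
  have hg : g = vals ψ X := by rw [← hψ, lookupV_zip X hnd g hlg]
  subst hf hg
  rw [subPre_vals hX] at this
  simpa [vals] using this

theorem RGood_of_DerAt (hAx : IsPretheory Ax) : ∀ (n : ℕ) (J : Judg A),
    DerAt Ax n J → J.RGood Ax n := by
  intro n
  induction n with
  | zero => intro J h; exact h.elim
  | succ n ih =>
    rintro J (h | h)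
    · exact RGood.mono (ih J h)
    cases h with
    | ctx_nil => exact ⟨by simp, fun pre z post e => by simp at e⟩
    | ctx_cons hs hfresh hpre =>
      have := ih _ hs
      exact CtxR.le (by omega) (CtxR.snoc this.1 hfresh this.2)
    | s1 h => exact RGood.mono (n := n) ⟨(ih _ h).1, .srefl (ih _ h).2⟩
    | s2 h => exact RGood.mono (n := n) ⟨(ih _ h).1, .ssymm (ih _ h).2⟩
    | s3 h1 h2 => exact RGood.mono (n := n) ⟨(ih _ h1).1, .strans (ih _ h1).2 (ih _ h2).2⟩
    | t1 h => exact RGood.mono (n := n) ⟨(ih _ h).1, .trefl (ih _ h).2⟩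
    | t2 h => exact RGood.mono (n := n) ⟨(ih _ h).1, .tsymm (ih _ h).2⟩
    | t3 h1 h2 => exact RGood.mono (n := n) ⟨(ih _ h1).1, .ttrans (ih _ h1).2 (ih _ h2).2⟩
    | seqt h1 h2 => exact ⟨(ih _ h1).1.le (by omega), .conv (ih _ h1).2 (ih _ h2).2⟩
    | seqteq h1 h2 h3 h4 => exact ⟨(ih _ h1).1.le (by omega), .conveq (ih _ h1).2 (ih _ h2).2
        (ih _ h2).2.left_term (ih _ h2).2.right_term⟩
    | var hi h =>
      exact RGood.mono (n := n) ⟨(ih _ h).1, .var (List.getElem_mem hi) (ih _ h).2⟩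
    | @sA X U hax h hv =>
      have hc : CtxR Ax n X := ih _ h
      refine ⟨hc.le (by omega), ?_⟩
      have hU := hAx.sort_shape _ _ hax
      obtain ⟨S, l⟩ := U
      subst hU
      rw [← vals_var]
      refine .sSub hax hc.1 hc.2 fun p hp => ?_
      rw [ssubst_id]; exact hc.var_mem hp
    | @tA X u U hax h hv =>
      have hc : CtxR Ax n X := (ih _ h).1
      refine ⟨hc.le (by omega), ?_⟩
      obtain ⟨t, rfl⟩ := hAx.term_shape _ _ _ hax
      rw [← vals_var]
      conv => congr; rfl; rfl; arg 3; rw [← ssubst_id U]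
      refine .tSub hax hc.1 hc.2 (ih _ h).2 (by rw [ssubst_id]; exact (ih _ h).2)
        fun p hp => ?_
      rw [ssubst_id]; exact hc.var_mem hp
    | @seqA X U U' hax h1 h2 =>
      have hc : CtxR Ax n X := (ih _ h1).1
      refine ⟨hc.le (by omega), ?_⟩
      have := R.seqSub (φ := Expr.var) (Y := X) hax hc.1 hc.2 (ih _ h1).2 (ih _ h2).2
      simp only [ssubst_id] at this
      exact this (ih _ h1).2 (ih _ h2).2 fun p hp => hc.var_mem hp
    | @teqA X u u' U hax h1 h2 =>
      have hc : CtxR Ax n X := (ih _ h1).1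
      refine ⟨hc.le (by omega), ?_⟩
      have := R.teqSub (φ := Expr.var) (Y := X) hax hc.1 hc.2 (ih _ h1).2 (ih _ h2).2
      simp only [ssubst_id, subst_id] at this
      exact this (ih _ h1).2 (ih _ h2).2 fun p hp => hc.var_mem hp
    | @sSub X S hax Y hY f hlen hJ hYc hargs =>
      have hc : CtxR Ax n X := (ih _ hJ).1
      obtain ⟨φ, rfl, hφ⟩ := args_of_list hc.isPreCtx hc.1 hlen hargs
      exact ⟨CtxR.le (Nat.le_succ n) (ih _ hYc),
        .sSub hax hc.1 hc.2 fun p hp => (ih _ (hφ p hp)).2⟩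
    | @tSub X t U hax Y hY f hlen hJ hU hargs =>
      have hc : CtxR Ax n X := (ih _ hJ).1
      have hs := (ih _ hJ).2.sort_of_term
      obtain ⟨φ, rfl, hφ⟩ := args_of_list hc.isPreCtx hc.1 hlen hargs
      rw [substL_vals φ fun x => hs.scope_sort] at hU ⊢
      exact ⟨(ih _ hU).1.le (by omega),
        .tSub hax hc.1 hc.2 hs (ih _ hU).2 fun p hp => (ih _ (hφ p hp)).2⟩
    | @seqSub1 X U U' hax Y hY f hlen hJ h1 h2 hargs =>
      have hc : CtxR Ax n X := (ih _ hJ).1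
      have hs := (ih _ hJ).2.left_sort
      have hs' := (ih _ hJ).2.right_sort
      obtain ⟨φ, rfl, hφ⟩ := args_of_list hc.isPreCtx hc.1 hlen hargs
      rw [substL_vals φ fun x => hs.scope_sort, substL_vals φ fun x => hs'.scope_sort] at *
      exact ⟨(ih _ h1).1.le (by omega),
        .seqSub hax hc.1 hc.2 hs hs' (ih _ h1).2 (ih _ h2).2 fun p hp => (ih _ (hφ p hp)).2⟩
    | @seqSub2 X S hax Y hY f g hlf hlg hJ h1 h2 hargs =>
      have hc : CtxR Ax n X := (ih _ hJ).1
      obtain ⟨φ, ψ, rfl, rfl, hφ⟩ := argsEq_of_list hc.isPreCtx hc.1 hlf hlg hargs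
      exact ⟨(ih _ h1).1.le (by omega),
        .seqCong hax hc.1 hc.2 (ih _ h1).2 (ih _ h2).2 fun p hp => (ih _ (hφ p hp)).2⟩
    | @teqSub1 X u u' U hax Y hY f hlen hJ h1 h2 hargs =>
      have hc : CtxR Ax n X := (ih _ hJ).1
      have hs := (ih _ hJ).2.left_term
      have hs' := (ih _ hJ).2.right_term
      have hs'' := hs.sort_of_term
      obtain ⟨φ, rfl, hφ⟩ := args_of_list hc.isPreCtx hc.1 hlen hargs
      rw [esubstL_vals φ fun x => hs.scope_term, substL_vals φ fun x => hs''.scope_sort] at h1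
      rw [esubstL_vals φ fun x => hs'.scope_term, substL_vals φ fun x => hs''.scope_sort] at h2
      rw [esubstL_vals φ fun x => hs.scope_term, substL_vals φ fun x => hs''.scope_sort,
        esubstL_vals φ fun x => hs'.scope_term]
      exact ⟨(ih _ h1).1.le (by omega),
        .teqSub hax hc.1 hc.2 hs hs' (ih _ h1).2 (ih _ h2).2 fun p hp => (ih _ (hφ p hp)).2⟩
    | @teqSub2 X t U hax Y hY f g hlf hlg hJ h1 h2 hargs =>
      have hc : CtxR Ax n X := (ih _ hJ).1
      have hs := (ih _ hJ).2.sort_of_term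
      obtain ⟨φ, ψ, rfl, rfl, hφ⟩ := argsEq_of_list hc.isPreCtx hc.1 hlf hlg hargs
      rw [substL_vals φ fun x => hs.scope_sort] at h1 h2 ⊢
      exact ⟨(ih _ h1).1.le (by omega),
        .teqCong hax hc.1 hc.2 hs (ih _ h1).2 (ih _ h2).2 fun p hp => (ih _ (hφ p hp)).2⟩

theorem DerAt.le {n m : ℕ} (h : n ≤ m) {J : Judg A} (hJ : DerAt Ax n J) : DerAt Ax m J := by
  induction h with
  | refl => exact hJ
  | step _ ih => exact .inl ih

/-- A finite family of stages has a common bound. -/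
theorem exists_bound {ι : Type} (l : List ι) (P : ι → ℕ → Prop)
    (hP : ∀ i n m, n ≤ m → P i n → P i m) (h : ∀ i ∈ l, ∃ n, P i n) :
    ∃ n, ∀ i ∈ l, P i n := by
  induction l with
  | nil => exact ⟨0, by simp⟩
  | cons a l ih =>
    obtain ⟨n, hn⟩ := ih fun i hi => h i (by simp [hi])
    obtain ⟨m, hm⟩ := h a (by simp)
    refine ⟨max n m, fun i hi => ?_⟩
    rcases List.mem_cons.1 hi with rfl | hi
    · exact hP _ _ _ (le_max_right _ _) hm
    · exact hP _ _ _ (le_max_left _ _) (hn i hi)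

end

section

variable {A B : Alphabet} {Ax : Set (Judg A)}

theorem derivable_args {m : ℕ} {J : ∀ i, i < m → Judg A}
    (h : ∀ i (hi : i < m), Derivable Ax (J i hi)) :
    ∃ n, ∀ i (hi : i < m), DerAt Ax n (J i hi) := by
  obtain ⟨n, hn⟩ := exists_bound (List.finRange m) (fun i n => DerAt Ax n (J i.1 i.2))
    (fun i n m hnm => DerAt.le hnm) fun i _ => h i.1 i.2
  exact ⟨n, fun i hi => hn ⟨i, hi⟩ (List.mem_finRange _)⟩

theorem Derivable.ax_step {J K1 K2 K3 : Judg A} {m : ℕ} {L : ∀ i, i < m → Judg A}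
    (h : ∀ D : Judg A → Prop, D K1 → D K2 → D K3 → (∀ i (hi : i < m), D (L i hi)) →
      Step Ax D J)
    (h1 : Derivable Ax K1) (h2 : Derivable Ax K2) (h3 : Derivable Ax K3)
    (h4 : ∀ i (hi : i < m), Derivable Ax (L i hi)) : Derivable Ax J := by
  obtain ⟨n1, h1⟩ := h1
  obtain ⟨n2, h2⟩ := h2
  obtain ⟨n3, h3⟩ := h3
  obtain ⟨n4, h4⟩ := derivable_args h4
  refine ⟨max (max n1 n2) (max n3 n4) + 1, .inr (h _ ?_ ?_ ?_ ?_)⟩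
  · exact h1.le (by omega)
  · exact h2.le (by omega)
  · exact h3.le (by omega)
  · exact fun i hi => (h4 i hi).le (by omega)

theorem Derivable.step1 {J K1 : Judg A}
    (h : ∀ D : Judg A → Prop, D K1 → Step Ax D J) (h1 : Derivable Ax K1) :
    Derivable Ax J := by
  obtain ⟨n1, h1⟩ := h1
  exact ⟨n1 + 1, .inr (h _ h1)⟩

theorem Derivable.step2 {J K1 K2 : Judg A}
    (h : ∀ D : Judg A → Prop, D K1 → D K2 → Step Ax D J) (h1 : Derivable Ax K1)
    (h2 : Derivable Ax K2) : Derivable Ax J := by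
  obtain ⟨n1, h1⟩ := h1
  obtain ⟨n2, h2⟩ := h2
  exact ⟨max n1 n2 + 1, .inr (h _ (h1.le (by omega)) (h2.le (by omega)))⟩

theorem Derivable.isPreCtx {X : PreCtx A} (h : Derivable Ax (.ctx X)) : IsPreCtx X := by
  obtain ⟨n, h⟩ := h
  induction n with
  | zero => exact h.elim
  | succ n ih =>
    rcases h with h | h
    · exact ih h
    · cases h with
      | ctx_nil => intro i hi; simp at hi
      | ctx_cons _ _ h => exact h

theorem derivable_ctx {X : PreCtx A} (hnd : (X.map Prod.fst).Nodup) (hX : IsPreCtx X)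
    (h : ∀ pre z post, X = pre ++ z :: post → Derivable Ax (.ctx pre) →
      Derivable Ax (.sort pre z.2)) : Derivable Ax (.ctx X) := by
  induction X using List.reverseRecOn with
  | nil => exact ⟨1, .inr .ctx_nil⟩
  | append_singleton X p ih =>
    have hX' : IsPreCtx X := by
      intro i hi v hv
      have := hX i (by simp; omega) v (by simpa [List.getElem_append, hi] using hv)
      rwa [List.take_append_of_le_length (by omega)] at this
    rw [List.map_append, List.nodup_append] at hnd
    have hc := ih hnd.1 hX' fun pre z post e => h pre z (post ++ [p]) (by simp [e])
    have hs := h X p [] rfl hc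
    refine Derivable.step1 (fun D hD => .ctx_cons hD ?_ hX) hs
    intro q hq e
    exact hnd.2.2 q.1 (List.mem_map.2 ⟨q, hq, rfl⟩) p.1 (by simp) e

theorem R.derivable {n : ℕ} {J : Judg A} (h : R Ax n J) {Y : PreCtx A}
    (hs : J.ctxOf ⊆ Y) (hY : Derivable Ax (.ctx Y)) : Derivable Ax (J.reCtx Y) := by
  have key : ∀ (Xa : PreCtx A) (n : ℕ), (Xa.map Prod.fst).Nodup →
      (∀ pre z post, Xa = pre ++ z :: post → R Ax n (.sort pre z.2)) →
      (∀ pre z post, Xa = pre ++ z :: post → ∀ {Y : PreCtx A},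
        pre ⊆ Y → Derivable Ax (.ctx Y) → Derivable Ax (.sort Y z.2)) →
      IsPreCtx Xa ∧ Derivable Ax (.ctx Xa) ∧ ∀ i (hi : i < Xa.length),
        Derivable Ax (.term Xa (.var (Xa[i]'hi).1) (Xa[i]'hi).2) := by
    intro Xa n hnd hctx ih
    have hp : IsPreCtx Xa := CtxR.isPreCtx ⟨hnd, hctx⟩
    have hc : Derivable Ax (.ctx Xa) :=
      derivable_ctx hnd hp fun pre z post e hpre => ih pre z post e (fun _ h => h) hpre
    refine ⟨hp, hc, fun i hi => ?_⟩
    refine Derivable.step1 (fun D hD => .var hi hD) ?_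
    exact ih _ _ _ (mem_take_fst_of_split hi) (List.take_subset _ _) hc
  induction h generalizing Y with
  | mono h ih => exact ih hs hY
  | srefl h ih => exact (ih hs hY).step1 fun D h => .s1 h
  | ssymm h ih => exact (ih hs hY).step1 fun D h => .s2 h
  | strans h1 h2 ih1 ih2 => exact (ih1 hs hY).step2 (fun D h h' => .s3 h h') (ih2 hs hY)
  | trefl h ih => exact (ih hs hY).step1 fun D h => .t1 h
  | tsymm h ih => exact (ih hs hY).step1 fun D h => .t2 h
  | ttrans h1 h2 ih1 ih2 => exact (ih1 hs hY).step2 (fun D h h' => .t3 h h') (ih2 hs hY)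
  | conv h1 h2 ih1 ih2 => exact (ih1 hs hY).step2 (fun D h h' => .seqt h h') (ih2 hs hY)
  | @conveq n X u v U V h1 h2 h3 h4 ih1 ih2 ih3 ih4 =>
    have e1 : Derivable Ax (.sortEq Y U V) := ih1 hs hY
    have e2 : Derivable Ax (.termEq Y u v U) := ih2 hs hY
    have e3 : ∀ w, Derivable Ax (.term Y w U) → Derivable Ax (.term Y w V) :=
      fun w hw => e1.step2 (fun D h h' => .seqt h h') hw
    exact Derivable.ax_step (m := 1) (L := fun _ _ => .termEq Y u v U)
        (fun D h1 h2 h3 h4 => .seqteq h1 (h4 0 (by omega)) h2 h3) e1 (e3 u (ih3 hs hY))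
      (e3 v (ih4 hs hY)) fun _ _ => e2
  | var hx h ih =>
    obtain ⟨i, hi, e⟩ := List.getElem_of_mem (hs hx)
    have h1 : Derivable Ax (.term Y (.var Y[i].1) Y[i].2) :=
      Derivable.step1 (fun D hD => .var hi hD) (by rw [e]; exact ih hs hY)
    rw [e] at h1; exact h1
  | @sSub n Xa S Y' φ hax hnd hctx hargs ih1 ih2 =>
    obtain ⟨hp, hc, hv⟩ := key Xa _ hnd hctx ih1
    have hJ : Derivable Ax (introSort Xa S) :=
      Derivable.ax_step (K2 := .ctx Xa) (K3 := .ctx Xa)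
        (fun D h1 _ _ h4 => .sA hax h1 h4) hc hc hc hv
    refine Derivable.ax_step
          (L := fun i hi => .term Y ((vals φ Xa)[i]'(by simpa [vals] using hi)) (subPre Xa (vals φ Xa) i hi))
          (fun D h1 h2 _ h4 => .sSub hax hY.isPreCtx (by simp [vals]) h1 h2
      fun i hi hif => h4 i hi) hJ hY hY ?_
    intro i hi
    rw [subPre_vals hp]
    simpa [vals, Judg.reCtx] using ih2 _ (List.getElem_mem hi) hs hY
  | @tSub n Xa t U Y' φ hax hnd hctx hU hUφ hargs ih1 ih2 ih3 ih4 =>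
    obtain ⟨hp, hc, hv⟩ := key Xa _ hnd hctx ih1
    have hJ : Derivable Ax (introTerm Xa t U) :=
      Derivable.ax_step (K2 := .ctx Xa) (K3 := .ctx Xa)
        (fun D h1 _ _ h4 => .tA hax h1 h4) (ih2 (fun _ h => h) hc) hc hc hv
    have e1 := substL_vals φ fun x => hU.scope_sort
    have : Derivable Ax (.term Y (.app t (vals φ Xa)) (U.substL (mkSub Xa (vals φ Xa)))) := by
      refine Derivable.ax_step
          (L := fun i hi => .term Y ((vals φ Xa)[i]'(by simpa [vals] using hi)) (subPre Xa (vals φ Xa) i hi))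
          (fun D h1 h2 _ h4 => .tSub hax hY.isPreCtx (by simp [vals]) h1 h2
        fun i hi hif => h4 i hi) hJ (by rw [e1]; exact ih3 hs hY) hY ?_
      intro i hi
      rw [subPre_vals hp]
      simpa [vals, Judg.reCtx] using ih4 _ (List.getElem_mem hi) hs hY
    rw [e1] at this; exact this
  | @seqSub n Xa U U' Y' φ hax hnd hctx hU hU' h1 h2 hargs ih1 ih2 ih3 ih4 ih5 ih6 =>
    obtain ⟨hp, hc, hv⟩ := key Xa _ hnd hctx ih1
    have hJ : Derivable Ax (.sortEq Xa U U') :=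
      (ih2 (fun _ h => h) hc).step2 (fun D h1 h2 => .seqA hax h1 h2) (ih3 (fun _ h => h) hc)
    have e1 := substL_vals φ fun x => hU.scope_sort
    have e2 := substL_vals φ fun x => hU'.scope_sort
    have : Derivable Ax (.sortEq Y (U.substL (mkSub Xa (vals φ Xa)))
        (U'.substL (mkSub Xa (vals φ Xa)))) := by
      refine Derivable.ax_step
          (L := fun i hi => .term Y ((vals φ Xa)[i]'(by simpa [vals] using hi)) (subPre Xa (vals φ Xa) i hi))
          (fun D h1 h2 h3 h4 => .seqSub1 hax hY.isPreCtx (by simp [vals])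
        h1 h2 h3 fun i hi hif => h4 i hi) hJ (by rw [e1]; exact ih4 hs hY)
        (by rw [e2]; exact ih5 hs hY) ?_
      intro i hi
      rw [subPre_vals hp]
      simpa [vals, Judg.reCtx] using ih6 _ (List.getElem_mem hi) hs hY
    rw [e1, e2] at this; exact this
  | @seqCong n Xa S Y' φ ψ hax hnd hctx h1 h2 hargs ih1 ih2 ih3 ih4 =>
    obtain ⟨hp, hc, hv⟩ := key Xa _ hnd hctx ih1
    have hJ : Derivable Ax (introSort Xa S) :=
      Derivable.ax_step (K2 := .ctx Xa) (K3 := .ctx Xa)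
        (fun D h1 _ _ h4 => .sA hax h1 h4) hc hc hc hv
    refine Derivable.ax_step
          (L := fun i hi => .termEq Y ((vals φ Xa)[i]'(by simpa [vals] using hi)) ((vals ψ Xa)[i]'(by simpa [vals] using hi)) (subPre Xa (vals φ Xa) i hi))
          (fun D h1 h2 h3 h4 => .seqSub2 hax hY.isPreCtx (by simp [vals])
      (by simp [vals]) h1 h2 h3 fun i hi hif hig => h4 i hi) hJ (ih2 hs hY) (ih3 hs hY) ?_
    intro i hi
    rw [subPre_vals hp]
    simpa [vals, Judg.reCtx] using ih4 _ (List.getElem_mem hi) hs hY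
  | @teqSub n Xa u u' U Y' φ hax hnd hctx hu hu' h1 h2 hargs ih1 ih2 ih3 ih4 ih5 ih6 =>
    obtain ⟨hp, hc, hv⟩ := key Xa _ hnd hctx ih1
    have hJ : Derivable Ax (.termEq Xa u u' U) :=
      (ih2 (fun _ h => h) hc).step2 (fun D h1 h2 => .teqA hax h1 h2) (ih3 (fun _ h => h) hc)
    have e0 := substL_vals φ fun x => hu.sort_of_term.scope_sort
    have e1 := esubstL_vals φ fun x => hu.scope_term
    have e2 := esubstL_vals φ fun x => hu'.scope_term
    have : Derivable Ax (.termEq Y (u.substL (mkSub Xa (vals φ Xa)))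
        (u'.substL (mkSub Xa (vals φ Xa))) (U.substL (mkSub Xa (vals φ Xa)))) := by
      refine Derivable.ax_step
          (L := fun i hi => .term Y ((vals φ Xa)[i]'(by simpa [vals] using hi)) (subPre Xa (vals φ Xa) i hi))
          (fun D h1 h2 h3 h4 => .teqSub1 hax hY.isPreCtx (by simp [vals])
        h1 h2 h3 fun i hi hif => h4 i hi) hJ (by rw [e0, e1]; exact ih4 hs hY)
        (by rw [e0, e2]; exact ih5 hs hY) ?_
      intro i hi
      rw [subPre_vals hp]
      simpa [vals, Judg.reCtx] using ih6 _ (List.getElem_mem hi) hs hY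
    rw [e0, e1, e2] at this; exact this
  | @teqCong n Xa t U Y' φ ψ hax hnd hctx hU h1 h2 hargs ih1 ih2 ih3 ih4 ih5 =>
    obtain ⟨hp, hc, hv⟩ := key Xa _ hnd hctx ih1
    have hJ : Derivable Ax (introTerm Xa t U) :=
      Derivable.ax_step (K2 := .ctx Xa) (K3 := .ctx Xa)
        (fun D h1 _ _ h4 => .tA hax h1 h4) (ih2 (fun _ h => h) hc) hc hc hv
    have e1 := substL_vals φ fun x => hU.scope_sort
    have : Derivable Ax (.termEq Y (.app t (vals φ Xa)) (.app t (vals ψ Xa))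
        (U.substL (mkSub Xa (vals φ Xa)))) := by
      refine Derivable.ax_step
          (L := fun i hi => .termEq Y ((vals φ Xa)[i]'(by simpa [vals] using hi)) ((vals ψ Xa)[i]'(by simpa [vals] using hi)) (subPre Xa (vals φ Xa) i hi))
          (fun D h1 h2 h3 h4 => .teqSub2 hax hY.isPreCtx (by simp [vals])
        (by simp [vals]) h1 h2 h3 fun i hi hif hig => h4 i hi) hJ
        (by rw [e1]; exact ih3 hs hY) (by rw [e1]; exact ih4 hs hY) ?_
      intro i hi
      rw [subPre_vals hp]
      simpa [vals, Judg.reCtx] using ih5 _ (List.getElem_mem hi) hs hY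
    rw [e1] at this; exact this

end

section

variable {A B : Alphabet} {Ax : Set (Judg A)}

/-! ### Ungraded derivability -/

/-- Ungraded derivability in the graded system. -/
def Dv (Ax : Set (Judg A)) (J : Judg A) : Prop := ∃ n, R Ax n J

/-- Ungraded validity of contexts. -/
def CtxD (Ax : Set (Judg A)) (X : PreCtx A) : Prop := ∃ n, CtxR Ax n X

theorem R.dv {n : ℕ} {J : Judg A} (h : R Ax n J) : Dv Ax J := ⟨n, h⟩

theorem dv_args {X : PreCtx A} {F : A.Var × SortE A → Judg A}
    (h : ∀ p ∈ X, Dv Ax (F p)) : ∃ n, ∀ p ∈ X, R Ax n (F p) :=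
  exists_bound X (fun p n => R Ax n (F p)) (fun _ _ _ hnm => R.le hnm) h

theorem ctxD_of {X : PreCtx A} (hnd : (X.map Prod.fst).Nodup)
    (h : ∀ pre z post, X = pre ++ z :: post → Dv Ax (.sort pre z.2)) : CtxD Ax X := by
  induction X using List.reverseRecOn with
  | nil => exact ⟨0, hnd, fun pre z post e => by simp at e⟩
  | append_singleton X p ih =>
    rw [List.map_append, List.nodup_append] at hnd
    obtain ⟨n, hn⟩ := ih hnd.1 fun pre z post e => h pre z (post ++ [p]) (by simp [e])
    obtain ⟨m, hm⟩ := h X p [] rfl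
    refine ⟨max n m, (hn.le (by omega)).snoc (fun q hq e => ?_) (hm.le (by omega))⟩
    exact hnd.2.2 q.1 (List.mem_map.2 ⟨q, hq, rfl⟩) p.1 (by simp) e

section rules
variable {X Y Xa : PreCtx A} {u v w : Expr A} {U V W : SortE A} {φ ψ : A.Var → Expr A}

theorem Dv.srefl (h : Dv Ax (.sort X U)) : Dv Ax (.sortEq X U U) :=
  let ⟨_, h⟩ := h; ⟨_, .srefl h⟩
theorem Dv.ssymm (h : Dv Ax (.sortEq X U V)) : Dv Ax (.sortEq X V U) :=
  let ⟨_, h⟩ := h; ⟨_, .ssymm h⟩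
theorem Dv.strans (h : Dv Ax (.sortEq X U V)) (h' : Dv Ax (.sortEq X V W)) :
    Dv Ax (.sortEq X U W) :=
  let ⟨n, h⟩ := h; let ⟨m, h'⟩ := h'
  ⟨max n m, .strans (h.le (by omega)) (h'.le (by omega))⟩
theorem Dv.trefl (h : Dv Ax (.term X u U)) : Dv Ax (.termEq X u u U) :=
  let ⟨_, h⟩ := h; ⟨_, .trefl h⟩
theorem Dv.tsymm (h : Dv Ax (.termEq X u v U)) : Dv Ax (.termEq X v u U) :=
  let ⟨_, h⟩ := h; ⟨_, .tsymm h⟩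
theorem Dv.ttrans (h : Dv Ax (.termEq X u v U)) (h' : Dv Ax (.termEq X v w U)) :
    Dv Ax (.termEq X u w U) :=
  let ⟨n, h⟩ := h; let ⟨m, h'⟩ := h'
  ⟨max n m, .ttrans (h.le (by omega)) (h'.le (by omega))⟩
theorem Dv.conv (h : Dv Ax (.sortEq X U V)) (h' : Dv Ax (.term X u U)) :
    Dv Ax (.term X u V) :=
  let ⟨n, h⟩ := h; let ⟨m, h'⟩ := h'
  ⟨max n m + 1, .conv (h.le (by omega)) (h'.le (by omega))⟩
theorem Dv.left_term (h : Dv Ax (.termEq X u v U)) : Dv Ax (.term X u U) :=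
  let ⟨_, h⟩ := h; ⟨_, h.left_term⟩
theorem Dv.right_term (h : Dv Ax (.termEq X u v U)) : Dv Ax (.term X v U) :=
  let ⟨_, h⟩ := h; ⟨_, h.right_term⟩
theorem Dv.left_sort (h : Dv Ax (.sortEq X U V)) : Dv Ax (.sort X U) :=
  let ⟨_, h⟩ := h; ⟨_, h.left_sort⟩
theorem Dv.sort_of_term (h : Dv Ax (.term X u U)) : Dv Ax (.sort X U) :=
  let ⟨_, h⟩ := h; ⟨_, h.sort_of_term⟩
theorem Dv.conveq (h : Dv Ax (.sortEq X U V)) (h' : Dv Ax (.termEq X u v U)) :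
    Dv Ax (.termEq X u v V) :=
  let ⟨n, h⟩ := h; let ⟨m, h'⟩ := h'
  ⟨max n m + 1, .conveq (h.le (by omega)) (h'.le (by omega)) (h'.left_term.le (by omega))
    (h'.right_term.le (by omega))⟩
theorem Dv.var {x : A.Var} (hx : (x, U) ∈ X) (h : Dv Ax (.sort X U)) :
    Dv Ax (.term X (.var x) U) :=
  let ⟨_, h⟩ := h; ⟨_, .var hx h⟩

theorem Dv.sSub {S : A.SortSym} (hax : introSort Xa S ∈ Ax) (hX : CtxD Ax Xa)
    (hargs : ∀ p ∈ Xa, Dv Ax (.term Y (φ p.1) (p.2.subst φ))) :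
    Dv Ax (.sort Y ⟨S, vals φ Xa⟩) := by
  obtain ⟨n, hX⟩ := hX
  obtain ⟨m, h⟩ := dv_args hargs
  exact ⟨max n m + 1, .sSub hax hX.1 (hX.le (by omega)).2 fun p hp => (h p hp).le (by omega)⟩

theorem Dv.tSub {t : A.TermSym} (hax : introTerm Xa t U ∈ Ax) (hX : CtxD Ax Xa)
    (hU : Dv Ax (.sort Xa U)) (hUφ : Dv Ax (.sort Y (U.subst φ)))
    (hargs : ∀ p ∈ Xa, Dv Ax (.term Y (φ p.1) (p.2.subst φ))) :
    Dv Ax (.term Y (.app t (vals φ Xa)) (U.subst φ)) := by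
  obtain ⟨n, hX⟩ := hX
  obtain ⟨m, h⟩ := dv_args hargs
  obtain ⟨a, hU⟩ := hU
  obtain ⟨b, hUφ⟩ := hUφ
  exact ⟨max (max n m) (max a b) + 1, .tSub hax hX.1 (hX.le (by omega)).2 (hU.le (by omega))
    (hUφ.le (by omega)) fun p hp => (h p hp).le (by omega)⟩

theorem Dv.seqSub (hax : Judg.sortEq Xa U V ∈ Ax) (hX : CtxD Ax Xa)
    (hU : Dv Ax (.sort Xa U)) (hV : Dv Ax (.sort Xa V))
    (h1 : Dv Ax (.sort Y (U.subst φ))) (h2 : Dv Ax (.sort Y (V.subst φ)))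
    (hargs : ∀ p ∈ Xa, Dv Ax (.term Y (φ p.1) (p.2.subst φ))) :
    Dv Ax (.sortEq Y (U.subst φ) (V.subst φ)) := by
  obtain ⟨n, hX⟩ := hX
  obtain ⟨m, h⟩ := dv_args hargs
  obtain ⟨a, hU⟩ := hU
  obtain ⟨b, hV⟩ := hV
  obtain ⟨c, h1⟩ := h1
  obtain ⟨d, h2⟩ := h2
  exact ⟨max (max (max n m) (max a b)) (max c d) + 1, .seqSub hax hX.1 (hX.le (by omega)).2
    (hU.le (by omega)) (hV.le (by omega)) (h1.le (by omega)) (h2.le (by omega))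
    fun p hp => (h p hp).le (by omega)⟩

theorem Dv.seqCong {S : A.SortSym} (hax : introSort Xa S ∈ Ax) (hX : CtxD Ax Xa)
    (h1 : Dv Ax (.sort Y ⟨S, vals φ Xa⟩)) (h2 : Dv Ax (.sort Y ⟨S, vals ψ Xa⟩))
    (hargs : ∀ p ∈ Xa, Dv Ax (.termEq Y (φ p.1) (ψ p.1) (p.2.subst φ))) :
    Dv Ax (.sortEq Y ⟨S, vals φ Xa⟩ ⟨S, vals ψ Xa⟩) := by
  obtain ⟨n, hX⟩ := hX
  obtain ⟨m, h⟩ := dv_args hargs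
  obtain ⟨c, h1⟩ := h1
  obtain ⟨d, h2⟩ := h2
  exact ⟨max (max n m) (max c d) + 1, .seqCong hax hX.1 (hX.le (by omega)).2
    (h1.le (by omega)) (h2.le (by omega)) fun p hp => (h p hp).le (by omega)⟩

theorem Dv.teqSub (hax : Judg.termEq Xa u v U ∈ Ax) (hX : CtxD Ax Xa)
    (hu : Dv Ax (.term Xa u U)) (hv : Dv Ax (.term Xa v U))
    (h1 : Dv Ax (.term Y (u.subst φ) (U.subst φ)))
    (h2 : Dv Ax (.term Y (v.subst φ) (U.subst φ)))
    (hargs : ∀ p ∈ Xa, Dv Ax (.term Y (φ p.1) (p.2.subst φ))) :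
    Dv Ax (.termEq Y (u.subst φ) (v.subst φ) (U.subst φ)) := by
  obtain ⟨n, hX⟩ := hX
  obtain ⟨m, h⟩ := dv_args hargs
  obtain ⟨a, hu⟩ := hu
  obtain ⟨b, hv⟩ := hv
  obtain ⟨c, h1⟩ := h1
  obtain ⟨d, h2⟩ := h2
  exact ⟨max (max (max n m) (max a b)) (max c d) + 1, .teqSub hax hX.1 (hX.le (by omega)).2
    (hu.le (by omega)) (hv.le (by omega)) (h1.le (by omega)) (h2.le (by omega))
    fun p hp => (h p hp).le (by omega)⟩

theorem Dv.teqCong {t : A.TermSym} (hax : introTerm Xa t U ∈ Ax) (hX : CtxD Ax Xa)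
    (hU : Dv Ax (.sort Xa U))
    (h1 : Dv Ax (.term Y (.app t (vals φ Xa)) (U.subst φ)))
    (h2 : Dv Ax (.term Y (.app t (vals ψ Xa)) (U.subst φ)))
    (hargs : ∀ p ∈ Xa, Dv Ax (.termEq Y (φ p.1) (ψ p.1) (p.2.subst φ))) :
    Dv Ax (.termEq Y (.app t (vals φ Xa)) (.app t (vals ψ Xa)) (U.subst φ)) := by
  obtain ⟨n, hX⟩ := hX
  obtain ⟨m, h⟩ := dv_args hargs
  obtain ⟨a, hU⟩ := hU
  obtain ⟨c, h1⟩ := h1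
  obtain ⟨d, h2⟩ := h2
  exact ⟨max (max (max n m) a) (max c d) + 1, .teqCong hax hX.1 (hX.le (by omega)).2
    (hU.le (by omega)) (h1.le (by omega)) (h2.le (by omega))
    fun p hp => (h p hp).le (by omega)⟩

end rules

/-! ### Substitution and congruence theorems -/

/-- Apply a substitution into the context `Y` to a judgment. -/
def Judg.sub (Y : PreCtx A) (σ : A.Var → Expr A) : Judg A → Judg A
  | .ctx X => .ctx X
  | .sort _ U => .sort Y (U.subst σ)
  | .term _ u U => .term Y (u.subst σ) (U.subst σ)
  | .sortEq _ U V => .sortEq Y (U.subst σ) (V.subst σ)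
  | .termEq _ u v U => .termEq Y (u.subst σ) (v.subst σ) (U.subst σ)

/-- `σ` is a morphism of contexts from `Y` to `X`. -/
def Mor (Ax : Set (Judg A)) (Y X : PreCtx A) (σ : A.Var → Expr A) : Prop :=
  ∀ p ∈ X, Dv Ax (.term Y (σ p.1) (p.2.subst σ))

theorem ssubst_mk (σ φ : A.Var → Expr A) (S : A.SortSym) (X : PreCtx A) :
    (SortE.mk S (vals φ X)).subst σ = ⟨S, vals (fun x => (φ x).subst σ) X⟩ := by
  simp only [SortE.subst, vals_subst]

theorem R.sub {n : ℕ} {J : Judg A} (h : R Ax n J) {Y : PreCtx A} {σ : A.Var → Expr A}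
    (hσ : Mor Ax Y J.ctxOf σ) : Dv Ax (J.sub Y σ) := by
  induction h with
  | mono h ih => exact ih hσ
  | srefl h ih => exact .srefl (ih hσ)
  | ssymm h ih => exact .ssymm (ih hσ)
  | strans h1 h2 ih1 ih2 => exact .strans (ih1 hσ) (ih2 hσ)
  | trefl h ih => exact .trefl (ih hσ)
  | tsymm h ih => exact .tsymm (ih hσ)
  | ttrans h1 h2 ih1 ih2 => exact .ttrans (ih1 hσ) (ih2 hσ)
  | conv h1 h2 ih1 ih2 => exact .conv (ih1 hσ) (ih2 hσ)
  | conveq h1 h2 h3 h4 i1 i2 => exact .conveq (i1 hσ) (i2 hσ)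
  | var hx h ih =>
    simp only [Judg.sub, subst_var]
    exact hσ _ hx
  | sSub hax hnd hctx hargs _ ih =>
    simp only [Judg.sub, ssubst_mk]
    refine .sSub hax ⟨_, hnd, hctx⟩ fun p hp => ?_
    simpa only [Judg.sub, ssubst_ssubst] using ih p hp hσ
  | tSub hax hnd hctx hU hUφ hargs _ _ ih1 ih2 =>
    simp only [Judg.sub, subst_app, vals_subst, ssubst_ssubst]
    refine .tSub hax ⟨_, hnd, hctx⟩ hU.dv ?_ fun p hp => ?_
    · simpa only [Judg.sub, ssubst_ssubst] using ih1 hσ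
    · simpa only [Judg.sub, ssubst_ssubst] using ih2 p hp hσ
  | seqSub hax hnd hctx hU hU' h1 h2 hargs _ _ _ i1 i2 i3 =>
    simp only [Judg.sub, ssubst_ssubst]
    refine .seqSub hax ⟨_, hnd, hctx⟩ hU.dv hU'.dv ?_ ?_ fun p hp => ?_
    · simpa only [Judg.sub, ssubst_ssubst] using i1 hσ
    · simpa only [Judg.sub, ssubst_ssubst] using i2 hσ
    · simpa only [Judg.sub, ssubst_ssubst] using i3 p hp hσ
  | seqCong hax hnd hctx h1 h2 hargs _ i1 i2 i3 =>
    simp only [Judg.sub, ssubst_mk]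
    refine .seqCong hax ⟨_, hnd, hctx⟩ ?_ ?_ fun p hp => ?_
    · simpa only [Judg.sub, ssubst_mk] using i1 hσ
    · simpa only [Judg.sub, ssubst_mk] using i2 hσ
    · simpa only [Judg.sub, ssubst_ssubst] using i3 p hp hσ
  | teqSub hax hnd hctx hu hu' h1 h2 hargs _ _ _ i1 i2 i3 =>
    simp only [Judg.sub, ssubst_ssubst, subst_subst]
    refine .teqSub hax ⟨_, hnd, hctx⟩ hu.dv hu'.dv ?_ ?_ fun p hp => ?_
    · simpa only [Judg.sub, ssubst_ssubst, subst_subst] using i1 hσ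
    · simpa only [Judg.sub, ssubst_ssubst, subst_subst] using i2 hσ
    · simpa only [Judg.sub, ssubst_ssubst] using i3 p hp hσ
  | teqCong hax hnd hctx hU h1 h2 hargs _ _ i1 i2 i3 =>
    simp only [Judg.sub, subst_app, vals_subst, ssubst_ssubst]
    refine .teqCong hax ⟨_, hnd, hctx⟩ hU.dv ?_ ?_ fun p hp => ?_
    · simpa only [Judg.sub, subst_app, vals_subst, ssubst_ssubst] using i1 hσ
    · simpa only [Judg.sub, subst_app, vals_subst, ssubst_ssubst] using i2 hσ
    · simpa only [Judg.sub, ssubst_ssubst] using i3 p hp hσ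

section
variable {X Y Z : PreCtx A} {u v : Expr A} {U V W : SortE A} {σ τ : A.Var → Expr A}

theorem Dv.sub_sort (h : Dv Ax (.sort X U)) (hσ : Mor Ax Y X σ) :
    Dv Ax (.sort Y (U.subst σ)) := let ⟨_, h⟩ := h; h.sub hσ
theorem Dv.sub_term (h : Dv Ax (.term X u U)) (hσ : Mor Ax Y X σ) :
    Dv Ax (.term Y (u.subst σ) (U.subst σ)) := let ⟨_, h⟩ := h; h.sub hσ
theorem Dv.sub_sortEq (h : Dv Ax (.sortEq X U V)) (hσ : Mor Ax Y X σ) :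
    Dv Ax (.sortEq Y (U.subst σ) (V.subst σ)) := let ⟨_, h⟩ := h; h.sub hσ
theorem Dv.sub_termEq (h : Dv Ax (.termEq X u v U)) (hσ : Mor Ax Y X σ) :
    Dv Ax (.termEq Y (u.subst σ) (v.subst σ) (U.subst σ)) := let ⟨_, h⟩ := h; h.sub hσ

/-- Substituting equal morphisms gives equal results. -/
theorem R.sub_congr (hσ : Mor Ax Y X σ) (hτ : Mor Ax Y X τ)
    (he : ∀ p ∈ X, Dv Ax (.termEq Y (σ p.1) (τ p.1) (p.2.subst σ))) : ∀ n : ℕ,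
    (∀ U, R Ax n (.sort X U) → Dv Ax (.sortEq Y (U.subst σ) (U.subst τ))) ∧
    (∀ u U, R Ax n (.term X u U) → Dv Ax (.termEq Y (u.subst σ) (u.subst τ) (U.subst σ))) := by
  intro n
  induction n with
  | zero => exact ⟨fun U h => (not_R_zero h).elim, fun u U h => (not_R_zero h).elim⟩
  | succ n ih =>
    constructor
    · intro U h
      have h1 := h.dv.sub_sort hσ
      have h2 := h.dv.sub_sort hτ
      obtain ⟨k, Xa, φ, e, hax, hX, hU, hargs⟩ := h.sort_inv
      cases e
      rw [hU] at h1 h2 ⊢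
      simp only [ssubst_mk] at h1 h2 ⊢
      refine .seqCong hax ⟨_, hX⟩ h1 h2 fun p hp => ?_
      simpa only [ssubst_ssubst] using ih.2 _ _ (hargs p hp)
    · intro u U h
      obtain ⟨y, rfl, h1, h2⟩ | ⟨k, Xa, t, V, φ, e, rfl, rfl, h3, h4, h5, h6, h7⟩ |
        ⟨k, V, e, h1, h2⟩ := h.term_inv
      · simp only [subst_var]
        exact he _ h1
      · have h1 := h.dv.sub_term hσ
        have h2 := h.dv.sub_term hτ
        cases e
        have h8 := (ih.1 _ h6).ssymm.conv h2
        simp only [subst_app, vals_subst, ssubst_ssubst] at h1 h8 ⊢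
        refine .teqCong h3 ⟨_, h4⟩ h5.dv h1 h8 fun p hp => ?_
        simpa only [ssubst_ssubst] using ih.2 _ _ (h7 p hp)
      · cases e
        exact (h1.dv.sub_sortEq hσ).conveq (ih.2 _ _ h2)

/-! ### Uniqueness of sorts and the untyped equality relation -/

/-- Term symbols have at most one introducing axiom. -/
def TUniq (Ax : Set (Judg A)) : Prop :=
  ∀ t Xa V Xa' V', introTerm Xa t V ∈ Ax → introTerm Xa' t V' ∈ Ax → Xa = Xa' ∧ V = V'

/-- Variables of a context have at most one sort. -/
def Fn (Z : PreCtx A) : Prop := ∀ x U V, (x, U) ∈ Z → (x, V) ∈ Z → U = V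

theorem fn_of_nodup (h : (Z.map Prod.fst).Nodup) : Fn Z := by
  intro x U V h1 h2
  have := List.inj_on_of_nodup_map h h1 h2 rfl
  exact congrArg Prod.snd this

theorem Dv.uniq (hT : TUniq Ax) (hZ : Fn Z) (h : Dv Ax (.term Z u U))
    (h' : Dv Ax (.term Z u V)) : Dv Ax (.sortEq Z U V) := by
  obtain ⟨n, h⟩ := h
  obtain ⟨m, h'⟩ := h'
  cases u with
  | var x =>
    obtain ⟨W, a1, a2, a3⟩ := h.var_inv
    obtain ⟨W', b1, b2, b3⟩ := h'.var_inv
    cases hZ _ _ _ a1 b1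
    exact a3.dv.ssymm.strans b3.dv
  | app t l =>
    obtain ⟨k, Xa, V1, φ, -, rfl, a3, a4, a5, a6, a7, a8⟩ := h.app_inv
    obtain ⟨k', Xb, V2, ψ, -, e, b3, b4, b5, b6, b7, b8⟩ := h'.app_inv
    obtain ⟨rfl, rfl⟩ := hT _ _ _ _ _ a3 b3
    have : V1.subst φ = V1.subst ψ := a5.subst_sort_congr fun x hx => by
      rw [← lookupV_of_vals φ _ _ hx, e, lookupV_of_vals ψ _ _ hx]
    rw [← this] at b8
    exact a8.dv.ssymm.strans b8.dv

/-- Equality of terms at some sort. -/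
def Eqv (Ax : Set (Judg A)) (Z : PreCtx A) (e e' : Expr A) : Prop :=
  ∃ W, Dv Ax (.termEq Z e e' W)

variable {e e' e'' : Expr A}

theorem Dv.eqv (h : Dv Ax (.termEq Z e e' W)) : Eqv Ax Z e e' := ⟨W, h⟩

theorem Dv.eqv_refl (h : Dv Ax (.term Z e W)) : Eqv Ax Z e e := ⟨W, h.trefl⟩

theorem Eqv.symm (h : Eqv Ax Z e e') : Eqv Ax Z e' e := let ⟨W, h⟩ := h; ⟨W, h.tsymm⟩

theorem Eqv.left (h : Eqv Ax Z e e') : ∃ W, Dv Ax (.term Z e W) :=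
  let ⟨W, h⟩ := h; ⟨W, h.left_term⟩

theorem Eqv.atSort (hT : TUniq Ax) (hZ : Fn Z) (h : Eqv Ax Z e e') (he : Dv Ax (.term Z e W)) :
    Dv Ax (.termEq Z e e' W) :=
  let ⟨_, h⟩ := h; (h.left_term.uniq hT hZ he).conveq h

theorem Eqv.typed (hT : TUniq Ax) (hZ : Fn Z) (h : Eqv Ax Z e e') (he : Dv Ax (.term Z e W)) :
    Dv Ax (.term Z e' W) := (h.atSort hT hZ he).right_term

theorem Eqv.trans (hT : TUniq Ax) (hZ : Fn Z) (h : Eqv Ax Z e e') (h' : Eqv Ax Z e' e'') :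
    Eqv Ax Z e e'' :=
  let ⟨_, h⟩ := h; ⟨_, h.ttrans (h'.atSort hT hZ h.right_term)⟩

theorem CtxD.initial {X X' : PreCtx A} (h : CtxD Ax (X ++ X')) : CtxD Ax X :=
  let ⟨n, h⟩ := h; ⟨n, h.initial⟩

theorem Mor.of_eqv (hT : TUniq Ax) (hZ : Fn Y) (hX : CtxD Ax X) (hσ : Mor Ax Y X σ)
    (he : ∀ p ∈ X, Eqv Ax Y (σ p.1) (τ p.1)) : Mor Ax Y X τ := by
  induction X using List.reverseRecOn with
  | nil => exact fun p hp => by simp at hp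
  | append_singleton X q ih =>
    have ih' := ih hX.initial (fun p hp => hσ p (by simp [hp])) fun p hp => he p (by simp [hp])
    intro p hp
    rw [List.mem_append] at hp
    rcases hp with hp | hp
    · exact ih' p hp
    · obtain rfl := List.mem_singleton.1 hp
      obtain ⟨n, hX⟩ := hX
      have h1 := hX.2 X p [] rfl
      have hσ' : Mor Ax Y X σ := fun p hp => hσ p (by simp [hp])
      have := (R.sub_congr hσ' ih' (fun p hp =>
        (he p (by simp [hp])).atSort hT hZ (hσ' p hp)) n).1 _ h1
      exact this.conv ((he p (by simp)).typed hT hZ (hσ p (by simp)))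

theorem exists_vals_of_forall₂ {P : Expr A → Expr A → Prop} {X : PreCtx A}
    (hnd : (X.map Prod.fst).Nodup) {φ : A.Var → Expr A} {l : List (Expr A)}
    (h : List.Forall₂ P (vals φ X) l) :
    ∃ ψ, l = vals ψ X ∧ ∀ p ∈ X, P (φ p.1) (ψ p.1) := by
  have hl : vals (lookupV (mkSub X l)) X = l :=
    lookupV_zip X hnd l (by simpa [vals] using h.length_eq.symm)
  refine ⟨lookupV (mkSub X l), hl.symm, ?_⟩
  generalize lookupV (mkSub X l) = ψ at hl
  subst hl
  simpa [vals, List.forall₂_map_left_iff, List.forall₂_map_right_iff, List.forall₂_same] using h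

theorem Dv.cong_app (hT : TUniq Ax) (hZ : Fn Z) {t : A.TermSym} {l l' : List (Expr A)}
    (h : Dv Ax (.term Z (.app t l) W)) (hl : List.Forall₂ (Eqv Ax Z) l l') :
    Eqv Ax Z (.app t l) (.app t l') := by
  obtain ⟨n, h⟩ := h
  obtain ⟨k, Xa, V, φ, rfl, rfl, h3, h4, h5, h6, h7, h8⟩ := h.app_inv
  obtain ⟨ψ, rfl, hψ⟩ := exists_vals_of_forall₂ h4.1 hl
  have m1 : Mor Ax Z Xa φ := fun p hp => (h7 p hp).dv
  have m2 : Mor Ax Z Xa ψ := m1.of_eqv hT hZ ⟨k, h4⟩ hψ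
  have he : ∀ p ∈ Xa, Dv Ax (.termEq Z (φ p.1) (ψ p.1) (p.2.subst φ)) :=
    fun p hp => (hψ p hp).atSort hT hZ (m1 p hp)
  refine ⟨_, Dv.teqCong h3 ⟨k, h4⟩ h5.dv (Dv.tSub h3 ⟨k, h4⟩ h5.dv h6.dv m1) ?_ he⟩
  exact ((R.sub_congr m1 m2 he k).1 V h5).ssymm.conv
    (Dv.tSub h3 ⟨k, h4⟩ h5.dv (h5.dv.sub_sort m2) m2)

theorem Dv.cong_sort (hT : TUniq Ax) (hZ : Fn Z) {S : A.SortSym} {l l' : List (Expr A)}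
    (h : Dv Ax (.sort Z ⟨S, l⟩)) (hl : List.Forall₂ (Eqv Ax Z) l l') :
    Dv Ax (.sortEq Z ⟨S, l⟩ ⟨S, l'⟩) := by
  obtain ⟨n, h⟩ := h
  obtain ⟨k, Xa, φ, rfl, h3, h4, h5, h6⟩ := h.sort_inv
  cases h5
  obtain ⟨ψ, rfl, hψ⟩ := exists_vals_of_forall₂ h4.1 hl
  have m1 : Mor Ax Z Xa φ := fun p hp => (h6 p hp).dv
  have m2 : Mor Ax Z Xa ψ := m1.of_eqv hT hZ ⟨k, h4⟩ hψ
  exact Dv.seqCong h3 ⟨k, h4⟩ h.dv (Dv.sSub h3 ⟨k, h4⟩ m2)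
    fun p hp => (hψ p hp).atSort hT hZ (m1 p hp)

end

/-! ### Canonical sorts -/

open Classical in
/-- The canonical sort of a term, where `Γ` gives the sorts of variables. -/
noncomputable def cs (Ax : Set (Judg A)) (Γ : A.Var → SortE A) : Expr A → SortE A
  | .var x => Γ x
  | .app t l =>
    if h : ∃ p : PreCtx A × SortE A, introTerm p.1 t p.2 ∈ Ax then
      h.choose.2.subst (lookupV (mkSub h.choose.1 l))
    else Γ (Classical.arbitrary A.Var)

/-- `Γ` extends the context `X`. -/
def Ext (Γ : A.Var → SortE A) (X : PreCtx A) : Prop := ∀ p ∈ X, Γ p.1 = p.2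

theorem cs_app (hT : TUniq Ax) {Γ : A.Var → SortE A} {Xa : PreCtx A} {t : A.TermSym}
    {V : SortE A} (hax : introTerm Xa t V ∈ Ax) (l : List (Expr A)) :
    cs Ax Γ (.app t l) = V.subst (lookupV (mkSub Xa l)) := by
  have h : ∃ p : PreCtx A × SortE A, introTerm p.1 t p.2 ∈ Ax := ⟨(Xa, V), hax⟩
  rw [cs, dif_pos h]
  obtain ⟨e1, e2⟩ := hT _ _ _ _ _ h.choose_spec hax
  rw [e1, e2]

theorem cs_app_vals (hT : TUniq Ax) {Γ : A.Var → SortE A} {Xa : PreCtx A} {t : A.TermSym}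
    {V : SortE A} (hax : introTerm Xa t V ∈ Ax) {n : ℕ} (hV : R Ax n (.sort Xa V))
    (φ : A.Var → Expr A) : cs Ax Γ (.app t (vals φ Xa)) = V.subst φ := by
  rw [cs_app hT hax]
  exact hV.subst_sort_congr fun x hx => lookupV_of_vals _ _ _ hx

theorem R.canon (hT : TUniq Ax) {Γ : A.Var → SortE A} {X : PreCtx A} (hΓ : Ext Γ X) {n : ℕ}
    {u : Expr A} {U : SortE A} (h : R Ax n (.term X u U)) :
    R Ax n (.term X u (cs Ax Γ u)) ∧ R Ax n (.sortEq X (cs Ax Γ u) U) := by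
  cases u with
  | var x =>
    obtain ⟨V, h1, h2, h3⟩ := h.var_inv
    rw [cs, hΓ _ h1]
    exact ⟨.var h1 h2, h3⟩
  | app t l =>
    obtain ⟨k, Xa, V, φ, rfl, rfl, h3, h4, h5, h6, h7, h8⟩ := h.app_inv
    rw [cs_app_vals hT h3 h5]
    exact ⟨.tSub h3 h4.1 h4.2 h5 h6 h7, h8⟩

/-- Canonical sorts of applications commute with substitution. -/
theorem R.cs_subst (hT : TUniq Ax) {Γ Γ' : A.Var → SortE A} {X : PreCtx A} {n : ℕ}
    {t : A.TermSym} {l : List (Expr A)} {U : SortE A} (h : R Ax n (.term X (.app t l) U))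
    (σ : A.Var → Expr A) :
    cs Ax Γ' ((Expr.app t l).subst σ) = (cs Ax Γ (.app t l)).subst σ := by
  obtain ⟨k, Xa, V, φ, rfl, rfl, h3, h4, h5, h6, h7, h8⟩ := h.app_inv
  rw [subst_app, vals_subst, cs_app_vals hT h3 h5, cs_app_vals hT h3 h5, ssubst_ssubst]

theorem IsPretheory.tUniq (h : IsPretheory Ax) : TUniq Ax := by
  intro t Xa V Xa' V' h1 h2
  have := (h.term_intro t).unique (y₁ := (Xa, V)) (y₂ := (Xa', V')) h1 h2
  exact ⟨congrArg Prod.fst this, congrArg Prod.snd this⟩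

end

section

variable {A B : Alphabet} {Ax : Set (Judg A)}

/-! ### Grids -/

section Grid
variable {α β γ δ : Type}

/-- The lexicographically ordered list of the values of `F` on `l1 × l2`. -/
def grid (l1 : List α) (l2 : List β) (F : α → β → γ) : List γ :=
  l1.flatMap fun a => l2.map (F a)

@[simp] theorem grid_nil (l2 : List β) (F : α → β → γ) : grid [] l2 F = [] := rfl

@[simp] theorem grid_cons (a : α) (l1 : List α) (l2 : List β) (F : α → β → γ) :
    grid (a :: l1) l2 F = l2.map (F a) ++ grid l1 l2 F := rfl

@[simp] theorem mem_grid {l1 : List α} {l2 : List β} {F : α → β → γ} {c : γ} :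
    c ∈ grid l1 l2 F ↔ ∃ a ∈ l1, ∃ b ∈ l2, F a b = c := by
  simp [grid]

theorem grid_append (l1 l1' : List α) (l2 : List β) (F : α → β → γ) :
    grid (l1 ++ l1') l2 F = grid l1 l2 F ++ grid l1' l2 F := by
  simp [grid]

theorem map_grid (f : γ → δ) (l1 : List α) (l2 : List β) (F : α → β → γ) :
    (grid l1 l2 F).map f = grid l1 l2 fun a b => f (F a b) := by
  simp [grid, List.map_flatMap, Function.comp_def]

theorem grid_map_left {α' : Type} (f : α' → α) (l1 : List α') (l2 : List β) (F : α → β → γ) :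
    grid (l1.map f) l2 F = grid l1 l2 fun a b => F (f a) b := by
  simp [grid, List.flatMap_map]

theorem grid_map_right {β' : Type} (f : β' → β) (l1 : List α) (l2 : List β') (F : α → β → γ) :
    grid l1 (l2.map f) F = grid l1 l2 fun a b => F a (f b) := by
  simp [grid, Function.comp_def]

theorem grid_congr {l1 : List α} {l2 : List β} {F G : α → β → γ}
    (h : ∀ a ∈ l1, ∀ b ∈ l2, F a b = G a b) : grid l1 l2 F = grid l1 l2 G := by
  induction l1 with
  | nil => rfl
  | cons a l ih =>
    rw [grid_cons, grid_cons, ih fun a ha => h a (by simp [ha]),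
      List.map_congr_left fun b hb => h a (by simp) b hb]

theorem forall₂_grid {P : γ → δ → Prop} {α' β' : Type} {l1 : List α} {l1' : List α'}
    {l2 : List β} {l2' : List β'} {F : α → β → γ} {G : α' → β' → δ}
    {Q : α → α' → Prop} {Q' : β → β' → Prop}
    (h1 : List.Forall₂ Q l1 l1') (h2 : List.Forall₂ Q' l2 l2')
    (h : ∀ a a' b b', a ∈ l1 → a' ∈ l1' → b ∈ l2 → b' ∈ l2' → Q a a' → Q' b b' →
      P (F a b) (G a' b')) :
    List.Forall₂ P (grid l1 l2 F) (grid l1' l2' G) := by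
  induction h1 with
  | nil => simp
  | @cons a a' l l' ha hl ih =>
    rw [grid_cons, grid_cons]
    refine List.rel_append ?_ (ih fun a a' b b' h1 h1' h2 h2' hq hq' =>
      h a a' b b' (by simp [h1]) (by simp [h1']) h2 h2' hq hq')
    rw [List.forall₂_map_left_iff, List.forall₂_map_right_iff]
    clear ih
    induction h2 with
    | nil => simp
    | @cons b b' m m' hb hm ih =>
      refine .cons (h a a' b b' (by simp) (by simp) (by simp) (by simp) ha hb) (ih ?_)
      exact fun a a' b b' h1 h1' h2 h2' hq hq' =>
        h a a' b b' h1 h1' (by simp [h2]) (by simp [h2']) hq hq'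

theorem length_grid (l1 : List α) (l2 : List β) (F : α → β → γ) :
    (grid l1 l2 F).length = l1.length * l2.length := by
  induction l1 with
  | nil => simp
  | cons a l ih => rw [grid_cons, List.length_append, ih, List.length_map, List.length_cons]; ring

theorem grid_getElem? {l1 : List α} {l2 : List β} {F : α → β → γ} :
    ∀ {i j : ℕ} (hi : i < l1.length) (hj : j < l2.length),
      (grid l1 l2 F)[i * l2.length + j]? = some (F l1[i] l2[j]) := by
  induction l1 with
  | nil => intro i j hi; simp at hi
  | cons a l ih =>
    intro i j hi hj
    rw [grid_cons]
    cases i with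
    | zero => simp [List.getElem?_append, hj]
    | succ i =>
      have e : (i + 1) * l2.length + j = l2.length + (i * l2.length + j) := by ring
      rw [e, List.getElem?_append_right (by simp)]
      simpa using ih (by simpa using hi) hj

theorem isGrid_grid {l1 : List α} {l2 : List β} {F : α → β → γ} {M : ℕ → ℕ → γ}
    (h : ∀ i (hi : i < l1.length) j (hj : j < l2.length), M i j = F l1[i] l2[j]) :
    IsGrid l1.length l2.length M (grid l1 l2 F) := by
  refine ⟨length_grid _ _ _, fun i j hi hj hh => ?_⟩
  rw [h i hi j hj, ← Option.some_inj, ← List.getElem?_eq_getElem, grid_getElem? hi hj]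

theorem eq_grid {l1 : List α} {l2 : List β} {F : α → β → γ} {L : List γ}
    (hl : L.length = l1.length * l2.length)
    (h : ∀ i j (hi : i < l1.length) (hj : j < l2.length) (hh : i * l2.length + j < L.length),
      L[i * l2.length + j]'hh = F l1[i] l2[j]) : L = grid l1 l2 F := by
  refine List.ext_getElem (by rw [hl, length_grid]) fun k hk hk' => ?_
  have hn : 0 < l2.length := by
    rcases Nat.eq_zero_or_pos l2.length with h0 | h0
    · rw [hl, h0] at hk; simp at hk
    · exact h0
  have hi : k / l2.length < l1.length := by
    rw [Nat.div_lt_iff_lt_mul hn, ← hl]; exact hk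
  have hj := Nat.mod_lt k hn
  have e : k / l2.length * l2.length + k % l2.length = k := Nat.div_add_mod' k _
  have := h _ _ hi hj (by rw [e]; exact hk)
  simp only [e] at this
  rw [this, ← Option.some_inj, ← List.getElem?_eq_getElem, ← grid_getElem? hi hj, e]

theorem IsGrid.eq {l1 : List α} {l2 : List β} {F : α → β → γ} {M : ℕ → ℕ → γ} {L : List γ}
    (hL : IsGrid l1.length l2.length M L)
    (h : ∀ i (hi : i < l1.length) j (hj : j < l2.length), M i j = F l1[i] l2[j]) :
    L = grid l1 l2 F :=
  eq_grid hL.1 fun i j hi hj hh => by rw [hL.2 i j hi hj hh, h i hi j hj]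

/-- The grid of two nonempty lists, without its last entry. -/
theorem dropLast_grid (l1 : List α) (a : α) (l2 : List β) (b : β) (F : α → β → γ) :
    (grid (l1 ++ [a]) (l2 ++ [b]) F).dropLast = grid l1 (l2 ++ [b]) F ++ l2.map (F a) := by
  rw [grid_append, grid_cons, grid_nil, List.append_nil, List.map_append, ← List.append_assoc,
    List.map_singleton, List.dropLast_concat]

end Grid

end

section

variable {A B : Alphabet} {TA : Set (Judg A)} {TB : Set (Judg B)}

/-! ### The tensor operation as a function -/

/-- Sorts of the variables of the two alphabets. -/
structure TEnv (TA : Set (Judg A)) (TB : Set (Judg B)) where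
  Γ : A.Var → SortE A
  Δ : B.Var → SortE B

/-- The canonical sort of an expression of the first alphabet. -/
noncomputable def TEnv.sA (E : TEnv TA TB) (u : Expr A) : SortE A := cs TA E.Γ u
/-- Approximations of the tensor of two term expressions. -/
noncomputable def tenN (E : TEnv TA TB) : ℕ → Expr A → Expr B → Expr (A.tensor B)
  | 0, _, _ => .var (Classical.arbitrary A.Var, Classical.arbitrary B.Var)
  | k + 1, u, .app t g =>
    .app (Sum.inl ((E.sA u).head, t)) (grid ((E.sA u).args ++ [u]) g (tenN E k))
  | k + 1, .app s f, .var y =>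
    .app (Sum.inr (s, (E.Δ y).head)) (grid f ((E.Δ y).args ++ [.var y]) (tenN E k))
  | _ + 1, .var x, .var y => .var (x, y)

open Classical in
/-- The tensor of two term expressions: the eventual value of the approximations. -/
noncomputable def ten (E : TEnv TA TB) (u : Expr A) (v : Expr B) : Expr (A.tensor B) :=
  if h : ∃ K, ∀ k ≥ K, tenN E k u v = tenN E K u v then tenN E h.choose u v
  else .var (Classical.arbitrary A.Var, Classical.arbitrary B.Var)

theorem ten_eq_of_stable {E : TEnv TA TB} {u : Expr A} {v : Expr B} {K : ℕ}
    (h : ∀ k ≥ K, tenN E k u v = tenN E K u v) : ten E u v = tenN E K u v := by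
  have h' : ∃ K, ∀ k ≥ K, tenN E k u v = tenN E K u v := ⟨K, h⟩
  rw [ten, dif_pos h', ← h'.choose_spec (max h'.choose K) (le_max_left _ _),
    h (max h'.choose K) (le_max_right _ _)]

variable {Ax : Set (Judg A)}

/-- An expression which is a term or an augmented sort over `X`, of rank at most `n`. -/
def Adm (Ax : Set (Judg A)) (Γ : A.Var → SortE A) (n : ℕ) (X : PreCtx A) (u : Expr A) : Prop :=
  (∀ e ∈ (cs Ax Γ u).args, ∃ k < n, ∃ W, R Ax k (.term X e W)) ∧
  ∀ t g, u = .app t g → ∀ e ∈ g, ∃ k < n, ∃ W, R Ax k (.term X e W)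

theorem Adm.le {Γ : A.Var → SortE A} {n n' : ℕ} {X : PreCtx A} {u : Expr A}
    (h : Adm Ax Γ n X u) (hn : n ≤ n') : Adm Ax Γ n' X u :=
  ⟨fun e he => let ⟨k, hk, W⟩ := h.1 e he; ⟨k, hk.trans_le hn, W⟩,
    fun t g hu e he => let ⟨k, hk, W⟩ := h.2 t g hu e he; ⟨k, hk.trans_le hn, W⟩⟩

theorem R.adm (hT : TUniq Ax) {Γ : A.Var → SortE A} {n : ℕ} {X : PreCtx A} {u : Expr A}
    {U : SortE A} (hΓ : Ext Γ X) (h : R Ax n (.term X u U)) : Adm Ax Γ n X u := by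
  refine ⟨fun e he => ?_, ?_⟩
  · obtain ⟨k, W, rfl, hh⟩ := (h.canon hT hΓ).1.sort_of_term.sort_args he
    exact ⟨k, by omega, W, hh⟩
  · rintro t g rfl e he
    obtain ⟨k, W, rfl, hh⟩ := h.app_args he
    exact ⟨k, by omega, W, hh⟩

theorem R.adm_sort {Γ : A.Var → SortE A} {n : ℕ} {X : PreCtx A} {x : A.Var}
    {U : SortE A} (hΓ : Γ x = U) (h : R Ax n (.sort X U)) : Adm Ax Γ n X (.var x) := by
  refine ⟨fun e he => ?_, by simp⟩
  rw [cs, hΓ] at he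
  obtain ⟨k, W, rfl, hh⟩ := h.sort_args he
  exact ⟨k, by omega, W, hh⟩

theorem Adm.pos {Γ : A.Var → SortE A} {n : ℕ} {X : PreCtx A} {t : A.TermSym} {g : List (Expr A)}
    {e : Expr A} (he : e ∈ g) (h : Adm Ax Γ n X (.app t g)) : 0 < n := by
  obtain ⟨k, hk, -⟩ := h.2 t g rfl e he
  omega

theorem R.cs_env {Γ Γ' : A.Var → SortE A} {n : ℕ} {X : PreCtx A} {u : Expr A}
    {U : SortE A} (hΓ : Ext Γ X) (hΓ' : Ext Γ' X) (hT : TUniq Ax) (h : R Ax n (.term X u U)) :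
    cs Ax Γ u = cs Ax Γ' u := by
  cases u with
  | var x =>
    obtain ⟨V, h1, -⟩ := h.var_inv
    rw [cs, cs, hΓ _ h1, hΓ' _ h1]
  | app t l =>
    obtain ⟨k, Xa, V, φ, rfl, rfl, h3, h4, h5, h6, h7, h8⟩ := h.app_inv
    rw [cs_app_vals hT h3 h5, cs_app_vals hT h3 h5]

theorem tenN_indep (hA : TUniq TA) (hB : TUniq TB) {E E' : TEnv TA TB} {X : PreCtx A}
    {Y : PreCtx B} (hX : Ext E.Γ X) (hX' : Ext E'.Γ X) (hY : Ext E.Δ Y) (hY' : Ext E'.Δ Y) :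
    ∀ (s n m : ℕ) (u : Expr A) (v : Expr B), n + m ≤ s → Adm TA E.Γ n X u → Adm TB E.Δ m Y v →
      cs TA E.Γ u = cs TA E'.Γ u → cs TB E.Δ v = cs TB E'.Δ v → ∀ k k', s < k → s < k' →
      tenN E k u v = tenN E' k' u v := by
  intro s
  induction s with
  | zero =>
    intro n m u v hs hu hv eu ev k k' hk hk'
    obtain ⟨k, rfl⟩ := Nat.exists_eq_add_of_lt hk
    obtain ⟨k', rfl⟩ := Nat.exists_eq_add_of_lt hk'
    obtain rfl : n = 0 := by omega
    obtain rfl : m = 0 := by omega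
    cases v with
    | app t g =>
      have : g = [] := by
        cases g with
        | nil => rfl
        | cons e g => exact absurd (hv.pos List.mem_cons_self) (by omega)
      subst this
      simp only [tenN, TEnv.sA, eu]
      simp [grid]
    | var y =>
      cases u with
      | var x => simp [tenN]
      | app t g =>
        have : g = [] := by
          cases g with
          | nil => rfl
          | cons e g => exact absurd (hu.pos List.mem_cons_self) (by omega)
        subst this
        rw [cs, cs] at ev
        simp [tenN, ev]
  | succ s ih =>
    intro n m u v hs hu hv eu ev k k' hk hk'
    obtain ⟨k, rfl⟩ := Nat.exists_eq_add_of_lt hk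
    obtain ⟨k', rfl⟩ := Nat.exists_eq_add_of_lt hk'
    cases v with
    | app t g =>
      simp only [tenN, TEnv.sA, eu]
      congr 1
      refine grid_congr fun a ha b hb => ?_
      obtain ⟨m', hm', W', hb⟩ := hv.2 t g rfl b hb
      rw [List.mem_append, List.mem_singleton] at ha
      rcases ha with ha | rfl
      · rw [← eu] at ha
        obtain ⟨n', hn', W, ha⟩ := hu.1 a ha
        exact ih n' m' a b (by omega) (ha.adm hA hX) (hb.adm hB hY) (ha.cs_env hX hX' hA)
          (hb.cs_env hY hY' hB) _ _ (by omega) (by omega)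
      · exact ih n m' a b (by omega) hu (hb.adm hB hY) eu
          (hb.cs_env hY hY' hB) _ _ (by omega) (by omega)
    | var y =>
      cases u with
      | var x => simp [tenN]
      | app t g =>
        have ev' := ev
        rw [cs, cs] at ev'
        simp only [tenN, ev']
        congr 1
        refine grid_congr fun a ha b hb => ?_
        obtain ⟨n', hn', W', ha⟩ := hu.2 t g rfl a ha
        rw [List.mem_append, List.mem_singleton] at hb
        rcases hb with hb | rfl
        · rw [← ev'] at hb
          obtain ⟨m', hm', W, hb⟩ := hv.1 b hb
          exact ih n' m' a b (by omega) (ha.adm hA hX) (hb.adm hB hY) (ha.cs_env hX hX' hA)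
            (hb.cs_env hY hY' hB) _ _ (by omega) (by omega)
        · exact ih n' m a _ (by omega) (ha.adm hA hX) hv (ha.cs_env hX hX' hA)
            ev _ _ (by omega) (by omega)

/-- The right hand side of the recursive description of `u ⊗ t(g)`, for `u` of sort `U`. -/
noncomputable def Lf (E : TEnv TA TB) (u : Expr A) (U : SortE A) (t : B.TermSym)
    (g : List (Expr B)) : Expr (A.tensor B) :=
  .app (Sum.inl (U.head, t)) (grid (U.args ++ [u]) g (ten E))

/-- The right hand side of the recursive description of `s(f) ⊗ v`, for `v` of sort `V`. -/
noncomputable def Rf (E : TEnv TA TB) (s : A.TermSym) (f : List (Expr A)) (v : Expr B)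
    (V : SortE B) : Expr (A.tensor B) :=
  .app (Sum.inr (s, V.head)) (grid f (V.args ++ [v]) (ten E))

/-- The tensor of two sort expressions. -/
noncomputable def tsort (E : TEnv TA TB) (u : Expr A) (U : SortE A) (v : Expr B) (V : SortE B) :
    SortE (A.tensor B) :=
  ⟨(U.head, V.head), grid U.args (V.args ++ [v]) (ten E) ++ V.args.map (ten E u)⟩

section
variable (hA : TUniq TA) (hB : TUniq TB)
include hA hB

theorem ten_eq_tenN {E : TEnv TA TB} {X : PreCtx A} {Y : PreCtx B} (hX : Ext E.Γ X)
    (hY : Ext E.Δ Y) {n m k : ℕ} {u : Expr A} {v : Expr B} (hu : Adm TA E.Γ n X u)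
    (hv : Adm TB E.Δ m Y v) (hk : n + m < k) : ten E u v = tenN E k u v :=
  ten_eq_of_stable fun k' hk' => tenN_indep hA hB hX hX hY hY _ n m u v le_rfl hu hv rfl rfl _ _
    (hk.trans_le hk') hk

theorem ten_indep {E E' : TEnv TA TB} {X : PreCtx A}
    {Y : PreCtx B} (hX : Ext E.Γ X) (hX' : Ext E'.Γ X) (hY : Ext E.Δ Y) (hY' : Ext E'.Δ Y)
    {n m : ℕ} {u : Expr A} {v : Expr B} (hu : Adm TA E.Γ n X u) (hv : Adm TB E.Δ m Y v)
    (eu : cs TA E.Γ u = cs TA E'.Γ u) (ev : cs TB E.Δ v = cs TB E'.Δ v) :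
    ten E u v = ten E' u v := by
  have hu' : Adm TA E'.Γ n X u := by rw [Adm, ← eu]; exact hu
  have hv' : Adm TB E'.Δ m Y v := by rw [Adm, ← ev]; exact hv
  rw [ten_eq_tenN hA hB hX hY hu hv (Nat.lt_succ_self _),
    ten_eq_tenN hA hB hX' hY' hu' hv' (Nat.lt_succ_self _)]
  exact tenN_indep hA hB hX hX' hY hY' _ n m u v le_rfl hu hv eu ev _ _ (by omega) (by omega)

theorem R.ten_indep {E E' : TEnv TA TB} {X : PreCtx A}
    {Y : PreCtx B} (hX : Ext E.Γ X) (hX' : Ext E'.Γ X) (hY : Ext E.Δ Y) (hY' : Ext E'.Δ Y)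
    {n m : ℕ} {u : Expr A} {v : Expr B} {U : SortE A} {V : SortE B}
    (hu : R TA n (.term X u U)) (hv : R TB m (.term Y v V)) :
    ten E u v = ten E' u v :=
  GATPaper.ten_indep hA hB hX hX' hY hY' (hu.adm hA hX) (hv.adm hB hY) (hu.cs_env hX hX' hA)
    (hv.cs_env hY hY' hB)

omit hA hB in
theorem ten_var_var (E : TEnv TA TB) (x : A.Var) (y : B.Var) :
    ten E (.var x) (.var y) = .var (x, y) := by
  have h (k : ℕ) : tenN E (k + 1) (.var x) (.var y) = .var (x, y) := by simp [tenN]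
  have : ∀ k ≥ 1, tenN E k (.var x) (.var y) = tenN E 1 (.var x) (.var y) := by
    intro k hk
    obtain ⟨k, rfl⟩ := Nat.exists_eq_add_of_le' hk
    rw [h, h]
  rw [ten_eq_of_stable this, h]

theorem ten_app {E : TEnv TA TB} {X : PreCtx A} {Y : PreCtx B} (hX : Ext E.Γ X)
    (hY : Ext E.Δ Y) {n m : ℕ} {u : Expr A} {t : B.TermSym} {g : List (Expr B)}
    (hu : Adm TA E.Γ n X u) (hv : Adm TB E.Δ m Y (.app t g)) :
    ten E u (.app t g) = Lf E u (E.sA u) t g := by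
  rw [ten_eq_tenN hA hB hX hY hu hv (k := n + m + 2) (by omega), tenN, Lf]
  congr 1
  refine grid_congr fun a ha b hb => ?_
  obtain ⟨m', hm', W', hb⟩ := hv.2 t g rfl b hb
  rw [List.mem_append, List.mem_singleton] at ha
  rcases ha with ha | rfl
  · obtain ⟨n', hn', W, ha⟩ := hu.1 a ha
    exact (ten_eq_tenN hA hB hX hY (ha.adm hA hX) (hb.adm hB hY) (by omega)).symm
  · exact (ten_eq_tenN hA hB hX hY hu (hb.adm hB hY) (by omega)).symm

theorem ten_app_var {E : TEnv TA TB} {X : PreCtx A} {Y : PreCtx B} (hX : Ext E.Γ X)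
    (hY : Ext E.Δ Y) {n m : ℕ} {s : A.TermSym} {f : List (Expr A)} {y : B.Var}
    (hu : Adm TA E.Γ n X (.app s f)) (hv : Adm TB E.Δ m Y (.var y)) :
    ten E (.app s f) (.var y) = Rf E s f (.var y) (E.Δ y) := by
  rw [ten_eq_tenN hA hB hX hY hu hv (k := n + m + 2) (by omega), tenN, Rf]
  congr 1
  refine grid_congr fun a ha b hb => ?_
  obtain ⟨n', hn', W', ha⟩ := hu.2 s f rfl a ha
  rw [List.mem_append, List.mem_singleton] at hb
  rcases hb with hb | rfl
  · obtain ⟨m', hm', W, hb⟩ := hv.1 b hb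
    exact (ten_eq_tenN hA hB hX hY (ha.adm hA hX) (hb.adm hB hY) (by omega)).symm
  · exact (ten_eq_tenN hA hB hX hY (ha.adm hA hX) hv (by omega)).symm

/-- Variables of a tensor are pairs of variables of the factors. -/
theorem ten_scope {E : TEnv TA TB} {X : PreCtx A} {Y : PreCtx B} (hX : Ext E.Γ X)
    (hY : Ext E.Δ Y) : ∀ (s n m : ℕ) (u : Expr A) (v : Expr B), n + m ≤ s →
      Adm TA E.Γ n X u → Adm TB E.Δ m Y v →
      ∀ p, Occurs (A := A.tensor B) p (ten E u v) →
      (p.1 ∈ X.map Prod.fst ∨ u = .var p.1) ∧ (p.2 ∈ Y.map Prod.fst ∨ v = .var p.2) := by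
  have key (n : ℕ) (u : Expr A) (W : SortE A) (h : R TA n (.term X u W)) (x : A.Var)
      (hx : x ∈ X.map Prod.fst ∨ u = .var x) : x ∈ X.map Prod.fst := by
    rcases hx with hx | rfl
    · exact hx
    · exact h.scope_term (occurs_var.2 rfl)
  have key' (n : ℕ) (u : Expr B) (W : SortE B) (h : R TB n (.term Y u W)) (x : B.Var)
      (hx : x ∈ Y.map Prod.fst ∨ u = .var x) : x ∈ Y.map Prod.fst := by
    rcases hx with hx | rfl
    · exact hx
    · exact h.scope_term (occurs_var.2 rfl)
  intro s
  induction s using Nat.strong_induction_on with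
  | _ s ih =>
  intro n m u v hs hu hv p hp
  cases v with
  | app t g =>
    rw [ten_app hA hB hX hY hu hv, Lf, occurs_app] at hp
    obtain ⟨e, he, hp⟩ := hp
    obtain ⟨a, ha, b, hb, rfl⟩ := mem_grid.1 he
    obtain ⟨m', hm', W', hb⟩ := hv.2 t g rfl b hb
    rw [List.mem_append, List.mem_singleton] at ha
    rcases ha with ha | rfl
    · obtain ⟨n', hn', W, ha⟩ := hu.1 a ha
      obtain ⟨h1, h2⟩ := ih (n' + m') (by omega) n' m' a b le_rfl (ha.adm hA hX) (hb.adm hB hY) p hp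
      exact ⟨.inl (key _ _ _ ha _ h1), .inl (key' _ _ _ hb _ h2)⟩
    · obtain ⟨h1, h2⟩ := ih (n + m') (by omega) n m' a b le_rfl hu (hb.adm hB hY) p hp
      exact ⟨h1, .inl (key' _ _ _ hb _ h2)⟩
  | var y =>
    cases u with
    | var x =>
      rw [ten_var_var, occurs_var] at hp
      subst hp
      simp
    | app t g =>
      rw [ten_app_var hA hB hX hY hu hv, Rf, occurs_app] at hp
      obtain ⟨e, he, hp⟩ := hp
      obtain ⟨a, ha, b, hb, rfl⟩ := mem_grid.1 he
      obtain ⟨n', hn', W', ha⟩ := hu.2 t g rfl a ha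
      rw [List.mem_append, List.mem_singleton] at hb
      rcases hb with hb | rfl
      · obtain ⟨m', hm', W, hb⟩ := hv.1 b hb
        obtain ⟨h1, h2⟩ := ih (n' + m') (by omega) n' m' a b le_rfl (ha.adm hA hX) (hb.adm hB hY) p hp
        exact ⟨.inl (key _ _ _ ha _ h1), .inl (key' _ _ _ hb _ h2)⟩
      · obtain ⟨h1, h2⟩ := ih (n' + m) (by omega) n' m a (.var y) le_rfl (ha.adm hA hX) hv p hp
        exact ⟨.inl (key _ _ _ ha _ h1), h2⟩

end

end

section

variable {A B : Alphabet} {TA : Set (Judg A)} {TB : Set (Judg B)} {Ax : Set (Judg A)}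

open Classical in
theorem lookupV_keys (ks : List A.Var) (H : A.Var → Expr A) (z : A.Var) :
    lookupV (ks.map fun z => (z, H z)) z = if z ∈ ks then H z else .var z := by
  induction ks with
  | nil => simp [lookupV]
  | cons k ks ih =>
    by_cases hk : k = z
    · subst hk; simp [lookupV]
    · simp [lookupV, hk, ih, Ne.symm hk]

theorem pairsR_eq {x : A.Var} {Y : PreCtx B} {g : ℕ → Expr (A.tensor B)}
    {H : (A.tensor B).Var → Expr (A.tensor B)}
    (h : ∀ j (hj : j < Y.length), g j = H (x, (Y[j]).1)) :
    pairsR x Y g = (Y.map fun q => ((x, q.1) : (A.tensor B).Var)).map fun z => (z, H z) := by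
  refine List.ext_getElem (by simp [pairsR]) fun k hk hk' => ?_
  simp only [pairsR, List.length_map, List.length_finRange] at hk
  simp [pairsR, h k hk]

theorem pairsL_eq {X : PreCtx A} {y : B.Var} {g : ℕ → Expr (A.tensor B)}
    {H : (A.tensor B).Var → Expr (A.tensor B)}
    (h : ∀ i (hi : i < X.length), g i = H ((X[i]).1, y)) :
    pairsL X y g = (X.map fun p => ((p.1, y) : (A.tensor B).Var)).map fun z => (z, H z) := by
  refine List.ext_getElem (by simp [pairsL]) fun k hk hk' => ?_
  simp only [pairsL, List.length_map, List.length_finRange] at hk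
  simp [pairsL, h k hk]

theorem R.canonSort (hT : TUniq Ax) {Γ : A.Var → SortE A} {n : ℕ} {X : PreCtx A} {u : Expr A}
    {U : SortE A} (hΓ : Ext Γ X) (h : R Ax n (.term X u U)) : CanonSort Ax X u (cs Ax Γ u) := by
  cases u with
  | var x =>
    obtain ⟨V, h1, -⟩ := h.var_inv
    obtain ⟨i, hi, e⟩ := List.getElem_of_mem h1
    rw [cs, hΓ _ h1]
    have := CanonSort.var (Ax := Ax) hi
    rwa [e] at this
  | app t l =>
    obtain ⟨k, Xa, V, φ, rfl, rfl, h3, h4, h5, h6, h7, h8⟩ := h.app_inv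
    rw [cs_app hT h3]
    exact .app h3

theorem CanonSort.eq_cs (hT : TUniq Ax) {Γ : A.Var → SortE A} {X : PreCtx A} {u : Expr A}
    {U : SortE A} (hΓ : Ext Γ X) (h : CanonSort Ax X u U) : U = cs Ax Γ u := by
  cases h with
  | var hi => rw [cs, hΓ _ (List.getElem_mem hi)]
  | app hax => rw [cs_app hT hax]; rfl

theorem Ext.take {Γ : A.Var → SortE A} {X : PreCtx A} (h : Ext Γ X) (i : ℕ) : Ext Γ (X.take i) :=
  fun p hp => h p (List.mem_of_mem_take hp)

theorem CtxR.take {n : ℕ} {X : PreCtx A} (h : CtxR Ax n X) (i : ℕ) : CtxR Ax n (X.take i) := by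
  rw [← List.take_append_drop i X] at h
  exact h.initial

theorem CtxR.getElem {n : ℕ} {X : PreCtx A} (h : CtxR Ax n X) {i : ℕ} (hi : i < X.length) :
    R Ax n (.sort (X.take i) X[i].2) :=
  h.2 (X.take i) X[i] (X.drop (i + 1)) (by simp)

open Classical in
/-- Change the sort of one variable. -/
noncomputable def upd {V W : Type} (Γ : V → W) (x : V) (U : W) : V → W :=
  Function.update Γ x U

theorem upd_self {V W : Type} (Γ : V → W) (x : V) (U : W) : upd Γ x U x = U := by
  classical exact Function.update_self ..

theorem upd_ne {V W : Type} (Γ : V → W) {x y : V} (h : y ≠ x) (U : W) : upd Γ x U y = Γ y := by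
  classical exact Function.update_of_ne h ..

theorem Ext.upd {Γ : A.Var → SortE A} {X : PreCtx A} (h : Ext Γ X) {x : A.Var}
    (hx : ∀ p ∈ X, p.1 ≠ x) (U : SortE A) : Ext (upd Γ x U) X :=
  fun p hp => by rw [upd_ne _ (hx p hp), h p hp]

section
variable (hA : TUniq TA) (hB : TUniq TB)
include hA hB

theorem ten_row_subst {E E' : TEnv TA TB} {X : PreCtx A} {Y : PreCtx B} {x : A.Var}
    {u : Expr A} {n : ℕ} (hX : Ext E.Γ X) (hX' : Ext E'.Γ X) (hY : Ext E.Δ Y) (hΔ : E'.Δ = E.Δ)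
    (hx : E'.Γ x = E.sA u) (hxX : ∀ p ∈ X, p.1 ≠ x) (hu : Adm TA E.Γ n X u)
    {σ : (A.tensor B).Var → Expr (A.tensor B)}
    (h1 : ∀ x' y, x' ≠ x → σ (x', y) = .var (x', y))
    (h2 : ∀ y ∈ Y.map Prod.fst, σ (x, y) = ten E u (.var y)) :
    ∀ (m : ℕ) (v : Expr B), Adm TB E.Δ m Y v → (∀ y, v = .var y → y ∈ Y.map Prod.fst) →
      (ten E' (.var x) v).subst σ = ten E u v := by
  have hxu : Adm TA E'.Γ n X (.var x) := ⟨by rw [cs, hx]; exact hu.1, by simp⟩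
  intro m
  induction m using Nat.strong_induction_on with
  | _ m ih =>
  intro v hv hs
  cases v with
  | var y =>
    rw [ten_var_var, subst_var, h2 y (hs y rfl)]
  | app t g =>
    have hY' : Ext E'.Δ Y := by rw [hΔ]; exact hY
    have hv' : Adm TB E'.Δ m Y (.app t g) := by rw [hΔ]; exact hv
    rw [ten_app hA hB hX hY hu hv, ten_app hA hB hX' hY' hxu hv', Lf, Lf, subst_app, map_grid,
      TEnv.sA, cs, hx]
    congr 1
    rw [grid_append, grid_append]
    congr 1
    · refine grid_congr fun a ha b hb => ?_
      obtain ⟨m', hm', W', hb⟩ := hv.2 t g rfl b hb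
      obtain ⟨n', hn', W, ha⟩ := hu.1 a ha
      rw [← R.ten_indep hA hB hX hX' hY hY' ha hb]
      refine (subst_congr _ fun z hz => ?_).trans (subst_id _)
      have := ten_scope hA hB hX hY _ n' m' a b le_rfl (ha.adm hA hX) (hb.adm hB hY) z hz
      refine h1 _ _ fun e => ?_
      have h3 : z.1 ∈ X.map Prod.fst := by
        rcases this.1 with h | h
        · exact h
        · subst h
          exact ha.scope_term (occurs_var.2 rfl)
      obtain ⟨p, hp, hpz⟩ := List.mem_map.1 h3
      exact hxX p hp (hpz.trans e)
    · rw [grid_cons, grid_cons, grid_nil, grid_nil, List.append_nil, List.append_nil]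
      refine List.map_congr_left fun b hb => ?_
      obtain ⟨m', hm', W', hb⟩ := hv.2 t g rfl b hb
      refine ih m' hm' b (hb.adm hB hY) ?_
      rintro y rfl
      exact hb.scope_term (occurs_var.2 rfl)

theorem TTg.eq_ten {a : TArg A} {b : TArg B} {c : Bool} {e : Expr (A.tensor B)}
    (h : TTg TA TB c a b e) (hc : c = false) : ∀ (E : TEnv TA TB) (n m M : ℕ),
    Ext E.Γ a.ctx → Ext E.Δ b.ctx → CtxR TB M b.ctx →
    Adm TA E.Γ n a.ctx a.tm → Adm TB E.Δ m b.ctx b.tm →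
    (∀ t g, b.tm = .app t g → a.srt = E.sA a.tm) → (∀ y, b.tm = .var y → b.srt = E.Δ y) →
    e = ten E a.tm b.tm := by
  induction h with
  | varvar => intros; rw [ten_var_var]
  | @varapp _ X x S ss Y t ts V SS TSf hSS hTS M out hM hMx hout ihM ihMx =>
    intro E n m N hX hY hC hu hv h1 h2
    have e1 : (⟨S, ss⟩ : SortE A) = E.Γ x := h1 t ts rfl
    rw [ten_app hA hB hX hY hu hv, Lf, TEnv.sA, cs, ← e1]
    congr 1
    have hu' := hu.1
    rw [cs, ← e1] at hu'
    have e2 : ss.length + 1 = (ss ++ [Expr.var x]).length := by simp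
    rw [e2] at hout
    refine hout.eq fun i hi j hj => ?_
    obtain ⟨m', hm', W', hb⟩ := hv.2 t ts rfl _ (List.getElem_mem hj)
    by_cases hi' : i < ss.length
    · rw [List.getElem_append_left hi']
      obtain ⟨n', hn', W, ha⟩ := hu' _ (List.getElem_mem hi')
      refine ihM i hi' j hj hc E n' m' N hX hY hC (ha.adm hA hX) (hb.adm hB hY)
        (fun _ _ _ => (hSS i hi').eq_cs hA hX) fun y hy => ?_
      have := (hTS j hj).eq_cs hB hY
      simp only at hy
      rw [hy] at this
      exact this
    · obtain rfl : i = ss.length := by simp at hi; omega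
      rw [List.getElem_append_right le_rfl]
      simp only [Nat.sub_self, List.getElem_cons_zero]
      refine ihMx j hj hc E n m' N hX hY hC hu (hb.adm hB hY)
        (fun _ _ _ => e1) fun y hy => ?_
      have := (hTS j hj).eq_cs hB hY
      simp only at hy
      rw [hy] at this
      exact this
  | @appvar _ X s ss U Y y T ts SS TSf hSS hTS M out hM hMy hout ihM ihMy =>
    intro E n m N hX hY hC hu hv h1 h2
    have e1 : (⟨T, ts⟩ : SortE B) = E.Δ y := h2 y rfl
    rw [ten_app_var hA hB hX hY hu hv, Rf, ← e1]
    congr 1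
    have hv' := hv.1
    rw [cs, ← e1] at hv'
    have e2 : ts.length + 1 = (ts ++ [Expr.var y]).length := by simp
    rw [e2] at hout
    refine hout.eq fun i hi j hj => ?_
    obtain ⟨n', hn', W', ha⟩ := hu.2 s ss rfl _ (List.getElem_mem hi)
    by_cases hj' : j < ts.length
    · rw [List.getElem_append_left hj']
      obtain ⟨m', hm', W, hb⟩ := hv' _ (List.getElem_mem hj')
      refine ihM i hi j hj' hc E n' m' N hX hY hC (ha.adm hA hX) (hb.adm hB hY)
        (fun _ _ _ => (hSS i hi).eq_cs hA hX) fun y hy => ?_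
      have := (hTS j hj').eq_cs hB hY
      simp only at hy
      rw [hy] at this
      exact this
    · obtain rfl : j = ts.length := by simp at hj; omega
      rw [List.getElem_append_right le_rfl]
      simp only [Nat.sub_self, List.getElem_cons_zero]
      exact ihMy i hi hc E n' m N hX hY hC (ha.adm hA hX) hv (by simp)
        fun y' hy => by cases hy; exact e1
  | @appapp_base X s ss U Y t ts V x hx e0 h0 g hg ih0 ihg =>
    intro E n m N hX hY hC hu hv h1 h2
    have e1 : U = E.sA (.app s ss) := h1 t ts rfl
    have hX' := Ext.upd hX hx U
    have := ih0 rfl ⟨upd E.Γ x U, E.Δ⟩ n m N hX' hY hC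
      ⟨by simp only [cs, upd_self, e1]; exact hu.1, by simp⟩ hv
      (fun _ _ _ => by simp only [TEnv.sA, cs, upd_self]) (by simp)
    have hgj : ∀ j (hj : j < Y.length), g j = ten E (.app s ss) (.var (Y[j]).1) := fun j hj =>
      ihg j hj rfl E n N N hX (hY.take j) (hC.take j) hu
        (R.adm_sort (hY _ (List.getElem_mem hj)) (hC.getElem hj)) (fun _ _ h => nomatch h)
        (fun y hy => by
          cases hy
          exact (hY _ (List.getElem_mem hj)).symm)
    rw [this, Expr.substL, pairsR_eq (H := fun z => ten E (.app s ss) (.var z.2)) hgj]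
    refine ten_row_subst (E := E) (E' := ⟨upd E.Γ x U, E.Δ⟩) hA hB hX hX' hY rfl
      ((upd_self ..).trans e1) hx hu ?_ ?_ m _ hv (by simp)
    · intro x' y hx'
      rw [lookupV_keys, if_neg]
      simp [Ne.symm hx']
    · intro y hy
      rw [lookupV_keys, if_pos]
      simpa using hy
  | appapp_star => cases hc

theorem TTg.of_adm : ∀ (n m M : ℕ) (E : TEnv TA TB) (X : PreCtx A) (Y : PreCtx B)
    (u : Expr A) (U : SortE A) (v : Expr B) (V : SortE B), Ext E.Γ X → Ext E.Δ Y → CtxR TB M Y →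
    Adm TA E.Γ n X u → Adm TB E.Δ m Y v →
    (∀ t g, v = .app t g → U = E.sA u) →
    (∀ y s f, v = .var y → u = .app s f → V = E.Δ y) →
    TTg TA TB false ⟨X, u, U⟩ ⟨Y, v, V⟩ (ten E u v) := by
  have rowR {Y : PreCtx B} {E : TEnv TA TB} (hY : Ext E.Δ Y) {ts : List (Expr B)} {m : ℕ}
      (h : ∀ e ∈ ts, ∃ k < m, ∃ W, R TB k (.term Y e W)) :
      ∀ j (hj : j < ts.length), CanonSort TB Y (ts[j]) (cs TB E.Δ (ts[j]?.getD (.var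
        (Classical.arbitrary _)))) := by
    intro j hj
    obtain ⟨k, _, W, h⟩ := h _ (List.getElem_mem hj)
    rw [List.getElem?_eq_getElem hj]
    exact h.canonSort hB hY
  have rowL {X : PreCtx A} {E : TEnv TA TB} (hX : Ext E.Γ X) {ts : List (Expr A)} {m : ℕ}
      (h : ∀ e ∈ ts, ∃ k < m, ∃ W, R TA k (.term X e W)) :
      ∀ j (hj : j < ts.length), CanonSort TA X (ts[j]) (cs TA E.Γ (ts[j]?.getD (.var
        (Classical.arbitrary _)))) := by
    intro j hj
    obtain ⟨k, _, W, h⟩ := h _ (List.getElem_mem hj)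
    rw [List.getElem?_eq_getElem hj]
    exact h.canonSort hA hX
  intro n
  induction n using Nat.strong_induction_on with
  | _ n ihn =>
  have hav (m M : ℕ) (E : TEnv TA TB) (X : PreCtx A) (Y : PreCtx B) (s : A.TermSym)
      (ss : List (Expr A)) (U : SortE A) (y : B.Var) (hX : Ext E.Γ X) (hY : Ext E.Δ Y)
      (hC : CtxR TB M Y) (hu : Adm TA E.Γ n X (.app s ss)) (hv : Adm TB E.Δ m Y (.var y)) :
      TTg TA TB false ⟨X, .app s ss, U⟩ ⟨Y, .var y, E.Δ y⟩ (ten E (.app s ss) (.var y)) := by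
    rw [ten_app_var hA hB hX hY hu hv, Rf]
    have hv' : ∀ e ∈ (E.Δ y).args, _ := hv.1
    have hu' := hu.2 s ss rfl
    generalize e1 : E.Δ y = D at hv' ⊢
    obtain ⟨T, ts⟩ := D
    refine .appvar _ _ (rowL hX hu') (rowR hY hv')
      (fun i j => ten E (ss[i]?.getD (.var (Classical.arbitrary _)))
        ((ts ++ [.var y])[j]?.getD (.var (Classical.arbitrary _)))) _ ?_ ?_ ?_
    · intro i hi j hj
      obtain ⟨n', hn', W, ha⟩ := hu' _ (List.getElem_mem hi)
      obtain ⟨m', hm', W', hb⟩ := hv' _ (List.getElem_mem hj)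
      simp only [List.getElem?_append_left hj, List.getElem?_eq_getElem hi,
        List.getElem?_eq_getElem hj, Option.getD_some]
      exact ihn n' hn' m' M E X Y _ _ _ _ hX hY hC (ha.adm hA hX) (hb.adm hB hY)
        (fun _ _ _ => rfl) fun y _ _ hy _ => by rw [hy, cs]
    · intro i hi
      obtain ⟨n', hn', W, ha⟩ := hu' _ (List.getElem_mem hi)
      simp only [List.getElem?_eq_getElem hi, Option.getD_some, List.getElem?_concat_length]
      exact ihn n' hn' m M E X Y _ _ _ _ hX hY hC (ha.adm hA hX) hv
        (by simp) fun y' _ _ hy _ => by cases hy; exact e1.symm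
    · have e2 : ts.length + 1 = (ts ++ [Expr.var y]).length := by simp
      rw [e2]
      refine isGrid_grid fun i hi j hj => ?_
      rw [List.getElem?_eq_getElem hi, List.getElem?_eq_getElem hj, Option.getD_some,
        Option.getD_some]
  intro m
  induction m using Nat.strong_induction_on with
  | _ m ihm =>
  have hva (M : ℕ) (E : TEnv TA TB) (X : PreCtx A) (Y : PreCtx B) (x : A.Var)
      (t : B.TermSym) (ts : List (Expr B)) (V : SortE B) (hX : Ext E.Γ X) (hY : Ext E.Δ Y)
      (hC : CtxR TB M Y) (hu : Adm TA E.Γ n X (.var x)) (hv : Adm TB E.Δ m Y (.app t ts)) :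
      TTg TA TB false ⟨X, .var x, E.Γ x⟩ ⟨Y, .app t ts, V⟩ (ten E (.var x) (.app t ts)) := by
    rw [ten_app hA hB hX hY hu hv, Lf, TEnv.sA, cs]
    have hu' : ∀ e ∈ (E.Γ x).args, _ := hu.1
    have hv' := hv.2 t ts rfl
    generalize e1 : E.Γ x = D at hu' ⊢
    obtain ⟨S, ss⟩ := D
    refine .varapp _ _ (rowL hX hu') (rowR hY hv')
      (fun i j => ten E ((ss ++ [.var x])[i]?.getD (.var (Classical.arbitrary _)))
        (ts[j]?.getD (.var (Classical.arbitrary _)))) _ ?_ ?_ ?_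
    · intro i hi j hj
      obtain ⟨n', hn', W, ha⟩ := hu' _ (List.getElem_mem hi)
      obtain ⟨m', hm', W', hb⟩ := hv' _ (List.getElem_mem hj)
      simp only [List.getElem?_append_left hi, List.getElem?_eq_getElem hi,
        List.getElem?_eq_getElem hj, Option.getD_some]
      exact ihn n' hn' m' M E X Y _ _ _ _ hX hY hC (ha.adm hA hX) (hb.adm hB hY)
        (fun _ _ _ => rfl) fun y _ _ hy _ => by rw [hy, cs]
    · intro j hj
      obtain ⟨m', hm', W', hb⟩ := hv' _ (List.getElem_mem hj)
      simp only [List.getElem?_eq_getElem hj, Option.getD_some, List.getElem?_concat_length]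
      exact ihm m' hm' M E X Y _ _ _ _ hX hY hC hu (hb.adm hB hY)
        (fun _ _ _ => by rw [TEnv.sA, cs, e1]) fun y _ _ hy _ => by rw [hy, cs]
    · have e2 : ss.length + 1 = (ss ++ [Expr.var x]).length := by simp
      rw [e2]
      refine isGrid_grid fun i hi j hj => ?_
      rw [List.getElem?_eq_getElem hi, List.getElem?_eq_getElem hj, Option.getD_some,
        Option.getD_some]
  intro M E X Y u U v V hX hY hC hu hv h1 h2
  cases v with
  | var y =>
    cases u with
    | var x => rw [ten_var_var]; exact .varvar
    | app s ss => rw [h2 y _ _ rfl rfl]; exact hav m M E X Y s ss U y hX hY hC hu hv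
  | app t ts =>
    cases u with
    | var x =>
      have := h1 t ts rfl
      rw [TEnv.sA, cs] at this
      rw [this]
      exact hva M E X Y x t ts V hX hY hC hu hv
    | app s ss =>
      have e1 : U = E.sA (.app s ss) := h1 t ts rfl
      obtain ⟨x, hx⟩ : ∃ x, ∀ p ∈ X, p.1 ≠ x := by
        obtain ⟨x, hx⟩ := Set.Finite.exists_notMem (List.finite_toSet (X.map Prod.fst))
        exact ⟨x, fun p hp e => hx (e ▸ List.mem_map_of_mem hp)⟩
      have hX' := Ext.upd hX hx U
      have h0 := hva M ⟨upd E.Γ x U, E.Δ⟩ X Y x t ts V hX' hY hC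
        ⟨by simp only [cs, upd_self, e1]; exact hu.1, by simp⟩ hv
      simp only [upd_self] at h0
      have := TTg.appapp_base (TA := TA) (TB := TB) (s := s) (ss := ss) hx _ h0
        (fun j => ten E (.app s ss) (.var ((Y[j]?.map Prod.fst).getD (Classical.arbitrary _))))
        (by
          intro j hj
          rw [List.getElem?_eq_getElem hj, Option.map_some, Option.getD_some,
            ← hY _ (List.getElem_mem hj)]
          exact hav M M E X (Y.take j) s ss U _ hX (hY.take j) (hC.take j) hu
            (R.adm_sort (hY _ (List.getElem_mem hj)) (hC.getElem hj)))
      convert this using 1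
      rw [Expr.substL, pairsR_eq (H := fun z => ten E (.app s ss) (.var z.2))
        (by intro j hj; simp [List.getElem?_eq_getElem hj])]
      refine (ten_row_subst (E := E) (E' := ⟨upd E.Γ x U, E.Δ⟩) hA hB hX hX' hY rfl
        ((upd_self ..).trans e1) hx hu ?_ ?_ m _ hv
        (by simp)).symm
      · intro x' y hx'
        rw [lookupV_keys, if_neg]
        simp [Ne.symm hx']
      · intro y hy
        rw [lookupV_keys, if_pos]
        simpa using hy

end

end

section

variable {A B : Alphabet} {TA : Set (Judg A)} {TB : Set (Judg B)} {Ax : Set (Judg A)}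

/-! ### Tensor precontexts and the axioms of the tensor product -/

/-- The tensor of two tuples of terms, as a function on variables. -/
noncomputable def tmap (E : TEnv TA TB) (f : A.Var → Expr A) (g : B.Var → Expr B) :
    (A.tensor B).Var → Expr (A.tensor B) := fun z => ten E (f z.1) (g z.2)

theorem tmap_mk (E : TEnv TA TB) (f : A.Var → Expr A) (g : B.Var → Expr B) (x : A.Var)
    (y : B.Var) : tmap E f g (x, y) = ten E (f x) (g y) := rfl

/-- The sort of the entry `x y` of a tensor precontext. -/
noncomputable def cellS (E : TEnv TA TB) (p : A.Var × SortE A) (q : B.Var × SortE B) :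
    SortE (A.tensor B) := tsort E (.var p.1) p.2 (.var q.1) q.2

/-- The tensor precontext `X ⊗ Y`. -/
noncomputable def TX (E : TEnv TA TB) (X : PreCtx A) (Y : PreCtx B) : PreCtx (A.tensor B) :=
  grid X Y fun p q => ((p.1, q.1), cellS E p q)

theorem Ext.mono {Γ : A.Var → SortE A} {X X' : PreCtx A} (h : Ext Γ X) (hs : X' ⊆ X) : Ext Γ X' :=
  fun p hp => h p (hs hp)

theorem occurs_tsort {E : TEnv TA TB} {u : Expr A} {U : SortE A} {v : Expr B} {V : SortE B}
    {z : (A.tensor B).Var} (h : SOccurs z (tsort E u U v V)) :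
    (∃ a ∈ U.args, ∃ b ∈ V.args ++ [v], Occurs z (ten E a b)) ∨
      ∃ b ∈ V.args, Occurs z (ten E u b) := by
  obtain ⟨e, he, ho⟩ := h
  simp only [tsort, List.mem_append, mem_grid, List.mem_map] at he
  rcases he with ⟨a, ha, b, hb, rfl⟩ | ⟨b, hb, rfl⟩
  · exact .inl ⟨a, ha, b, by simpa using hb, ho⟩
  · exact .inr ⟨b, hb, ho⟩

theorem mem_args_var {n : ℕ} {X : PreCtx A} {U : SortE A} (hU : R Ax n (.sort X U)) {x : A.Var}
    {a : Expr A} (ha : a ∈ U.args) (e : a = .var x) : x ∈ X.map Prod.fst :=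
  hU.scope_sort ⟨a, ha, by rw [e]; exact .var⟩

theorem substL_eq {e : Expr A} {ks : List A.Var} {H : A.Var → Expr A}
    (h : ∀ z, Occurs z e → z ∈ ks ∨ H z = .var z) :
    e.substL (ks.map fun z => (z, H z)) = e.subst H := by
  refine subst_congr e fun z hz => ?_
  rw [lookupV_keys]
  split_ifs with hk
  · rfl
  · exact ((h z hz).resolve_left hk).symm

theorem ssubstL_eq {W : SortE A} {ks : List A.Var} {H : A.Var → Expr A}
    (h : ∀ z, SOccurs z W → z ∈ ks ∨ H z = .var z) :
    W.substL (ks.map fun z => (z, H z)) = W.subst H := by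
  refine ssubst_congr W fun z hz => ?_
  rw [lookupV_keys]
  split_ifs with hk
  · rfl
  · exact ((h z hz).resolve_left hk).symm

theorem IsGrid.dropLast_eq {α β γ : Type} {l1 : List α} {l2 : List β} {F : α → β → γ}
    {M : ℕ → ℕ → γ} {L : List γ} (hL : IsGrid l1.length l2.length M L)
    (h : ∀ i (hi : i < l1.length) j (hj : j < l2.length),
      i * l2.length + j + 1 < l1.length * l2.length → M i j = F l1[i] l2[j]) :
    L.dropLast = (grid l1 l2 F).dropLast := by
  refine List.ext_getElem (by simp [hL.1, length_grid]) fun k hk hk' => ?_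
  rw [List.length_dropLast, hL.1] at hk
  have hn : 0 < l2.length := by
    rcases Nat.eq_zero_or_pos l2.length with h0 | h0
    · rw [h0] at hk; simp at hk
    · exact h0
  have hi : k / l2.length < l1.length := by
    rw [Nat.div_lt_iff_lt_mul hn]; omega
  have hj := Nat.mod_lt k hn
  have e : k / l2.length * l2.length + k % l2.length = k := Nat.div_add_mod' k _
  have h1 := hL.2 _ _ hi hj (by rw [e, hL.1]; omega)
  have h2 := grid_getElem? (F := F) hi hj
  simp only [e] at h1 h2
  rw [List.getElem_dropLast, List.getElem_dropLast, h1, h _ hi _ hj (by rw [e]; omega),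
    ← Option.some_inj, ← List.getElem?_eq_getElem, h2]

section
variable (hA : TUniq TA) (hB : TUniq TB)
include hA hB

theorem TSo.eq_tsort {E : TEnv TA TB} {n m M : ℕ} {X : PreCtx A} {Y : PreCtx B} {x : A.Var}
    {U : SortE A} {y : B.Var} {V : SortE B} {W : SortE (A.tensor B)}
    (h : TSo TA TB false X x U Y y V W) (hX : Ext E.Γ X) (hY : Ext E.Δ Y) (hx : E.Γ x = U)
    (hy : E.Δ y = V) (hC : CtxR TB M Y) (hU : R TA n (.sort X U)) (hV : R TB m (.sort Y V)) :
    W = tsort E (.var x) U (.var y) V := by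
  obtain ⟨hx', hy', SS, TSf, hSS, hTS, M', out, hM, hMx, hMy, hout⟩ := h
  rename_i S ss T ts
  rw [tsort, ← dropLast_grid]
  congr 1
  rw [show ss.length + 1 = (ss ++ [Expr.var x]).length by simp,
    show ts.length + 1 = (ts ++ [Expr.var y]).length by simp] at hout
  have key : ∀ i (hi : i < (ss ++ [Expr.var x]).length) j (hj : j < (ts ++ [Expr.var y]).length),
      i < ss.length ∨ j < ts.length →
      M' i j = ten E ((ss ++ [Expr.var x])[i]) ((ts ++ [Expr.var y])[j]) := by
    intro i hi j hj hij
    by_cases hi' : i < ss.length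
    · obtain ⟨n', _, rfl, ha⟩ := hU.sort_args (List.getElem_mem hi')
      by_cases hj' : j < ts.length
      · obtain ⟨m', _, rfl, hb⟩ := hV.sort_args (List.getElem_mem hj')
        rw [List.getElem_append_left hi', List.getElem_append_left hj']
        refine (hM i hi' j hj').eq_ten hA hB rfl E n' m' M hX hY hC (ha.adm hA hX) (hb.adm hB hY)
          (fun _ _ _ => (hSS i hi').eq_cs hA hX) fun y hy => ?_
        have := (hTS j hj').eq_cs hB hY
        simp only at hy
        rw [hy] at this
        exact this
      · obtain rfl : j = ts.length := by simp at hj; omega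
        rw [List.getElem_append_left hi', List.getElem_append_right le_rfl]
        simp only [Nat.sub_self, List.getElem_cons_zero]
        exact (hMy i hi').eq_ten hA hB rfl E n' m M hX hY hC (ha.adm hA hX) (hV.adm_sort hy)
          (fun _ _ h => nomatch h) fun y' h => by cases h; exact hy.symm
    · have hj' := hij.resolve_left hi'
      obtain rfl : i = ss.length := by simp at hi; omega
      obtain ⟨m', _, rfl, hb⟩ := hV.sort_args (List.getElem_mem hj')
      rw [List.getElem_append_left hj', List.getElem_append_right le_rfl]
      simp only [Nat.sub_self, List.getElem_cons_zero]
      refine (hMx j hj').eq_ten hA hB rfl E n m' M hX hY hC (hU.adm_sort hx) (hb.adm hB hY)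
        (fun _ _ _ => hx.symm) fun y hy => ?_
      have := (hTS j hj').eq_cs hB hY
      simp only at hy
      rw [hy] at this
      exact this
  refine hout.dropLast_eq fun i hi j hj hij => key i hi j hj ?_
  by_contra hc
  simp only [List.length_append, List.length_singleton] at hi hj hij
  obtain rfl : i = ss.length := by omega
  obtain rfl : j = ts.length := by omega
  simp only [Nat.add_one_mul] at hij
  omega

theorem TSo.of_tsort {E : TEnv TA TB} {n m M : ℕ} {X : PreCtx A} {Y : PreCtx B} {x : A.Var}
    {U : SortE A} {y : B.Var} {V : SortE B} (hX : Ext E.Γ X) (hY : Ext E.Δ Y) (hx : E.Γ x = U)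
    (hy : E.Δ y = V) (hC : CtxR TB M Y) (hU : R TA n (.sort X U)) (hV : R TB m (.sort Y V))
    (hxX : ∀ p ∈ X, p.1 ≠ x) (hyY : ∀ p ∈ Y, p.1 ≠ y) :
    TSo TA TB false X x U Y y V (tsort E (.var x) U (.var y) V) := by
  obtain ⟨S, ss⟩ := U
  obtain ⟨T, ts⟩ := V
  rw [tsort, ← dropLast_grid]
  have ha : ∀ i (hi : i < ss.length), ∃ n' W, R TA n' (.term X ss[i] W) := fun i hi =>
    let ⟨n', W, _, h⟩ := hU.sort_args (List.getElem_mem hi); ⟨n', W, h⟩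
  have hb : ∀ j (hj : j < ts.length), ∃ m' W, R TB m' (.term Y ts[j] W) := fun i hi =>
    let ⟨n', W, _, h⟩ := hV.sort_args (List.getElem_mem hi); ⟨n', W, h⟩
  have ga : ∀ i (hi : i < ss.length), (ss ++ [Expr.var x])[i]?.getD (.var x) = ss[i] := by
    intro i hi
    rw [List.getElem?_append_left hi, List.getElem?_eq_getElem hi, Option.getD_some]
  have gb : ∀ i (hi : i < ts.length), (ts ++ [Expr.var y])[i]?.getD (.var y) = ts[i] := by
    intro i hi
    rw [List.getElem?_append_left hi, List.getElem?_eq_getElem hi, Option.getD_some]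
  have ga' : (ss ++ [Expr.var x])[ss.length]?.getD (.var x) = .var x := by simp
  have gb' : (ts ++ [Expr.var y])[ts.length]?.getD (.var y) = .var y := by simp
  refine .mk hxX hyY (fun i => cs TA E.Γ ((ss ++ [Expr.var x])[i]?.getD (.var x)))
    (fun j => cs TB E.Δ ((ts ++ [Expr.var y])[j]?.getD (.var y))) ?_ ?_
    (fun i j => ten E ((ss ++ [Expr.var x])[i]?.getD (.var x))
      ((ts ++ [Expr.var y])[j]?.getD (.var y))) _ ?_ ?_ ?_ ?_
  · intro i hi
    obtain ⟨n', W, h⟩ := ha i hi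
    simp only [ga i hi]
    exact h.canonSort hA hX
  · intro i hi
    obtain ⟨n', W, h⟩ := hb i hi
    simp only [gb i hi]
    exact h.canonSort hB hY
  · intro i hi j hj
    obtain ⟨n', W, h⟩ := ha i hi
    obtain ⟨m', W', h'⟩ := hb j hj
    simp only [ga i hi, gb j hj]
    exact TTg.of_adm hA hB n' m' M E X Y _ _ _ _ hX hY hC (h.adm hA hX) (h'.adm hB hY)
      (fun _ _ _ => rfl) fun y _ _ hy _ => by rw [hy, cs]
  · intro j hj
    obtain ⟨m', W', h'⟩ := hb j hj
    simp only [ga', gb j hj]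
    exact TTg.of_adm hA hB n m' M E X Y _ _ _ _ hX hY hC (hU.adm_sort hx) (h'.adm hB hY)
      (fun _ _ _ => hx.symm) fun y _ _ hy _ => by rw [hy, cs]
  · intro i hi
    obtain ⟨n', W, h⟩ := ha i hi
    simp only [gb', ga i hi]
    exact TTg.of_adm hA hB n' m M E X Y _ _ _ _ hX hY hC (h.adm hA hX) (hV.adm_sort hy)
      (fun _ _ h => nomatch h) fun y' _ _ h _ => by cases h; exact hy.symm
  · rw [show ss.length + 1 = (ss ++ [Expr.var x]).length by simp,
      show ts.length + 1 = (ts ++ [Expr.var y]).length by simp]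
    refine isGrid_grid fun i hi j hj => ?_
    rw [List.getElem?_eq_getElem hi, List.getElem?_eq_getElem hj, Option.getD_some,
      Option.getD_some]

theorem TCtx.eq_TX {E : TEnv TA TB} {n m : ℕ} {X : PreCtx A} {Y : PreCtx B}
    {Z : PreCtx (A.tensor B)} (h : TCtx TA TB false X Y Z) (hX : Ext E.Γ X) (hY : Ext E.Δ Y)
    (hCX : CtxR TA n X) (hC : CtxR TB m Y) : Z = TX E X Y := by
  refine eq_grid h.1 fun i j hi hj hh => Prod.ext (h.2 i j hi hj hh).1 ?_
  exact (h.2 i j hi hj hh).2.eq_tsort hA hB (hX.take i) (hY.take j) (hX _ (List.getElem_mem hi))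
    (hY _ (List.getElem_mem hj)) (hC.take j) (hCX.getElem hi) (hC.getElem hj)

theorem TCtx.of_TX {E : TEnv TA TB} {n m : ℕ} {X : PreCtx A} {Y : PreCtx B}
    (hX : Ext E.Γ X) (hY : Ext E.Δ Y)
    (hCX : CtxR TA n X) (hC : CtxR TB m Y) : TCtx TA TB false X Y (TX E X Y) := by
  have nodup {C : Alphabet} {X : PreCtx C} (h : (X.map Prod.fst).Nodup) (i : ℕ)
      (hi : i < X.length) : ∀ p ∈ X.take i, p.1 ≠ X[i].1 := by
    intro p hp e
    have h1 : X = X.take i ++ X[i] :: X.drop (i + 1) := by simp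
    rw [h1, List.map_append, List.nodup_append] at h
    exact h.2.2 p.1 (List.mem_map_of_mem hp) _ (List.mem_cons_self ..) e
  refine ⟨length_grid .., fun i j hi hj hh => ?_⟩
  have e := grid_getElem? (F := fun p q => ((p.1, q.1), cellS E p q)) hi hj
  have e2 : (TX E X Y)[i * Y.length + j] = ((X[i].1, Y[j].1), cellS E X[i] Y[j]) := by
    rw [← Option.some_inj, ← List.getElem?_eq_getElem]; exact e
  rw [e2]
  exact ⟨rfl, TSo.of_tsort hA hB (hX.take i) (hY.take j) (hX _ (List.getElem_mem hi))
    (hY _ (List.getElem_mem hj)) (hC.take j) (hCX.getElem hi) (hC.getElem hj)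
    (nodup hCX.1 i hi) (nodup hC.1 j hj)⟩

end

end

section

variable {A B : Alphabet} {TA : Set (Judg A)} {TB : Set (Judg B)} {Ax : Set (Judg A)}
variable {chA : PreCtx A → A.Var} {chB : PreCtx B → B.Var}

/-- Two extended contexts `X, x : U` and `Y, w : V` over an environment. -/
structure Base (E : TEnv TA TB) (n m : ℕ) (X : PreCtx A) (x : A.Var) (U : SortE A)
    (Y : PreCtx B) (w : B.Var) (V : SortE B) : Prop where
  gx : Ext E.Γ (X ++ [(x, U)])
  gy : Ext E.Δ (Y ++ [(w, V)])
  cx : CtxR TA n (X ++ [(x, U)])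
  cy : CtxR TB m (Y ++ [(w, V)])

section Base
variable {E : TEnv TA TB} {n m : ℕ} {X : PreCtx A} {x : A.Var} {U : SortE A}
  {Y : PreCtx B} {w : B.Var} {V : SortE B}

theorem snoc_ne {X : PreCtx A} {x : A.Var} {U : SortE A}
    (h : ((X ++ [(x, U)]).map Prod.fst).Nodup) : ∀ p ∈ X, p.1 ≠ x := by
  rintro p hp rfl
  rw [List.map_append, List.nodup_append] at h
  exact h.2.2 p.1 (List.mem_map_of_mem hp) _ (List.mem_cons_self ..) rfl

theorem Base.hX (h : Base E n m X x U Y w V) : Ext E.Γ X := h.gx.mono (List.subset_append_left ..)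
theorem Base.hY (h : Base E n m X x U Y w V) : Ext E.Δ Y := h.gy.mono (List.subset_append_left ..)
theorem Base.hx (h : Base E n m X x U Y w V) : E.Γ x = U := h.gx (x, U) (by simp)
theorem Base.hw (h : Base E n m X x U Y w V) : E.Δ w = V := h.gy (w, V) (by simp)
theorem Base.hU (h : Base E n m X x U Y w V) : R TA n (.sort X U) := h.cx.2 X (x, U) [] rfl
theorem Base.hV (h : Base E n m X x U Y w V) : R TB m (.sort Y V) := h.cy.2 Y (w, V) [] rfl
theorem Base.xX (h : Base E n m X x U Y w V) : ∀ p ∈ X, p.1 ≠ x := snoc_ne h.cx.1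
theorem Base.wY (h : Base E n m X x U Y w V) : ∀ p ∈ Y, p.1 ≠ w := snoc_ne h.cy.1
theorem Base.xX' (h : Base E n m X x U Y w V) : x ∉ X.map Prod.fst := by
  rw [List.mem_map]; rintro ⟨p, hp, e⟩; exact h.xX p hp e
theorem Base.wY' (h : Base E n m X x U Y w V) : w ∉ Y.map Prod.fst := by
  rw [List.mem_map]; rintro ⟨p, hp, e⟩; exact h.wY p hp e

theorem Base.admx (h : Base E n m X x U Y w V) : Adm TA E.Γ n X (.var x) := h.hU.adm_sort h.hx
theorem Base.admw (h : Base E n m X x U Y w V) : Adm TB E.Δ m Y (.var w) := h.hV.adm_sort h.hw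

variable (hA : TUniq TA) (hB : TUniq TB)
include hA hB

theorem Base.occurs (h : Base E n m X x U Y w V) {z : (A.tensor B).Var}
    (hz : SOccurs z (tsort E (.var x) U (.var w) V)) :
    z.1 ∈ X.map Prod.fst ∧ (z.2 ∈ Y.map Prod.fst ∨ z.2 = w) ∨
      z.1 = x ∧ z.2 ∈ Y.map Prod.fst := by
  rcases occurs_tsort hz with ⟨a, ha, b, hb, ho⟩ | ⟨b, hb, ho⟩
  · obtain ⟨n', _, rfl, ha'⟩ := h.hU.sort_args ha
    have h2 : Adm TB E.Δ m Y b ∧ (b = .var z.2 → z.2 ∈ Y.map Prod.fst ∨ z.2 = w) := by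
      rcases List.mem_append.1 hb with hb | hb
      · obtain ⟨m', _, rfl, hb'⟩ := h.hV.sort_args hb
        exact ⟨(hb'.adm hB h.hY).le (by omega), fun e => .inl (mem_args_var h.hV hb e)⟩
      · rw [List.mem_singleton] at hb
        subst hb
        exact ⟨h.admw, fun e => .inr (by cases e; rfl)⟩
    have h3 := ten_scope hA hB h.hX h.hY _ _ _ _ _ le_rfl (ha'.adm hA h.hX) h2.1 z ho
    exact .inl ⟨h3.1.elim id (mem_args_var h.hU ha), h3.2.elim .inl h2.2⟩
  · obtain ⟨m', _, rfl, hb'⟩ := h.hV.sort_args hb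
    have h3 := ten_scope hA hB h.hX h.hY _ _ _ _ _ le_rfl h.admx (hb'.adm hB h.hY) z ho
    have h4 : z.2 ∈ Y.map Prod.fst := h3.2.elim id (mem_args_var h.hV hb)
    rcases h3.1 with h5 | h5
    · exact .inl ⟨h5, .inl h4⟩
    · exact .inr ⟨by cases h5; rfl, h4⟩

omit hA hB in
theorem tmap_id (E : TEnv TA TB) (x : A.Var) (y : B.Var) :
    tmap E Expr.var Expr.var (x, y) = .var (x, y) := ten_var_var ..

theorem Base.substL_left (h : Base E n m X x U Y w V) {v : Expr B} {g : ℕ → Expr (A.tensor B)}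
    (hg : ∀ i (hi : i < X.length), g i = ten E (.var X[i].1) v) :
    (tsort E (.var x) U (.var w) V).substL (pairsL X w g) =
      (tsort E (.var x) U (.var w) V).subst (tmap E .var (upd .var w v)) := by
  rw [pairsL_eq (H := tmap E .var (upd .var w v)), ssubstL_eq]
  · rintro ⟨z1, z2⟩ hz
    by_cases e : z2 = w
    · rcases h.occurs hA hB hz with h1 | h1
      · obtain ⟨p, hp, e2⟩ := List.mem_map.1 h1.1
        exact .inl (List.mem_map.2 ⟨p, hp, Prod.ext e2 e.symm⟩)
      · exact absurd (e ▸ h1.2) h.wY'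
    · right
      rw [tmap_mk, upd_ne _ e, ten_var_var]
  · intro i hi
    rw [hg i hi, tmap_mk, upd_self]

theorem Base.substL_right (h : Base E n m X x U Y w V) {u : Expr A} {g : ℕ → Expr (A.tensor B)}
    (hg : ∀ j (hj : j < Y.length), g j = ten E u (.var Y[j].1)) :
    (tsort E (.var x) U (.var w) V).substL (pairsR x Y g) =
      (tsort E (.var x) U (.var w) V).subst (tmap E (upd .var x u) .var) := by
  rw [pairsR_eq (H := tmap E (upd .var x u) .var), ssubstL_eq]
  · rintro ⟨z1, z2⟩ hz
    by_cases e : z1 = x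
    · rcases h.occurs hA hB hz with h1 | h1
      · exact absurd (e ▸ h1.1) h.xX'
      · obtain ⟨p, hp, e2⟩ := List.mem_map.1 h1.2
        exact .inl (List.mem_map.2 ⟨p, hp, Prod.ext e.symm e2⟩)
    · right
      rw [tmap_mk, upd_ne _ e, ten_var_var]
  · intro i hi
    rw [hg i hi, tmap_mk, upd_self]

theorem Base.substL_both (h : Base E n m X x U Y w V) {u : Expr A} {v : Expr B}
    {gx gy : ℕ → Expr (A.tensor B)}
    (hgx : ∀ i (hi : i < X.length), gx i = ten E (.var X[i].1) v)
    (hgy : ∀ j (hj : j < Y.length), gy j = ten E u (.var Y[j].1)) :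
    (tsort E (.var x) U (.var w) V).substL (pairsL X w gx ++ pairsR x Y gy) =
      (tsort E (.var x) U (.var w) V).subst (tmap E (upd .var x u) (upd .var w v)) := by
  rw [pairsL_eq (H := tmap E (upd .var x u) (upd .var w v)),
    pairsR_eq (H := tmap E (upd .var x u) (upd .var w v)), ← List.map_append, ssubstL_eq]
  · rintro ⟨z1, z2⟩ hz
    rw [List.mem_append]
    by_cases e : z1 = x
    · rcases h.occurs hA hB hz with h1 | h1
      · exact absurd (e ▸ h1.1) h.xX'
      · obtain ⟨p, hp, e2⟩ := List.mem_map.1 h1.2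
        exact .inl (.inr (List.mem_map.2 ⟨p, hp, Prod.ext e.symm e2⟩))
    · by_cases e' : z2 = w
      · rcases h.occurs hA hB hz with h1 | h1
        · obtain ⟨p, hp, e2⟩ := List.mem_map.1 h1.1
          exact .inl (.inl (List.mem_map.2 ⟨p, hp, Prod.ext e2 e'.symm⟩))
        · exact absurd (e' ▸ h1.2) h.wY'
      · right
        rw [tmap_mk, upd_ne _ e, upd_ne _ e', ten_var_var]
  · intro i hi
    rw [hgy i hi, tmap_mk, upd_self, upd_ne _ (h.wY _ (List.getElem_mem hi))]
  · intro i hi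
    rw [hgx i hi, tmap_mk, upd_self, upd_ne _ (h.xX _ (List.getElem_mem hi))]

theorem Base.substL_term (h : Base E n m X x U Y w V) {u : Expr A} {v : Expr B}
    (hu : R TA n (.term X u U)) {gx : ℕ → Expr (A.tensor B)}
    (hgx : ∀ i (hi : i < X.length), gx i = ten E (.var X[i].1) v) :
    (ten E u (.var w)).substL (pairsL X w gx) =
      (ten E u (.var w)).subst (tmap E .var (upd .var w v)) := by
  rw [pairsL_eq (H := tmap E .var (upd .var w v)), substL_eq]
  · rintro ⟨z1, z2⟩ hz
    by_cases e : z2 = w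
    · have h3 := ten_scope hA hB h.hX h.hY _ _ _ _ _ le_rfl (hu.adm hA h.hX) h.admw _ hz
      have h4 : z1 ∈ X.map Prod.fst := h3.1.elim id fun e => hu.scope_term (by rw [e]; exact .var)
      obtain ⟨p, hp, e2⟩ := List.mem_map.1 h4
      exact .inl (List.mem_map.2 ⟨p, hp, Prod.ext e2 e.symm⟩)
    · right
      rw [tmap_mk, upd_ne _ e, ten_var_var]
  · intro i hi
    rw [hgx i hi, tmap_mk, upd_self]

end Base

end

section

variable {A B : Alphabet} {TA : Set (Judg A)} {TB : Set (Judg B)} {Ax : Set (Judg A)}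
variable {chA : PreCtx A → A.Var} {chB : PreCtx B → B.Var}

/-- The tensor precontext of two extended contexts, without its last entry. -/
noncomputable def TX0 (E : TEnv TA TB) (X : PreCtx A) (p : A.Var × SortE A) (Y : PreCtx B)
    (q : B.Var × SortE B) : PreCtx (A.tensor B) :=
  TX E X (Y ++ [q]) ++ Y.map fun q => ((p.1, q.1), cellS E p q)

theorem TX_dropLast (E : TEnv TA TB) (X : PreCtx A) (p : A.Var × SortE A) (Y : PreCtx B)
    (q : B.Var × SortE B) : (TX E (X ++ [p]) (Y ++ [q])).dropLast = TX0 E X p Y q :=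
  dropLast_grid ..

section
variable {E : TEnv TA TB} {n m k : ℕ} {X : PreCtx A} {U : SortE A} {Y : PreCtx B} {V : SortE B}
  {x : A.Var} {w : B.Var}
/-- The same extended contexts with the last sort of the first one replaced. -/
theorem Base.updA (h : Base E n m X x U Y w V) {U' : SortE A} (hU' : R TA n (.sort X U')) :
    Base (⟨upd E.Γ x U', E.Δ⟩ : TEnv TA TB) n m X x U' Y w V := by
  refine ⟨fun p hp => ?_, h.gy, h.cx.initial.snoc h.xX hU', h.cy⟩
  rcases List.mem_append.1 hp with hp | hp
  · exact h.hX.upd h.xX _ p hp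
  · rw [List.mem_singleton] at hp; subst hp; exact upd_self ..

theorem Base.updB (h : Base E n m X x U Y w V) {V' : SortE B} (hV' : R TB m (.sort Y V')) :
    Base (⟨E.Γ, upd E.Δ w V'⟩ : TEnv TA TB) n m X x U Y w V' := by
  refine ⟨h.gx, fun p hp => ?_, h.cx, h.cy.initial.snoc h.wY hV'⟩
  rcases List.mem_append.1 hp with hp | hp
  · exact h.hY.upd h.wY _ p hp
  · rw [List.mem_singleton] at hp; subst hp; exact upd_self ..

variable (hA : TUniq TA) (hB : TUniq TB)
include hA hB

theorem Base.tso (h : Base E n m X x U Y w V) :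
    TSo TA TB false X x U Y w V (tsort E (.var x) U (.var w) V) :=
  TSo.of_tsort hA hB h.hX h.hY h.hx h.hw h.cy.initial h.hU h.hV h.xX h.wY

theorem Base.tctx (h : Base E n m X x U Y w V) :
    TCtx TA TB false (X ++ [(x, U)]) (Y ++ [(w, V)]) (TX E (X ++ [(x, U)]) (Y ++ [(w, V)])) :=
  TCtx.of_TX hA hB h.gx h.gy h.cx h.cy

theorem Base.row (h : Base E n m X x U Y w V) {v : Expr B} (hv : Adm TB E.Δ m Y v) :
    ∃ g : ℕ → Expr (A.tensor B), (∀ i (hi : i < X.length), g i = ten E (.var X[i].1) v) ∧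
      ∀ i (hi : i < X.length), TTg TA TB false ⟨X.take i, .var X[i].1, X[i].2⟩ ⟨Y, v, V⟩ (g i) := by
  refine ⟨fun i => ten E (.var (X[i]?.getD (x, U)).1) v, fun i hi => ?_, fun i hi => ?_⟩
  · beta_reduce
    rw [List.getElem?_eq_getElem hi, Option.getD_some]
  · beta_reduce
    rw [List.getElem?_eq_getElem hi, Option.getD_some]
    have := h.hX _ (List.getElem_mem hi)
    exact TTg.of_adm hA hB n m m E _ _ _ _ _ _ (h.hX.take i) h.hY h.cy.initial
      ((h.cx.initial.getElem hi).adm_sort this) hv (fun _ _ _ => this.symm) fun _ _ _ _ h => nomatch h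

theorem Base.col (h : Base E n m X x U Y w V) {u : Expr A} (hu : Adm TA E.Γ n X u) :
    ∃ g : ℕ → Expr (A.tensor B), (∀ j (hj : j < Y.length), g j = ten E u (.var Y[j].1)) ∧
      ∀ j (hj : j < Y.length), TTg TA TB false ⟨X, u, U⟩ ⟨Y.take j, .var Y[j].1, Y[j].2⟩ (g j) := by
  refine ⟨fun i => ten E u (.var (Y[i]?.getD (w, V)).1), fun i hi => ?_, fun i hi => ?_⟩
  · beta_reduce
    rw [List.getElem?_eq_getElem hi, Option.getD_some]
  · beta_reduce
    rw [List.getElem?_eq_getElem hi, Option.getD_some]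
    have := h.hY _ (List.getElem_mem hi)
    exact TTg.of_adm hA hB n m m E _ _ _ _ _ _ h.hX (h.hY.take i) (h.cy.initial.take i)
      hu ((h.cy.initial.getElem hi).adm_sort this) (fun _ _ h => nomatch h) fun y _ _ hy _ => by
        cases hy; exact this.symm

theorem Base.cellx (h : Base E n m X x U Y w V) {v : Expr B} (hv : Adm TB E.Δ m Y v)
    (V' : SortE B) : TTg TA TB false ⟨X, .var x, U⟩ ⟨Y, v, V'⟩ (ten E (.var x) v) :=
  TTg.of_adm hA hB n m m E _ _ _ _ _ _ h.hX h.hY h.cy.initial h.admx hv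
    (fun _ _ _ => h.hx.symm) fun _ _ _ _ h => nomatch h

theorem Base.cellw (h : Base E n m X x U Y w V) {u : Expr A} (hu : Adm TA E.Γ n X u)
    (U' : SortE A) : TTg TA TB false ⟨X, u, U'⟩ ⟨Y, .var w, V⟩ (ten E u (.var w)) :=
  TTg.of_adm hA hB n m m E _ _ _ _ _ _ h.hX h.hY h.cy.initial hu h.admw
    (fun _ _ h => nomatch h) fun y _ _ hy _ => by cases hy; exact h.hw.symm

theorem Base.ax_ss (h : Base E n m X (chA X) U Y (chB Y) V) (hJ : Judg.sort X U ∈ TA)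
    (hJ' : Judg.sort Y V ∈ TB) :
    Judg.sort (TX0 E X (chA X, U) Y (chB Y, V)) (tsort E (.var (chA X)) U (.var (chB Y)) V) ∈
      tensorAx TA TB chA chB := by
  rw [← TX_dropLast]
  exact ⟨_, _, hJ, hJ', .ss (h.tctx hA hB) (h.tso hA hB)⟩

theorem Base.ax_seqs (h : Base E n m X (chA X) U Y (chB Y) V) {U' : SortE A}
    (hU' : R TA n (.sort X U')) (hJ : Judg.sortEq X U U' ∈ TA) (hJ' : Judg.sort Y V ∈ TB) :
    Judg.sortEq (TX0 E X (chA X, U) Y (chB Y, V)) (tsort E (.var (chA X)) U (.var (chB Y)) V)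
      (tsort (⟨upd E.Γ (chA X) U', E.Δ⟩ : TEnv TA TB) (.var (chA X)) U' (.var (chB Y)) V) ∈
      tensorAx TA TB chA chB := by
  rw [← TX_dropLast]
  exact ⟨_, _, hJ, hJ', .seqs (h.tctx hA hB) (h.tso hA hB) ((h.updA hU').tso hA hB)⟩

theorem Base.ax_sseq (h : Base E n m X (chA X) U Y (chB Y) V) {V' : SortE B}
    (hV' : R TB m (.sort Y V')) (hJ : Judg.sort X U ∈ TA) (hJ' : Judg.sortEq Y V V' ∈ TB) :
    Judg.sortEq (TX0 E X (chA X, U) Y (chB Y, V)) (tsort E (.var (chA X)) U (.var (chB Y)) V)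
      (tsort (⟨E.Γ, upd E.Δ (chB Y) V'⟩ : TEnv TA TB) (.var (chA X)) U (.var (chB Y)) V') ∈
      tensorAx TA TB chA chB := by
  rw [← TX_dropLast]
  exact ⟨_, _, hJ, hJ', .sseq (h.tctx hA hB) (h.tso hA hB) ((h.updB hV').tso hA hB)⟩

theorem Base.tctxA (h : Base E n m X x U Y w V) :
    TCtx TA TB false (X ++ [(x, U)]) Y (TX E (X ++ [(x, U)]) Y) :=
  TCtx.of_TX hA hB h.gx h.hY h.cx h.cy.initial

theorem Base.tctxB (h : Base E n m X x U Y w V) :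
    TCtx TA TB false X (Y ++ [(w, V)]) (TX E X (Y ++ [(w, V)])) :=
  TCtx.of_TX hA hB h.hX h.gy h.cx.initial h.cy

theorem Base.ax_st (h : Base E n m X (chA X) U Y (chB Y) V) {v : Expr B}
    (hv : R TB m (.term Y v V)) (hJ : Judg.sort X U ∈ TA) (hJ' : Judg.term Y v V ∈ TB) :
    Judg.term (TX E (X ++ [(chA X, U)]) Y) (ten E (.var (chA X)) v)
      ((tsort E (.var (chA X)) U (.var (chB Y)) V).subst (tmap E .var (upd .var (chB Y) v))) ∈
      tensorAx TA TB chA chB := by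
  have hv' := hv.adm hB h.hY
  obtain ⟨g, hg, hg'⟩ := h.row hA hB hv'
  rw [← h.substL_left hA hB hg]
  exact ⟨_, _, hJ, hJ', .st (h.tctxA hA hB) (h.cellx hA hB hv' _) (h.tso hA hB) hg'⟩

theorem Base.ax_ts (h : Base E n m X (chA X) U Y (chB Y) V) {u : Expr A}
    (hu : R TA n (.term X u U)) (hJ : Judg.term X u U ∈ TA) (hJ' : Judg.sort Y V ∈ TB) :
    Judg.term (TX E X (Y ++ [(chB Y, V)])) (ten E u (.var (chB Y)))
      ((tsort E (.var (chA X)) U (.var (chB Y)) V).subst (tmap E (upd .var (chA X) u) .var)) ∈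
      tensorAx TA TB chA chB := by
  have hu' := hu.adm hA h.hX
  obtain ⟨g, hg, hg'⟩ := h.col hA hB hu'
  rw [← h.substL_right hA hB hg]
  exact ⟨_, _, hJ, hJ', .ts (h.tctxB hA hB) (h.cellw hA hB hu' _) (h.tso hA hB) hg'⟩

theorem Base.ax_steq (h : Base E n m X (chA X) U Y (chB Y) V) {v v' : Expr B}
    (hv : R TB m (.term Y v V)) (hv' : R TB m (.term Y v' V)) (hJ : Judg.sort X U ∈ TA)
    (hJ' : Judg.termEq Y v v' V ∈ TB) :
    Judg.termEq (TX E (X ++ [(chA X, U)]) Y) (ten E (.var (chA X)) v) (ten E (.var (chA X)) v')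
      ((tsort E (.var (chA X)) U (.var (chB Y)) V).subst (tmap E .var (upd .var (chB Y) v))) ∈
      tensorAx TA TB chA chB := by
  obtain ⟨g, hg, hg'⟩ := h.row hA hB (hv.adm hB h.hY)
  rw [← h.substL_left hA hB hg]
  exact ⟨_, _, hJ, hJ', .steq (h.tctxA hA hB) (h.cellx hA hB (hv.adm hB h.hY) _)
    (h.cellx hA hB (hv'.adm hB h.hY) _) (h.tso hA hB) hg'⟩

theorem Base.ax_teqs (h : Base E n m X (chA X) U Y (chB Y) V) {u u' : Expr A}
    (hu : R TA n (.term X u U)) (hu' : R TA n (.term X u' U)) (hJ : Judg.termEq X u u' U ∈ TA)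
    (hJ' : Judg.sort Y V ∈ TB) :
    Judg.termEq (TX E X (Y ++ [(chB Y, V)])) (ten E u (.var (chB Y))) (ten E u' (.var (chB Y)))
      ((tsort E (.var (chA X)) U (.var (chB Y)) V).subst (tmap E (upd .var (chA X) u) .var)) ∈
      tensorAx TA TB chA chB := by
  obtain ⟨g, hg, hg'⟩ := h.col hA hB (hu.adm hA h.hX)
  rw [← h.substL_right hA hB hg]
  exact ⟨_, _, hJ, hJ', .teqs (h.tctxB hA hB) (h.cellw hA hB (hu.adm hA h.hX) _)
    (h.cellw hA hB (hu'.adm hA h.hX) _) (h.tso hA hB) hg'⟩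

theorem Base.ax_seqt (h : Base E n m X (chA X) U Y (chB Y) V) {U' : SortE A} {v : Expr B}
    (hU' : R TA n (.sort X U')) (hv : R TB m (.term Y v V)) (hJ : Judg.sortEq X U U' ∈ TA)
    (hJ' : Judg.term Y v V ∈ TB) :
    Judg.termEq (TX E (X ++ [(chA X, U)]) Y) (ten E (.var (chA X)) v)
      (ten (⟨upd E.Γ (chA X) U', E.Δ⟩ : TEnv TA TB) (.var (chA X)) v)
      ((tsort E (.var (chA X)) U (.var (chB Y)) V).subst (tmap E .var (upd .var (chB Y) v))) ∈
      tensorAx TA TB chA chB := by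
  obtain ⟨g, hg, hg'⟩ := h.row hA hB (hv.adm hB h.hY)
  rw [← h.substL_left hA hB hg]
  exact ⟨_, _, hJ, hJ', .seqt (h.tctxA hA hB) (h.cellx hA hB (hv.adm hB h.hY) _)
    ((h.updA hU').cellx hA hB (hv.adm hB h.hY) _) (h.tso hA hB) hg'⟩

theorem Base.ax_tseq (h : Base E n m X (chA X) U Y (chB Y) V) {V' : SortE B} {u : Expr A}
    (hV' : R TB m (.sort Y V')) (hu : R TA n (.term X u U)) (hJ : Judg.term X u U ∈ TA)
    (hJ' : Judg.sortEq Y V V' ∈ TB) :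
    Judg.termEq (TX E X (Y ++ [(chB Y, V)])) (ten E u (.var (chB Y)))
      (ten (⟨E.Γ, upd E.Δ (chB Y) V'⟩ : TEnv TA TB) u (.var (chB Y)))
      ((tsort E (.var (chA X)) U (.var (chB Y)) V).subst (tmap E (upd .var (chA X) u) .var)) ∈
      tensorAx TA TB chA chB := by
  obtain ⟨g, hg, hg'⟩ := h.col hA hB (hu.adm hA h.hX)
  rw [← h.substL_right hA hB hg]
  exact ⟨_, _, hJ, hJ', .tseq (h.tctxB hA hB) (h.cellw hA hB (hu.adm hA h.hX) _)
    ((h.updB hV').cellw hA hB (hu.adm hA h.hX) _) (h.tso hA hB) hg'⟩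

theorem Base.ax_tt (h : Base E n m X (chA X) U Y (chB Y) V) {s : A.TermSym} {f : List (Expr A)}
    {t : B.TermSym} {g : List (Expr B)} (hU : U = E.sA (.app s f))
    (hu : R TA n (.term X (.app s f) U)) (hv : R TB m (.term Y (.app t g) V))
    (hJ : Judg.term X (.app s f) U ∈ TA) (hJ' : Judg.term Y (.app t g) V ∈ TB) :
    Judg.termEq (TX E X Y) (ten E (.app s f) (.app t g))
      ((ten E (.app s f) (.var (chB Y))).subst (tmap E .var (upd .var (chB Y) (.app t g))))
      ((tsort E (.var (chA X)) U (.var (chB Y)) V).subst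
        (tmap E (upd .var (chA X) (.app s f)) (upd .var (chB Y) (.app t g)))) ∈
      tensorAx TA TB chA chB := by
  obtain ⟨gx, hgx, hgx'⟩ := h.row hA hB (hv.adm hB h.hY)
  obtain ⟨gy, hgy, hgy'⟩ := h.col hA hB (hu.adm hA h.hX)
  rw [← h.substL_both hA hB hgx hgy, ← h.substL_term hA hB hu hgx]
  exact ⟨_, _, hJ, hJ', .tt (TCtx.of_TX hA hB h.hX h.hY h.cx.initial h.cy.initial)
    (TTg.of_adm hA hB n m m E _ _ _ _ _ _ h.hX h.hY h.cy.initial (hu.adm hA h.hX)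
      (hv.adm hB h.hY) (fun _ _ _ => hU) fun _ _ _ h => nomatch h)
    (.appapp_base h.wY _ (h.cellw hA hB (hu.adm hA h.hX) _) gx hgx') (h.tso hA hB) hgx' hgy'⟩

end

end

section

variable {A B : Alphabet} {TA : Set (Judg A)} {TB : Set (Judg B)} {Ax : Set (Judg A)}
variable {chA : PreCtx A → A.Var} {chB : PreCtx B → B.Var}

/-- Every axiom is derivable in the graded system. -/
structure GoodTh (Ax : Set (Judg A)) : Prop where
  pre : IsPretheory Ax
  ax : ∀ J ∈ Ax, ∃ n, J.RGood Ax n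

theorem IsGAT.goodTh (h : IsGAT Ax) : GoodTh Ax :=
  ⟨h.1, fun J hJ => let ⟨n, hn⟩ := h.2 J hJ; ⟨n, RGood_of_DerAt h.1 n J hn⟩⟩

theorem GoodTh.tUniq (h : GoodTh Ax) : TUniq Ax := h.pre.tUniq

theorem exists_ext [Inhabited (SortE A)] {X : PreCtx A} (h : (X.map Prod.fst).Nodup) :
    ∃ Γ : A.Var → SortE A, Ext Γ X := by
  induction X using List.reverseRecOn with
  | nil => exact ⟨fun _ => default, fun p hp => by simp at hp⟩
  | append_singleton X p ih =>
    have h' : (X.map Prod.fst).Nodup := by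
      rw [List.map_append] at h; exact (List.nodup_append.1 h).1
    obtain ⟨Γ, hΓ⟩ := ih h'
    refine ⟨upd Γ p.1 p.2, fun q hq => ?_⟩
    rcases List.mem_append.1 hq with hq | hq
    · exact hΓ.upd (snoc_ne (U := p.2) h) _ q hq
    · rw [List.mem_singleton] at hq; subst hq; exact upd_self ..

theorem CtxR.snoc_ch {ch : PreCtx A → A.Var} (hch : FreshCh ch) {n : ℕ} {X : PreCtx A}
    {U : SortE A} (h : CtxR Ax n X) (hU : R Ax n (.sort X U)) :
    CtxR Ax n (X ++ [(ch X, U)]) := h.snoc (hch X) hU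

theorem exists_base (hchA : FreshCh chA) (hchB : FreshCh chB) {n m : ℕ} {X : PreCtx A}
    {U : SortE A} {Y : PreCtx B} {V : SortE B} (hX : CtxR TA n X) (hU : R TA n (.sort X U))
    (hY : CtxR TB m Y) (hV : R TB m (.sort Y V)) :
    ∃ E : TEnv TA TB, Base E n m X (chA X) U Y (chB Y) V := by
  have : Inhabited (SortE A) := ⟨U⟩
  have : Inhabited (SortE B) := ⟨V⟩
  obtain ⟨Γ, hΓ⟩ := exists_ext (hX.snoc_ch hchA hU).1
  obtain ⟨Δ, hΔ⟩ := exists_ext (hY.snoc_ch hchB hV).1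
  exact ⟨⟨Γ, Δ⟩, hΓ, hΔ, hX.snoc_ch hchA hU, hY.snoc_ch hchB hV⟩

theorem GoodTh.term_intro {X : PreCtx A} {u : Expr A} {U : SortE A} (h : GoodTh Ax)
    (hJ : Judg.term X u U ∈ Ax) : ∃ t, u = .app t (ctxVars X) ∧ introTerm X t U ∈ Ax := by
  obtain ⟨t, rfl⟩ := h.pre.term_shape X u U hJ
  exact ⟨t, rfl, hJ⟩

theorem GoodTh.sort_intro {X : PreCtx A} {U : SortE A} (h : GoodTh Ax)
    (hJ : Judg.sort X U ∈ Ax) : ∃ S, U = ⟨S, ctxVars X⟩ ∧ introSort X S ∈ Ax := by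
  have := h.pre.sort_shape X U hJ
  obtain ⟨S, l⟩ := U
  simp only at this
  subst this
  exact ⟨S, rfl, hJ⟩

/-- The inversion of the introductory axioms of the tensor theory. -/
theorem tensorAx_term (hA : GoodTh TA) (hB : GoodTh TB) (hchA : FreshCh chA) (hchB : FreshCh chB)
    {Z : PreCtx (A.tensor B)} {e : Expr (A.tensor B)} {W : SortE (A.tensor B)}
    (h : Judg.term Z e W ∈ tensorAx TA TB chA chB) :
    (∃ X S Y t V, introSort X S ∈ TA ∧ introTerm Y t V ∈ TB ∧
      TJudg TA TB chA chB false (introSort X S) (introTerm Y t V) (.term Z e W) ∧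
      ∃ l, e = .app (.inl (S, t)) l) ∨
    (∃ X s U Y T, introTerm X s U ∈ TA ∧ introSort Y T ∈ TB ∧
      TJudg TA TB chA chB false (introTerm X s U) (introSort Y T) (.term Z e W) ∧
      ∃ l, e = .app (.inr (s, T)) l) := by
  obtain ⟨J, J', hJ, hJ', h⟩ := h
  cases h with
  | @st X U Y v V Z e W g hZ he hW hg =>
    left
    obtain ⟨S, rfl, hS⟩ := hA.sort_intro hJ
    obtain ⟨t, rfl, ht⟩ := hB.term_intro hJ'
    refine ⟨X, S, Y, t, V, hS, ht, .st hZ he hW hg, ?_⟩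
    cases he; exact ⟨_, rfl⟩
  | @ts X u U Y V Z e W g hZ he hW hg =>
    right
    obtain ⟨s, rfl, hs⟩ := hA.term_intro hJ
    obtain ⟨T, rfl, hT⟩ := hB.sort_intro hJ'
    refine ⟨X, s, U, Y, T, hs, hT, .ts hZ he hW hg, ?_⟩
    cases he; exact ⟨_, rfl⟩

theorem st_unique (hA : GoodTh TA) (hB : GoodTh TB) (hchA : FreshCh chA) (hchB : FreshCh chB)
    {X : PreCtx A} {U : SortE A} {Y : PreCtx B} {v : Expr B} {V : SortE B}
    (hJ : Judg.sort X U ∈ TA) (hJ' : Judg.term Y v V ∈ TB) :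
    ∃ Z W, ∀ Z' e' W', TJudg TA TB chA chB false (.sort X U) (.term Y v V) (.term Z' e' W') →
      Z' = Z ∧ W' = W := by
  obtain ⟨n, hX, hU⟩ := hA.ax _ hJ
  obtain ⟨m, hY, hv⟩ := hB.ax _ hJ'
  obtain ⟨E, h⟩ := exists_base hchA hchB hX hU hY hv.sort_of_term
  have hA' := hA.tUniq
  have hB' := hB.tUniq
  refine ⟨TX E (X ++ [(chA X, U)]) Y,
    (tsort E (.var (chA X)) U (.var (chB Y)) V).subst (tmap E .var (upd .var (chB Y) v)), ?_⟩
  intro Z' e' W' hh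
  cases hh with
  | st hZ he hW hg =>
    refine ⟨hZ.eq_TX hA' hB' h.gx h.hY h.cx h.cy.initial, ?_⟩
    rw [hW.eq_tsort hA' hB' h.hX h.hY h.hx h.hw h.cy.initial h.hU h.hV]
    refine h.substL_left hA' hB' fun i hi => ?_
    have := h.hX _ (List.getElem_mem hi)
    exact (hg i hi).eq_ten hA' hB' rfl E n m m (h.hX.take i) h.hY h.cy.initial
      ((h.cx.initial.getElem hi).adm_sort this) (hv.adm hB' h.hY) (fun _ _ _ => this.symm)
      fun y hy => by subst hy; obtain ⟨t, ht, -⟩ := hB.term_intro hJ'; exact nomatch ht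

theorem ts_unique (hA : GoodTh TA) (hB : GoodTh TB) (hchA : FreshCh chA) (hchB : FreshCh chB)
    {X : PreCtx A} {U : SortE A} {Y : PreCtx B} {u : Expr A} {V : SortE B}
    (hJ : Judg.term X u U ∈ TA) (hJ' : Judg.sort Y V ∈ TB) :
    ∃ Z W, ∀ Z' e' W', TJudg TA TB chA chB false (.term X u U) (.sort Y V) (.term Z' e' W') →
      Z' = Z ∧ W' = W := by
  obtain ⟨n, hX, hu⟩ := hA.ax _ hJ
  obtain ⟨m, hY, hV⟩ := hB.ax _ hJ'
  obtain ⟨E, h⟩ := exists_base hchA hchB hX hu.sort_of_term hY hV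
  have hA' := hA.tUniq
  have hB' := hB.tUniq
  refine ⟨TX E X (Y ++ [(chB Y, V)]),
    (tsort E (.var (chA X)) U (.var (chB Y)) V).subst (tmap E (upd .var (chA X) u) .var), ?_⟩
  intro Z' e' W' hh
  cases hh with
  | ts hZ he hW hg =>
    refine ⟨hZ.eq_TX hA' hB' h.hX h.gy h.cx.initial h.cy, ?_⟩
    rw [hW.eq_tsort hA' hB' h.hX h.hY h.hx h.hw h.cy.initial h.hU h.hV]
    refine h.substL_right hA' hB' fun j hj => ?_
    have := h.hY _ (List.getElem_mem hj)
    exact (hg j hj).eq_ten hA' hB' rfl E n m m h.hX (h.hY.take j) (h.cy.initial.take j)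
      (hu.adm hA' h.hX) ((h.cy.initial.getElem hj).adm_sort this) (fun _ _ e => nomatch e)
      fun y hy => by cases hy; exact this.symm

theorem tensor_tUniq (hA : GoodTh TA) (hB : GoodTh TB) (hchA : FreshCh chA) (hchB : FreshCh chB) :
    TUniq (tensorAx TA TB chA chB) := by
  intro t Z V Z' V' h h'
  rcases tensorAx_term hA hB hchA hchB h with
    ⟨X, S, Y, t0, V0, h1, h2, h3, l, h4⟩ | ⟨X, s, U, Y, T, h1, h2, h3, l, h4⟩ <;>
  rcases tensorAx_term hA hB hchA hchB h' with
    ⟨X', S', Y', t0', V0', h1', h2', h3', l', h4'⟩ | ⟨X', s', U', Y', T', h1', h2', h3', l', h4'⟩ <;>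
  · injection h4 with h4
    injection h4' with h4' _
    subst h4
    cases h4'
    all_goals
      first
      | obtain rfl := (hA.pre.sort_intro S).unique h1 h1'
        obtain ⟨rfl, rfl⟩ := hB.tUniq _ _ _ _ _ h2 h2'
        obtain ⟨Z0, W0, hh⟩ := st_unique hA hB hchA hchB h1 h2
        obtain ⟨rfl, rfl⟩ := hh _ _ _ h3
        obtain ⟨rfl, rfl⟩ := hh _ _ _ h3'
        exact ⟨rfl, rfl⟩
      | obtain rfl := (hB.pre.sort_intro T).unique h2 h2'
        obtain ⟨rfl, rfl⟩ := hA.tUniq _ _ _ _ _ h1 h1'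
        obtain ⟨Z0, W0, hh⟩ := ts_unique hA hB hchA hchB h1 h2
        obtain ⟨rfl, rfl⟩ := hh _ _ _ h3
        obtain ⟨rfl, rfl⟩ := hh _ _ _ h3'
        exact ⟨rfl, rfl⟩

end

section

variable {A B : Alphabet} {TA : Set (Judg A)} {TB : Set (Judg B)}
  {T : Set (Judg (A.tensor B))}

/-! ### Congruence of the constructions `tsort`, `Lf` and `Rf` -/

/-- The shape of a tensor sort, for an arbitrary operation on terms. -/
def tsortF (F : Expr A → Expr B → Expr (A.tensor B)) (u : Expr A) (U : SortE A) (v : Expr B)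
    (V : SortE B) : SortE (A.tensor B) :=
  ⟨(U.head, V.head), grid U.args (V.args ++ [v]) F ++ V.args.map (F u)⟩

/-- The shape of a left unfolded tensor term, for an arbitrary operation on terms. -/
def LfF (F : Expr A → Expr B → Expr (A.tensor B)) (u : Expr A) (U : SortE A) (t : B.TermSym)
    (g : List (Expr B)) : Expr (A.tensor B) :=
  .app (Sum.inl (U.head, t)) (grid (U.args ++ [u]) g F)

/-- The shape of a right unfolded tensor term, for an arbitrary operation on terms. -/
def RfF (F : Expr A → Expr B → Expr (A.tensor B)) (s : A.TermSym) (f : List (Expr A)) (v : Expr B)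
    (V : SortE B) : Expr (A.tensor B) :=
  .app (Sum.inr (s, V.head)) (grid f (V.args ++ [v]) F)

theorem tsort_eqF (E : TEnv TA TB) : tsort E = tsortF (ten E) := rfl
theorem Lf_eqF (E : TEnv TA TB) : Lf E = LfF (ten E) := rfl
theorem Rf_eqF (E : TEnv TA TB) : Rf E = RfF (ten E) := rfl

theorem tsortF_subst (F : Expr A → Expr B → Expr (A.tensor B))
    (Θ : (A.tensor B).Var → Expr (A.tensor B)) (u : Expr A) (U : SortE A) (v : Expr B)
    (V : SortE B) :
    (tsortF F u U v V).subst Θ = tsortF (fun a b => (F a b).subst Θ) u U v V := by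
  rw [tsortF, SortE.subst, List.map_append, map_grid, List.map_map]
  rfl

theorem LfF_subst (F : Expr A → Expr B → Expr (A.tensor B))
    (Θ : (A.tensor B).Var → Expr (A.tensor B)) (u : Expr A) (U : SortE A) (t : B.TermSym)
    (g : List (Expr B)) :
    (LfF F u U t g).subst Θ = LfF (fun a b => (F a b).subst Θ) u U t g := by
  rw [LfF, subst_app, map_grid]
  rfl

theorem RfF_subst (F : Expr A → Expr B → Expr (A.tensor B))
    (Θ : (A.tensor B).Var → Expr (A.tensor B)) (s : A.TermSym) (f : List (Expr A)) (v : Expr B)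
    (V : SortE B) :
    (RfF F s f v V).subst Θ = RfF (fun a b => (F a b).subst Θ) s f v V := by
  rw [RfF, subst_app, map_grid]
  rfl

theorem forall₂_snoc {α β : Type} {Q : α → β → Prop} {l : List α} {l' : List β} {a : α} {b : β}
    (h : List.Forall₂ Q l l') (h' : Q a b) : List.Forall₂ Q (l ++ [a]) (l' ++ [b]) :=
  List.rel_append h (.cons h' .nil)

theorem forall₂_self {α : Type} {Q : α → α → Prop} {l : List α} (h : ∀ a ∈ l, Q a a) :
    List.Forall₂ Q l l := List.forall₂_same.2 h

theorem forall₂_map {α β : Type} {Q : α → β → Prop} {l : List α} {f : α → β}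
    (h : ∀ a ∈ l, Q a (f a)) : List.Forall₂ Q l (l.map f) :=
  List.forall₂_map_right_iff.2 (List.forall₂_same.2 h)

section
variable {Z : PreCtx (A.tensor B)} {F G : Expr A → Expr B → Expr (A.tensor B)}
  {u u' : Expr A} {U U' : SortE A} {v v' : Expr B} {V V' : SortE B}
  {Q : Expr A → Expr A → Prop} {Q' : Expr B → Expr B → Prop}
variable (hT : TUniq T) (hZ : Fn Z)
include hT hZ

theorem tsortF_congr (h : Dv T (.sort Z (tsortF F u U v V)))
    (eU : U.head = U'.head) (eV : V.head = V'.head)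
    (hU : List.Forall₂ Q U.args U'.args) (hV : List.Forall₂ Q' V.args V'.args)
    (h1 : ∀ a a' b b', Q a a' → Q' b b' → Eqv T Z (F a b) (G a' b'))
    (h2 : ∀ a a', Q a a' → Eqv T Z (F a v) (G a' v'))
    (h3 : ∀ b b', Q' b b' → Eqv T Z (F u b) (G u' b')) :
    Dv T (.sortEq Z (tsortF F u U v V) (tsortF G u' U' v' V')) := by
  rw [tsortF, tsortF, ← eU, ← eV]
  refine Dv.cong_sort hT hZ h (List.rel_append ?_ ?_)
  · exact forall₂_grid (Q := Q) (Q' := fun b b' => Q' b b' ∨ b = v ∧ b' = v') hU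
      (forall₂_snoc (hV.imp fun _ _ h => .inl h) (.inr ⟨rfl, rfl⟩))
      (by rintro a a' b b' - - - - hq (hq' | ⟨rfl, rfl⟩)
          exacts [h1 _ _ _ _ hq hq', h2 _ _ hq])
  · rw [List.forall₂_map_left_iff, List.forall₂_map_right_iff]
    exact hV.imp h3

theorem LfF_congr {W : SortE (A.tensor B)} {t : B.TermSym} {g g' : List (Expr B)}
    (h : Dv T (.term Z (LfF F u U t g) W))
    (eU : U.head = U'.head)
    (hU : List.Forall₂ Q U.args U'.args) (hV : List.Forall₂ Q' g g')
    (h1 : ∀ a a' b b', Q a a' → Q' b b' → Eqv T Z (F a b) (G a' b'))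
    (h3 : ∀ b b', Q' b b' → Eqv T Z (F u b) (G u' b')) :
    Eqv T Z (LfF F u U t g) (LfF G u' U' t g') := by
  rw [LfF, LfF, ← eU]
  exact Dv.cong_app hT hZ h (forall₂_grid (Q := fun a a' => Q a a' ∨ a = u ∧ a' = u') (Q' := Q')
    (forall₂_snoc (hU.imp fun _ _ h => .inl h) (.inr ⟨rfl, rfl⟩)) hV
      (by rintro a a' b b' - - - - (hq | ⟨rfl, rfl⟩) hq'
          exacts [h1 _ _ _ _ hq hq', h3 _ _ hq']))

theorem RfF_congr {W : SortE (A.tensor B)} {s : A.TermSym} {f f' : List (Expr A)}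
    (h : Dv T (.term Z (RfF F s f v V) W))
    (eV : V.head = V'.head)
    (hU : List.Forall₂ Q f f') (hV : List.Forall₂ Q' V.args V'.args)
    (h1 : ∀ a a' b b', Q a a' → Q' b b' → Eqv T Z (F a b) (G a' b'))
    (h2 : ∀ a a', Q a a' → Eqv T Z (F a v) (G a' v')) :
    Eqv T Z (RfF F s f v V) (RfF G s f' v' V') := by
  rw [RfF, RfF, ← eV]
  exact Dv.cong_app hT hZ h (forall₂_grid (Q := Q) (Q' := fun a a' => Q' a a' ∨ a = v ∧ a' = v')
    hU (forall₂_snoc (hV.imp fun _ _ h => .inl h) (.inr ⟨rfl, rfl⟩))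
      (by rintro a a' b b' - - - - hq (hq' | ⟨rfl, rfl⟩)
          exacts [h1 _ _ _ _ hq hq', h2 _ _ hq]))

end

/-! ### The statements proved by simultaneous induction -/

/-- A context `Z` interpreting the tensor of the contexts `X` and `Y`. -/
structure Env (T : Set (Judg (A.tensor B))) (E : TEnv TA TB) (X : PreCtx A) (Y : PreCtx B)
    (Z : PreCtx (A.tensor B)) : Prop where
  hX : Ext E.Γ X
  hY : Ext E.Δ Y
  fn : Fn Z
  cell : ∀ p ∈ X, ∀ q ∈ Y, Dv T (.term Z (.var (p.1, q.1)) (cellS E p q))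

/-- The tensor of `u : U` with terms of rank `m` over `Y` behaves as expected. -/
structure TyL (T : Set (Judg (A.tensor B))) (E : TEnv TA TB) (Y : PreCtx B)
    (Z : PreCtx (A.tensor B)) (m : ℕ) (u : Expr A) (U : SortE A) : Prop where
  ty : ∀ v V, R TB m (.term Y v V) → Dv T (.term Z (ten E u v) (tsort E u U v V))
  lf : ∀ t g V, R TB m (.term Y (.app t g) V) → Eqv T Z (ten E u (.app t g)) (Lf E u U t g)
  cg : ∀ v v' V, R TB m (.termEq Y v v' V) → Eqv T Z (ten E u v) (ten E u v')

/-- The tensor of terms of rank `n` over `X` with `v : V` behaves as expected. -/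
structure TyR (T : Set (Judg (A.tensor B))) (E : TEnv TA TB) (X : PreCtx A)
    (Z : PreCtx (A.tensor B)) (n : ℕ) (v : Expr B) (V : SortE B) : Prop where
  ty : ∀ u U, R TA n (.term X u U) → Dv T (.term Z (ten E u v) (tsort E u U v V))
  rf : ∀ s f U, R TA n (.term X (.app s f) U) → Eqv T Z (ten E (.app s f) v) (Rf E s f v V)
  cg : ∀ u u' U, R TA n (.termEq X u u' U) → Eqv T Z (ten E u v) (ten E u' v)

/-- The tensor of `u : U` and `v : V` behaves as expected. -/
structure Good (T : Set (Judg (A.tensor B))) (E : TEnv TA TB) (Z : PreCtx (A.tensor B))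
    (u : Expr A) (U : SortE A) (v : Expr B) (V : SortE B) : Prop where
  ty : Dv T (.term Z (ten E u v) (tsort E u U v V))
  lf : ∀ t g, v = .app t g → Eqv T Z (ten E u v) (Lf E u U t g)
  rf : ∀ s f, u = .app s f → Eqv T Z (ten E u v) (Rf E s f v V)

/-- Compatibility of the tensor operation with derivability for the ranks `n` and `m`. -/
structure Cl (TA : Set (Judg A)) (TB : Set (Judg B)) (T : Set (Judg (A.tensor B))) (n m : ℕ) :
    Prop where
  good : ∀ {E : TEnv TA TB} {X Y Z}, Env T E X Y Z → ∀ {u U v V}, R TA n (.term X u U) →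
    R TB m (.term Y v V) → Good T E Z u U v V
  ss : ∀ {E : TEnv TA TB} {X Y Z}, Env T E X Y Z → ∀ {u U v V}, R TA n (.sort X U) →
    R TB m (.sort Y V) → TyL T E Y Z (m - 1) u U → TyR T E X Z (n - 1) v V →
    Dv T (.sort Z (tsort E u U v V))
  e3L : ∀ {E : TEnv TA TB} {X Y Z}, Env T E X Y Z → ∀ {u U U' v V}, R TA n (.sortEq X U U') →
    R TB m (.sort Y V) → TyL T E Y Z (m - 1) u U → TyL T E Y Z (m - 1) u U' →
    TyR T E X Z (n - 1) v V → Dv T (.sortEq Z (tsort E u U v V) (tsort E u U' v V))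
  e3R : ∀ {E : TEnv TA TB} {X Y Z}, Env T E X Y Z → ∀ {u U v V V'}, R TA n (.sort X U) →
    R TB m (.sortEq Y V V') → TyL T E Y Z (m - 1) u U → TyR T E X Z (n - 1) v V →
    TyR T E X Z (n - 1) v V' → Dv T (.sortEq Z (tsort E u U v V) (tsort E u U v V'))
  e2L : ∀ {E : TEnv TA TB} {X Y Z}, Env T E X Y Z → ∀ {u U U' t g V}, R TA n (.sortEq X U U') →
    R TB m (.term Y (.app t g) V) → TyL T E Y Z (m - 1) u U → TyL T E Y Z (m - 1) u U' →
    Eqv T Z (Lf E u U t g) (Lf E u U' t g)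
  e2R : ∀ {E : TEnv TA TB} {X Y Z}, Env T E X Y Z → ∀ {s f U v V V'},
    R TA n (.term X (.app s f) U) → R TB m (.sortEq Y V V') → TyR T E X Z (n - 1) v V →
    TyR T E X Z (n - 1) v V' → Eqv T Z (Rf E s f v V) (Rf E s f v V')
  e1L : ∀ {E : TEnv TA TB} {X Y Z}, Env T E X Y Z → ∀ {u u' U v V}, R TA n (.termEq X u u' U) →
    R TB m (.term Y v V) → Eqv T Z (ten E u v) (ten E u' v)
  e1R : ∀ {E : TEnv TA TB} {X Y Z}, Env T E X Y Z → ∀ {u U v v' V}, R TA n (.term X u U) →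
    R TB m (.termEq Y v v' V) → Eqv T Z (ten E u v) (ten E u v')

section
variable {E : TEnv TA TB} {X : PreCtx A} {Y : PreCtx B} {Z : PreCtx (A.tensor B)} {n m : ℕ}
  {u : Expr A} {U : SortE A} {v : Expr B} {V : SortE B}

theorem TyL.le {m' : ℕ} (h : TyL T E Y Z m u U) (hm : m' ≤ m) : TyL T E Y Z m' u U :=
  ⟨fun v V hv => h.ty v V (hv.le hm), fun t g V hv => h.lf t g V (hv.le hm),
    fun v v' V hv => h.cg v v' V (hv.le hm)⟩

theorem TyR.le {m' : ℕ} (h : TyR T E X Z m v V) (hm : m' ≤ m) : TyR T E X Z m' v V :=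
  ⟨fun v V hv => h.ty v V (hv.le hm), fun t g V hv => h.rf t g V (hv.le hm),
    fun v v' V hv => h.cg v v' V (hv.le hm)⟩

theorem TyL.zero : TyL T E Y Z 0 u U :=
  ⟨fun _ _ h => absurd h not_R_zero, fun _ _ _ h => absurd h not_R_zero,
    fun _ _ _ h => absurd h not_R_zero⟩

theorem TyR.zero : TyR T E X Z 0 v V :=
  ⟨fun _ _ h => absurd h not_R_zero, fun _ _ _ h => absurd h not_R_zero,
    fun _ _ _ h => absurd h not_R_zero⟩

theorem Cl.tyL (h : Cl TA TB T n m) (hE : Env T E X Y Z) (hu : R TA n (.term X u U)) :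
    TyL T E Y Z m u U :=
  ⟨fun _ _ hv => (h.good hE hu hv).ty, fun _ _ _ hv => (h.good hE hu hv).lf _ _ rfl,
    fun _ _ _ hv => h.e1R hE hu hv⟩

theorem Cl.tyR (h : Cl TA TB T n m) (hE : Env T E X Y Z) (hv : R TB m (.term Y v V)) :
    TyR T E X Z n v V :=
  ⟨fun _ _ hu => (h.good hE hu hv).ty, fun _ _ _ hu => (h.good hE hu hv).rf _ _ rfl,
    fun _ _ _ hu => h.e1L hE hu hv⟩

theorem Cl.zero_left (m : ℕ) : Cl TA TB T 0 m := by
  constructor <;> intros <;> exact absurd ‹R TA 0 _› not_R_zero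

theorem Cl.zero_right (n : ℕ) : Cl TA TB T n 0 := by
  constructor <;> intros <;> exact absurd ‹R TB 0 _› not_R_zero

end

end

section

variable {A B : Alphabet} {TA : Set (Judg A)} {TB : Set (Judg B)}
  {T : Set (Judg (A.tensor B))}

/-! ### Substitution into tensors -/

/-- Substitutions `f` for `X₀` and `g` for `Y₀` whose tensor can be substituted into tensors of
terms over `X₀` and `Y₀`. -/
structure SubH (T : Set (Judg (A.tensor B))) (N M : ℕ) (E₀ E : TEnv TA TB) (X₀ : PreCtx A)
    (Y₀ : PreCtx B) (X : PreCtx A) (Y : PreCtx B) (Z : PreCtx (A.tensor B))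
    (f : A.Var → Expr A) (g : B.Var → Expr B) : Prop where
  gX : Ext E₀.Γ X₀
  gY : Ext E₀.Δ Y₀
  cX : ∃ n, CtxR TA n X₀
  cY : ∃ n, CtxR TB n Y₀
  env : Env T E X Y Z
  hL : ∀ p ∈ X₀, TyL T E Y Z M (f p.1) (p.2.subst f)
  hR : ∀ q ∈ Y₀, TyR T E X Z N (g q.1) (q.2.subst g)
  hc : ∀ p ∈ X₀, ∀ q ∈ Y₀, Dv T (.term Z (ten E (f p.1) (g q.1))
    (tsort E (f p.1) (p.2.subst f) (g q.1) (q.2.subst g)))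
  argA : ∀ p ∈ X₀, ∀ a ∈ p.2.args, ∃ W, R TA N (.term X (a.subst f) W)
  argB : ∀ q ∈ Y₀, ∀ b ∈ q.2.args, ∃ W, R TB M (.term Y (b.subst g) W)
  cl : Cl TA TB T N M

section
variable (hA : TUniq TA) (hB : TUniq TB) (hT : TUniq T)
variable {N M : ℕ} {E₀ E : TEnv TA TB} {X₀ : PreCtx A}
    {Y₀ : PreCtx B} {X : PreCtx A} {Y : PreCtx B} {Z : PreCtx (A.tensor B)}
    {f : A.Var → Expr A} {g : B.Var → Expr B}

theorem tsort_subst (hT : TUniq T) (hZ : Fn Z) {u u' : Expr A} {U : SortE A} {v v' : Expr B}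
    {V : SortE B} {Θ : (A.tensor B).Var → Expr (A.tensor B)}
    (h : Dv T (.sort Z (tsort E u' (U.subst f) v' (V.subst g))))
    (h1 : ∀ a ∈ U.args, ∀ b ∈ V.args,
      Eqv T Z ((ten E₀ a b).subst Θ) (ten E (a.subst f) (b.subst g)))
    (h2 : ∀ a ∈ U.args, Eqv T Z ((ten E₀ a v).subst Θ) (ten E (a.subst f) v'))
    (h3 : ∀ b ∈ V.args, Eqv T Z ((ten E₀ u b).subst Θ) (ten E u' (b.subst g))) :
    Dv T (.sortEq Z ((tsort E₀ u U v V).subst Θ) (tsort E u' (U.subst f) v' (V.subst g))) := by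
  rw [tsort_eqF, tsortF_subst]
  rw [tsort_eqF] at h ⊢
  refine (tsortF_congr (U' := U) (V' := V) (u' := u) (v' := v)
    (G := fun a b => (ten E₀ a b).subst Θ) hT hZ h rfl rfl (Q := fun a' a => a ∈ U.args ∧ a' = a.subst f)
    (Q' := fun b' b => b ∈ V.args ∧ b' = b.subst g) ?_ ?_ ?_ ?_ ?_).ssymm
  · exact (forall₂_map (Q := fun a a' => a ∈ U.args ∧ a' = a.subst f) fun a ha => ⟨ha, rfl⟩).flip
  · exact (forall₂_map (Q := fun a a' => a ∈ V.args ∧ a' = a.subst g) fun a ha => ⟨ha, rfl⟩).flip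
  · rintro _ a _ b ⟨ha, rfl⟩ ⟨hb, rfl⟩
    exact (h1 a ha b hb).symm
  · rintro _ a ⟨ha, rfl⟩
    exact (h2 a ha).symm
  · rintro _ b ⟨hb, rfl⟩
    exact (h3 b hb).symm

include hA hB hT

theorem SubH.sub (h : SubH T N M E₀ E X₀ Y₀ X Y Z f g) : ∀ (s n k : ℕ), n + k ≤ s →
    ∀ (u : Expr A) (U : SortE A) (v : Expr B) (V : SortE B), R TA n (.term X₀ u U) →
    R TB k (.term Y₀ v V) →
    (∀ s l, u = .app s l → ∃ W, R TA N (.term X (u.subst f) W)) →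
    (∀ t l, v = .app t l → ∃ W, R TB M (.term Y (v.subst g) W)) →
    Eqv T Z ((ten E₀ u v).subst (tmap E f g)) (ten E (u.subst f) (v.subst g)) := by
  have hZ := h.env.fn
  intro s
  induction s using Nat.strong_induction_on with
  | _ s ih =>
  intro n k hs u U v V hu hv hu' hv'
  cases v with
  | app t l =>
    obtain ⟨W', hv'⟩ := hv' t l rfl
    have hb : ∀ b ∈ l, ∃ k' < k, ∃ V, R TB k' (.term Y₀ b V) := fun b hb => by
      obtain ⟨k', W, rfl, hh⟩ := hv.app_args hb
      exact ⟨k', by omega, W, hh⟩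
    have hb' : ∀ b ∈ l, ∃ V, R TB M (.term Y (b.subst g) V) := fun b hb => by
      rw [subst_app] at hv'
      obtain ⟨k', W, rfl, hh⟩ := hv'.app_args (List.mem_map_of_mem hb)
      exact ⟨W, hh.le (by omega)⟩
    have key : ∀ S : SortE A, E₀.sA u = S → (∀ a ∈ S.args, ∃ n' < n, ∃ W, R TA n' (.term X₀ a W)) →
        (∀ a ∈ S.args, ∃ W, R TA N (.term X (a.subst f) W)) →
        Eqv T Z (ten E (u.subst f) ((Expr.app t l).subst g))
          (Lf E (u.subst f) (S.subst f) t (l.map (Expr.subst g))) →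
        Eqv T Z ((ten E₀ u (.app t l)).subst (tmap E f g))
          (ten E (u.subst f) ((Expr.app t l).subst g)) := by
      intro S hS ha ha' hh
      rw [ten_app hA hB h.gX h.gY (hu.adm hA h.gX) (hv.adm hB h.gY), hS, Lf_eqF, LfF_subst]
      obtain ⟨W, hW⟩ := hh.symm.left
      refine Eqv.symm (hh.trans hT hZ ?_)
      refine LfF_congr hT hZ hW rfl
        (Q := fun a' a => a ∈ S.args ∧ a' = a.subst f) (Q' := fun b' b => b ∈ l ∧ b' = b.subst g)
        ?_ ?_ ?_ ?_
      · exact (forall₂_map (Q := fun a a' => a ∈ S.args ∧ a' = a.subst f)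
          fun a ha => ⟨ha, rfl⟩).flip
      · exact (forall₂_map (Q := fun a a' => a ∈ l ∧ a' = a.subst g) fun a ha => ⟨ha, rfl⟩).flip
      · rintro _ a _ b ⟨h1, rfl⟩ ⟨h2, rfl⟩
        obtain ⟨n', hn, Wa, ha⟩ := ha a h1
        obtain ⟨k', hk, Wb, hb⟩ := hb b h2
        exact (ih (n' + k') (by omega) n' k' le_rfl _ _ _ _ ha hb (fun _ _ _ => ha' a h1)
          (fun _ _ _ => hb' b h2)).symm
      · rintro _ b ⟨h2, rfl⟩
        obtain ⟨k', hk, Wb, hb⟩ := hb b h2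
        exact (ih (n + k') (by omega) n k' le_rfl _ _ _ _ hu hb hu'
          (fun _ _ _ => hb' b h2)).symm
    cases u with
    | var x =>
      obtain ⟨V', hx, h1, h2⟩ := hu.var_inv
      refine key V' (h.gX _ hx) (fun a ha => ?_) (h.argA _ hx) ?_
      swap
      · rw [subst_app] at hv' ⊢
        rw [subst_var]
        exact (h.hL _ hx).lf _ _ _ hv'
      obtain ⟨k', W, rfl, hh⟩ := h1.sort_args ha
      exact ⟨k', by omega, W, hh⟩
    | app s l' =>
      obtain ⟨W, hu''⟩ := hu' s l' rfl
      have hc := (hu''.canon hA h.env.hX).1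
      rw [R.cs_subst hA (Γ := E₀.Γ) hu] at hc
      refine key _ rfl (fun a ha => ?_) (fun a ha => ?_) ((h.cl.good h.env hc hv').lf _ _ (subst_app ..))
      · obtain ⟨k', W, rfl, hh⟩ := (hu.canon hA h.gX).1.sort_of_term.sort_args ha
        exact ⟨k', by omega, W, hh⟩
      · obtain ⟨k', W, rfl, hh⟩ := hc.sort_of_term.sort_args (List.mem_map_of_mem ha)
        exact ⟨W, hh.le (by omega)⟩
  | var y =>
    obtain ⟨V', hy, h1, h2⟩ := hv.var_inv
    cases u with
    | var x =>
      obtain ⟨U', hx, h3, h4⟩ := hu.var_inv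
      rw [ten_var_var, subst_var, subst_var, subst_var, tmap_mk]
      exact (h.hc _ hx _ hy).eqv_refl
    | app s l =>
      obtain ⟨W', hu''⟩ := hu' s l rfl
      have hh := (h.hR _ hy).rf _ _ _ (subst_app f s l ▸ hu'')
      rw [ten_app_var hA hB h.gX h.gY (hu.adm hA h.gX) (hv.adm hB h.gY), h.gY _ hy, Rf_eqF,
        RfF_subst, subst_app f, subst_var g]
      obtain ⟨W, hW⟩ := hh.symm.left
      refine Eqv.symm (hh.trans hT hZ ?_)
      refine RfF_congr hT hZ hW rfl
        (Q := fun a' a => a ∈ l ∧ a' = a.subst f)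
        (Q' := fun b' b => b ∈ V'.args ∧ b' = b.subst g) ?_ ?_ ?_ ?_
      · exact (forall₂_map (Q := fun a a' => a ∈ l ∧ a' = a.subst f)
          fun a ha => ⟨ha, rfl⟩).flip
      · exact (forall₂_map (Q := fun a a' => a ∈ V'.args ∧ a' = a.subst g)
          fun a ha => ⟨ha, rfl⟩).flip
      · rintro _ a _ b ⟨i1, rfl⟩ ⟨i2, rfl⟩
        obtain ⟨n', Wa, rfl, ha⟩ := hu.app_args i1
        obtain ⟨k', Wb, rfl, hb⟩ := h1.sort_args i2
        rw [subst_app] at hu''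
        obtain ⟨n'', Wa', rfl, ha'⟩ := hu''.app_args (List.mem_map_of_mem i1)
        exact (ih (n' + k') (by omega) n' k' le_rfl _ _ _ _ ha hb
          (fun _ _ _ => ⟨_, ha'.le (by omega)⟩) (fun _ _ _ => h.argB _ hy b i2)).symm
      · rintro _ a ⟨i1, rfl⟩
        obtain ⟨n', Wa, rfl, ha⟩ := hu.app_args i1
        rw [subst_app] at hu''
        obtain ⟨n'', Wa', rfl, ha'⟩ := hu''.app_args (List.mem_map_of_mem i1)
        show Eqv T Z (ten E (a.subst f) (g y)) _
        rw [← subst_var g]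
        exact (ih (n' + k) (by omega) n' k le_rfl _ _ _ _ ha hv
          (fun _ _ _ => ⟨_, ha'.le (by omega)⟩) hv').symm

theorem SubH.eqv (h : SubH T N M E₀ E X₀ Y₀ X Y Z f g) {n k : ℕ}
    {u : Expr A} {U : SortE A} {v : Expr B} {V : SortE B} (hu : R TA n (.term X₀ u U))
    (hv : R TB k (.term Y₀ v V))
    (hu' : ∃ W, R TA N (.term X (u.subst f) W)) (hv' : ∃ W, R TB M (.term Y (v.subst g) W)) :
    Eqv T Z ((ten E₀ u v).subst (tmap E f g)) (ten E (u.subst f) (v.subst g)) :=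
  h.sub hA hB hT _ n k le_rfl _ _ _ _ hu hv (fun _ _ _ => hu') fun _ _ _ => hv'

theorem SubH.eqv_var_left (h : SubH T N M E₀ E X₀ Y₀ X Y Z f g) {k : ℕ}
    {p : A.Var × SortE A} (hp : p ∈ X₀) {v : Expr B} {V : SortE B}
    (hv : R TB k (.term Y₀ v V)) (hv' : ∃ W, R TB M (.term Y (v.subst g) W)) :
    Eqv T Z ((ten E₀ (.var p.1) v).subst (tmap E f g)) (ten E (f p.1) (v.subst g)) :=
  by
  obtain ⟨_, hc⟩ := h.cX
  rw [← subst_var f]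
  exact h.sub hA hB hT _ _ k le_rfl _ _ _ _ (hc.var_mem hp) hv nofun fun _ _ _ => hv'

theorem SubH.eqv_var_right (h : SubH T N M E₀ E X₀ Y₀ X Y Z f g) {n : ℕ}
    {q : B.Var × SortE B} (hq : q ∈ Y₀) {u : Expr A} {U : SortE A}
    (hu : R TA n (.term X₀ u U)) (hu' : ∃ W, R TA N (.term X (u.subst f) W)) :
    Eqv T Z ((ten E₀ u (.var q.1)).subst (tmap E f g)) (ten E (u.subst f) (g q.1)) :=
  by
  obtain ⟨_, hc⟩ := h.cY
  rw [← subst_var g]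
  exact h.sub hA hB hT _ n _ le_rfl _ _ _ _ hu (hc.var_mem hq) (fun _ _ _ => hu') nofun

/-- The tensor of two substitutions respects the sorts of the cells. -/
theorem SubH.mor_cell (h : SubH T N M E₀ E X₀ Y₀ X Y Z f g) {p : A.Var × SortE A} (hp : p ∈ X₀)
    {q : B.Var × SortE B} (hq : q ∈ Y₀) :
    Dv T (.term Z (tmap E f g (p.1, q.1)) ((cellS E₀ p q).subst (tmap E f g))) := by
  have hc := h.hc p hp q hq
  rw [tmap_mk]
  obtain ⟨n, cX⟩ := h.cX
  obtain ⟨m, cY⟩ := h.cY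
  refine (tsort_subst hT h.env.fn hc.sort_of_term (fun a ha b hb => ?_) (fun a ha => ?_)
    (fun b hb => ?_)).ssymm.conv hc
  · obtain ⟨_, _, -, h1⟩ := (cX.sort_mem hp).sort_args ha
    obtain ⟨_, _, -, h2⟩ := (cY.sort_mem hq).sort_args hb
    exact h.eqv hA hB hT h1 h2 (h.argA p hp a ha) (h.argB q hq b hb)
  · obtain ⟨_, _, -, h1⟩ := (cX.sort_mem hp).sort_args ha
    exact h.eqv_var_right hA hB hT hq h1 (h.argA p hp a ha)
  · obtain ⟨_, _, -, h2⟩ := (cY.sort_mem hq).sort_args hb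
    exact h.eqv_var_left hA hB hT hp h2 (h.argB q hq b hb)

end

end

section

variable {A B : Alphabet} {TA : Set (Judg A)} {TB : Set (Judg B)} {Ax : Set (Judg A)}
  {T : Set (Judg (A.tensor B))}

theorem Dv.weaken_sort {X Y : PreCtx A} {U : SortE A} (h : Dv Ax (.sort X U)) (hs : X ⊆ Y) :
    Dv Ax (.sort Y U) := let ⟨n, h⟩ := h; ⟨n, h.weaken_sort hs⟩

theorem CtxD.sort_mem {X : PreCtx A} (h : CtxD Ax X) {p : A.Var × SortE A} (hp : p ∈ X) :
    Dv Ax (.sort X p.2) := let ⟨n, h⟩ := h; ⟨n, h.sort_mem hp⟩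

theorem CtxD.fn {X : PreCtx A} (h : CtxD Ax X) : Fn X := let ⟨_, h⟩ := h; fn_of_nodup h.1

theorem R.subst_upd {n : ℕ} {X : PreCtx A} {U : SortE A} (h : R Ax n (.sort X U)) {x : A.Var}
    (hx : ∀ p ∈ X, p.1 ≠ x) (φ : A.Var → Expr A) (u : Expr A) :
    U.subst (upd φ x u) = U.subst φ :=
  ssubst_congr U fun y hy => by
    obtain ⟨p, hp, rfl⟩ := List.mem_map.1 (h.scope_sort hy)
    exact upd_ne _ (hx p hp) _

theorem R.subst_upd_term {n : ℕ} {X : PreCtx A} {e : Expr A} {U : SortE A}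
    (h : R Ax n (.term X e U)) {x : A.Var}
    (hx : ∀ p ∈ X, p.1 ≠ x) (φ : A.Var → Expr A) (u : Expr A) :
    e.subst (upd φ x u) = e.subst φ :=
  subst_congr e fun y hy => by
    obtain ⟨p, hp, rfl⟩ := List.mem_map.1 (h.scope_term hy)
    exact upd_ne _ (hx p hp) _

/-- The induction hypothesis of the main induction. -/
def Below (TA : Set (Judg A)) (TB : Set (Judg B)) (T : Set (Judg (A.tensor B))) (s : ℕ) : Prop :=
  ∀ n m, n + m < s → Cl TA TB T n m

/-! ### Validity of tensor contexts -/

theorem grid_split {α β γ : Type} {F : α → β → γ} {l2 : List β} {z : γ} {post : List γ} :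
    ∀ {l1 : List α} {pre : List γ}, grid l1 l2 F = pre ++ z :: post →
    ∃ a1 a a2 b1 b b2, l1 = a1 ++ a :: a2 ∧ l2 = b1 ++ b :: b2 ∧
      pre = grid a1 l2 F ++ b1.map (F a) ∧ z = F a b := by
  intro l1
  induction l1 with
  | nil => intro pre h; simp at h
  | cons a l1 ih =>
    intro pre h
    rw [grid_cons, List.append_eq_append_iff] at h
    rcases h with ⟨as, h1, h2⟩ | ⟨bs, h1, h2⟩
    · obtain ⟨a1, a', a2, b1, b, b2, rfl, rfl, rfl, rfl⟩ := ih h2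
      exact ⟨a :: a1, a', a2, b1, b, b2, rfl, rfl, by rw [grid_cons, h1, List.append_assoc], rfl⟩
    · cases bs with
      | nil =>
        obtain ⟨a1, a', a2, b1, b, b2, e1, e2, e3, rfl⟩ := ih (pre := []) h2.symm
        rw [List.append_nil] at h1
        have e4 := List.append_eq_nil_iff.1 e3.symm
        refine ⟨a :: a1, a', a2, b1, b, b2, by rw [e1]; rfl, e2, ?_, rfl⟩
        rw [grid_cons, h1, List.append_assoc, e4.1, e4.2]
        simp
      | cons c bs =>
        obtain ⟨rfl, rfl⟩ := List.cons.inj h2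
        rw [List.map_eq_append_iff] at h1
        obtain ⟨b1, b2, rfl, rfl, h3⟩ := h1
        rw [List.map_eq_cons_iff] at h3
        obtain ⟨b, b2, rfl, rfl, rfl⟩ := h3
        exact ⟨[], a, l1, b1, b, b2, rfl, rfl, rfl, rfl⟩

theorem keys_TX (E : TEnv TA TB) (X : PreCtx A) (Y : PreCtx B) :
    (TX E X Y).map Prod.fst = grid (X.map Prod.fst) (Y.map Prod.fst) Prod.mk := by
  rw [TX, map_grid, grid_map_left, grid_map_right]

theorem nodup_keys_TX (E : TEnv TA TB) {X : PreCtx A} {Y : PreCtx B}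
    (hX : (X.map Prod.fst).Nodup) (hY : (Y.map Prod.fst).Nodup) :
    ((TX E X Y).map Prod.fst).Nodup := by
  rw [keys_TX]
  exact List.Nodup.product hX hY

theorem mem_TX {E : TEnv TA TB} {X : PreCtx A} {Y : PreCtx B} {p : A.Var × SortE A}
    {q : B.Var × SortE B} (hp : p ∈ X) (hq : q ∈ Y) : ((p.1, q.1), cellS E p q) ∈ TX E X Y :=
  mem_grid.2 ⟨p, hp, q, hq, rfl⟩

theorem Env.of_ctx {E : TEnv TA TB} {X : PreCtx A} {Y : PreCtx B} {Z : PreCtx (A.tensor B)}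
    (hX : Ext E.Γ X) (hY : Ext E.Δ Y) (hZ : CtxD T Z) (hs : TX E X Y ⊆ Z) : Env T E X Y Z :=
  ⟨hX, hY, hZ.fn, fun _ hp _ hq => .var (hs (mem_TX hp hq)) (hZ.sort_mem (hs (mem_TX hp hq)))⟩

theorem ctxD_TX {s : ℕ} (ih : Below TA TB T s) {E : TEnv TA TB} {X : PreCtx A} {Y : PreCtx B}
    {Z Z' : PreCtx (A.tensor B)} (hX : Ext E.Γ X) (hY : Ext E.Δ Y)
    (nX : (X.map Prod.fst).Nodup) (nY : (Y.map Prod.fst).Nodup)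
    (hZ : TX E X Y = Z ++ Z')
    (H : ∀ Xp p Xs Yp q Ys, X = Xp ++ p :: Xs → Y = Yp ++ q :: Ys →
      (TX E Xp Y).length + Yp.length < Z.length →
      ∃ a b, a + b < s ∧ R TA a (.sort Xp p.2) ∧ R TB b (.sort Yp q.2)) : CtxD T Z := by
  have nd := nodup_keys_TX E nX nY
  have key : ∀ (L : ℕ) (pre : PreCtx (A.tensor B)) z post, pre.length = L → L < Z.length →
      TX E X Y = pre ++ z :: post → Dv T (.sort pre z.2) := by
    intro L
    induction L using Nat.strong_induction_on with
    | _ L hL =>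
    intro pre z post hl hlt h
    have fn : Fn pre := by
      refine fn_of_nodup ?_
      rw [h, List.map_append] at nd
      exact nd.of_append_left
    have hv : ∀ z' ∈ pre, Dv T (.term pre (.var z'.1) z'.2) := by
      intro z' hz'
      obtain ⟨s, t, e⟩ := List.append_of_mem hz'
      have hl' : s.length < L := by rw [← hl, e]; simp
      refine .var hz' (.weaken_sort (hL s.length hl' s z' (t ++ z :: post) rfl (by omega)
        (by rw [h, e]; simp)) (by rw [e]; simp))
    obtain ⟨Xp, p, Xs, Yp, q, Ys, rfl, rfl, e3, rfl⟩ := grid_split h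
    obtain ⟨a, b, hab, ha, hb⟩ := H Xp p Xs Yp q Ys rfl rfl (by
      rw [e3] at hl; simp at hl; rw [TX]; omega)
    have c1 : ∀ p' ∈ Xp, ∀ q' ∈ Yp ++ q :: Ys, Dv T (.term pre (.var (p'.1, q'.1)) (cellS E p' q')) :=
      fun p' hp q' hq => hv ((p'.1, q'.1), cellS E p' q') (by
        rw [e3]; exact List.mem_append_left _ (mem_grid.2 ⟨p', hp, q', hq, rfl⟩))
    have c2 : ∀ q' ∈ Yp, Dv T (.term pre (.var (p.1, q'.1)) (cellS E p q')) :=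
      fun q' hq => hv ((p.1, q'.1), cellS E p q') (by
        rw [e3]; exact List.mem_append_right _ (List.mem_map.2 ⟨q', hq, rfl⟩))
    have hXp : Ext E.Γ Xp := hX.mono (by simp)
    have hYp : Ext E.Δ Yp := hY.mono (by simp)
    have e1 : Env T E Xp (Yp ++ q :: Ys) pre := ⟨hXp, hY, fn, c1⟩
    have e0 : Env T E Xp Yp pre := ⟨hXp, hYp, fn, fun p' hp q' hq => c1 p' hp q' (by simp [hq])⟩
    have e2 : Env T E (Xp ++ [p]) Yp pre := by
      refine ⟨hX.mono (by simp), hYp, fn, fun p' hp q' hq => ?_⟩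
      rcases List.mem_append.1 hp with hp | hp
      · exact c1 p' hp q' (by simp [hq])
      · rw [List.mem_singleton] at hp
        rw [hp]
        exact c2 q' hq
    refine (ih a b hab).ss e0 ha hb ?_ ?_
    · cases b with
      | zero => exact TyL.zero
      | succ b =>
        exact (ih a b (by omega)).tyL e2 (.var (by simp) (ha.weaken_sort (by simp)))
    · cases a with
      | zero => exact TyR.zero
      | succ a =>
        exact (ih a (b + 1 - 1 ) (by omega) |>.tyR e1 (.var (by simp) (hb.weaken_sort (by simp))))
  refine ctxD_of ?_ fun pre z post h => ?_
  · rw [hZ, List.map_append] at nd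
    exact nd.of_append_left
  · refine key _ pre z (post ++ Z') rfl (by rw [h]; simp) (by rw [hZ, h]; simp)

theorem ctxD_TX_full {s n m : ℕ} (ih : Below TA TB T s) (hs : n + m < s) {E : TEnv TA TB}
    {X : PreCtx A} {Y : PreCtx B} (hX : Ext E.Γ X) (hY : Ext E.Δ Y)
    (cX : CtxR TA n X) (cY : CtxR TB m Y) : CtxD T (TX E X Y) :=
  ctxD_TX ih hX hY cX.1 cY.1 (List.append_nil _).symm fun Xp p Xs Yp q Ys h h' _ =>
    ⟨n, m, hs, cX.2 _ _ _ h, cY.2 _ _ _ h'⟩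

theorem TX_snoc (E : TEnv TA TB) (X : PreCtx A) (p : A.Var × SortE A) (Y : PreCtx B) :
    TX E (X ++ [p]) Y = TX E X Y ++ Y.map fun q => ((p.1, q.1), cellS E p q) := by
  rw [TX, grid_append]
  simp [TX]

theorem TX_subset_TX0_left (E : TEnv TA TB) (X : PreCtx A) (p : A.Var × SortE A) (Y : PreCtx B)
    (q : B.Var × SortE B) : TX E (X ++ [p]) Y ⊆ TX0 E X p Y q := by
  rw [TX_snoc, TX0]
  refine List.append_subset.2 ⟨?_, List.subset_append_right ..⟩
  intro c hc
  obtain ⟨a, ha, b, hb, rfl⟩ := mem_grid.1 hc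
  exact List.mem_append_left _ (mem_grid.2 ⟨a, ha, b, by simp [hb], rfl⟩)

theorem TX_subset_TX0_right (E : TEnv TA TB) (X : PreCtx A) (p : A.Var × SortE A) (Y : PreCtx B)
    (q : B.Var × SortE B) : TX E X (Y ++ [q]) ⊆ TX0 E X p Y q :=
  List.subset_append_left ..

theorem Base.ctxD_TX0 {s k k' : ℕ} (ih : Below TA TB T s) (hs : k + k' + 1 < s)
    {E : TEnv TA TB} {X : PreCtx A} {x : A.Var} {U : SortE A} {Y : PreCtx B} {w : B.Var}
    {V : SortE B} (h : Base E (k + 1) (k' + 1) X x U Y w V) (cX : CtxR TA k X)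
    (cY : CtxR TB k' Y) : CtxD T (TX0 E X (x, U) Y (w, V)) := by
  refine ctxD_TX ih h.gx h.gy h.cx.1 h.cy.1 (Z' := [((x, w), cellS E (x, U) (w, V))])
    (by rw [TX_snoc, TX0]; simp) fun Xp p Xs Yp q Ys e e' hl => ?_
  rcases List.eq_nil_or_concat Ys with rfl | ⟨Ys, q', rfl⟩
  · obtain ⟨rfl, e2⟩ := List.append_inj' e' rfl
    cases e2
    rcases List.eq_nil_or_concat Xs with rfl | ⟨Xs, p', rfl⟩
    · obtain ⟨rfl, e2⟩ := List.append_inj' e rfl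
      cases e2
      simp [TX0, TX] at hl
    · rw [List.concat_eq_append, ← List.cons_append, ← List.append_assoc] at e
      obtain ⟨rfl, -⟩ := List.append_inj' e rfl
      exact ⟨k, k' + 1, by omega, cX.2 _ _ _ rfl, h.cy.2 _ _ _ e'⟩
  · rw [List.concat_eq_append, ← List.cons_append, ← List.append_assoc] at e'
    obtain ⟨rfl, -⟩ := List.append_inj' e' rfl
    exact ⟨k + 1, k', by omega, h.cx.2 _ _ _ e, cY.2 _ _ _ rfl⟩

end

section

variable {A B : Alphabet} {TA : Set (Judg A)} {TB : Set (Judg B)}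
  {T : Set (Judg (A.tensor B))}

/-- Data for substituting into an axiom of the tensor theory: extended contexts `Xa, x : U₀` and
`Wt, w : T₀`, and substitutions for them. -/
structure PM (T : Set (Judg (A.tensor B))) (E₀ E : TEnv TA TB) (k k' : ℕ) (Xa : PreCtx A)
    (x : A.Var) (U₀ : SortE A) (Wt : PreCtx B) (w : B.Var) (T₀ : SortE B) (X : PreCtx A)
    (Y : PreCtx B) (Z : PreCtx (A.tensor B)) (f : A.Var → Expr A) (g : B.Var → Expr B) :
    Prop where
  base : Base E₀ (k + 1) (k' + 1) Xa x U₀ Wt w T₀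
  cX : CtxR TA k Xa
  cY : CtxR TB k' Wt
  env : Env T E X Y Z
  hφ : ∀ p ∈ Xa, R TA k (.term X (f p.1) (p.2.subst f))
  hψ : ∀ q ∈ Wt, R TB k' (.term Y (g q.1) (q.2.subst g))
  hU : R TA (k + 1) (.sort X (U₀.subst f))
  hV : R TB (k' + 1) (.sort Y (T₀.subst g))
  hL : TyL T E Y Z k' (f x) (U₀.subst f)
  hR : TyR T E X Z k (g w) (T₀.subst g)

section
variable {E₀ E : TEnv TA TB} {k k' s : ℕ} {Xa : PreCtx A}
    {x : A.Var} {U₀ : SortE A} {Wt : PreCtx B} {w : B.Var} {T₀ : SortE B} {X : PreCtx A}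
    {Y : PreCtx B} {Z : PreCtx (A.tensor B)} {f : A.Var → Expr A} {g : B.Var → Expr B}

theorem R.sort_subst_args {n : ℕ} {U : SortE A} {f : A.Var → Expr A} {X : PreCtx A}
    (h : R TA (n + 1) (.sort X (U.subst f))) : ∀ a ∈ U.args, ∃ W, R TA n (.term X (a.subst f) W) := by
  intro a ha
  obtain ⟨k, W, e, h⟩ := h.sort_args (List.mem_map_of_mem ha)
  exact ⟨W, h.le (by omega)⟩

theorem R.sort_subst_args' {n : ℕ} {U : SortE A} {f : A.Var → Expr A} {X : PreCtx A}
    (h : R TA n (.sort X (U.subst f))) : ∀ a ∈ U.args, ∃ W, R TA n (.term X (a.subst f) W) :=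
  h.mono.sort_subst_args

theorem subH_of_cl {N M : ℕ} (hcl : Cl TA TB T N M) (hgX : Ext E₀.Γ Xa) (hgY : Ext E₀.Δ Wt)
    (cX : ∃ n, CtxR TA n Xa) (cY : ∃ n, CtxR TB n Wt) (env : Env T E X Y Z)
    (hφ : ∀ p ∈ Xa, R TA N (.term X (f p.1) (p.2.subst f)))
    (hψ : ∀ q ∈ Wt, R TB M (.term Y (g q.1) (q.2.subst g))) :
    SubH T N M E₀ E Xa Wt X Y Z f g where
  gX := hgX
  gY := hgY
  cX := cX
  cY := cY
  env := env
  hL p hp := hcl.tyL env (hφ p hp)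
  hR q hq := hcl.tyR env (hψ q hq)
  hc p hp q hq := (hcl.good env (hφ p hp) (hψ q hq)).ty
  argA p hp := (hφ p hp).sort_of_term.sort_subst_args'
  argB q hq := (hψ q hq).sort_of_term.sort_subst_args'
  cl := hcl

theorem PM.subH (h : PM T E₀ E k k' Xa x U₀ Wt w T₀ X Y Z f g) {N M : ℕ} (hN : k ≤ N) (hM : k' ≤ M)
    (hcl : Cl TA TB T N M) : SubH T N M E₀ E Xa Wt X Y Z f g :=
  subH_of_cl hcl h.base.hX h.base.hY ⟨_, h.cX⟩ ⟨_, h.cY⟩ h.env (fun p hp => (h.hφ p hp).le hN)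
    fun q hq => (h.hψ q hq).le hM

theorem PM.subA (h : PM T E₀ E k k' Xa x U₀ Wt w T₀ X Y Z f g) (hcl : Cl TA TB T k k') :
    SubH T k k' E₀ E (Xa ++ [(x, U₀)]) Wt X Y Z f g := by
  have h0 := h.subH le_rfl le_rfl hcl
  refine ⟨h.base.gx, h0.gY, ⟨_, h.base.cx⟩, h0.cY, h.env, ?_, h0.hR, ?_, ?_, h0.argB, hcl⟩
  all_goals
    intro p hp
    rcases List.mem_append.1 hp with hp | hp
    rotate_left
    · rw [List.mem_singleton] at hp
      subst hp
      first | exact h.hL | exact fun q hq => h.hL.ty _ _ (h.hψ q hq) | exact h.hU.sort_subst_args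
  exacts [h0.hL p hp, h0.hc p hp, h0.argA p hp]

theorem PM.subB (h : PM T E₀ E k k' Xa x U₀ Wt w T₀ X Y Z f g) (hcl : Cl TA TB T k k') :
    SubH T k k' E₀ E Xa (Wt ++ [(w, T₀)]) X Y Z f g := by
  have h0 := h.subH le_rfl le_rfl hcl
  refine ⟨h0.gX, h.base.gy, h0.cX, ⟨_, h.base.cy⟩, h.env, h0.hL, ?_, fun p hp => ?_, h0.argA, ?_, hcl⟩
  all_goals
    intro q hq
    rcases List.mem_append.1 hq with hq | hq
    rotate_left
    · rw [List.mem_singleton] at hq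
      subst hq
      first | exact h.hR | exact h.hR.ty _ _ (h.hφ p hp) | exact h.hV.sort_subst_args
  exacts [h0.hR q hq, h0.hc p hp q hq, h0.argB q hq]

variable (hA : TUniq TA) (hB : TUniq TB) (hT : TUniq T)
include hA hB hT

theorem PM.mor (h : PM T E₀ E k k' Xa x U₀ Wt w T₀ X Y Z f g) (hcl : Cl TA TB T k k') :
    Mor T Z (TX0 E₀ Xa (x, U₀) Wt (w, T₀)) (tmap E f g) := by
  intro c hc
  rcases List.mem_append.1 hc with hc | hc
  · obtain ⟨p, hp, q, hq, rfl⟩ := mem_grid.1 hc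
    exact (h.subB hcl).mor_cell hA hB hT hp hq
  · obtain ⟨q, hq, rfl⟩ := List.mem_map.1 hc
    exact (h.subA hcl).mor_cell hA hB hT (p := (x, U₀)) (by simp) hq

theorem PM.morA (h : PM T E₀ E k k' Xa x U₀ Wt w T₀ X Y Z f g) (hcl : Cl TA TB T k k') :
    Mor T Z (TX E₀ (Xa ++ [(x, U₀)]) Wt) (tmap E f g) :=
  fun c hc => h.mor hA hB hT hcl c (TX_subset_TX0_left _ _ _ _ _ hc)

theorem PM.morB (h : PM T E₀ E k k' Xa x U₀ Wt w T₀ X Y Z f g) (hcl : Cl TA TB T k k') :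
    Mor T Z (TX E₀ Xa (Wt ++ [(w, T₀)])) (tmap E f g) :=
  fun c hc => h.mor hA hB hT hcl c (TX_subset_TX0_right _ _ _ _ _ hc)

theorem PM.cell (h : PM T E₀ E k k' Xa x U₀ Wt w T₀ X Y Z f g) (hcl : Cl TA TB T k k')
    (hs : Dv T (.sort Z (tsort E (f x) (U₀.subst f) (g w) (T₀.subst g)))) :
    Dv T (.sortEq Z ((tsort E₀ (.var x) U₀ (.var w) T₀).subst (tmap E f g))
      (tsort E (f x) (U₀.subst f) (g w) (T₀.subst g))) := by
  refine tsort_subst hT h.env.fn hs (fun a ha b hb => ?_) (fun a ha => ?_) (fun b hb => ?_)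
  · obtain ⟨_, _, -, h1⟩ := h.base.hU.sort_args ha
    obtain ⟨_, _, -, h2⟩ := h.base.hV.sort_args hb
    exact (h.subH le_rfl le_rfl hcl).eqv hA hB hT h1 h2 (h.hU.sort_subst_args a ha)
      (h.hV.sort_subst_args b hb)
  · obtain ⟨_, _, -, h1⟩ := h.base.hU.sort_args ha
    exact (h.subB hcl).eqv_var_right hA hB hT (q := (w, T₀)) (by simp) h1
      (h.hU.sort_subst_args a ha)
  · obtain ⟨_, _, -, h2⟩ := h.base.hV.sort_args hb
    exact (h.subA hcl).eqv_var_left hA hB hT (p := (x, U₀)) (by simp) h2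
      (h.hV.sort_subst_args b hb)

end

end

section

variable {A B : Alphabet} {TA : Set (Judg A)} {TB : Set (Judg B)}
  {T : Set (Judg (A.tensor B))}
variable {chA : PreCtx A → A.Var} {chB : PreCtx B → B.Var}

/-- The assumptions on the two theories. -/
structure TH (TA : Set (Judg A)) (TB : Set (Judg B)) (chA : PreCtx A → A.Var)
    (chB : PreCtx B → B.Var) : Prop where
  gA : GoodTh TA
  gB : GoodTh TB
  fA : FreshCh chA
  fB : FreshCh chB

theorem TH.hA (H : TH TA TB chA chB) : TUniq TA := H.gA.tUniq
theorem TH.hB (H : TH TA TB chA chB) : TUniq TB := H.gB.tUniq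
theorem TH.hT (H : TH TA TB chA chB) : TUniq (tensorAx TA TB chA chB) :=
  tensor_tUniq H.gA H.gB H.fA H.fB

section
variable {E₀ E : TEnv TA TB} {k k' s : ℕ} {Xa : PreCtx A}
    {x : A.Var} {U₀ : SortE A} {Wt : PreCtx B} {w : B.Var} {T₀ : SortE B} {X : PreCtx A}
    {Y : PreCtx B} {Z : PreCtx (A.tensor B)} {φ : A.Var → Expr A} {ψ : B.Var → Expr B}
    {u : Expr A} {v : Expr B}

theorem Base.PM (h : Base E₀ (k + 1) (k' + 1) Xa x U₀ Wt w T₀) (cX : CtxR TA k Xa)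
    (cY : CtxR TB k' Wt) (env : Env T E X Y Z)
    (hφ : ∀ p ∈ Xa, R TA k (.term X (φ p.1) (p.2.subst φ)))
    (hψ : ∀ q ∈ Wt, R TB k' (.term Y (ψ q.1) (q.2.subst ψ)))
    (hU : R TA (k + 1) (.sort X (U₀.subst φ))) (hV : R TB (k' + 1) (.sort Y (T₀.subst ψ)))
    (hL : TyL T E Y Z k' u (U₀.subst φ)) (hR : TyR T E X Z k v (T₀.subst ψ)) :
    PM T E₀ E k k' Xa x U₀ Wt w T₀ X Y Z (upd φ x u) (upd ψ w v) := by
  have eU := h.hU.subst_upd h.xX φ u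
  have eV := h.hV.subst_upd h.wY ψ v
  refine ⟨h, cX, cY, env, fun p hp => ?_, fun q hq => ?_, eU ▸ hU, eV ▸ hV, ?_, ?_⟩
  · rw [(cX.sort_mem hp).subst_upd h.xX, upd_ne _ (h.xX p hp)]
    exact hφ p hp
  · rw [(cY.sort_mem hq).subst_upd h.wY, upd_ne _ (h.wY q hq)]
    exact hψ q hq
  · rw [eU, upd_self]
    exact hL
  · rw [eV, upd_self]
    exact hR

theorem Base.PM_id (h : Base E₀ (k + 1) (k' + 1) Xa x U₀ Wt w T₀) (cX : CtxR TA k Xa)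
    (cY : CtxR TB k' Wt) (env : Env T E Xa Wt Z)
    (hL : TyL T E Wt Z k' u U₀) (hR : TyR T E Xa Z k v T₀) :
    GATPaper.PM T E₀ E k k' Xa x U₀ Wt w T₀ Xa Wt Z (upd .var x u) (upd .var w v) := by
  refine h.PM cX cY env (fun p hp => ?_) (fun q hq => ?_) ?_ ?_ ?_ ?_
  · rw [ssubst_id]; exact cX.var_mem hp
  · rw [ssubst_id]; exact cY.var_mem hq
  all_goals rw [ssubst_id]
  exacts [h.hU, h.hV, hL, hR]

/-- The value of the last cell for substitutions given by updates. -/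
theorem PM.cell_upd (hA : TUniq TA) (hB : TUniq TB) (hT : TUniq T)
    (h : PM T E₀ E k k' Xa x U₀ Wt w T₀ X Y Z (upd φ x u) (upd ψ w v))
    (hcl : Cl TA TB T k k')
    (hs : Dv T (.sort Z (tsort E u (U₀.subst φ) v (T₀.subst ψ)))) :
    Dv T (.sortEq Z ((tsort E₀ (.var x) U₀ (.var w) T₀).subst (tmap E (upd φ x u) (upd ψ w v)))
      (tsort E u (U₀.subst φ) v (T₀.subst ψ))) := by
  have := h.cell hA hB hT hcl
  rw [upd_self, upd_self, h.base.hU.subst_upd h.base.xX, h.base.hV.subst_upd h.base.wY] at this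
  exact this hs

theorem vals_upd {X : PreCtx A} {x : A.Var} (h : ∀ p ∈ X, p.1 ≠ x) (φ : A.Var → Expr A)
    (u : Expr A) : vals (upd φ x u) X = vals φ X :=
  List.map_congr_left fun p hp => upd_ne _ (h p hp) _

theorem ssubst_ctxVars (S : A.SortSym) (X : PreCtx A) (φ : A.Var → Expr A) :
    (SortE.mk S (ctxVars X)).subst φ = ⟨S, vals φ X⟩ := by
  rw [← vals_var, ssubst_mk]
  simp only [subst_var]

theorem grid_vals {γ : Type} {F : Expr A → Expr B → γ} (f : A.Var → Expr A) (g : B.Var → Expr B)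
    (X : PreCtx A) (Y : PreCtx B) :
    grid (vals f X) (vals g Y) F = grid X Y fun p q => F (f p.1) (g q.1) := by
  rw [vals, vals, grid_map_left, grid_map_right]

theorem vals_TX (E₀ E : TEnv TA TB) (f : A.Var → Expr A) (g : B.Var → Expr B) (X : PreCtx A)
    (Y : PreCtx B) :
    vals (tmap E f g) (TX E₀ X Y) = grid (vals f X) (vals g Y) (ten E) := by
  rw [grid_vals, vals, TX, map_grid]
  rfl

theorem vals_snoc (f : A.Var → Expr A) (X : PreCtx A) (p : A.Var × SortE A) :
    vals f (X ++ [p]) = vals f X ++ [f p.1] := by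
  simp [vals]

theorem tsort_vals (E₀ E : TEnv TA TB) (S : A.SortSym) (S' : B.SortSym) (p : A.Var × SortE A)
    (q : B.Var × SortE B) (f : A.Var → Expr A) (g : B.Var → Expr B) :
    (⟨(S, S'), vals (tmap E f g) (TX0 E₀ Xa p Wt q)⟩ : SortE (A.tensor B)) =
      tsort E (f p.1) ⟨S, vals f Xa⟩ (g q.1) ⟨S', vals g Wt⟩ := by
  rw [tsort_eqF, tsortF, TX0]
  congr 1
  rw [← vals_snoc, vals, List.map_append]
  refine congr (congrArg _ (vals_TX E₀ E f g ..)) ?_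
  simp only [vals, List.map_map]
  exact List.map_congr_left fun a _ => rfl

theorem Lf_vals (E₀ E : TEnv TA TB) (S : A.SortSym) (t : B.TermSym) (p : A.Var × SortE A)
    (f : A.Var → Expr A) (g : B.Var → Expr B) :
    .app (Sum.inl (S, t)) (vals (tmap E f g) (TX E₀ (Xa ++ [p]) Wt)) =
      Lf E (f p.1) ⟨S, vals f Xa⟩ t (vals g Wt) := by
  rw [Lf_eqF, LfF, vals_TX, vals_snoc]

theorem Rf_vals (E₀ E : TEnv TA TB) (s : A.TermSym) (S : B.SortSym) (q : B.Var × SortE B)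
    (f : A.Var → Expr A) (g : B.Var → Expr B) :
    .app (Sum.inr (s, S)) (vals (tmap E f g) (TX E₀ Xa (Wt ++ [q]))) =
      Rf E s (vals f Xa) (g q.1) ⟨S, vals g Wt⟩ := by
  rw [Rf_eqF, RfF, vals_TX, vals_snoc]

theorem vals_tmap_var (E : TEnv TA TB) (Z : PreCtx (A.tensor B)) :
    vals (tmap E .var .var) Z = ctxVars Z :=
  List.map_congr_left fun z _ => tmap_id E z.1.1 z.1.2

theorem tsort_ctxVars (E : TEnv TA TB) (S : A.SortSym) (S' : B.SortSym) (p : A.Var × SortE A)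
    (q : B.Var × SortE B) : tsort E (.var p.1) ⟨S, ctxVars Xa⟩ (.var q.1) ⟨S', ctxVars Wt⟩ =
      ⟨(S, S'), ctxVars (TX0 E Xa p Wt q)⟩ := by
  rw [← vals_tmap_var E, tsort_vals, vals_var, vals_var]

theorem ss_step (H : TH TA TB chA chB) (ih : Below TA TB (tensorAx TA TB chA chB) s)
    (hs : k + k' + 1 < s) (hE : Env (tensorAx TA TB chA chB) E X Y Z) {U : SortE A} {V : SortE B}
    (hU : R TA (k + 1) (.sort X U)) (hV : R TB (k' + 1) (.sort Y V))
    (hL : TyL (tensorAx TA TB chA chB) E Y Z k' u U)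
    (hR : TyR (tensorAx TA TB chA chB) E X Z k v V) :
    Dv (tensorAx TA TB chA chB) (.sort Z (tsort E u U v V)) := by
  obtain ⟨_, Xa, φ, e, hax, cX, eU, hφ⟩ := hU.sort_inv
  obtain rfl := Nat.succ.inj e
  obtain ⟨_, Wt, ψ, e, hax', cY, eV, hψ⟩ := hV.sort_inv
  obtain rfl := Nat.succ.inj e
  have eU' : U = (SortE.mk U.head (ctxVars Xa)).subst φ := by rw [ssubst_ctxVars]; exact eU
  have eV' : V = (SortE.mk V.head (ctxVars Wt)).subst ψ := by rw [ssubst_ctxVars]; exact eV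
  generalize U.head = S at *
  generalize V.head = S' at *
  have sX : R TA (k + 1) (.sort Xa ⟨S, ctxVars Xa⟩) :=
    .sSub (φ := Expr.var) hax cX.1 cX.2 fun p hp => by rw [ssubst_id]; exact cX.var_mem hp
  have sY : R TB (k' + 1) (.sort Wt ⟨S', ctxVars Wt⟩) :=
    .sSub (φ := Expr.var) hax' cY.1 cY.2 fun p hp => by rw [ssubst_id]; exact cY.var_mem hp
  obtain ⟨E₀, hb⟩ := exists_base H.fA H.fB (cX.le (Nat.le_succ _)) sX (cY.le (Nat.le_succ _)) sY
  have pm := hb.PM cX cY hE hφ hψ (eU' ▸ hU) (eV' ▸ hV) (u := u) (v := v) (eU' ▸ hL) (eV' ▸ hR)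
  have ax := hb.ax_ss H.hA H.hB hax hax'
  rw [tsort_ctxVars E₀ S S' (chA Xa, ⟨S, ctxVars Xa⟩) (chB Wt, ⟨S', ctxVars Wt⟩)] at ax
  have := Dv.sSub ax (hb.ctxD_TX0 ih hs cX cY) (pm.mor H.hA H.hB H.hT (ih k k' (by omega)))
  rw [tsort_vals, upd_self, upd_self, vals_upd hb.xX, vals_upd hb.wY] at this
  rw [eU, eV]
  exact this

end

end

section

variable {A B : Alphabet} {TA : Set (Judg A)} {TB : Set (Judg B)}
  {T : Set (Judg (A.tensor B))}
variable {chA : PreCtx A → A.Var} {chB : PreCtx B → B.Var}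

theorem upd_id (x : A.Var) : upd Expr.var x (Expr.var x) = (Expr.var : A.Var → Expr A) := by
  funext y
  by_cases h : y = x
  · rw [h, upd_self]
  · exact upd_ne _ h _

theorem CtxR.sSub_var {n : ℕ} {X : PreCtx A} {S : A.SortSym} (h : CtxR TA n X)
    (hax : introSort X S ∈ TA) : R TA (n + 1) (.sort X ⟨S, ctxVars X⟩) :=
  .sSub (φ := Expr.var) hax h.1 h.2 fun p hp => by rw [ssubst_id]; exact h.var_mem hp

theorem CtxR.tSub_var {n : ℕ} {X : PreCtx A} {t : A.TermSym} {U : SortE A} (h : CtxR TA n X)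
    (hU : R TA n (.sort X U)) (hax : introTerm X t U ∈ TA) :
    R TA (n + 1) (.term X (.app t (ctxVars X)) U) := by
  have := R.tSub (φ := Expr.var) hax h.1 h.2 hU (Y := X) (by rw [ssubst_id]; exact hU)
    fun p hp => by rw [ssubst_id]; exact h.var_mem hp
  rwa [ssubst_id] at this

theorem subst_ctxVars (t : A.TermSym) (X : PreCtx A) (φ : A.Var → Expr A) :
    (Expr.app t (ctxVars X)).subst φ = .app t (vals φ X) := by
  rw [← vals_var, subst_app, vals_subst]
  simp only [subst_var]

section
variable {E₀ E : TEnv TA TB} {k k' s : ℕ} {Xa : PreCtx A}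
    {x : A.Var} {U₀ : SortE A} {Wt : PreCtx B} {w : B.Var} {T₀ : SortE B} {X : PreCtx A}
    {Y : PreCtx B} {Z : PreCtx (A.tensor B)} {f : A.Var → Expr A} {g : B.Var → Expr B}

theorem PM.cell_right (hA : TUniq TA) (hB : TUniq TB) (hT : TUniq T)
    (h : PM T E₀ E k k' Xa x U₀ Wt w T₀ X Y Z f g) (ih : Below TA TB T s) (hs : k + k' + 1 < s)
    {v : Expr B} {V : SortE B} (hv : R TB (k' + 1) (.term Wt v V))
    (hv' : ∃ V, R TB (k' + 1) (.term Y (v.subst g) V))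
    (h' : Dv T (.sort Z (tsort E (f x) (U₀.subst f) (v.subst g) (T₀.subst g)))) :
    Dv T (.sortEq Z ((tsort E₀ (.var x) U₀ v T₀).subst (tmap E f g))
      (tsort E (f x) (U₀.subst f) (v.subst g) (T₀.subst g))) := by
  have hcl := ih k k' (by omega)
  refine tsort_subst hT h.env.fn h' (fun a ha b hb => ?_) (fun a ha => ?_) (fun b hb => ?_)
  · obtain ⟨_, _, -, h1⟩ := h.base.hU.sort_args ha
    obtain ⟨_, _, -, h2⟩ := h.base.hV.sort_args hb
    exact (h.subH le_rfl le_rfl hcl).eqv hA hB hT h1 h2 (h.hU.sort_subst_args a ha)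
      (h.hV.sort_subst_args b hb)
  · obtain ⟨_, _, -, h1⟩ := h.base.hU.sort_args ha
    exact (h.subH le_rfl (Nat.le_succ _) (ih k (k' + 1) (by omega))).eqv hA hB hT h1 hv
      (h.hU.sort_subst_args a ha) hv'
  · obtain ⟨_, _, -, h2⟩ := h.base.hV.sort_args hb
    exact (h.subA hcl).eqv_var_left hA hB hT (p := (x, U₀)) (by simp) h2
      (h.hV.sort_subst_args b hb)

theorem PM.cell_left (hA : TUniq TA) (hB : TUniq TB) (hT : TUniq T)
    (h : PM T E₀ E k k' Xa x U₀ Wt w T₀ X Y Z f g) (ih : Below TA TB T s) (hs : k + k' + 1 < s)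
    {u : Expr A} {U : SortE A} (hu : R TA (k + 1) (.term Xa u U))
    (hu' : ∃ U, R TA (k + 1) (.term X (u.subst f) U))
    (h' : Dv T (.sort Z (tsort E (u.subst f) (U₀.subst f) (g w) (T₀.subst g)))) :
    Dv T (.sortEq Z ((tsort E₀ u U₀ (.var w) T₀).subst (tmap E f g))
      (tsort E (u.subst f) (U₀.subst f) (g w) (T₀.subst g))) := by
  have hcl := ih k k' (by omega)
  refine tsort_subst hT h.env.fn h' (fun a ha b hb => ?_) (fun a ha => ?_) (fun b hb => ?_)
  · obtain ⟨_, _, -, h1⟩ := h.base.hU.sort_args ha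
    obtain ⟨_, _, -, h2⟩ := h.base.hV.sort_args hb
    exact (h.subH le_rfl le_rfl hcl).eqv hA hB hT h1 h2 (h.hU.sort_subst_args a ha)
      (h.hV.sort_subst_args b hb)
  · obtain ⟨_, _, -, h1⟩ := h.base.hU.sort_args ha
    exact (h.subB hcl).eqv_var_right hA hB hT (q := (w, T₀)) (by simp) h1
      (h.hU.sort_subst_args a ha)
  · obtain ⟨_, _, -, h2⟩ := h.base.hV.sort_args hb
    exact (h.subH (Nat.le_succ _) le_rfl (ih (k + 1) k' (by omega))).eqv hA hB hT hu h2
      hu' (h.hV.sort_subst_args b hb)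

theorem Base.envA {n m : ℕ} (h : Base E n m Xa x U₀ Wt w T₀) (hZ : CtxD T (TX E (Xa ++ [(x, U₀)]) Wt)) :
    Env T E (Xa ++ [(x, U₀)]) Wt (TX E (Xa ++ [(x, U₀)]) Wt) :=
  .of_ctx h.gx h.hY hZ (List.Subset.refl _)

theorem Env.mono {X' : PreCtx A} {Y' : PreCtx B} (h : Env T E X Y Z) (hX : X' ⊆ X) (hY : Y' ⊆ Y) :
    Env T E X' Y' Z :=
  ⟨h.hX.mono hX, h.hY.mono hY, h.fn, fun p hp q hq => h.cell p (hX hp) q (hY hq)⟩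

/-- Facts about the context of an axiom obtained from a term `v` of the second theory. -/
structure StageL (TA : Set (Judg A)) (TB : Set (Judg B)) (T : Set (Judg (A.tensor B)))
    (E₀ : TEnv TA TB) (k k' : ℕ) (Xa : PreCtx A) (x : A.Var) (U₀ : SortE A) (Wt : PreCtx B)
    (w : B.Var) (V₀ : SortE B) (v : Expr B) : Prop where
  ctx : CtxD T (TX E₀ (Xa ++ [(x, U₀)]) Wt)
  env : Env T E₀ (Xa ++ [(x, U₀)]) Wt (TX E₀ (Xa ++ [(x, U₀)]) Wt)
  env' : Env T E₀ Xa Wt (TX E₀ (Xa ++ [(x, U₀)]) Wt)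
  tyL : TyL T E₀ Wt (TX E₀ (Xa ++ [(x, U₀)]) Wt) k' (.var x) U₀
  tyR : TyR T E₀ Xa (TX E₀ (Xa ++ [(x, U₀)]) Wt) k v V₀
  ss : Dv T (.sort (TX E₀ (Xa ++ [(x, U₀)]) Wt) (tsort E₀ (.var x) U₀ v V₀))
  eq : Dv T (.sortEq (TX E₀ (Xa ++ [(x, U₀)]) Wt) ((tsort E₀ (.var x) U₀ (.var w) V₀).subst
    (tmap E₀ .var (upd .var w v))) (tsort E₀ (.var x) U₀ v V₀))

variable {u : Expr A} {U : SortE A} {ψ : B.Var → Expr B} {t : B.TermSym} {V₀ : SortE B}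

theorem Base.stageL (H : TH TA TB chA chB) (ih : Below TA TB (tensorAx TA TB chA chB) s)
    (hs : k + k' + 1 < s) (hb : Base E₀ (k + 1) (k' + 1) Xa x U₀ Wt w V₀) (cX : CtxR TA k Xa)
    (cY : CtxR TB k' Wt) {v : Expr B} (hv : R TB (k' + 1) (.term Wt v V₀)) :
    StageL TA TB (tensorAx TA TB chA chB) E₀ k k' Xa x U₀ Wt w V₀ v := by
  have hZ₀ := ctxD_TX_full ih (n := k + 1) (m := k') (by omega) hb.gx hb.hY hb.cx cY
  have env₀ := hb.envA hZ₀
  have env₀' := env₀.mono (X' := Xa) (Y' := Wt) (List.subset_append_left ..) (List.Subset.refl _)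
  have tyL := (ih (k + 1) k' (by omega)).tyL env₀
    (hb.cx.var_mem (p := (x, U₀)) (by simp))
  have tyR := (ih k (k' + 1) (by omega)).tyR env₀' hv
  have pm₀ := hb.PM_id cX cY env₀' tyL tyR
  have ss₀ := ss_step H ih hs env₀' hb.hU hb.hV tyL tyR
  have w₀ := pm₀.cell_upd H.hA H.hB H.hT (ih k k' (by omega))
    (by rw [ssubst_id, ssubst_id]; exact ss₀)
  rw [upd_id, ssubst_id, ssubst_id] at w₀
  exact ⟨hZ₀, env₀, env₀', tyL, tyR, ss₀, w₀⟩

theorem tl_step (H : TH TA TB chA chB) (ih : Below TA TB (tensorAx TA TB chA chB) s)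
    (hs : k + k' + 1 < s) (hE : Env (tensorAx TA TB chA chB) E X Y Z)
    (hU : R TA (k + 1) (.sort X U)) (hax' : introTerm Wt t V₀ ∈ TB) (cY : CtxR TB k' Wt)
    (hV₀ : R TB k' (.sort Wt V₀)) (hV : R TB k' (.sort Y (V₀.subst ψ)))
    (hψ : ∀ q ∈ Wt, R TB k' (.term Y (ψ q.1) (q.2.subst ψ)))
    (hL : TyL (tensorAx TA TB chA chB) E Y Z k' u U) :
    Dv (tensorAx TA TB chA chB) (.term Z (Lf E u U t (vals ψ Wt))
      (tsort E u U (.app t (vals ψ Wt)) (V₀.subst ψ))) := by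
  have hA := H.hA
  have hB := H.hB
  have hT := H.hT
  obtain ⟨_, Xa, φ, e, hax, cX, eU, hφ⟩ := hU.sort_inv
  obtain rfl := Nat.succ.inj e
  have eU' : U = (SortE.mk U.head (ctxVars Xa)).subst φ := by rw [ssubst_ctxVars]; exact eU
  generalize U.head = S at *
  have sX := cX.sSub_var hax
  obtain ⟨E₀, hb⟩ := exists_base H.fA H.fB (cX.le (Nat.le_succ k)) sX (cY.le (Nat.le_succ k'))
    hV₀.mono
  have tv := cY.tSub_var hV₀ hax'
  have tv' : R TB (k' + 1) (.term Y (.app t (vals ψ Wt)) (V₀.subst ψ)) :=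
    .tSub hax' cY.1 cY.2 hV₀ hV hψ
  have st := hb.stageL H ih hs cX cY tv
  have ax := hb.ax_st hA hB tv hax hax'
  rw [ten_app hA hB hb.hX hb.hY hb.admx (tv.adm hB hb.hY),
    show E₀.sA (.var (chA Xa)) = _ from hb.hx, ← vals_var Wt, ← vals_var Xa,
    ← Lf_vals E₀ E₀ S t (chA Xa, _), vals_tmap_var] at ax
  have tyR := (ih k (k' + 1) (by omega)).tyR hE tv'
  have ss := ss_step H ih hs hE hU hV.mono hL tyR
  have pm := hb.PM cX cY hE hφ hψ (eU' ▸ hU) hV.mono (eU' ▸ hL) tyR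
  have mor := pm.morA hA hB hT (ih k k' (by omega))
  have key := Dv.tSub ax st.ctx st.eq.left_sort (st.eq.left_sort.sub_sort mor) mor
  have g1 : (Expr.app t (ctxVars Wt)).subst (upd ψ (chB Wt) (.app t (vals ψ Wt))) =
      .app t (vals ψ Wt) := by rw [subst_ctxVars, vals_upd hb.wY]
  have e2 := pm.cell_right hA hB hT ih hs tv (by rw [g1]; exact ⟨_, tv'⟩)
    (by rw [g1, upd_self, sX.subst_upd hb.xX, hV₀.subst_upd hb.wY, ← eU']; exact ss)
  rw [g1, upd_self, sX.subst_upd hb.xX, hV₀.subst_upd hb.wY, ← eU'] at e2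
  have key := ((st.eq.sub_sortEq mor).strans e2).conv key
  rw [Lf_vals, upd_self, vals_upd hb.xX, vals_upd hb.wY, ← eU] at key
  exact key

end

end

section

variable {A B : Alphabet} {TA : Set (Judg A)} {TB : Set (Judg B)}
  {T : Set (Judg (A.tensor B))}
variable {chA : PreCtx A → A.Var} {chB : PreCtx B → B.Var}

section
variable {E₀ E : TEnv TA TB} {k k' s : ℕ} {Xa : PreCtx A}
    {x : A.Var} {U₀ : SortE A} {Wt : PreCtx B} {w : B.Var} {T₀ : SortE B} {X : PreCtx A}
    {Y : PreCtx B} {Z : PreCtx (A.tensor B)} {f : A.Var → Expr A} {g : B.Var → Expr B}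

theorem Base.envB {n m : ℕ} (h : Base E n m Xa x U₀ Wt w T₀) (hZ : CtxD T (TX E Xa (Wt ++ [(w, T₀)]))) :
    Env T E Xa (Wt ++ [(w, T₀)]) (TX E Xa (Wt ++ [(w, T₀)])) :=
  .of_ctx h.hX h.gy hZ (List.Subset.refl _)

/-- Facts about the context of an axiom obtained from a term `u` of the first theory. -/
structure StageR (TA : Set (Judg A)) (TB : Set (Judg B)) (T : Set (Judg (A.tensor B)))
    (E₀ : TEnv TA TB) (k k' : ℕ) (Xa : PreCtx A) (x : A.Var) (U₀ : SortE A) (Wt : PreCtx B)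
    (w : B.Var) (V₀ : SortE B) (u : Expr A) : Prop where
  ctx : CtxD T (TX E₀ Xa (Wt ++ [(w, V₀)]))
  env : Env T E₀ Xa (Wt ++ [(w, V₀)]) (TX E₀ Xa (Wt ++ [(w, V₀)]))
  env' : Env T E₀ Xa Wt (TX E₀ Xa (Wt ++ [(w, V₀)]))
  tyL : TyL T E₀ Wt (TX E₀ Xa (Wt ++ [(w, V₀)])) k' u U₀
  tyR : TyR T E₀ Xa (TX E₀ Xa (Wt ++ [(w, V₀)])) k (.var w) V₀
  ss : Dv T (.sort (TX E₀ Xa (Wt ++ [(w, V₀)])) (tsort E₀ u U₀ (.var w) V₀))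
  eq : Dv T (.sortEq (TX E₀ Xa (Wt ++ [(w, V₀)])) ((tsort E₀ (.var x) U₀ (.var w) V₀).subst
    (tmap E₀ (upd .var x u) .var)) (tsort E₀ u U₀ (.var w) V₀))

variable {v : Expr B} {V : SortE B} {φ : A.Var → Expr A} {t : A.TermSym} {V₀ : SortE B}

theorem Base.stageR (H : TH TA TB chA chB) (ih : Below TA TB (tensorAx TA TB chA chB) s)
    (hs : k + k' + 1 < s) (hb : Base E₀ (k + 1) (k' + 1) Xa x U₀ Wt w V₀) (cX : CtxR TA k Xa)
    (cY : CtxR TB k' Wt) {u : Expr A} (hu : R TA (k + 1) (.term Xa u U₀)) :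
    StageR TA TB (tensorAx TA TB chA chB) E₀ k k' Xa x U₀ Wt w V₀ u := by
  have hZ₀ := ctxD_TX_full ih (n := k) (m := k' + 1) (by omega) hb.hX hb.gy cX hb.cy
  have env₀ := hb.envB hZ₀
  have env₀' := env₀.mono (X' := Xa) (Y' := Wt) (List.Subset.refl _) (List.subset_append_left ..)
  have tyR := (ih k (k' + 1) (by omega)).tyR env₀
    (hb.cy.var_mem (p := (w, V₀)) (by simp))
  have tyL := (ih (k + 1) k' (by omega)).tyL env₀' hu
  have pm₀ := hb.PM_id cX cY env₀' tyL tyR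
  have ss₀ := ss_step H ih hs env₀' hb.hU hb.hV tyL tyR
  have w₀ := pm₀.cell_upd H.hA H.hB H.hT (ih k k' (by omega))
    (by rw [ssubst_id, ssubst_id]; exact ss₀)
  rw [upd_id, ssubst_id, ssubst_id] at w₀
  exact ⟨hZ₀, env₀, env₀', tyL, tyR, ss₀, w₀⟩

theorem tr_step (H : TH TA TB chA chB) (ih : Below TA TB (tensorAx TA TB chA chB) s)
    (hs : k + k' + 1 < s) (hE : Env (tensorAx TA TB chA chB) E X Y Z)
    (hV : R TB (k' + 1) (.sort Y V)) (hax : introTerm Xa t U₀ ∈ TA) (cX : CtxR TA k Xa)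
    (hU₀ : R TA k (.sort Xa U₀)) (hU : R TA k (.sort X (U₀.subst φ)))
    (hφ : ∀ q ∈ Xa, R TA k (.term X (φ q.1) (q.2.subst φ)))
    (hR : TyR (tensorAx TA TB chA chB) E X Z k v V) :
    Dv (tensorAx TA TB chA chB) (.term Z (Rf E t (vals φ Xa) v V)
      (tsort E (.app t (vals φ Xa)) (U₀.subst φ) v V)) := by
  have hA := H.hA
  have hB := H.hB
  have hT := H.hT
  obtain ⟨_, Wt, ψ, e, hax', cY, eV, hψ⟩ := hV.sort_inv
  obtain rfl := Nat.succ.inj e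
  have eV' : V = (SortE.mk V.head (ctxVars Wt)).subst ψ := by rw [ssubst_ctxVars]; exact eV
  generalize V.head = S at *
  have sY := cY.sSub_var hax'
  obtain ⟨E₀, hb⟩ := exists_base H.fA H.fB (cX.le (Nat.le_succ k)) hU₀.mono
    (cY.le (Nat.le_succ k')) sY
  have tu := cX.tSub_var hU₀ hax
  have tu' : R TA (k + 1) (.term X (.app t (vals φ Xa)) (U₀.subst φ)) :=
    .tSub hax cX.1 cX.2 hU₀ hU hφ
  have st := hb.stageR H ih hs cX cY tu
  have ax := hb.ax_ts hA hB tu hax hax'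
  rw [ten_app_var hA hB hb.hX hb.hY (tu.adm hA hb.hX) hb.admw, show E₀.Δ (chB Wt) = _ from hb.hw, ← vals_var Wt, ← vals_var Xa,
    ← Rf_vals E₀ E₀ t S (chB Wt, _), vals_tmap_var] at ax
  have tyL := (ih (k + 1) k' (by omega)).tyL hE tu'
  have ss := ss_step H ih hs hE hU.mono hV tyL hR
  have pm := hb.PM cX cY hE hφ hψ hU.mono (eV' ▸ hV) tyL (eV' ▸ hR)
  have mor := pm.morB hA hB hT (ih k k' (by omega))
  have key := Dv.tSub ax st.ctx st.eq.left_sort (st.eq.left_sort.sub_sort mor) mor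
  have g1 : (Expr.app t (ctxVars Xa)).subst (upd φ (chA Xa) (.app t (vals φ Xa))) =
      .app t (vals φ Xa) := by rw [subst_ctxVars, vals_upd hb.xX]
  have e2 := pm.cell_left hA hB hT ih hs tu (by rw [g1]; exact ⟨_, tu'⟩)
    (by rw [g1, upd_self, sY.subst_upd hb.wY, hU₀.subst_upd hb.xX, ← eV']; exact ss)
  rw [g1, upd_self, sY.subst_upd hb.wY, hU₀.subst_upd hb.xX, ← eV'] at e2
  have key := ((st.eq.sub_sortEq mor).strans e2).conv key
  rw [Rf_vals, upd_self, vals_upd hb.xX, vals_upd hb.wY, ← eV] at key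
  exact key

end

end

section

variable {A B : Alphabet} {TA : Set (Judg A)} {TB : Set (Judg B)}
  {T : Set (Judg (A.tensor B))}
variable {chA : PreCtx A → A.Var} {chB : PreCtx B → B.Var}

theorem map_subst_ctxVars (X : PreCtx A) (φ : A.Var → Expr A) :
    (ctxVars X).map (Expr.subst φ) = vals φ X := by
  rw [← vals_var, vals_subst]; simp only [subst_var]

section
variable {E₀ E : TEnv TA TB} {Z : PreCtx (A.tensor B)} {f : A.Var → Expr A} {g : B.Var → Expr B}
  {W : SortE (A.tensor B)}

theorem Lf_subst (hT : TUniq T) (hZ : Fn Z) {u u' : Expr A} {U : SortE A} {t : B.TermSym}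
    {l : List (Expr B)} {Θ : (A.tensor B).Var → Expr (A.tensor B)}
    (h : Dv T (.term Z (Lf E u' (U.subst f) t (l.map (Expr.subst g))) W))
    (h1 : ∀ a ∈ U.args, ∀ b ∈ l, Eqv T Z ((ten E₀ a b).subst Θ) (ten E (a.subst f) (b.subst g)))
    (h3 : ∀ b ∈ l, Eqv T Z ((ten E₀ u b).subst Θ) (ten E u' (b.subst g))) :
    Eqv T Z ((Lf E₀ u U t l).subst Θ) (Lf E u' (U.subst f) t (l.map (Expr.subst g))) := by
  rw [Lf_eqF, LfF_subst]
  rw [Lf_eqF] at h ⊢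
  refine (LfF_congr (U' := U) (u' := u) (g' := l) (G := fun a b => (ten E₀ a b).subst Θ) hT hZ h rfl (Q := fun a' a => a ∈ U.args ∧ a' = a.subst f)
    (Q' := fun b' b => b ∈ l ∧ b' = b.subst g) ?_ ?_ ?_ ?_).symm
  · exact (forall₂_map (Q := fun a a' => a ∈ U.args ∧ a' = a.subst f) fun a ha => ⟨ha, rfl⟩).flip
  · exact (forall₂_map (Q := fun a a' => a ∈ l ∧ a' = a.subst g) fun a ha => ⟨ha, rfl⟩).flip
  · rintro _ a _ b ⟨ha, rfl⟩ ⟨hb, rfl⟩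
    exact (h1 a ha b hb).symm
  · rintro _ b ⟨hb, rfl⟩
    exact (h3 b hb).symm

theorem Rf_subst (hT : TUniq T) (hZ : Fn Z) {v v' : Expr B} {V : SortE B} {s : A.TermSym}
    {l : List (Expr A)} {Θ : (A.tensor B).Var → Expr (A.tensor B)}
    (h : Dv T (.term Z (Rf E s (l.map (Expr.subst f)) v' (V.subst g)) W))
    (h1 : ∀ a ∈ l, ∀ b ∈ V.args, Eqv T Z ((ten E₀ a b).subst Θ) (ten E (a.subst f) (b.subst g)))
    (h2 : ∀ a ∈ l, Eqv T Z ((ten E₀ a v).subst Θ) (ten E (a.subst f) v')) :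
    Eqv T Z ((Rf E₀ s l v V).subst Θ) (Rf E s (l.map (Expr.subst f)) v' (V.subst g)) := by
  rw [Rf_eqF, RfF_subst]
  rw [Rf_eqF] at h ⊢
  refine (RfF_congr (V' := V) (v' := v) (f' := l) (G := fun a b => (ten E₀ a b).subst Θ) hT hZ h rfl (Q := fun a' a => a ∈ l ∧ a' = a.subst f)
    (Q' := fun b' b => b ∈ V.args ∧ b' = b.subst g) ?_ ?_ ?_ ?_).symm
  · exact (forall₂_map (Q := fun a a' => a ∈ l ∧ a' = a.subst f) fun a ha => ⟨ha, rfl⟩).flip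
  · exact (forall₂_map (Q := fun a a' => a ∈ V.args ∧ a' = a.subst g) fun a ha => ⟨ha, rfl⟩).flip
  · rintro _ a _ b ⟨ha, rfl⟩ ⟨hb, rfl⟩
    exact (h1 a ha b hb).symm
  · rintro _ a ⟨ha, rfl⟩
    exact (h2 a ha).symm

end

section
variable {E : TEnv TA TB} {k k' n : ℕ} {Xa : PreCtx A} {U₀ : SortE A} {Wt : PreCtx B}
    {V₀ : SortE B} {X : PreCtx A} {Y : PreCtx B} {Z : PreCtx (A.tensor B)}
    {φ : A.Var → Expr A} {ψ : B.Var → Expr B} {s : A.TermSym} {t : B.TermSym}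

theorem tt_step (H : TH TA TB chA chB) (ih : Below TA TB (tensorAx TA TB chA chB) n)
    (hs : k + k' + 1 < n) (hE : Env (tensorAx TA TB chA chB) E X Y Z)
    (hax : introTerm Xa s U₀ ∈ TA) (cX : CtxR TA k Xa) (hU₀ : R TA k (.sort Xa U₀))
    (hU : R TA k (.sort X (U₀.subst φ))) (hφ : ∀ p ∈ Xa, R TA k (.term X (φ p.1) (p.2.subst φ)))
    (hax' : introTerm Wt t V₀ ∈ TB) (cY : CtxR TB k' Wt) (hV₀ : R TB k' (.sort Wt V₀))
    (hV : R TB k' (.sort Y (V₀.subst ψ)))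
    (hψ : ∀ q ∈ Wt, R TB k' (.term Y (ψ q.1) (q.2.subst ψ))) :
    Eqv (tensorAx TA TB chA chB) Z
      (Lf E (.app s (vals φ Xa)) (U₀.subst φ) t (vals ψ Wt))
      (Rf E s (vals φ Xa) (.app t (vals ψ Wt)) (V₀.subst ψ)) := by
  have hA := H.hA
  have hB := H.hB
  have hT := H.hT
  obtain ⟨E₀, hb⟩ := exists_base H.fA H.fB (cX.le (Nat.le_succ k)) hU₀.mono
    (cY.le (Nat.le_succ k')) hV₀.mono
  have tu := cX.tSub_var hU₀ hax
  have tv := cY.tSub_var hV₀ hax'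
  have tu' : R TA (k + 1) (.term X (.app s (vals φ Xa)) (U₀.subst φ)) :=
    .tSub hax cX.1 cX.2 hU₀ hU hφ
  have tv' : R TB (k' + 1) (.term Y (.app t (vals ψ Wt)) (V₀.subst ψ)) :=
    .tSub hax' cY.1 cY.2 hV₀ hV hψ
  have hc := ih k k' (by omega)
  have hc1 := ih (k + 1) k' (by omega)
  have hc2 := ih k (k' + 1) (by omega)
  have hZ₀ := ctxD_TX_full ih (n := k) (m := k') (by omega) hb.hX hb.hY cX cY
  have env₀ : Env (tensorAx TA TB chA chB) E₀ Xa Wt (TX E₀ Xa Wt) :=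
    .of_ctx hb.hX hb.hY hZ₀ (List.Subset.refl _)
  have tyL₀ := hc1.tyL env₀ tu
  have tyR₀ := hc2.tyR env₀ tv
  have tyL := hc1.tyL hE tu'
  have tyR := hc2.tyR hE tv'
  have lf₀ := tl_step H ih hs env₀ (ψ := .var) hU₀.mono hax' cY hV₀ (by rw [ssubst_id]; exact hV₀)
    (fun q hq => by rw [ssubst_id]; exact cY.var_mem hq) tyL₀
  have rf₀ := tr_step H ih hs env₀ (φ := .var) hV₀.mono hax cX hU₀ (by rw [ssubst_id]; exact hU₀)
    (fun q hq => by rw [ssubst_id]; exact cX.var_mem hq) tyR₀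
  have lf := tl_step H ih hs hE (ψ := ψ) hU.mono hax' cY hV₀ hV hψ tyL
  have rf := tr_step H ih hs hE (φ := φ) hV.mono hax cX hU₀ hU hφ tyR
  have hUs : U₀ = E₀.sA (.app s (ctxVars Xa)) := by
    have := cs_app_vals (Γ := E₀.Γ) hA hax hU₀ .var
    rw [ssubst_id] at this
    exact this.symm
  have ax := hb.ax_tt hA hB hUs tu tv hax hax'
  rw [ten_app hA hB hb.hX hb.hY (tu.adm hA hb.hX) (tv.adm hB hb.hY), ← hUs,
    ten_app_var hA hB hb.hX hb.hY (tu.adm hA hb.hX) hb.admw, hb.hw] at ax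
  have pm₀ := hb.PM_id cX cY env₀ tyL₀ tyR₀
  have w₀ := pm₀.cell_upd hA hB hT hc
    (by rw [ssubst_id, ssubst_id]; exact ss_step H ih hs env₀ hU₀.mono hV₀.mono tyL₀ tyR₀)
  rw [ssubst_id, ssubst_id] at w₀
  rw [vals_var, ssubst_id] at lf₀ rf₀
  have sv : ∀ q ∈ Wt, upd Expr.var (chB Wt) (.app t (ctxVars Wt)) q.1 = .var q.1 :=
    fun q hq => upd_ne _ (hb.wY q hq) _
  have cX' : ∃ n, CtxR TA n Xa := ⟨_, cX⟩
  have cY' : ∃ n, CtxR TB n Wt := ⟨_, cY⟩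
  have iX : ∀ p ∈ Xa, R TA k (.term Xa (.var p.1) (p.2.subst .var)) :=
    fun p hp => by rw [ssubst_id]; exact cX.var_mem hp
  have e₀ : Eqv (tensorAx TA TB chA chB) (TX E₀ Xa Wt)
      ((Rf E₀ s (ctxVars Xa) (.var (chB Wt)) V₀).subst
        (tmap E₀ .var (upd .var (chB Wt) (.app t (ctxVars Wt)))))
      (Rf E₀ s (ctxVars Xa) (.app t (ctxVars Wt)) V₀) := by
    have sub₀ := subH_of_cl (f := .var) (g := upd .var (chB Wt) (.app t (ctxVars Wt))) hc
      hb.hX hb.hY cX' cY' env₀ iX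
      fun q hq => by
        rw [sv q hq, (cY.sort_mem hq).subst_upd hb.wY, ssubst_id]; exact cY.var_mem hq
    have eV : V₀.subst (upd .var (chB Wt) (.app t (ctxVars Wt))) = V₀ := by
      rw [hV₀.subst_upd hb.wY, ssubst_id]
    have := Rf_subst (E₀ := E₀) (E := E₀) (f := .var) (v := .var (chB Wt))
      (g := upd .var (chB Wt) (.app t (ctxVars Wt)))
      (Θ := tmap E₀ .var (upd .var (chB Wt) (.app t (ctxVars Wt)))) hT env₀.fn (V := V₀)
      (v' := .app t (ctxVars Wt)) (s := s) (l := ctxVars Xa)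
      (by rw [map_subst_ctxVars, vals_var, eV]; exact rf₀) (fun a ha b hb' => by
        obtain ⟨p, hp, rfl⟩ := List.mem_map.1 ha
        obtain ⟨_, _, -, h2⟩ := (hV₀.le (Nat.le_succ k')).sort_args hb'
        refine sub₀.eqv hA hB hT (cX.var_mem hp) h2 ⟨_, by rw [subst_var]; exact iX p hp⟩ ?_
        exact R.sort_subst_args' (U := V₀) (by rw [eV]; exact hV₀) b hb')
      (fun a ha => by
        obtain ⟨p, hp, rfl⟩ := List.mem_map.1 ha
        rw [ten_var_var, subst_var, tmap_mk, upd_self, subst_var]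
        exact (tyR₀.ty _ _ (cX.var_mem hp)).eqv_refl)
    rwa [map_subst_ctxVars, vals_var, eV] at this
  have sub := subH_of_cl (f := φ) (g := ψ) hc hb.hX hb.hY cX' cY' hE hφ hψ
  have sub1 := subH_of_cl (f := φ) (g := ψ) hc1 hb.hX hb.hY cX' cY' hE
    (fun p hp => (hφ p hp).mono) hψ
  have sub2 := subH_of_cl (f := φ) (g := ψ) hc2 hb.hX hb.hY cX' cY' hE hφ
    fun p hp => (hψ p hp).mono
  have mor : Mor (tensorAx TA TB chA chB) Z (TX E₀ Xa Wt) (tmap E φ ψ) := by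
    intro z hz
    obtain ⟨p, hp, q, hq, rfl⟩ := mem_grid.1 hz
    exact sub.mor_cell hA hB hT hp hq
  have key := Dv.teqSub ax hZ₀ (w₀.ssymm.conv lf₀) (w₀.ssymm.conv (e₀.symm.typed hT env₀.fn rf₀))
    ((w₀.ssymm.conv lf₀).sub_term mor)
    ((w₀.ssymm.conv (e₀.symm.typed hT env₀.fn rf₀)).sub_term mor) mor
  obtain ⟨_, e₀⟩ := e₀
  have e1 := Lf_subst (E₀ := E₀) (E := E) (f := φ) (g := ψ) (u := .app s (ctxVars Xa))
    (u' := .app s (vals φ Xa)) (U := U₀) (t := t) (l := ctxVars Wt) (Θ := tmap E φ ψ) hT hE.fn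
    (by rw [map_subst_ctxVars]; exact lf) (fun a ha b hb' => by
      obtain ⟨q, hq, rfl⟩ := List.mem_map.1 hb'
      obtain ⟨_, _, -, h1⟩ := (hU₀.le (Nat.le_succ k)).sort_args ha
      exact sub.eqv hA hB hT h1 (cY.var_mem hq) (hU.sort_subst_args' a ha)
        ⟨_, by rw [subst_var]; exact hψ q hq⟩)
    (fun b hb' => by
      obtain ⟨q, hq, rfl⟩ := List.mem_map.1 hb'
      have := sub1.eqv hA hB hT tu (cY.var_mem hq)
        ⟨_, by rw [subst_ctxVars]; exact tu'⟩ ⟨_, by rw [subst_var]; exact hψ q hq⟩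
      rwa [subst_ctxVars] at this)
  have e2 := Rf_subst (E₀ := E₀) (E := E) (f := φ) (g := ψ) (v := .app t (ctxVars Wt))
    (v' := .app t (vals ψ Wt)) (V := V₀) (s := s) (l := ctxVars Xa) (Θ := tmap E φ ψ) hT hE.fn
    (by rw [map_subst_ctxVars]; exact rf) (fun a ha b hb' => by
      obtain ⟨q, hq, rfl⟩ := List.mem_map.1 ha
      obtain ⟨_, _, -, h1⟩ := (hV₀.le (Nat.le_succ k')).sort_args hb'
      exact sub.eqv hA hB hT (cX.var_mem hq) h1 
        ⟨_, by rw [subst_var]; exact hφ q hq⟩ (hV.sort_subst_args' b hb'))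
    (fun a ha => by
      obtain ⟨q, hq, rfl⟩ := List.mem_map.1 ha
      have := sub2.eqv hA hB hT (cX.var_mem hq) tv
        ⟨_, by rw [subst_var]; exact hφ q hq⟩ ⟨_, by rw [subst_ctxVars]; exact tv'⟩
      rwa [subst_ctxVars] at this)
  rw [map_subst_ctxVars] at e1 e2
  exact e1.symm.trans hT hE.fn (key.eqv.trans hT hE.fn
    ((e₀.sub_termEq mor).eqv.trans hT hE.fn e2))

end

end

section

section
variable {A : Alphabet} {Ax : Set (Judg A)} {N : ℕ} {X : PreCtx A}

theorem R.sortEq_ind {P : SortE A → SortE A → Prop}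
    (mono : ∀ {U V}, R Ax N (.sortEq X U V) → P U V)
    (refl : ∀ {U}, R Ax (N + 1) (.sort X U) → P U U)
    (symm : ∀ {U V}, P U V → P V U)
    (trans : ∀ {U V W}, R Ax (N + 1) (.sortEq X U V) → R Ax (N + 1) (.sortEq X V W) →
      P U V → P V W → P U W)
    (sub : ∀ {Xa U U' φ}, Judg.sortEq Xa U U' ∈ Ax → CtxR Ax N Xa → R Ax N (.sort Xa U) →
      R Ax N (.sort Xa U') → R Ax N (.sort X (U.subst φ)) → R Ax N (.sort X (U'.subst φ)) →
      (∀ p ∈ Xa, R Ax N (.term X (φ p.1) (p.2.subst φ))) → P (U.subst φ) (U'.subst φ))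
    (cong : ∀ {Xa S φ ψ}, introSort Xa S ∈ Ax → CtxR Ax N Xa → R Ax N (.sort X ⟨S, vals φ Xa⟩) →
      R Ax N (.sort X ⟨S, vals ψ Xa⟩) →
      (∀ p ∈ Xa, R Ax N (.termEq X (φ p.1) (ψ p.1) (p.2.subst φ))) →
      P ⟨S, vals φ Xa⟩ ⟨S, vals ψ Xa⟩)
    {U V : SortE A} (h : R Ax (N + 1) (.sortEq X U V)) : P U V := by
  generalize hn : N + 1 = n, hJ : Judg.sortEq X U V = J at h
  induction h generalizing U V with
  | mono h => cases hn; cases hJ; exact mono h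
  | srefl h => cases hn; cases hJ; exact refl h
  | ssymm h ih => cases hJ; exact symm (ih hn rfl)
  | strans h1 h2 ih1 ih2 =>
    cases hJ; subst hn; exact trans h1 h2 (ih1 rfl rfl) (ih2 rfl rfl)
  | seqSub hax hnd hctx hU hU' h1 h2 hargs =>
    cases hn; cases hJ; exact sub hax ⟨hnd, hctx⟩ hU hU' h1 h2 hargs
  | seqCong hax hnd hctx h1 h2 hargs =>
    cases hn; cases hJ; exact cong hax ⟨hnd, hctx⟩ h1 h2 hargs
  | _ => cases hJ

theorem R.termEq_ind {P : Expr A → Expr A → SortE A → Prop}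
    (mono : ∀ {u v U}, R Ax N (.termEq X u v U) → P u v U)
    (refl : ∀ {u U}, R Ax (N + 1) (.term X u U) → P u u U)
    (symm : ∀ {u v U}, P u v U → P v u U)
    (trans : ∀ {u v w U}, P u v U → P v w U → P u w U)
    (conv : ∀ {u v U V}, R Ax N (.termEq X u v U) → P u v V)
    (sub : ∀ {Xa u u' U φ}, Judg.termEq Xa u u' U ∈ Ax → CtxR Ax N Xa → R Ax N (.term Xa u U) →
      R Ax N (.term Xa u' U) → R Ax N (.term X (u.subst φ) (U.subst φ)) →
      R Ax N (.term X (u'.subst φ) (U.subst φ)) →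
      (∀ p ∈ Xa, R Ax N (.term X (φ p.1) (p.2.subst φ))) →
      P (u.subst φ) (u'.subst φ) (U.subst φ))
    (cong : ∀ {Xa t U φ ψ}, introTerm Xa t U ∈ Ax → CtxR Ax N Xa → R Ax N (.sort Xa U) →
      R Ax N (.term X (.app t (vals φ Xa)) (U.subst φ)) →
      R Ax N (.term X (.app t (vals ψ Xa)) (U.subst φ)) →
      (∀ p ∈ Xa, R Ax N (.termEq X (φ p.1) (ψ p.1) (p.2.subst φ))) →
      P (.app t (vals φ Xa)) (.app t (vals ψ Xa)) (U.subst φ))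
    {u v : Expr A} {U : SortE A} (h : R Ax (N + 1) (.termEq X u v U)) : P u v U := by
  generalize hn : N + 1 = n, hJ : Judg.termEq X u v U = J at h
  induction h generalizing u v U with
  | mono h => cases hn; cases hJ; exact mono h
  | trefl h => cases hn; cases hJ; exact refl h
  | tsymm h ih => cases hJ; exact symm (ih hn rfl)
  | ttrans h1 h2 ih1 ih2 => cases hJ; exact trans (ih1 hn rfl) (ih2 hn rfl)
  | conveq h1 h2 h3 h4 => cases hn; cases hJ; exact conv h2
  | teqSub hax hnd hctx hu hu' h1 h2 hargs =>
    cases hn; cases hJ; exact sub hax ⟨hnd, hctx⟩ hu hu' h1 h2 hargs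
  | teqCong hax hnd hctx hU h1 h2 hargs =>
    cases hn; cases hJ; exact cong hax ⟨hnd, hctx⟩ hU h1 h2 hargs
  | _ => cases hJ

end

variable {A B : Alphabet} {TA : Set (Judg A)} {TB : Set (Judg B)}
  {T : Set (Judg (A.tensor B))}

section
variable {E : TEnv TA TB} {X : PreCtx A} {Y : PreCtx B} {Z : PreCtx (A.tensor B)} {s n : ℕ}

theorem TyL.transport (hT : TUniq T) (ih : Below TA TB T s) (hE : Env T E X Y Z) {u : Expr A}
    {U W : SortE A} (hUW : R TA n (.sortEq X U W)) {M : ℕ} (hs : n + M < s)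
    (h : TyL T E Y Z M u U) : TyL T E Y Z M u W := by
  induction M with
  | zero => exact .zero
  | succ M hM =>
    have h0 := h.le (Nat.le_succ M)
    have h1 := hM (by omega) h0
    have hc := ih n (M + 1) hs
    refine ⟨fun v V hv => ?_, fun t g V hv => ?_, h.cg⟩
    · exact (hc.e3L hE hUW hv.sort_of_term h0 h1
        ((ih (n - 1) (M + 1) (by omega)).tyR hE hv)).conv (h.ty v V hv)
    · exact (h.lf t g V hv).trans hT hE.fn (hc.e2L hE hUW hv h0 h1)

theorem TyR.transport (hT : TUniq T) (ih : Below TA TB T s) (hE : Env T E X Y Z) {v : Expr B}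
    {V W : SortE B} (hVW : R TB n (.sortEq Y V W)) {M : ℕ} (hs : M + n < s)
    (h : TyR T E X Z M v V) : TyR T E X Z M v W := by
  induction M with
  | zero => exact .zero
  | succ M hM =>
    have h0 := h.le (Nat.le_succ M)
    have h1 := hM (by omega) h0
    have hc := ih (M + 1) n hs
    refine ⟨fun u U hu => ?_, fun s f U hu => ?_, h.cg⟩
    · exact (hc.e3R hE hu.sort_of_term hVW
        ((ih (M + 1) (n - 1) (by omega)).tyL hE hu) h0 h1).conv (h.ty u U hu)
    · exact (h.rf s f U hu).trans hT hE.fn (hc.e2R hE hu hVW h0 h1)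

end

end

section

variable {A B : Alphabet} {TA : Set (Judg A)} {TB : Set (Judg B)}
  {T : Set (Judg (A.tensor B))}
variable {chA : PreCtx A → A.Var} {chB : PreCtx B → B.Var}

theorem forall₂_vals {Q : Expr A → Expr A → Prop} {X : PreCtx A} {φ ψ : A.Var → Expr A}
    (h : ∀ p ∈ X, Q (φ p.1) (ψ p.1)) : List.Forall₂ Q (vals φ X) (vals ψ X) := by
  rw [vals, vals, List.forall₂_map_left_iff, List.forall₂_map_right_iff]
  exact forall₂_self h

section
variable {E₀ E : TEnv TA TB} {k k' s n m : ℕ} {Xa : PreCtx A}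
    {x : A.Var} {U₀ U₀' : SortE A} {Wt : PreCtx B} {w : B.Var} {T₀ V : SortE B} {X : PreCtx A}
    {Y : PreCtx B} {Z : PreCtx (A.tensor B)} {f : A.Var → Expr A} {g : B.Var → Expr B}

theorem Base.tsort_updA (hA : TUniq TA) (hB : TUniq TB) {S : B.SortSym}
    (h : Base E₀ n m Xa x U₀ Wt w ⟨S, ctxVars Wt⟩) (hU' : R TA n (.sort Xa U₀')) :
    tsort (⟨upd E₀.Γ x U₀', E₀.Δ⟩ : TEnv TA TB) (.var x) U₀' (.var w) ⟨S, ctxVars Wt⟩ =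
      tsort E₀ (.var x) U₀' (.var w) ⟨S, ctxVars Wt⟩ := by
  have hb' := h.updA hU'
  rw [tsort, tsort]
  congr 2
  · refine grid_congr fun a ha b hb => ?_
    obtain ⟨_, _, -, h1⟩ := hU'.sort_args ha
    rcases List.mem_append.1 hb with hb | hb
    · obtain ⟨_, _, -, h2⟩ := h.hV.sort_args hb
      exact R.ten_indep hA hB hb'.hX h.hX hb'.hY h.hY h1 h2
    · rw [List.mem_singleton.1 hb]
      exact R.ten_indep hA hB hb'.hX h.hX hb'.gy h.gy h1
        (h.cy.var_mem (p := (w, ⟨S, ctxVars Wt⟩)) (by simp))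
  · refine List.map_congr_left fun b hb => ?_
    obtain ⟨q, -, rfl⟩ := List.mem_map.1 hb
    rw [ten_var_var, ten_var_var]

theorem Base.tsort_updB (hA : TUniq TA) (hB : TUniq TB) {S : A.SortSym} {V₀ V₀' : SortE B}
    (h : Base E₀ n m Xa x ⟨S, ctxVars Xa⟩ Wt w V₀) (hV' : R TB m (.sort Wt V₀')) :
    tsort (⟨E₀.Γ, upd E₀.Δ w V₀'⟩ : TEnv TA TB) (.var x) ⟨S, ctxVars Xa⟩ (.var w) V₀' =
      tsort E₀ (.var x) ⟨S, ctxVars Xa⟩ (.var w) V₀' := by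
  have hb' := h.updB hV'
  rw [tsort, tsort]
  congr 2
  · refine grid_congr fun a ha b hb => ?_
    obtain ⟨p, hp, rfl⟩ := List.mem_map.1 ha
    rcases List.mem_append.1 hb with hb | hb
    · obtain ⟨_, _, -, h2⟩ := hV'.sort_args hb
      exact R.ten_indep hA hB hb'.hX h.hX hb'.hY h.hY (h.cx.initial.var_mem hp) h2
    · rw [List.mem_singleton.1 hb, ten_var_var, ten_var_var]
  · refine List.map_congr_left fun b hb => ?_
    obtain ⟨_, _, -, h2⟩ := hV'.sort_args hb
    exact R.ten_indep hA hB hb'.gx h.gx hb'.hY h.hY (h.cx.var_mem (p := (x, ⟨S, ctxVars Xa⟩)) (by simp)) h2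

theorem PM.cell_sortL (hA : TUniq TA) (hB : TUniq TB) (hT : TUniq T)
    (h : PM T E₀ E k k' Xa x U₀ Wt w T₀ X Y Z f g) (hcl : Cl TA TB T k k')
    (hU' : R TA (k + 1) (.sort Xa U₀')) (hU'f : R TA (k + 1) (.sort X (U₀'.subst f)))
    (hs : Dv T (.sort Z (tsort E (f x) (U₀'.subst f) (g w) (T₀.subst g)))) :
    Dv T (.sortEq Z ((tsort E₀ (.var x) U₀' (.var w) T₀).subst (tmap E f g))
      (tsort E (f x) (U₀'.subst f) (g w) (T₀.subst g))) := by
  refine tsort_subst hT h.env.fn hs (fun a ha b hb => ?_) (fun a ha => ?_) (fun b hb => ?_)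
  · obtain ⟨_, _, -, h1⟩ := hU'.sort_args ha
    obtain ⟨_, _, -, h2⟩ := h.base.hV.sort_args hb
    exact (h.subH le_rfl le_rfl hcl).eqv hA hB hT h1 h2 (hU'f.sort_subst_args a ha)
      (h.hV.sort_subst_args b hb)
  · obtain ⟨_, _, -, h1⟩ := hU'.sort_args ha
    exact (h.subB hcl).eqv_var_right hA hB hT (q := (w, T₀)) (by simp) h1
      (hU'f.sort_subst_args a ha)
  · obtain ⟨_, _, -, h2⟩ := h.base.hV.sort_args hb
    exact (h.subA hcl).eqv_var_left hA hB hT (p := (x, U₀)) (by simp) h2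
      (h.hV.sort_subst_args b hb)

theorem PM.cell_sortR (hA : TUniq TA) (hB : TUniq TB) (hT : TUniq T)
    (h : PM T E₀ E k k' Xa x U₀ Wt w T₀ X Y Z f g) (hcl : Cl TA TB T k k') {T₀' : SortE B}
    (hV' : R TB (k' + 1) (.sort Wt T₀')) (hV'g : R TB (k' + 1) (.sort Y (T₀'.subst g)))
    (hs : Dv T (.sort Z (tsort E (f x) (U₀.subst f) (g w) (T₀'.subst g)))) :
    Dv T (.sortEq Z ((tsort E₀ (.var x) U₀ (.var w) T₀').subst (tmap E f g))
      (tsort E (f x) (U₀.subst f) (g w) (T₀'.subst g))) := by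
  refine tsort_subst hT h.env.fn hs (fun a ha b hb => ?_) (fun a ha => ?_) (fun b hb => ?_)
  · obtain ⟨_, _, -, h1⟩ := h.base.hU.sort_args ha
    obtain ⟨_, _, -, h2⟩ := hV'.sort_args hb
    exact (h.subH le_rfl le_rfl hcl).eqv hA hB hT h1 h2 (h.hU.sort_subst_args a ha)
      (hV'g.sort_subst_args b hb)
  · obtain ⟨_, _, -, h1⟩ := h.base.hU.sort_args ha
    exact (h.subB hcl).eqv_var_right hA hB hT (q := (w, T₀)) (by simp) h1
      (h.hU.sort_subst_args a ha)
  · obtain ⟨_, _, -, h2⟩ := hV'.sort_args hb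
    exact (h.subA hcl).eqv_var_left hA hB hT (p := (x, U₀)) (by simp) h2
      (hV'g.sort_subst_args b hb)

variable {φ : A.Var → Expr A} {u : Expr A} {v : Expr B}

theorem e3L_of_mem (H : TH TA TB chA chB) (ih : Below TA TB (tensorAx TA TB chA chB) s)
    (hs : k + k' + 1 < s) (hE : Env (tensorAx TA TB chA chB) E X Y Z)
    (hV : R TB (k' + 1) (.sort Y V)) (hR : TyR (tensorAx TA TB chA chB) E X Z k v V)
    (hax : Judg.sortEq Xa U₀ U₀' ∈ TA) (cX : CtxR TA k Xa) (hU₀ : R TA k (.sort Xa U₀))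
    (hU₀' : R TA k (.sort Xa U₀')) (hU : R TA k (.sort X (U₀.subst φ)))
    (hU' : R TA k (.sort X (U₀'.subst φ)))
    (hφ : ∀ p ∈ Xa, R TA k (.term X (φ p.1) (p.2.subst φ)))
    (hL : TyL (tensorAx TA TB chA chB) E Y Z k' u (U₀.subst φ))
    (hL' : TyL (tensorAx TA TB chA chB) E Y Z k' u (U₀'.subst φ)) :
    Dv (tensorAx TA TB chA chB) (.sortEq Z (tsort E u (U₀.subst φ) v V)
      (tsort E u (U₀'.subst φ) v V)) := by
  have hA := H.hA
  have hB := H.hB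
  have hT := H.hT
  obtain ⟨_, Wt, ψ, e, hax', cY, eV, hψ⟩ := hV.sort_inv
  obtain rfl := Nat.succ.inj e
  have eV' : V = (SortE.mk V.head (ctxVars Wt)).subst ψ := by rw [ssubst_ctxVars]; exact eV
  generalize V.head = S' at *
  have sY := cY.sSub_var hax'
  obtain ⟨E₀, hb⟩ := exists_base H.fA H.fB (cX.le (Nat.le_succ _)) hU₀.mono (cY.le (Nat.le_succ _)) sY
  have ax := hb.ax_seqs hA hB hU₀'.mono hax hax'
  rw [hb.tsort_updA hA hB hU₀'.mono] at ax
  have cZ := hb.ctxD_TX0 ih hs cX cY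
  have env₁ := Env.of_ctx hb.gx hb.hY cZ (TX_subset_TX0_left ..)
  have env₂ := Env.of_ctx hb.hX hb.gy cZ (TX_subset_TX0_right ..)
  have env₀ := env₁.mono (X' := Xa) (Y' := Wt) (List.subset_append_left ..) (List.Subset.refl _)
  have tyL := (ih (k + 1) k' (by omega)).tyL env₁ (hb.cx.var_mem (p := (chA Xa, U₀)) (by simp))
  have tyR := (ih k (k' + 1) (by omega)).tyR env₂
    (hb.cy.var_mem (p := (chB Wt, ⟨S', ctxVars Wt⟩)) (by simp))
  have tyR : TyR _ E₀ Xa _ k (.var (chB Wt)) _ := tyR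
  have hUU : R TA (k + 1) (.sortEq Xa U₀ U₀') := by
    have := R.seqSub (φ := Expr.var) (Y := Xa) hax cX.1 cX.2 hU₀ hU₀' (by rwa [ssubst_id])
      (by rwa [ssubst_id]) fun p hp => by rw [ssubst_id]; exact cX.var_mem hp
    rwa [ssubst_id, ssubst_id] at this
  have tyL' := tyL.transport hT ih env₀ hUU (by omega)
  have s1 := ss_step H ih hs env₀ hb.hU hb.hV tyL tyR
  have s2 := ss_step H ih hs env₀ hU₀'.mono hb.hV tyL' tyR
  have g1 := ss_step H ih hs hE hU.mono hV hL hR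
  have g2 := ss_step H ih hs hE hU'.mono hV hL' hR
  have hcl := ih k k' (by omega)
  have pm := hb.PM cX cY hE hφ hψ hU.mono (eV' ▸ hV) hL (eV' ▸ hR)
  have mor := pm.mor hA hB hT hcl
  have key := Dv.seqSub ax cZ s1 s2 (s1.sub_sort mor) (s2.sub_sort mor) mor
  have c1 := pm.cell_upd hA hB hT hcl (by rw [← eV']; exact g1)
  have c2 := pm.cell_sortL hA hB hT hcl hU₀'.mono (by rw [hU₀'.subst_upd hb.xX]; exact hU'.mono)
    (by rw [hU₀'.subst_upd hb.xX, sY.subst_upd hb.wY, upd_self, upd_self, ← eV']; exact g2)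
  rw [hU₀'.subst_upd hb.xX, sY.subst_upd hb.wY, upd_self, upd_self, ← eV'] at c2
  rw [← eV'] at c1
  exact (c1.ssymm.strans key).strans c2

theorem e3L_step (H : TH TA TB chA chB) (ih : Below TA TB (tensorAx TA TB chA chB) s)
    (hs : k + k' + 1 < s) (hE : Env (tensorAx TA TB chA chB) E X Y Z) {U U' : SortE A}
    (hUU' : R TA (k + 1) (.sortEq X U U'))
    (hV : R TB (k' + 1) (.sort Y V)) (hL : TyL (tensorAx TA TB chA chB) E Y Z k' u U)
    (hL' : TyL (tensorAx TA TB chA chB) E Y Z k' u U')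
    (hR : TyR (tensorAx TA TB chA chB) E X Z k v V) :
    Dv (tensorAx TA TB chA chB) (.sortEq Z (tsort E u U v V) (tsort E u U' v V)) := by
  have hT := H.hT
  refine R.sortEq_ind (P := fun U U' => TyL (tensorAx TA TB chA chB) E Y Z k' u U →
    TyL (tensorAx TA TB chA chB) E Y Z k' u U' → Dv (tensorAx TA TB chA chB)
      (.sortEq Z (tsort E u U v V) (tsort E u U' v V))) ?_ ?_ ?_ ?_ ?_ ?_ hUU' hL hL'
  · exact fun h h1 h2 => (ih k (k' + 1) (by omega)).e3L hE h hV h1 h2 (hR.le (Nat.sub_le ..))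
  · exact fun h h1 _ => (ss_step H ih hs hE h hV h1 hR).srefl
  · exact fun h h1 h2 => (h h2 h1).ssymm
  · intro U V W h1 h2 i1 i2 l1 l2
    have := l1.transport hT ih hE h1 (by omega)
    exact (i1 l1 this).strans (i2 this l2)
  · intro Xa U U' φ hax cX hU hU' h1 h2 hφ l1 l2
    exact e3L_of_mem H ih hs hE hV hR hax cX hU hU' h1 h2 hφ l1 l2
  · intro Xa S φ ψ hax cX h1 h2 hφ l1 l2
    have ss := ss_step H ih hs hE h1.mono hV l1 hR
    rw [tsort_eqF] at ss ⊢
    refine tsortF_congr hT hE.fn (Q := fun a a' => ∃ W, R TA k (.termEq X a a' W))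
      (Q' := fun b b' => b = b' ∧ ∃ W, R TB k' (.term Y b W)) ss rfl rfl ?_ ?_ ?_ ?_ ?_
    · exact forall₂_vals fun p hp => ⟨_, hφ p hp⟩
    · exact forall₂_self fun b hb => ⟨rfl, by
        obtain ⟨_, W, e, h⟩ := hV.sort_args hb
        obtain rfl := Nat.succ.inj e
        exact ⟨_, h⟩⟩
    · rintro a a' b _ ⟨_, ha⟩ ⟨rfl, _, hb⟩
      exact (ih k k' (by omega)).e1L hE ha hb
    · rintro a a' ⟨_, ha⟩
      exact hR.cg _ _ _ ha
    · rintro b _ ⟨rfl, _, hb⟩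
      exact (l1.ty _ _ hb).eqv_refl

end

end

section

variable {A B : Alphabet} {TA : Set (Judg A)} {TB : Set (Judg B)}
  {T : Set (Judg (A.tensor B))}
variable {chA : PreCtx A → A.Var} {chB : PreCtx B → B.Var}

section
variable {E₀ E : TEnv TA TB} {k k' s n m : ℕ} {Xa : PreCtx A}
    {x : A.Var} {U₀ U : SortE A} {Wt : PreCtx B} {w : B.Var} {V₀ V₀' V : SortE B} {X : PreCtx A}
    {Y : PreCtx B} {Z : PreCtx (A.tensor B)} {ψ : B.Var → Expr B} {u : Expr A} {v : Expr B}

theorem R.sortEq_var {n : ℕ} {X : PreCtx A} {U U' : SortE A} (hax : Judg.sortEq X U U' ∈ TA)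
    (cX : CtxR TA n X) (hU : R TA n (.sort X U)) (hU' : R TA n (.sort X U')) :
    R TA (n + 1) (.sortEq X U U') := by
  have := R.seqSub (φ := Expr.var) (Y := X) hax cX.1 cX.2 hU hU' (by rwa [ssubst_id])
    (by rwa [ssubst_id]) fun p hp => by rw [ssubst_id]; exact cX.var_mem hp
  rwa [ssubst_id, ssubst_id] at this

theorem e3R_of_mem (H : TH TA TB chA chB) (ih : Below TA TB (tensorAx TA TB chA chB) s)
    (hs : k + k' + 1 < s) (hE : Env (tensorAx TA TB chA chB) E X Y Z)
    (hU : R TA (k + 1) (.sort X U)) (hL : TyL (tensorAx TA TB chA chB) E Y Z k' u U)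
    (hax' : Judg.sortEq Wt V₀ V₀' ∈ TB) (cY : CtxR TB k' Wt) (hV₀ : R TB k' (.sort Wt V₀))
    (hV₀' : R TB k' (.sort Wt V₀')) (hV : R TB k' (.sort Y (V₀.subst ψ)))
    (hV' : R TB k' (.sort Y (V₀'.subst ψ)))
    (hψ : ∀ p ∈ Wt, R TB k' (.term Y (ψ p.1) (p.2.subst ψ)))
    (hR : TyR (tensorAx TA TB chA chB) E X Z k v (V₀.subst ψ))
    (hR' : TyR (tensorAx TA TB chA chB) E X Z k v (V₀'.subst ψ)) :
    Dv (tensorAx TA TB chA chB) (.sortEq Z (tsort E u U v (V₀.subst ψ))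
      (tsort E u U v (V₀'.subst ψ))) := by
  have hA := H.hA
  have hB := H.hB
  have hT := H.hT
  obtain ⟨_, Xa, φ, e, hax, cX, eU, hφ⟩ := hU.sort_inv
  obtain rfl := Nat.succ.inj e
  have eU' : U = (SortE.mk U.head (ctxVars Xa)).subst φ := by rw [ssubst_ctxVars]; exact eU
  generalize U.head = S at *
  have sX := cX.sSub_var hax
  obtain ⟨E₀, hb⟩ := exists_base H.fA H.fB (cX.le (Nat.le_succ _)) sX (cY.le (Nat.le_succ _)) hV₀.mono
  have ax := hb.ax_sseq hA hB hV₀'.mono hax hax'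
  rw [hb.tsort_updB hA hB hV₀'.mono] at ax
  have cZ := hb.ctxD_TX0 ih hs cX cY
  have env₁ := Env.of_ctx hb.gx hb.hY cZ (TX_subset_TX0_left ..)
  have env₂ := Env.of_ctx hb.hX hb.gy cZ (TX_subset_TX0_right ..)
  have env₀ := env₁.mono (X' := Xa) (Y' := Wt) (List.subset_append_left ..) (List.Subset.refl _)
  have tyL := (ih (k + 1) k' (by omega)).tyL env₁
    (hb.cx.var_mem (p := (chA Xa, ⟨S, ctxVars Xa⟩)) (by simp))
  have tyR := (ih k (k' + 1) (by omega)).tyR env₂ (hb.cy.var_mem (p := (chB Wt, V₀)) (by simp))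
  have tyL : TyL _ E₀ Wt _ k' (.var (chA Xa)) _ := tyL
  have tyR' := tyR.transport hT ih env₀ (R.sortEq_var hax' cY hV₀ hV₀') (by omega)
  have s1 := ss_step H ih hs env₀ hb.hU hb.hV tyL tyR
  have s2 := ss_step H ih hs env₀ hb.hU hV₀'.mono tyL tyR'
  have g1 := ss_step H ih hs hE hU hV.mono hL hR
  have g2 := ss_step H ih hs hE hU hV'.mono hL hR'
  have hcl := ih k k' (by omega)
  have pm := hb.PM cX cY hE hφ hψ (eU' ▸ hU) hV.mono (eU' ▸ hL) hR
  have mor := pm.mor hA hB hT hcl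
  have key := Dv.seqSub ax cZ s1 s2 (s1.sub_sort mor) (s2.sub_sort mor) mor
  have c1 := pm.cell_upd hA hB hT hcl (by rw [← eU']; exact g1)
  have c2 := pm.cell_sortR hA hB hT hcl hV₀'.mono (by rw [hV₀'.subst_upd hb.wY]; exact hV'.mono)
    (by rw [hV₀'.subst_upd hb.wY, sX.subst_upd hb.xX, upd_self, upd_self, ← eU']; exact g2)
  rw [hV₀'.subst_upd hb.wY, sX.subst_upd hb.xX, upd_self, upd_self, ← eU'] at c2
  rw [← eU'] at c1
  exact (c1.ssymm.strans key).strans c2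

theorem e3R_step (H : TH TA TB chA chB) (ih : Below TA TB (tensorAx TA TB chA chB) s)
    (hs : k + k' + 1 < s) (hE : Env (tensorAx TA TB chA chB) E X Y Z) {V V' : SortE B}
    (hU : R TA (k + 1) (.sort X U)) (hVV' : R TB (k' + 1) (.sortEq Y V V'))
    (hL : TyL (tensorAx TA TB chA chB) E Y Z k' u U)
    (hR : TyR (tensorAx TA TB chA chB) E X Z k v V)
    (hR' : TyR (tensorAx TA TB chA chB) E X Z k v V') :
    Dv (tensorAx TA TB chA chB) (.sortEq Z (tsort E u U v V) (tsort E u U v V')) := by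
  have hT := H.hT
  refine R.sortEq_ind (P := fun V V' => TyR (tensorAx TA TB chA chB) E X Z k v V →
    TyR (tensorAx TA TB chA chB) E X Z k v V' → Dv (tensorAx TA TB chA chB)
      (.sortEq Z (tsort E u U v V) (tsort E u U v V'))) ?_ ?_ ?_ ?_ ?_ ?_ hVV' hR hR'
  · exact fun h h1 h2 => (ih (k + 1) k' (by omega)).e3R hE hU h (hL.le (Nat.sub_le ..)) h1 h2
  · exact fun h h1 _ => (ss_step H ih hs hE hU h hL h1).srefl
  · exact fun h h1 h2 => (h h2 h1).ssymm
  · intro U V W h1 h2 i1 i2 l1 l2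
    have := l1.transport hT ih hE h1 (by omega)
    exact (i1 l1 this).strans (i2 this l2)
  · intro Wt V V' ψ hax cY hV hV' h1 h2 hψ l1 l2
    exact e3R_of_mem H ih hs hE hU hL hax cY hV hV' h1 h2 hψ l1 l2
  · intro Wt S φ ψ hax cY h1 h2 hφ l1 l2
    have ss := ss_step H ih hs hE hU h1.mono hL l1
    rw [tsort_eqF] at ss ⊢
    refine tsortF_congr hT hE.fn (Q := fun a a' => a = a' ∧ ∃ W, R TA k (.term X a W))
      (Q' := fun b b' => ∃ W, R TB k' (.termEq Y b b' W)) ss rfl rfl ?_ ?_ ?_ ?_ ?_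
    · exact forall₂_self fun b hb => ⟨rfl, by
        obtain ⟨_, W, e, h⟩ := hU.sort_args hb
        obtain rfl := Nat.succ.inj e
        exact ⟨_, h⟩⟩
    · exact forall₂_vals fun p hp => ⟨_, hφ p hp⟩
    · rintro a _ b b' ⟨rfl, _, ha⟩ ⟨_, hb⟩
      exact (ih k k' (by omega)).e1R hE ha hb
    · rintro a _ ⟨rfl, _, ha⟩
      exact (l1.ty _ _ ha).eqv_refl
    · rintro b b' ⟨_, hb⟩
      exact hL.cg _ _ _ hb

end

end

section

variable {A B : Alphabet} {TA : Set (Judg A)} {TB : Set (Judg B)}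
  {T : Set (Judg (A.tensor B))}
variable {chA : PreCtx A → A.Var} {chB : PreCtx B → B.Var}

section
variable {E₀ E : TEnv TA TB} {k k' s n m : ℕ} {Xa : PreCtx A}
    {x : A.Var} {U₀ U₀' : SortE A} {Wt : PreCtx B} {w : B.Var} {V₀ V : SortE B} {X : PreCtx A}
    {Y : PreCtx B} {Z : PreCtx (A.tensor B)} {φ : A.Var → Expr A} {ψ : B.Var → Expr B}
    {u : Expr A} {t : B.TermSym}

theorem Base.Lf_updA (hA : TUniq TA) (hB : TUniq TB)
    (h : Base E₀ n m Xa x U₀ Wt w V₀) (hU' : R TA n (.sort Xa U₀')) :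
    Lf (⟨upd E₀.Γ x U₀', E₀.Δ⟩ : TEnv TA TB) (.var x) U₀' t (ctxVars Wt) =
      Lf E₀ (.var x) U₀' t (ctxVars Wt) := by
  have hb' := h.updA hU'
  rw [Lf, Lf]
  congr 1
  refine grid_congr fun a ha b hb => ?_
  obtain ⟨q, hq, rfl⟩ := List.mem_map.1 hb
  rcases List.mem_append.1 ha with ha | ha
  · obtain ⟨_, _, -, h1⟩ := hU'.sort_args ha
    exact R.ten_indep hA hB hb'.hX h.hX hb'.hY h.hY h1 (h.cy.initial.var_mem hq)
  · rw [List.mem_singleton.1 ha, ten_var_var, ten_var_var]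

theorem PM.Lf_cell (hA : TUniq TA) (hB : TUniq TB) (hT : TUniq T)
    {f : A.Var → Expr A} {g : B.Var → Expr B} {W : SortE (A.tensor B)}
    (h : PM T E₀ E k k' Xa x U₀ Wt w V₀ X Y Z f g) (hcl : Cl TA TB T k k')
    (hU' : R TA (k + 1) (.sort Xa U₀')) (hU'f : R TA (k + 1) (.sort X (U₀'.subst f)))
    (hs : Dv T (.term Z (Lf E (f x) (U₀'.subst f) t (vals g Wt)) W)) :
    Eqv T Z ((Lf E₀ (.var x) U₀' t (ctxVars Wt)).subst (tmap E f g))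
      (Lf E (f x) (U₀'.subst f) t (vals g Wt)) := by
  rw [← map_subst_ctxVars] at hs ⊢
  refine Lf_subst hT h.env.fn hs (fun a ha b hb => ?_) fun b hb => ?_
  · obtain ⟨q, hq, rfl⟩ := List.mem_map.1 hb
    obtain ⟨_, _, -, h1⟩ := hU'.sort_args ha
    exact (h.subH le_rfl le_rfl hcl).eqv hA hB hT h1 (h.cY.var_mem hq)
      (hU'f.sort_subst_args a ha) ⟨_, by rw [subst_var]; exact h.hψ _ hq⟩
  · obtain ⟨q, hq, rfl⟩ := List.mem_map.1 hb
    exact (h.subA hcl).eqv_var_left hA hB hT (p := (x, U₀)) (by simp) (h.cY.var_mem hq)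
      ⟨_, by rw [subst_var]; exact h.hψ _ hq⟩

theorem e2L_of_mem (H : TH TA TB chA chB) (ih : Below TA TB (tensorAx TA TB chA chB) s)
    (hs : k + k' + 1 < s) (hE : Env (tensorAx TA TB chA chB) E X Y Z)
    (hax : Judg.sortEq Xa U₀ U₀' ∈ TA) (cX : CtxR TA k Xa) (hU₀ : R TA k (.sort Xa U₀))
    (hU₀' : R TA k (.sort Xa U₀')) (hU : R TA k (.sort X (U₀.subst φ)))
    (hU' : R TA k (.sort X (U₀'.subst φ)))
    (hφ : ∀ p ∈ Xa, R TA k (.term X (φ p.1) (p.2.subst φ)))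
    (hax' : introTerm Wt t V₀ ∈ TB) (cY : CtxR TB k' Wt)
    (hV₀ : R TB k' (.sort Wt V₀)) (hV : R TB k' (.sort Y (V₀.subst ψ)))
    (hψ : ∀ q ∈ Wt, R TB k' (.term Y (ψ q.1) (q.2.subst ψ)))
    (hL : TyL (tensorAx TA TB chA chB) E Y Z k' u (U₀.subst φ))
    (hL' : TyL (tensorAx TA TB chA chB) E Y Z k' u (U₀'.subst φ)) :
    Eqv (tensorAx TA TB chA chB) Z (Lf E u (U₀.subst φ) t (vals ψ Wt))
      (Lf E u (U₀'.subst φ) t (vals ψ Wt)) := by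
  have hA := H.hA
  have hB := H.hB
  have hT := H.hT
  obtain ⟨E₀, hb⟩ := exists_base H.fA H.fB (cX.le (Nat.le_succ k)) hU₀.mono
    (cY.le (Nat.le_succ k')) hV₀.mono
  have tv := cY.tSub_var hV₀ hax'
  have tv' : R TB (k' + 1) (.term Y (.app t (vals ψ Wt)) (V₀.subst ψ)) :=
    .tSub hax' cY.1 cY.2 hV₀ hV hψ
  have st := hb.stageL H ih hs cX cY tv
  have hb' := hb.updA hU₀'.mono
  have ax := hb.ax_seqt hA hB hU₀'.mono tv hax hax'
  rw [ten_app hA hB hb.hX hb.hY hb.admx (tv.adm hB hb.hY),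
    ten_app hA hB hb'.hX hb'.hY hb'.admx (tv.adm hB hb'.hY),
    show E₀.sA (.var (chA Xa)) = _ from hb.hx,
    show TEnv.sA ⟨upd E₀.Γ (chA Xa) U₀', E₀.Δ⟩ (.var (chA Xa)) = _ from hb'.hx,
    hb.Lf_updA hA hB hU₀'.mono] at ax
  have tyL' := st.tyL.transport hT ih st.env' (R.sortEq_var hax cX hU₀ hU₀') (by omega)
  have l1 := tl_step H ih hs st.env' hb.hU hax' cY hV₀ (ψ := .var) (by rwa [ssubst_id])
    (fun q hq => by rw [ssubst_id]; exact cY.var_mem hq) st.tyL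
  have l2 := tl_step H ih hs st.env' hU₀'.mono hax' cY hV₀ (ψ := .var) (by rwa [ssubst_id])
    (fun q hq => by rw [ssubst_id]; exact cY.var_mem hq) tyL'
  rw [vals_var, ssubst_id] at l1 l2
  have ee := (ih (k + 1) k' (by omega)).e3L st.env' (R.sortEq_var hax cX hU₀ hU₀') hV₀
    (st.tyL.le (Nat.sub_le ..)) (tyL'.le (Nat.sub_le ..)) st.tyR
  have l1 := st.eq.ssymm.conv l1
  have l2 := (ee.ssymm.strans st.eq.ssymm).conv l2
  have tyR := (ih k (k' + 1) (by omega)).tyR hE tv'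
  have hcl := ih k k' (by omega)
  have pm := hb.PM cX cY hE hφ hψ hU.mono hV.mono hL tyR
  have mor := pm.morA hA hB hT hcl
  have key := (Dv.teqSub ax st.ctx l1 l2 (l1.sub_term mor) (l2.sub_term mor) mor).eqv
  have g1 := tl_step H ih hs hE hU.mono hax' cY hV₀ hV hψ hL
  have g2 := tl_step H ih hs hE hU'.mono hax' cY hV₀ hV hψ hL'
  have c1 := pm.Lf_cell hA hB hT hcl hU₀.mono (by rw [hU₀.subst_upd hb.xX]; exact hU.mono)
    (by rw [hU₀.subst_upd hb.xX, upd_self, vals_upd hb.wY]; exact g1)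
  have c2 := pm.Lf_cell hA hB hT hcl hU₀'.mono (by rw [hU₀'.subst_upd hb.xX]; exact hU'.mono)
    (by rw [hU₀'.subst_upd hb.xX, upd_self, vals_upd hb.wY]; exact g2)
  rw [hU₀.subst_upd hb.xX, upd_self, vals_upd hb.wY] at c1
  rw [hU₀'.subst_upd hb.xX, upd_self, vals_upd hb.wY] at c2
  exact (c1.symm.trans hT hE.fn key).trans hT hE.fn c2

theorem e2L_step (H : TH TA TB chA chB) (ih : Below TA TB (tensorAx TA TB chA chB) s)
    (hs : k + k' + 1 < s) (hE : Env (tensorAx TA TB chA chB) E X Y Z) {U U' : SortE A}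
    {g : List (Expr B)} (hUU' : R TA (k + 1) (.sortEq X U U'))
    (hv : R TB (k' + 1) (.term Y (.app t g) V))
    (hL : TyL (tensorAx TA TB chA chB) E Y Z k' u U)
    (hL' : TyL (tensorAx TA TB chA chB) E Y Z k' u U') :
    Eqv (tensorAx TA TB chA chB) Z (Lf E u U t g) (Lf E u U' t g) := by
  have hT := H.hT
  have hv0 := hv
  obtain ⟨_, Wt, V₀, ψ, e, rfl, hax', cY, hV₀, hV, hψ, -⟩ := hv.app_inv
  obtain rfl := Nat.succ.inj e
  refine R.sortEq_ind (P := fun U U' => TyL (tensorAx TA TB chA chB) E Y Z k' u U →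
    TyL (tensorAx TA TB chA chB) E Y Z k' u U' → Eqv (tensorAx TA TB chA chB) Z
      (Lf E u U t (vals ψ Wt)) (Lf E u U' t (vals ψ Wt))) ?_ ?_ ?_ ?_ ?_ ?_ hUU' hL hL'
  · exact fun h h1 h2 => (ih k (k' + 1) (by omega)).e2L hE h hv0 h1 h2
  · exact fun h h1 _ => (tl_step H ih hs hE h hax' cY hV₀ hV hψ h1).eqv_refl
  · exact fun h h1 h2 => (h h2 h1).symm
  · intro U V W h1 h2 i1 i2 l1 l2
    have := l1.transport hT ih hE h1 (by omega)
    exact (i1 l1 this).trans hT hE.fn (i2 this l2)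
  · intro Xa U U' φ hax cX hU hU' h1 h2 hφ l1 l2
    exact e2L_of_mem H ih hs hE hax cX hU hU' h1 h2 hφ hax' cY hV₀ hV hψ l1 l2
  · intro Xa S φ φ' hax cX h1 h2 hφ l1 l2
    have tl := tl_step H ih hs hE h1.mono hax' cY hV₀ hV hψ l1
    rw [Lf_eqF] at tl ⊢
    refine LfF_congr hT hE.fn (Q := fun a a' => ∃ W, R TA k (.termEq X a a' W))
      (Q' := fun b b' => b = b' ∧ ∃ W, R TB k' (.term Y b W)) tl rfl ?_ ?_ ?_ ?_
    · exact forall₂_vals fun p hp => ⟨_, hφ p hp⟩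
    · exact forall₂_vals fun q hq => ⟨rfl, _, hψ q hq⟩
    · rintro a a' b _ ⟨_, ha⟩ ⟨rfl, _, hb⟩
      exact (ih k k' (by omega)).e1L hE ha hb
    · rintro b _ ⟨rfl, _, hb⟩
      exact (l1.ty _ _ hb).eqv_refl

end

end

section

variable {A B : Alphabet} {TA : Set (Judg A)} {TB : Set (Judg B)}
  {T : Set (Judg (A.tensor B))}
variable {chA : PreCtx A → A.Var} {chB : PreCtx B → B.Var}

section
variable {E₀ E : TEnv TA TB} {k k' s n m : ℕ} {Xa : PreCtx A}
    {x : A.Var} {U₀ U : SortE A} {Wt : PreCtx B} {w : B.Var} {V₀ V₀' : SortE B} {X : PreCtx A}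
    {Y : PreCtx B} {Z : PreCtx (A.tensor B)} {φ : A.Var → Expr A} {ψ : B.Var → Expr B}
    {v : Expr B} {t : A.TermSym}

theorem Base.Rf_updB (hA : TUniq TA) (hB : TUniq TB)
    (h : Base E₀ n m Xa x U₀ Wt w V₀) (hV' : R TB m (.sort Wt V₀')) :
    Rf (⟨E₀.Γ, upd E₀.Δ w V₀'⟩ : TEnv TA TB) t (ctxVars Xa) (.var w) V₀' =
      Rf E₀ t (ctxVars Xa) (.var w) V₀' := by
  have hb' := h.updB hV'
  rw [Rf, Rf]
  congr 1
  refine grid_congr fun a ha b hb => ?_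
  obtain ⟨q, hq, rfl⟩ := List.mem_map.1 ha
  rcases List.mem_append.1 hb with hb | hb
  · obtain ⟨_, _, -, h1⟩ := hV'.sort_args hb
    exact R.ten_indep hA hB hb'.hX h.hX hb'.hY h.hY (h.cx.initial.var_mem hq) h1
  · rw [List.mem_singleton.1 hb, ten_var_var, ten_var_var]

theorem PM.Rf_cell (hA : TUniq TA) (hB : TUniq TB) (hT : TUniq T)
    {f : A.Var → Expr A} {g : B.Var → Expr B} {W : SortE (A.tensor B)}
    (h : PM T E₀ E k k' Xa x U₀ Wt w V₀ X Y Z f g) (hcl : Cl TA TB T k k')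
    (hV' : R TB (k' + 1) (.sort Wt V₀')) (hV'g : R TB (k' + 1) (.sort Y (V₀'.subst g)))
    (hs : Dv T (.term Z (Rf E t (vals f Xa) (g w) (V₀'.subst g)) W)) :
    Eqv T Z ((Rf E₀ t (ctxVars Xa) (.var w) V₀').subst (tmap E f g))
      (Rf E t (vals f Xa) (g w) (V₀'.subst g)) := by
  rw [← map_subst_ctxVars] at hs ⊢
  refine Rf_subst hT h.env.fn hs (fun a ha b hb => ?_) fun a ha => ?_
  · obtain ⟨q, hq, rfl⟩ := List.mem_map.1 ha
    obtain ⟨_, _, -, h1⟩ := hV'.sort_args hb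
    exact (h.subH le_rfl le_rfl hcl).eqv hA hB hT (h.cX.var_mem hq) h1
      ⟨_, by rw [subst_var]; exact h.hφ _ hq⟩ (hV'g.sort_subst_args b hb)
  · obtain ⟨q, hq, rfl⟩ := List.mem_map.1 ha
    exact (h.subB hcl).eqv_var_right hA hB hT (q := (w, V₀)) (by simp) (h.cX.var_mem hq)
      ⟨_, by rw [subst_var]; exact h.hφ _ hq⟩

theorem e2R_of_mem (H : TH TA TB chA chB) (ih : Below TA TB (tensorAx TA TB chA chB) s)
    (hs : k + k' + 1 < s) (hE : Env (tensorAx TA TB chA chB) E X Y Z)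
    (hax' : Judg.sortEq Wt V₀ V₀' ∈ TB) (cY : CtxR TB k' Wt) (hV₀ : R TB k' (.sort Wt V₀))
    (hV₀' : R TB k' (.sort Wt V₀')) (hV : R TB k' (.sort Y (V₀.subst ψ)))
    (hV' : R TB k' (.sort Y (V₀'.subst ψ)))
    (hψ : ∀ p ∈ Wt, R TB k' (.term Y (ψ p.1) (p.2.subst ψ)))
    (hax : introTerm Xa t U₀ ∈ TA) (cX : CtxR TA k Xa)
    (hU₀ : R TA k (.sort Xa U₀)) (hU : R TA k (.sort X (U₀.subst φ)))
    (hφ : ∀ q ∈ Xa, R TA k (.term X (φ q.1) (q.2.subst φ)))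
    (hR : TyR (tensorAx TA TB chA chB) E X Z k v (V₀.subst ψ))
    (hR' : TyR (tensorAx TA TB chA chB) E X Z k v (V₀'.subst ψ)) :
    Eqv (tensorAx TA TB chA chB) Z (Rf E t (vals φ Xa) v (V₀.subst ψ))
      (Rf E t (vals φ Xa) v (V₀'.subst ψ)) := by
  have hA := H.hA
  have hB := H.hB
  have hT := H.hT
  obtain ⟨E₀, hb⟩ := exists_base H.fA H.fB (cX.le (Nat.le_succ k)) hU₀.mono
    (cY.le (Nat.le_succ k')) hV₀.mono
  have tu := cX.tSub_var hU₀ hax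
  have tu' : R TA (k + 1) (.term X (.app t (vals φ Xa)) (U₀.subst φ)) :=
    .tSub hax cX.1 cX.2 hU₀ hU hφ
  have st := hb.stageR H ih hs cX cY tu
  have hb' := hb.updB hV₀'.mono
  have ax := hb.ax_tseq hA hB hV₀'.mono tu hax hax'
  rw [ten_app_var hA hB hb.hX hb.hY (tu.adm hA hb.hX) hb.admw,
    ten_app_var hA hB hb'.hX hb'.hY (tu.adm hA hb'.hX) hb'.admw,
    show E₀.Δ (chB Wt) = _ from hb.hw,
    show TEnv.Δ ⟨E₀.Γ, upd E₀.Δ (chB Wt) V₀'⟩ (chB Wt) = _ from hb'.hw,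
    hb.Rf_updB hA hB hV₀'.mono] at ax
  have tyR' := st.tyR.transport hT ih st.env' (R.sortEq_var hax' cY hV₀ hV₀') (by omega)
  have l1 := tr_step H ih hs st.env' hb.hV hax cX hU₀ (φ := .var) (by rwa [ssubst_id])
    (fun q hq => by rw [ssubst_id]; exact cX.var_mem hq) st.tyR
  have l2 := tr_step H ih hs st.env' hV₀'.mono hax cX hU₀ (φ := .var) (by rwa [ssubst_id])
    (fun q hq => by rw [ssubst_id]; exact cX.var_mem hq) tyR'
  rw [vals_var, ssubst_id] at l1 l2
  have ee := (ih k (k' + 1) (by omega)).e3R st.env' hU₀ (R.sortEq_var hax' cY hV₀ hV₀')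
    st.tyL (st.tyR.le (Nat.sub_le ..)) (tyR'.le (Nat.sub_le ..))
  have l1 := st.eq.ssymm.conv l1
  have l2 := (ee.ssymm.strans st.eq.ssymm).conv l2
  have tyL := (ih (k + 1) k' (by omega)).tyL hE tu'
  have hcl := ih k k' (by omega)
  have pm := hb.PM cX cY hE hφ hψ hU.mono hV.mono tyL hR
  have mor := pm.morB hA hB hT hcl
  have key := (Dv.teqSub ax st.ctx l1 l2 (l1.sub_term mor) (l2.sub_term mor) mor).eqv
  have g1 := tr_step H ih hs hE hV.mono hax cX hU₀ hU hφ hR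
  have g2 := tr_step H ih hs hE hV'.mono hax cX hU₀ hU hφ hR'
  have c1 := pm.Rf_cell hA hB hT hcl hV₀.mono (by rw [hV₀.subst_upd hb.wY]; exact hV.mono)
    (by rw [hV₀.subst_upd hb.wY, upd_self, vals_upd hb.xX]; exact g1)
  have c2 := pm.Rf_cell hA hB hT hcl hV₀'.mono (by rw [hV₀'.subst_upd hb.wY]; exact hV'.mono)
    (by rw [hV₀'.subst_upd hb.wY, upd_self, vals_upd hb.xX]; exact g2)
  rw [hV₀.subst_upd hb.wY, upd_self, vals_upd hb.xX] at c1
  rw [hV₀'.subst_upd hb.wY, upd_self, vals_upd hb.xX] at c2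
  exact (c1.symm.trans hT hE.fn key).trans hT hE.fn c2

theorem e2R_step (H : TH TA TB chA chB) (ih : Below TA TB (tensorAx TA TB chA chB) s)
    (hs : k + k' + 1 < s) (hE : Env (tensorAx TA TB chA chB) E X Y Z) {V V' : SortE B}
    {f : List (Expr A)} (hu : R TA (k + 1) (.term X (.app t f) U))
    (hVV' : R TB (k' + 1) (.sortEq Y V V'))
    (hR : TyR (tensorAx TA TB chA chB) E X Z k v V)
    (hR' : TyR (tensorAx TA TB chA chB) E X Z k v V') :
    Eqv (tensorAx TA TB chA chB) Z (Rf E t f v V) (Rf E t f v V') := by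
  have hT := H.hT
  have hu0 := hu
  obtain ⟨_, Xa, U₀, φ, e, rfl, hax, cX, hU₀, hU, hφ, -⟩ := hu.app_inv
  obtain rfl := Nat.succ.inj e
  refine R.sortEq_ind (P := fun V V' => TyR (tensorAx TA TB chA chB) E X Z k v V →
    TyR (tensorAx TA TB chA chB) E X Z k v V' → Eqv (tensorAx TA TB chA chB) Z
      (Rf E t (vals φ Xa) v V) (Rf E t (vals φ Xa) v V')) ?_ ?_ ?_ ?_ ?_ ?_ hVV' hR hR'
  · exact fun h h1 h2 => (ih (k + 1) k' (by omega)).e2R hE hu0 h h1 h2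
  · exact fun h h1 _ => (tr_step H ih hs hE h hax cX hU₀ hU hφ h1).eqv_refl
  · exact fun h h1 h2 => (h h2 h1).symm
  · intro U V W h1 h2 i1 i2 l1 l2
    have := l1.transport hT ih hE h1 (by omega)
    exact (i1 l1 this).trans hT hE.fn (i2 this l2)
  · intro Wt V V' ψ hax' cY hV hV' h1 h2 hψ l1 l2
    exact e2R_of_mem H ih hs hE hax' cY hV hV' h1 h2 hψ hax cX hU₀ hU hφ l1 l2
  · intro Wt S ψ ψ' hax' cY h1 h2 hψ l1 l2
    have tr := tr_step H ih hs hE h1.mono hax cX hU₀ hU hφ l1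
    rw [Rf_eqF] at tr ⊢
    refine RfF_congr hT hE.fn (Q := fun a a' => a = a' ∧ ∃ W, R TA k (.term X a W))
      (Q' := fun b b' => ∃ W, R TB k' (.termEq Y b b' W)) tr rfl ?_ ?_ ?_ ?_
    · exact forall₂_vals fun q hq => ⟨rfl, _, hφ q hq⟩
    · exact forall₂_vals fun p hp => ⟨_, hψ p hp⟩
    · rintro a _ b b' ⟨rfl, _, ha⟩ ⟨_, hb⟩
      exact (ih k k' (by omega)).e1R hE ha hb
    · rintro b _ ⟨rfl, _, hb⟩
      exact (l1.ty _ _ hb).eqv_refl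

end

end

section

variable {A B : Alphabet} {TA : Set (Judg A)} {TB : Set (Judg B)}
variable {chA : PreCtx A → A.Var} {chB : PreCtx B → B.Var}

section
variable {E : TEnv TA TB} {k k' s : ℕ} {X : PreCtx A} {Y : PreCtx B} {Z : PreCtx (A.tensor B)}
    {u : Expr A} {U : SortE A} {v : Expr B} {V : SortE B}

theorem good_step (H : TH TA TB chA chB) (ih : Below TA TB (tensorAx TA TB chA chB) s)
    (hs : k + k' + 1 < s) (hE : Env (tensorAx TA TB chA chB) E X Y Z)
    (hu : R TA (k + 1) (.term X u U)) (hv : R TB (k' + 1) (.term Y v V)) :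
    Good (tensorAx TA TB chA chB) E Z u U v V := by
  have hA := H.hA
  have hB := H.hB
  have hT := H.hT
  have hu' := hu.adm hA hE.hX
  have hv' := hv.adm hB hE.hY
  have hL := (ih (k + 1) k' (by omega)).tyL hE hu
  have hR := (ih k (k' + 1) (by omega)).tyR hE hv
  rcases hu.term_inv with ⟨x, rfl, hx, hU⟩ | ⟨_, Xa, t, U₀, φ, e, rfl, rfl, hax, cX, hU₀, hU, hφ⟩ |
    ⟨_, U', e, hU, hu₀⟩
  · rcases hv.term_inv with ⟨y, rfl, hy, hV⟩ |
      ⟨_, Wt, t', V₀, ψ, e', rfl, rfl, hax', cY, hV₀, hV, hψ⟩ | ⟨_, V', e', hV, hv₀⟩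
    · exact ⟨by rw [ten_var_var]; exact hE.cell _ hx _ hy, (fun _ _ h => nomatch h),
        fun _ _ h => nomatch h⟩
    · obtain rfl := Nat.succ.inj e'
      have ty := tl_step H ih hs hE hU hax' cY hV₀ hV hψ hL
      have eq : ten E (.var x) (.app t' (vals ψ Wt)) = Lf E (.var x) U t' (vals ψ Wt) := by
        rw [ten_app hA hB hE.hX hE.hY hu' hv', show E.sA (.var x) = U from hE.hX _ hx]
      refine ⟨by rw [eq]; exact ty, fun t g h => ?_, fun _ _ h => nomatch h⟩
      cases h
      rw [eq]
      exact ty.eqv_refl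
    · obtain rfl := Nat.succ.inj e'
      have hc := ih (k + 1) k' (by omega)
      have gd := hc.good hE hu hv₀
      have lL := (ih (k + 1) (k' - 1) (by omega)).tyL hE hu
      have rR := (ih k k' (by omega)).tyR hE hv₀
      exact ⟨(hc.e3R hE hu.sort_of_term hV lL rR hR).conv gd.ty, gd.lf, fun _ _ h => nomatch h⟩
  · obtain rfl := Nat.succ.inj e
    rcases hv.term_inv with ⟨y, rfl, hy, hV⟩ |
      ⟨_, Wt, t', V₀, ψ, e', rfl, rfl, hax', cY, hV₀, hV, hψ⟩ | ⟨_, V', e', hV, hv₀⟩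
    · have ty := tr_step H ih hs hE hV hax cX hU₀ hU hφ hR
      have eq : ten E (.app t (vals φ Xa)) (.var y) = Rf E t (vals φ Xa) (.var y) V := by
        rw [ten_app_var hA hB hE.hX hE.hY hu' hv', show E.Δ y = V from hE.hY _ hy]
      refine ⟨by rw [eq]; exact ty, (fun _ _ h => nomatch h), fun t g h => ?_⟩
      cases h
      rw [eq]
      exact ty.eqv_refl
    · obtain rfl := Nat.succ.inj e'
      have ty := tl_step H ih hs hE hU.mono hax' cY hV₀ hV hψ hL
      have eq : ten E (.app t (vals φ Xa)) (.app t' (vals ψ Wt)) =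
          Lf E (.app t (vals φ Xa)) (U₀.subst φ) t' (vals ψ Wt) := by
        rw [ten_app hA hB hE.hX hE.hY hu' hv', TEnv.sA, cs_app_vals hA hax hU₀]
      refine ⟨by rw [eq]; exact ty, fun t g h => ?_, fun t g h => ?_⟩
      · cases h
        rw [eq]
        exact ty.eqv_refl
      · cases h
        rw [eq]
        exact tt_step H ih hs hE hax cX hU₀ hU hφ hax' cY hV₀ hV hψ
    · obtain rfl := Nat.succ.inj e'
      have hc := ih (k + 1) k' (by omega)
      have gd := hc.good hE hu hv₀
      have lL := (ih (k + 1) (k' - 1) (by omega)).tyL hE hu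
      have rR := (ih k k' (by omega)).tyR hE hv₀
      exact ⟨(hc.e3R hE hu.sort_of_term hV lL rR hR).conv gd.ty, gd.lf, fun s f h =>
        (gd.rf s f h).trans hT hE.fn (hc.e2R hE (h ▸ hu) hV rR hR)⟩
  · obtain rfl := Nat.succ.inj e
    have hc := ih k (k' + 1) (by omega)
    have gd := hc.good hE hu₀ hv
    have rR := (ih (k - 1) (k' + 1) (by omega)).tyR hE hv
    have lL := (ih k k' (by omega)).tyL hE hu₀
    exact ⟨(hc.e3L hE hU hv.sort_of_term lL hL rR).conv gd.ty, fun t g h =>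
      (gd.lf t g h).trans hT hE.fn (hc.e2L hE hU (h ▸ hv) lL hL), gd.rf⟩

end

end

section

variable {A B : Alphabet} {TA : Set (Judg A)} {TB : Set (Judg B)}
variable {chA : PreCtx A → A.Var} {chB : PreCtx B → B.Var}

section
variable {E : TEnv TA TB} {k k' s : ℕ} {X : PreCtx A} {Y : PreCtx B} {Z : PreCtx (A.tensor B)}
    {u u' : Expr A} {U U₀ : SortE A} {v : Expr B} {V : SortE B} {Xa : PreCtx A}
    {φ : A.Var → Expr A}

theorem R.termEq_var {n : ℕ} (hax : Judg.termEq X u u' U ∈ TA)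
    (cX : CtxR TA n X) (hu : R TA n (.term X u U)) (hu' : R TA n (.term X u' U)) :
    R TA (n + 1) (.termEq X u u' U) := by
  have := R.teqSub (φ := Expr.var) (Y := X) hax cX.1 cX.2 hu hu'
    (by rwa [ssubst_id, subst_id]) (by rwa [ssubst_id, subst_id])
    fun p hp => by rw [ssubst_id]; exact cX.var_mem hp
  rwa [ssubst_id, subst_id, subst_id] at this

theorem e1L_of_mem (H : TH TA TB chA chB) (ih : Below TA TB (tensorAx TA TB chA chB) s)
    (hs : k + k' + 1 < s) (hE : Env (tensorAx TA TB chA chB) E X Y Z) {y : B.Var}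
    (hy : (y, V) ∈ Y) (hV : R TB (k' + 1) (.sort Y V)) (hax : Judg.termEq Xa u u' U₀ ∈ TA)
    (cX : CtxR TA k Xa) (hu : R TA k (.term Xa u U₀)) (hu' : R TA k (.term Xa u' U₀))
    (h1 : R TA k (.term X (u.subst φ) (U₀.subst φ)))
    (h2 : R TA k (.term X (u'.subst φ) (U₀.subst φ)))
    (hφ : ∀ p ∈ Xa, R TA k (.term X (φ p.1) (p.2.subst φ))) :
    Eqv (tensorAx TA TB chA chB) Z (ten E (u.subst φ) (.var y)) (ten E (u'.subst φ) (.var y)) := by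
  have hA := H.hA
  have hB := H.hB
  have hT := H.hT
  obtain ⟨_, Wt, ψ, e, hax', cY, eV, hψ⟩ := hV.sort_inv
  obtain rfl := Nat.succ.inj e
  have eV' : V = (SortE.mk V.head (ctxVars Wt)).subst ψ := by rw [ssubst_ctxVars]; exact eV
  generalize V.head = S at *
  have sY := cY.sSub_var hax'
  obtain ⟨E₀, hb⟩ := exists_base H.fA H.fB (cX.le (Nat.le_succ k)) hu.sort_of_term.mono
    (cY.le (Nat.le_succ k')) sY
  have st := hb.stageR H ih hs cX cY hu.mono
  have ax := hb.ax_teqs hA hB hu.mono hu'.mono hax hax'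
  have l1 := st.tyR.ty _ _ hu
  have l2 := st.tyR.ty _ _ hu'
  have hcl := ih k k' (by omega)
  have ss := st.ss
  have ee : Dv (tensorAx TA TB chA chB) (.sortEq (TX E₀ Xa (Wt ++ [(chB Wt, ⟨S, ctxVars Wt⟩)]))
      (tsort E₀ u U₀ (.var (chB Wt)) ⟨S, ctxVars Wt⟩)
      (tsort E₀ u' U₀ (.var (chB Wt)) ⟨S, ctxVars Wt⟩)) := by
    rw [tsort_eqF] at ss ⊢
    refine tsortF_congr hT st.env.fn (Q := fun a a' => a = a' ∧ ∃ W, R TA k (.term Xa a W))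
      (Q' := fun b b' => b = b' ∧ ∃ W, R TB k' (.term Wt b W)) ss rfl rfl ?_ ?_ ?_ ?_ ?_
    · exact forall₂_self fun a ha => ⟨rfl, by
        obtain ⟨_, W, e, h⟩ := hb.hU.sort_args ha
        obtain rfl := Nat.succ.inj e
        exact ⟨_, h⟩⟩
    · exact forall₂_self fun b hb' => ⟨rfl, by
        obtain ⟨_, W, e, h⟩ := hb.hV.sort_args hb'
        obtain rfl := Nat.succ.inj e
        exact ⟨_, h⟩⟩
    · rintro a _ b _ ⟨rfl, _, ha⟩ ⟨rfl, _, hb'⟩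
      exact (hcl.good st.env' ha hb').ty.eqv_refl
    · rintro a _ ⟨rfl, _, ha⟩
      exact (st.tyR.ty _ _ ha).eqv_refl
    · rintro b _ ⟨rfl, _, hb'⟩
      exact (ih (k + 1) k' (by omega)).e1L st.env' (R.termEq_var hax cX hu hu') hb'
  have l1 := st.eq.ssymm.conv l1
  have l2 := (ee.ssymm.strans st.eq.ssymm).conv l2
  have tyL := hcl.tyL hE h1
  have tyR := (ih k (k' + 1) (by omega)).tyR hE (R.var hy hV)
  have pm := hb.PM cX cY hE hφ hψ h1.sort_of_term.mono (eV' ▸ hV) tyL (eV' ▸ tyR)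
  have mor := pm.morB hA hB hT hcl
  have key := (Dv.teqSub ax st.ctx l1 l2 (l1.sub_term mor) (l2.sub_term mor) mor).eqv
  have c1 := (pm.subB hcl).eqv_var_right hA hB hT (q := (chB Wt, ⟨S, ctxVars Wt⟩)) (by simp) hu
    ⟨_, by rw [hu.subst_upd_term hb.xX]; exact h1⟩
  have c2 := (pm.subB hcl).eqv_var_right hA hB hT (q := (chB Wt, ⟨S, ctxVars Wt⟩)) (by simp) hu'
    ⟨_, by rw [hu'.subst_upd_term hb.xX]; exact h2⟩
  rw [hu.subst_upd_term hb.xX, upd_self] at c1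
  rw [hu'.subst_upd_term hb.xX, upd_self] at c2
  exact (c1.symm.trans hT hE.fn key).trans hT hE.fn c2

theorem e1L_step (H : TH TA TB chA chB) (ih : Below TA TB (tensorAx TA TB chA chB) s)
    (hs : k + k' + 1 < s) (hE : Env (tensorAx TA TB chA chB) E X Y Z)
    (huu' : R TA (k + 1) (.termEq X u u' U)) (hv : R TB (k' + 1) (.term Y v V)) :
    Eqv (tensorAx TA TB chA chB) Z (ten E u v) (ten E u' v) := by
  have hT := H.hT
  have hv0 := hv
  rcases hv.term_inv with ⟨y, rfl, hy, hV⟩ | ⟨_, Wt, t, V₀, ψ, e, rfl, rfl, hax, cY, hV₀, hV, hψ⟩ |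
    ⟨_, V', e, hV, hv₀⟩
  · refine R.termEq_ind (P := fun u u' U => Eqv (tensorAx TA TB chA chB) Z
      (ten E u (.var y)) (ten E u' (.var y))) ?_ ?_ ?_ ?_ ?_ ?_ ?_ huu'
    · exact fun h => (ih k (k' + 1) (by omega)).e1L hE h hv
    · exact fun h => (good_step H ih hs hE h hv).ty.eqv_refl
    · exact fun h => h.symm
    · exact fun h h' => h.trans hT hE.fn h'
    · exact fun h => (ih k (k' + 1) (by omega)).e1L hE h hv
    · intro Xa u u' U φ hax cX hu hu' h1 h2 hφ
      exact e1L_of_mem H ih hs hE hy hV hax cX hu hu' h1 h2 hφ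
    · intro Xa t U φ ψ hax cX hU h1 h2 hφ
      have g1 := good_step H ih hs hE h1.mono hv
      have g2 := good_step H ih hs hE h2.mono hv
      have tr := (g1.rf _ _ rfl).typed hT hE.fn g1.ty
      refine ((g1.rf _ _ rfl).trans hT hE.fn ?_).trans hT hE.fn (g2.rf _ _ rfl).symm
      rw [Rf_eqF] at tr ⊢
      refine RfF_congr hT hE.fn (Q := fun a a' => ∃ W, R TA k (.termEq X a a' W))
        (Q' := fun b b' => b = b' ∧ ∃ W, R TB k' (.term Y b W)) tr rfl ?_ ?_ ?_ ?_
      · exact forall₂_vals fun p hp => ⟨_, hφ p hp⟩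
      · exact forall₂_self fun b hb => ⟨rfl, by
          obtain ⟨_, W, e, h⟩ := hV.sort_args hb
          obtain rfl := Nat.succ.inj e
          exact ⟨_, h⟩⟩
      · rintro a a' b _ ⟨_, ha⟩ ⟨rfl, _, hb⟩
        exact (ih k k' (by omega)).e1L hE ha hb
      · rintro a a' ⟨_, ha⟩
        exact (ih k (k' + 1) (by omega)).e1L hE ha hv
  · obtain rfl := Nat.succ.inj e
    have hu := huu'.left_term
    have g1 := good_step H ih hs hE hu hv
    have g2 := good_step H ih hs hE huu'.right_term hv
    have tl := (g1.lf _ _ rfl).typed hT hE.fn g1.ty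
    refine ((g1.lf _ _ rfl).trans hT hE.fn ?_).trans hT hE.fn (g2.lf _ _ rfl).symm
    rw [Lf_eqF] at tl ⊢
    refine LfF_congr hT hE.fn (Q := fun a a' => a = a' ∧ ∃ W, R TA k (.term X a W))
      (Q' := fun b b' => b = b' ∧ ∃ W, R TB k' (.term Y b W)) tl rfl ?_ ?_ ?_ ?_
    · exact forall₂_self fun b hb => ⟨rfl, by
        obtain ⟨_, W, e, h⟩ := hu.sort_of_term.sort_args hb
        obtain rfl := Nat.succ.inj e
        exact ⟨_, h⟩⟩
    · exact forall₂_vals fun q hq => ⟨rfl, _, hψ q hq⟩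
    · rintro a _ b _ ⟨rfl, _, ha⟩ ⟨rfl, _, hb⟩
      exact ((ih k k' (by omega)).good hE ha hb).ty.eqv_refl
    · rintro b _ ⟨rfl, _, hb⟩
      exact (ih (k + 1) k' (by omega)).e1L hE huu' hb
  · obtain rfl := Nat.succ.inj e
    exact (ih (k + 1) k' (by omega)).e1L hE huu' hv₀

end

end

section

variable {A B : Alphabet} {TA : Set (Judg A)} {TB : Set (Judg B)}
variable {chA : PreCtx A → A.Var} {chB : PreCtx B → B.Var}

section
variable {E : TEnv TA TB} {k k' s : ℕ} {X : PreCtx A} {Y : PreCtx B} {Z : PreCtx (A.tensor B)}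
    {u : Expr A} {U : SortE A} {v v' : Expr B} {V V₀ : SortE B} {Wt : PreCtx B}
    {ψ : B.Var → Expr B}

theorem e1R_of_mem (H : TH TA TB chA chB) (ih : Below TA TB (tensorAx TA TB chA chB) s)
    (hs : k + k' + 1 < s) (hE : Env (tensorAx TA TB chA chB) E X Y Z) {x : A.Var}
    (hx : (x, U) ∈ X) (hU : R TA (k + 1) (.sort X U)) (hax : Judg.termEq Wt v v' V₀ ∈ TB)
    (cY : CtxR TB k' Wt) (hv : R TB k' (.term Wt v V₀)) (hv' : R TB k' (.term Wt v' V₀))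
    (h1 : R TB k' (.term Y (v.subst ψ) (V₀.subst ψ)))
    (h2 : R TB k' (.term Y (v'.subst ψ) (V₀.subst ψ)))
    (hψ : ∀ p ∈ Wt, R TB k' (.term Y (ψ p.1) (p.2.subst ψ))) :
    Eqv (tensorAx TA TB chA chB) Z (ten E (.var x) (v.subst ψ)) (ten E (.var x) (v'.subst ψ)) := by
  have hA := H.hA
  have hB := H.hB
  have hT := H.hT
  obtain ⟨_, Xa, φ, e, hax', cX, eU, hφ⟩ := hU.sort_inv
  obtain rfl := Nat.succ.inj e
  have eU' : U = (SortE.mk U.head (ctxVars Xa)).subst φ := by rw [ssubst_ctxVars]; exact eU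
  generalize U.head = S at *
  have sX := cX.sSub_var hax'
  obtain ⟨E₀, hb⟩ := exists_base H.fA H.fB (cX.le (Nat.le_succ k)) sX
    (cY.le (Nat.le_succ k')) hv.sort_of_term.mono
  have st := hb.stageL H ih hs cX cY hv.mono
  have ax := hb.ax_steq hA hB hv.mono hv'.mono hax' hax
  have l1 := st.tyL.ty _ _ hv
  have l2 := st.tyL.ty _ _ hv'
  have hcl := ih k k' (by omega)
  have ss := st.ss
  have ee : Dv (tensorAx TA TB chA chB) (.sortEq (TX E₀ (Xa ++ [(chA Xa, ⟨S, ctxVars Xa⟩)]) Wt)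
      (tsort E₀ (.var (chA Xa)) ⟨S, ctxVars Xa⟩ v V₀)
      (tsort E₀ (.var (chA Xa)) ⟨S, ctxVars Xa⟩ v' V₀)) := by
    rw [tsort_eqF] at ss ⊢
    refine tsortF_congr hT st.env.fn (Q := fun a a' => a = a' ∧ ∃ W, R TA k (.term Xa a W))
      (Q' := fun b b' => b = b' ∧ ∃ W, R TB k' (.term Wt b W)) ss rfl rfl ?_ ?_ ?_ ?_ ?_
    · exact forall₂_self fun a ha => ⟨rfl, by
        obtain ⟨_, W, e, h⟩ := hb.hU.sort_args ha
        obtain rfl := Nat.succ.inj e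
        exact ⟨_, h⟩⟩
    · exact forall₂_self fun b hb' => ⟨rfl, by
        obtain ⟨_, W, e, h⟩ := hb.hV.sort_args hb'
        obtain rfl := Nat.succ.inj e
        exact ⟨_, h⟩⟩
    · rintro a _ b _ ⟨rfl, _, ha⟩ ⟨rfl, _, hb'⟩
      exact (hcl.good st.env' ha hb').ty.eqv_refl
    · rintro a _ ⟨rfl, _, ha⟩
      exact (ih k (k' + 1) (by omega)).e1R st.env' ha (R.termEq_var hax cY hv hv')
    · rintro b _ ⟨rfl, _, hb'⟩
      exact (st.tyL.ty _ _ hb').eqv_refl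
  have l1 := st.eq.ssymm.conv l1
  have l2 := (ee.ssymm.strans st.eq.ssymm).conv l2
  have tyL := (ih (k + 1) k' (by omega)).tyL hE (R.var hx hU)
  have tyR := hcl.tyR hE h1
  have pm := hb.PM cX cY hE hφ hψ (eU' ▸ hU) h1.sort_of_term.mono (eU' ▸ tyL) tyR
  have mor := pm.morA hA hB hT hcl
  have key := (Dv.teqSub ax st.ctx l1 l2 (l1.sub_term mor) (l2.sub_term mor) mor).eqv
  have c1 := (pm.subA hcl).eqv_var_left hA hB hT (p := (chA Xa, ⟨S, ctxVars Xa⟩)) (by simp) hv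
    ⟨_, by rw [hv.subst_upd_term hb.wY]; exact h1⟩
  have c2 := (pm.subA hcl).eqv_var_left hA hB hT (p := (chA Xa, ⟨S, ctxVars Xa⟩)) (by simp) hv'
    ⟨_, by rw [hv'.subst_upd_term hb.wY]; exact h2⟩
  rw [hv.subst_upd_term hb.wY, upd_self] at c1
  rw [hv'.subst_upd_term hb.wY, upd_self] at c2
  exact (c1.symm.trans hT hE.fn key).trans hT hE.fn c2

theorem e1R_step (H : TH TA TB chA chB) (ih : Below TA TB (tensorAx TA TB chA chB) s)
    (hs : k + k' + 1 < s) (hE : Env (tensorAx TA TB chA chB) E X Y Z)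
    (hu : R TA (k + 1) (.term X u U)) (hvv' : R TB (k' + 1) (.termEq Y v v' V)) :
    Eqv (tensorAx TA TB chA chB) Z (ten E u v) (ten E u v') := by
  have hT := H.hT
  have hu0 := hu
  rcases hu.term_inv with ⟨x, rfl, hx, hU⟩ | ⟨_, Xa, t, U₀, φ, e, rfl, rfl, hax, cX, hU₀, hU, hφ⟩ |
    ⟨_, U', e, hU, hu₀⟩
  · refine R.termEq_ind (P := fun v v' V => Eqv (tensorAx TA TB chA chB) Z
      (ten E (.var x) v) (ten E (.var x) v')) ?_ ?_ ?_ ?_ ?_ ?_ ?_ hvv'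
    · exact fun h => (ih (k + 1) k' (by omega)).e1R hE hu h
    · exact fun h => (good_step H ih hs hE hu h).ty.eqv_refl
    · exact fun h => h.symm
    · exact fun h h' => h.trans hT hE.fn h'
    · exact fun h => (ih (k + 1) k' (by omega)).e1R hE hu h
    · intro Wt v v' V ψ hax cY hv hv' h1 h2 hψ
      exact e1R_of_mem H ih hs hE hx hU hax cY hv hv' h1 h2 hψ
    · intro Wt t V ψ ψ' hax cY hV h1 h2 hψ
      have g1 := good_step H ih hs hE hu h1.mono
      have g2 := good_step H ih hs hE hu h2.mono
      have tl := (g1.lf _ _ rfl).typed hT hE.fn g1.ty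
      refine ((g1.lf _ _ rfl).trans hT hE.fn ?_).trans hT hE.fn (g2.lf _ _ rfl).symm
      rw [Lf_eqF] at tl ⊢
      refine LfF_congr hT hE.fn (Q := fun a a' => a = a' ∧ ∃ W, R TA k (.term X a W))
        (Q' := fun b b' => ∃ W, R TB k' (.termEq Y b b' W)) tl rfl ?_ ?_ ?_ ?_
      · exact forall₂_self fun a ha => ⟨rfl, by
          obtain ⟨_, W, e, h⟩ := hU.sort_args ha
          obtain rfl := Nat.succ.inj e
          exact ⟨_, h⟩⟩
      · exact forall₂_vals fun p hp => ⟨_, hψ p hp⟩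
      · rintro a _ b b' ⟨rfl, _, ha⟩ ⟨_, hb⟩
        exact (ih k k' (by omega)).e1R hE ha hb
      · rintro b b' ⟨_, hb⟩
        exact (ih (k + 1) k' (by omega)).e1R hE hu hb
  · obtain rfl := Nat.succ.inj e
    have hv := hvv'.left_term
    have g1 := good_step H ih hs hE hu hv
    have g2 := good_step H ih hs hE hu hvv'.right_term
    have tr := (g1.rf _ _ rfl).typed hT hE.fn g1.ty
    refine ((g1.rf _ _ rfl).trans hT hE.fn ?_).trans hT hE.fn (g2.rf _ _ rfl).symm
    rw [Rf_eqF] at tr ⊢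
    refine RfF_congr hT hE.fn (Q := fun a a' => a = a' ∧ ∃ W, R TA k (.term X a W))
      (Q' := fun b b' => b = b' ∧ ∃ W, R TB k' (.term Y b W)) tr rfl ?_ ?_ ?_ ?_
    · exact forall₂_vals fun q hq => ⟨rfl, _, hφ q hq⟩
    · exact forall₂_self fun b hb => ⟨rfl, by
        obtain ⟨_, W, e, h⟩ := hv.sort_of_term.sort_args hb
        obtain rfl := Nat.succ.inj e
        exact ⟨_, h⟩⟩
    · rintro a _ b _ ⟨rfl, _, ha⟩ ⟨rfl, _, hb⟩
      exact ((ih k k' (by omega)).good hE ha hb).ty.eqv_refl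
    · rintro a _ ⟨rfl, _, ha⟩
      exact (ih k (k' + 1) (by omega)).e1R hE ha hvv'
  · obtain rfl := Nat.succ.inj e
    exact (ih k (k' + 1) (by omega)).e1R hE hu₀ hvv'

end

end

section

variable {A B : Alphabet} {TA : Set (Judg A)} {TB : Set (Judg B)}
variable {chA : PreCtx A → A.Var} {chB : PreCtx B → B.Var}

theorem below (H : TH TA TB chA chB) (s : ℕ) : Below TA TB (tensorAx TA TB chA chB) s := by
  induction s with
  | zero => exact fun n m h => absurd h (Nat.not_lt_zero _)
  | succ s ih =>
    intro n m h
    rcases n with _ | k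
    · exact .zero_left m
    rcases m with _ | k'
    · exact .zero_right _
    have hs : k + k' + 1 < s := by omega
    exact ⟨fun h => good_step H ih hs h, fun h => ss_step H ih hs h, fun h => e3L_step H ih hs h,
      fun h => e3R_step H ih hs h, fun h => e2L_step H ih hs h, fun h => e2R_step H ih hs h,
      fun h => e1L_step H ih hs h, fun h => e1R_step H ih hs h⟩

theorem closed (H : TH TA TB chA chB) (n m : ℕ) : Cl TA TB (tensorAx TA TB chA chB) n m :=
  below H (n + m + 1) n m (Nat.lt_succ_self _)

end

section

variable {A B : Alphabet} {Ax : Set (Judg A)} {X X' X'' : PreCtx A} {f f' : List (Expr A)}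
  {φ φ' σ τ : A.Var → Expr A}

/-! ### Context morphisms as substitutions -/

theorem CtxD.derivable (h : CtxD Ax X) : Derivable Ax (.ctx X) := by
  obtain ⟨n, h⟩ := h
  exact derivable_ctx h.1 h.isPreCtx fun pre z post e hp =>
    (h.2 pre z post e).derivable (List.Subset.refl _) hp

theorem derivable_of_dv {J : Judg A} (h : Dv Ax J) (hX : CtxD Ax J.ctxOf) :
    Derivable Ax (J.reCtx J.ctxOf) :=
  let ⟨_, h⟩ := h
  h.derivable (List.Subset.refl _) hX.derivable

theorem ctxD_of_derivable (hAx : IsPretheory Ax) (h : Derivable Ax (.ctx X)) : CtxD Ax X :=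
  let ⟨n, h⟩ := h
  ⟨n, RGood_of_DerAt hAx n _ h⟩

theorem IsMor.exists_subst (hAx : IsPretheory Ax) (h : IsMor Ax X X' f) :
    ∃ φ, f = vals φ X' ∧ CtxD Ax X ∧ CtxD Ax X' ∧ Mor Ax X X' φ := by
  obtain ⟨hX, hX', hl, ht⟩ := h
  obtain ⟨n, cX'⟩ := ctxD_of_derivable hAx hX'
  have e := lookupV_zip X' cX'.1 f hl
  generalize lookupV (mkSub X' f) = φ at e
  subst e
  refine ⟨φ, rfl, ctxD_of_derivable hAx hX, ⟨n, cX'⟩, fun p hp => ?_⟩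
  obtain ⟨i, hi, rfl⟩ := List.getElem_of_mem hp
  obtain ⟨m, h⟩ := ht i hi (by simpa [vals] using hi)
  have h := (RGood_of_DerAt hAx m _ h).2
  rw [subPre_vals cX'.isPreCtx] at h
  simp only [vals, List.getElem_map] at h
  exact ⟨_, h⟩

theorem Mor.isMor (hX : CtxD Ax X) (hX' : CtxD Ax X') (h : Mor Ax X X' φ) :
    IsMor Ax X X' (vals φ X') := by
  refine ⟨hX.derivable, hX'.derivable, by simp [vals], fun i hi hif => ?_⟩
  obtain ⟨n, cX'⟩ := hX'
  rw [subPre_vals cX'.isPreCtx]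
  simp only [vals, List.getElem_map]
  exact derivable_of_dv (h _ (List.getElem_mem hi)) hX

theorem Mor.morEq (hT : TUniq Ax) (hX : CtxD Ax X) (hX' : CtxD Ax X') (h : Mor Ax X X' σ)
    (he : ∀ p ∈ X', Eqv Ax X (σ p.1) (τ p.1)) : MorEq Ax X X' (vals σ X') (vals τ X') := by
  refine ⟨h.isMor hX hX', (h.of_eqv hT hX.fn hX' he).isMor hX hX', fun i hi hif hig => ?_⟩
  have hh := (he _ (List.getElem_mem hi)).atSort hT hX.fn (h _ (List.getElem_mem hi))
  obtain ⟨n, cX'⟩ := hX'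
  rw [subPre_vals cX'.isPreCtx]
  simp only [vals, List.getElem_map]
  exact derivable_of_dv hh hX

theorem Mor.comp (h : Mor Ax X X' φ) (h' : Mor Ax X' X'' φ') :
    Mor Ax X X'' fun x => (φ' x).subst φ := fun p hp => by
  rw [← ssubst_ssubst]
  exact (h' p hp).sub_term h

theorem compMor_vals (h' : Mor Ax X' X'' φ') :
    compMor X' (vals φ X') (vals φ' X'') = vals (fun x => (φ' x).subst φ) X'' := by
  unfold compMor
  conv_lhs => rw [show vals φ' X'' = X''.map fun p => φ' p.1 from rfl, List.map_map]
  refine List.map_congr_left fun p hp => ?_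
  obtain ⟨_, h⟩ := h' p hp
  exact esubstL_vals φ fun x hx => h.scope_term hx

theorem Mor.exists_height (h : Mor Ax X X' φ) :
    ∃ n, ∀ p ∈ X', R Ax n (.term X (φ p.1) (p.2.subst φ)) :=
  exists_bound X' _ (fun _ _ _ hnm h => h.le hnm) h

theorem Mor.id (h : CtxD Ax X) : Mor Ax X X .var := fun p hp => by
  obtain ⟨n, h⟩ := h
  rw [ssubst_id]
  exact ⟨_, h.var_mem hp⟩

theorem CtxD.nil : CtxD Ax [] := ⟨0, List.nodup_nil, fun pre z post h => by simp at h⟩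

theorem MorEq.nil : MorEq Ax [] [] [] [] := by
  have h : IsMor Ax [] [] [] := (Mor.id CtxD.nil).isMor CtxD.nil CtxD.nil
  exact ⟨h, h, fun i hi => absurd hi (Nat.not_lt_zero i)⟩

theorem preCtx_eq_nil [IsEmpty (SortE A)] : X = [] :=
  List.eq_nil_iff_forall_not_mem.2 fun p _ => IsEmpty.false p.2

end

section

variable {A B : Alphabet} {TA : Set (Judg A)} {TB : Set (Judg B)}
variable {chA : PreCtx A → A.Var} {chB : PreCtx B → B.Var}

/-! ### Tensors of context morphisms -/

section
variable {E E' E'' : TEnv TA TB} {X X' X'' : PreCtx A} {Y Y' Y'' : PreCtx B}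
  {φ φ' : A.Var → Expr A} {ψ ψ' : B.Var → Expr B}

theorem ctxD_tensor (H : TH TA TB chA chB) (hX : Ext E.Γ X) (hY : Ext E.Δ Y) (cX : CtxD TA X)
    (cY : CtxD TB Y) : CtxD (tensorAx TA TB chA chB) (TX E X Y) :=
  let ⟨_, cX⟩ := cX
  let ⟨_, cY⟩ := cY
  ctxD_TX_full (below H _) (Nat.lt_succ_self _) hX hY cX cY

theorem exists_subH (H : TH TA TB chA chB) (hX : Ext E.Γ X) (hY : Ext E.Δ Y) (hX' : Ext E'.Γ X')
    (hY' : Ext E'.Δ Y') (cX : CtxD TA X) (cY : CtxD TB Y) (cX' : CtxD TA X') (cY' : CtxD TB Y')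
    (hφ : Mor TA X X' φ) (hψ : Mor TB Y Y' ψ) (N₀ M₀ : ℕ) :
    ∃ N ≥ N₀, ∃ M ≥ M₀,
      SubH (tensorAx TA TB chA chB) N M E' E X' Y' X Y (TX E X Y) φ ψ := by
  obtain ⟨N, hφ⟩ := hφ.exists_height
  obtain ⟨M, hψ⟩ := hψ.exists_height
  refine ⟨max N N₀, le_max_right .., max M M₀, le_max_right .., subH_of_cl (closed H _ _) hX' hY'
    cX' cY' (.of_ctx hX hY (ctxD_tensor H hX hY cX cY) (List.Subset.refl _))
    (fun p hp => (hφ p hp).le (le_max_left ..)) fun q hq => (hψ q hq).le (le_max_left ..)⟩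

theorem Mor.tensor (H : TH TA TB chA chB) (hX : Ext E.Γ X) (hY : Ext E.Δ Y) (hX' : Ext E'.Γ X')
    (hY' : Ext E'.Δ Y') (cX : CtxD TA X) (cY : CtxD TB Y) (cX' : CtxD TA X') (cY' : CtxD TB Y')
    (hφ : Mor TA X X' φ) (hψ : Mor TB Y Y' ψ) :
    Mor (tensorAx TA TB chA chB) (TX E X Y) (TX E' X' Y') (tmap E φ ψ) := by
  obtain ⟨_, -, _, -, h⟩ := exists_subH H hX hY hX' hY' cX cY cX' cY' hφ hψ 0 0
  intro c hc
  obtain ⟨p, hp, q, hq, rfl⟩ := mem_grid.1 hc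
  exact h.mor_cell H.hA H.hB H.hT hp hq

theorem morEq_tensor (H : TH TA TB chA chB) (hX : Ext E.Γ X) (hY : Ext E.Δ Y)
    (hX' : Ext E'.Γ X') (hY' : Ext E'.Δ Y') (hX'' : Ext E''.Γ X'') (hY'' : Ext E''.Δ Y'')
    (cX : CtxD TA X) (cY : CtxD TB Y) (cX' : CtxD TA X') (cY' : CtxD TB Y')
    (cX'' : CtxD TA X'') (cY'' : CtxD TB Y'')
    (hφ : Mor TA X X' φ) (hψ : Mor TB Y Y' ψ) (hφ' : Mor TA X' X'' φ') (hψ' : Mor TB Y' Y'' ψ') :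
    MorEq (tensorAx TA TB chA chB) (TX E X Y) (TX E'' X'' Y'')
      (compMor (TX E' X' Y') (vals (tmap E φ ψ) (TX E' X' Y'))
        (vals (tmap E' φ' ψ') (TX E'' X'' Y'')))
      (vals (tmap E (fun x => (φ' x).subst φ) fun y => (ψ' y).subst ψ) (TX E'' X'' Y'')) := by
  have m₁ := Mor.tensor H hX hY hX' hY' cX cY cX' cY' hφ hψ
  have m₂ := Mor.tensor H hX' hY' hX'' hY'' cX' cY' cX'' cY'' hφ' hψ'
  rw [compMor_vals m₂]
  refine (m₁.comp m₂).morEq H.hT (ctxD_tensor H hX hY cX cY) (ctxD_tensor H hX'' hY'' cX'' cY'') ?_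
  intro c hc
  obtain ⟨p, hp, q, hq, rfl⟩ := mem_grid.1 hc
  obtain ⟨n, hu⟩ := hφ' p hp
  obtain ⟨m, hv⟩ := hψ' q hq
  obtain ⟨n', hu'⟩ := hφ.comp hφ' p hp
  obtain ⟨m', hv'⟩ := hψ.comp hψ' q hq
  obtain ⟨N, hN, M, hM, h⟩ := exists_subH H hX hY hX' hY' cX cY cX' cY' hφ hψ n' m'
  rw [tmap_mk, tmap_mk]
  exact h.eqv H.hA H.hB H.hT hu hv ⟨_, hu'.le hN⟩ ⟨_, hv'.le hM⟩

theorem TMorCtx.eq_vals (H : TH TA TB chA chB) {e : List (Expr (A.tensor B))}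
    (h : TMorCtx TA TB false X (vals φ X') Y e) (hX : Ext E.Γ X) (hY : Ext E.Δ Y)
    (cY : CtxD TB Y) (hφ : Mor TA X X' φ) : e = vals (tmap E φ .var) (TX E' X' Y) := by
  rw [vals_TX, vals_var, ctxVars, grid_map_right]
  refine eq_grid h.1 fun i j hi hj hh => ?_
  obtain ⟨U, hU, ht⟩ := h.2 i j hi hj hh
  obtain ⟨m, cY⟩ := cY
  obtain ⟨n, hu⟩ : ∃ n, ∃ W, R TA n (.term X (vals φ X')[i] W) := by
    obtain ⟨n, h⟩ := hφ _ (List.getElem_mem (by simpa [vals] using hi : i < X'.length))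
    exact ⟨n, _, by simpa [vals] using h⟩
  obtain ⟨W, hu⟩ := hu
  exact ht.eq_ten H.hA H.hB rfl E n m m hX (hY.take j) (cY.take j) (hu.adm H.hA hX)
    ((cY.getElem hj).adm_sort (hY _ (List.getElem_mem hj))) (fun t g h => nomatch h)
    fun y h => by cases h; exact (hY _ (List.getElem_mem hj)).symm

theorem TCtxMor.eq_vals (H : TH TA TB chA chB) {e : List (Expr (A.tensor B))}
    (h : TCtxMor TA TB false X Y (vals ψ Y') e) (hX : Ext E.Γ X) (hY : Ext E.Δ Y)
    (cX : CtxD TA X) (cY : CtxD TB Y) (hψ : Mor TB Y Y' ψ) :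
    e = vals (tmap E .var ψ) (TX E' X Y') := by
  rw [vals_TX, vals_var, ctxVars, grid_map_left]
  refine eq_grid h.1 fun i j hi hj hh => ?_
  obtain ⟨V, hV, ht⟩ := h.2 i j hi hj hh
  obtain ⟨n, cX⟩ := cX
  obtain ⟨m₀, cY⟩ := cY
  obtain ⟨m, hv⟩ : ∃ n, ∃ W, R TB n (.term Y (vals ψ Y')[j] W) := by
    obtain ⟨n, h⟩ := hψ _ (List.getElem_mem (by simpa [vals] using hj : j < Y'.length))
    exact ⟨n, _, by simpa [vals] using h⟩
  obtain ⟨W, hv⟩ := hv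
  exact ht.eq_ten H.hA H.hB rfl E n m m₀ (hX.take i) hY cY
    ((cX.getElem hi).adm_sort (hX _ (List.getElem_mem hi))) (hv.adm H.hB hY)
    (fun t g _ => (hX _ (List.getElem_mem hi)).symm)
    fun y h => by
      have := hV.eq_cs H.hB hY
      simp only at h
      rw [this, h]; rfl

end

end

theorem TCtx.eq_nil {A B : Alphabet} {TA : Set (Judg A)} {TB : Set (Judg B)} {X : PreCtx A}
    {Y : PreCtx B} {Z : PreCtx (A.tensor B)} (h : TCtx TA TB false X Y Z)
    (h0 : X.length * Y.length = 0) : Z = [] :=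
  List.eq_nil_of_length_eq_zero (h.1.trans h0)

/-- For context morphisms `f : X → X'`, `f' : X' → X''` in `𝔸`
and `g : Y → Y'`, `g' : Y' → Y''` in `𝔹`, the morphism equalities
`(f'⊗Y) ∘ (f⊗Y) ≡ (f'∘f) ⊗ Y : X⊗Y → X''⊗Y` and
`(X⊗g') ∘ (X⊗g) ≡ X ⊗ (g'∘g) : X⊗Y → X⊗Y''` are derivable in `𝔸⊗𝔹`. -/
theorem tensor_one_sided_composition
    (A B : Alphabet) (TA : Set (Judg A)) (TB : Set (Judg B))
    (hA : IsGAT TA) (hB : IsGAT TB)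
    (chA : PreCtx A → A.Var) (hchA : FreshCh chA)
    (chB : PreCtx B → B.Var) (hchB : FreshCh chB)
    (X X' X'' : PreCtx A) (f f' : List (Expr A))
    (Y Y' Y'' : PreCtx B) (g g' : List (Expr B))
    (hf : IsMor TA X X' f) (hf' : IsMor TA X' X'' f')
    (hg : IsMor TB Y Y' g) (hg' : IsMor TB Y' Y'' g')
    (ZXY Z'Y Z''Y ZXY' ZXY'' : PreCtx (A.tensor B))
    (hZXY : TCtx TA TB false X Y ZXY) (hZ'Y : TCtx TA TB false X' Y Z'Y)
    (hZ''Y : TCtx TA TB false X'' Y Z''Y)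
    (hZXY' : TCtx TA TB false X Y' ZXY') (hZXY'' : TCtx TA TB false X Y'' ZXY'')
    (e1 e2 e3 d1 d2 d3 : List (Expr (A.tensor B)))
    (he1 : TMorCtx TA TB false X f Y e1)
    (he2 : TMorCtx TA TB false X' f' Y e2)
    (he3 : TMorCtx TA TB false X (compMor X' f f') Y e3)
    (hd1 : TCtxMor TA TB false X Y g d1)
    (hd2 : TCtxMor TA TB false X Y' g' d2)
    (hd3 : TCtxMor TA TB false X Y (compMor Y' g g') d3) :
    MorEq (tensorAx TA TB chA chB) ZXY Z''Y (compMor Z'Y e1 e2) e3 ∧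
    MorEq (tensorAx TA TB chA chB) ZXY ZXY'' (compMor ZXY' d1 d2) d3 := by
  have H : TH TA TB chA chB := ⟨hA.goodTh, hB.goodTh, hchA, hchB⟩
  obtain ⟨φ, rfl, cX, cX', hφ⟩ := hf.exists_subst hA.1
  obtain ⟨φ', rfl, -, cX'', hφ'⟩ := hf'.exists_subst hA.1
  obtain ⟨ψ, rfl, cY, cY', hψ⟩ := hg.exists_subst hB.1
  obtain ⟨ψ', rfl, -, cY'', hψ'⟩ := hg'.exists_subst hB.1
  rw [compMor_vals hφ'] at he3
  rw [compMor_vals hψ'] at hd3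
  by_cases h0 : IsEmpty (SortE A) ∨ IsEmpty (SortE B)
  · have hl (U : PreCtx A) (V : PreCtx B) : U.length * V.length = 0 := by
      rcases h0 with h0 | h0
      · rw [preCtx_eq_nil (X := U)]; simp
      · rw [preCtx_eq_nil (X := V)]; simp
    have hn {l : List (Expr (A.tensor B))} {k : ℕ} (h : l.length = k) (hk : k = 0) : l = [] :=
      List.eq_nil_of_length_eq_zero (h.trans hk)
    rw [hZXY.eq_nil (hl ..), hZ''Y.eq_nil (hl ..), hZXY''.eq_nil (hl ..),
      hn he2.1 (by simpa [vals] using hl X'' Y), hn he3.1 (by simpa [vals] using hl X'' Y),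
      hn hd2.1 (by simpa [vals] using hl X Y''), hn hd3.1 (by simpa [vals] using hl X Y'')]
    exact ⟨MorEq.nil, MorEq.nil⟩
  · obtain ⟨hA0, hB0⟩ := not_or.1 h0
    rw [not_isEmpty_iff] at hA0 hB0
    have := Classical.inhabited_of_nonempty hA0
    have := Classical.inhabited_of_nonempty hB0
    have ext {C : Alphabet} [Inhabited (SortE C)] {TC : Set (Judg C)} {W : PreCtx C}
        (h : CtxD TC W) : ∃ Γ : C.Var → SortE C, Ext Γ W := let ⟨_, h⟩ := h; exists_ext h.1
    obtain ⟨Γ, hX⟩ := ext cX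
    obtain ⟨Γ', hX'⟩ := ext cX'
    obtain ⟨Γ'', hX''⟩ := ext cX''
    obtain ⟨Δ, hY⟩ := ext cY
    obtain ⟨Δ', hY'⟩ := ext cY'
    obtain ⟨Δ'', hY''⟩ := ext cY''
    have eZ {U : PreCtx A} {V : PreCtx B} {Z : PreCtx (A.tensor B)} (h : TCtx TA TB false U V Z)
        (E : TEnv TA TB) (hU : Ext E.Γ U) (hV : Ext E.Δ V) (cU : CtxD TA U) (cV : CtxD TB V) :
        Z = TX E U V :=
      let ⟨_, cU⟩ := cU
      let ⟨_, cV⟩ := cV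
      h.eq_TX H.hA H.hB hU hV cU cV
    have idX := Mor.id cX
    have idY := Mor.id cY
    refine ⟨?_, ?_⟩
    · rw [eZ hZXY ⟨Γ, Δ⟩ hX hY cX cY, eZ hZ'Y ⟨Γ', Δ⟩ hX' hY cX' cY,
        eZ hZ''Y ⟨Γ'', Δ⟩ hX'' hY cX'' cY,
        he1.eq_vals (E := ⟨Γ, Δ⟩) (E' := ⟨Γ', Δ⟩) H hX hY cY hφ,
        he2.eq_vals (E := ⟨Γ', Δ⟩) (E' := ⟨Γ'', Δ⟩) H hX' hY cY hφ',
        he3.eq_vals (E := ⟨Γ, Δ⟩) (E' := ⟨Γ'', Δ⟩) H hX hY cY (hφ.comp hφ')]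
      have := morEq_tensor (E := ⟨Γ, Δ⟩) (E' := ⟨Γ', Δ⟩) (E'' := ⟨Γ'', Δ⟩) H hX hY hX' hY hX'' hY
        cX cY cX' cY cX'' cY hφ idY hφ' idY
      simpa only [subst_var] using this
    · rw [eZ hZXY ⟨Γ, Δ⟩ hX hY cX cY, eZ hZXY' ⟨Γ, Δ'⟩ hX hY' cX cY',
        eZ hZXY'' ⟨Γ, Δ''⟩ hX hY'' cX cY'',
        hd1.eq_vals (E := ⟨Γ, Δ⟩) (E' := ⟨Γ, Δ'⟩) H hX hY cX cY hψ,
        hd2.eq_vals (E := ⟨Γ, Δ'⟩) (E' := ⟨Γ, Δ''⟩) H hX hY' cX cY' hψ',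
        hd3.eq_vals (E := ⟨Γ, Δ⟩) (E' := ⟨Γ, Δ''⟩) H hX hY cX cY (hψ.comp hψ')]
      have := morEq_tensor (E := ⟨Γ, Δ⟩) (E' := ⟨Γ, Δ'⟩) (E'' := ⟨Γ, Δ''⟩) H hX hY hX hY' hX hY''
        cX cY cX cY' cX cY'' idX hψ idX hψ'
      simpa only [subst_var] using this

end GATPaper
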